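/- Let D_k^min(x) = #{ d_k^min(N) : N ∈ ℕ, d_k^min(N) ≤ ((k−1)/12)·x }. There exists an absolute constant A > 0 such that for every even integer k ≥ 2 and every real x ≥ 16, (x/log x)·exp( C·log²( (log log x)/(log log log x) ) − A·log log log x ) ≤ D_k^min(x) ≤ (x/log x)·exp( C·log²( (log log x)/(log log log x) ) + A·log log log x ). -/

import Mathlib

noncomputable section

/-- Value at `N` of the multiplicative function determined by local values `f p e`
on prime powers `p^e` (`e ≥ 1`). -/
def mval (f : ℕ → ℕ → ℝ) (N : ℕ) : ℝ := ∏ p ∈ N.primeFactors, f p (N.factorization p)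

def psiFull : ℕ → ℝ := mval fun p e => (p:ℝ)^e + (p:ℝ)^(e-1)

def nuInfFull : ℕ → ℝ := mval fun p e =>
  if Odd e then 2*(p:ℝ)^((e-1)/2) else (p:ℝ)^(e/2) + (p:ℝ)^(e/2-1)

def nu2Full : ℕ → ℝ := mval fun p e =>
  if p^e = 2 then 1 else if p % 4 = 1 then 2 else 0

def nu3Full : ℕ → ℝ := mval fun p e =>
  if p^e = 3 then 1 else if p % 3 = 1 then 2 else 0

def psiNew : ℕ → ℝ := mval fun p e =>
  if e = 1 then (p:ℝ)-1
  else if e = 2 then (p:ℝ)^2-(p:ℝ)-1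
  else (p:ℝ)^(e-3)*((p:ℝ)-1)^2*((p:ℝ)+1)

def nuInfNew : ℕ → ℝ := mval fun p e =>
  if e = 2 then (p:ℝ)-2
  else if Even e ∧ 2 < e then (p:ℝ)^(e/2-2)*((p:ℝ)-1)^2
  else 0

def nu2New : ℕ → ℝ := mval fun p e =>
  if p % 4 = 3 ∧ e = 1 then -2
  else if (p % 4 = 3 ∧ e = 2) ∨ p^e = 8 then 1
  else if (p % 4 = 1 ∧ e = 2) ∨ p^e = 2 ∨ p^e = 4 then -1
  else 0

def nu3New : ℕ → ℝ := mval fun p e =>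
  if p % 3 = 2 ∧ e = 1 then -2
  else if (p % 3 = 2 ∧ e = 2) ∨ p^e = 27 then 1
  else if (p % 3 = 1 ∧ e = 2) ∨ p^e = 3 ∨ p^e = 9 then -1
  else 0

def psiMin : ℕ → ℝ := mval fun p e =>
  ((p:ℝ)-1)/((Nat.gcd (Nat.gcd 2 (p-1)) e : ℕ) : ℝ)
    * (if e = 1 then 1 else if e = 2 then (p:ℝ)-1 else (p:ℝ)^(e-3)*((p:ℝ)^2-1))

def nuInfMin : ℕ → ℝ := mval fun p e =>
  if p = 2 ∧ Even e ∧ 2 < e then (2:ℝ)^(e/2-2) else 0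

def nu2Min : ℕ → ℝ := mval fun p e =>
  if p % 4 = 3 then -2*((ArithmeticFunction.moebius (p^(e-1)) : ℤ) : ℝ)
  else if p^e = 2 ∨ p^e = 4 then -1
  else if p^e = 8 then 1
  else 0

def nu3Min : ℕ → ℝ := mval fun p e =>
  if p % 3 = 2 ∧ p^e ≠ 4 then -2*((ArithmeticFunction.moebius (p^(e-1)) : ℤ) : ℝ)
  else if p^e = 3 ∨ p^e = 9 then -1
  else if p^e = 4 ∨ p^e = 27 then 1
  else 0

/-- The Kronecker symbol `(−4|n)`, i.e. the nontrivial character mod 4. -/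
def chi4 (n : ℕ) : ℝ := if n % 4 = 1 then 1 else if n % 4 = 3 then -1 else 0

/-- The Kronecker symbol `(−3|n)`, i.e. the nontrivial character mod 3. -/
def chi3 (n : ℕ) : ℝ := if n % 3 = 1 then 1 else if n % 3 = 2 then -1 else 0

def c2 (k : ℕ) : ℝ := -(1/4) * chi4 (k-1)

def c3 (k : ℕ) : ℝ := -(1/3) * chi3 (k-1)

def delta2 (k : ℕ) : ℝ := if k = 2 then 1 else 0

def dFull (k N : ℕ) : ℝ :=
  ((k:ℝ)-1)/12 * psiFull N - 1/2 * nuInfFull N + c2 k * nu2Full N + c3 k * nu3Full N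
    + delta2 k

def dNew (k N : ℕ) : ℝ :=
  ((k:ℝ)-1)/12 * psiNew N - 1/2 * nuInfNew N + c2 k * nu2New N + c3 k * nu3New N
    + delta2 k * ((ArithmeticFunction.moebius N : ℤ) : ℝ)

def dMin (k N : ℕ) : ℝ :=
  ((k:ℝ)-1)/12 * psiMin N - 1/2 * nuInfMin N + c2 k * nu2Min N + c3 k * nu3Min N
    + delta2 k * ((ArithmeticFunction.moebius N : ℤ) : ℝ)

/-- `ω(N)`: the number of distinct prime divisors of `N`. -/
def omega (N : ℕ) : ℕ := N.primeFactors.card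

/-- A positive integer is squarefull if `p² ∣ N` for every prime `p ∣ N`. -/
def Squarefull (n : ℕ) : Prop := ∀ p : ℕ, p.Prime → p ∣ n → p^2 ∣ n

/-- `H(N)`: the largest squarefull divisor of `N`. -/
def squarefullPart (N : ℕ) : ℕ := sSup {d : ℕ | d ∣ N ∧ Squarefull d}

/-- `η = ζ(3/2)/ζ(3)`. -/
def eta : ℝ := (riemannZeta (3/2) / riemannZeta 3).re

/-- Ford's coefficients `a_n = (n+1)log(n+1) − n log n − 1`. -/
def fordA (n : ℕ) : ℝ := ((n:ℝ)+1)*Real.log ((n:ℝ)+1) - (n:ℝ)*Real.log n - 1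


def loglog (x : ℝ) : ℝ := Real.log (Real.log x)

def logloglog (x : ℝ) : ℝ := Real.log (Real.log (Real.log x))

def loglogloglog (x : ℝ) : ℝ := Real.log (Real.log (Real.log (Real.log x)))

end

section
open Finset Real
noncomputable section
notation:max x:max "°" => (x : ℝ)
notation "♭" => (by linarith)
notation "♯" => (by positivity)
notation "♮" => (by norm_num)
notation "⋆" => (by omega)

/-- double exponential -/
def EE (t : ℝ) : ℝ := exp (exp t)
/-- level of an integer -/
def lev (p : ℕ) : ℕ := ⌈log (log p)⌉₊ - 1
def PR (b : ℕ) : Finset ℕ := (range (⌊EE (b+1)⌋₊+1)).filter Nat.Prime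
def LP (l : ℕ) : Finset ℕ := (PR l).filter (fun p ↦ lev p = l)

theorem log_fact_eq (n : ℕ) : log (n.factorial) =
    ∑ p ∈ (range (n+1)).filter Nat.Prime, (n.factorial.factorization p : ℝ) * log p := by
  have h0 := Nat.prod_factorization_pow_eq_self (Nat.factorial_ne_zero n)
  rw [Finsupp.prod, Nat.support_factorization] at h0
  have h1 : (n.factorial : ℝ) = ∏ p ∈ n.factorial.primeFactors, p°^(n.factorial.factorization p) := by
    exact_mod_cast h0.symm
  have h2 : n.factorial.primeFactors = (range (n+1)).filter Nat.Prime := by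
    ext p
    simp only [Nat.mem_primeFactors, mem_filter, mem_range]
    constructor
    · rintro ⟨hp, hd, _⟩; exact ⟨Nat.lt_succ_of_le ((hp.dvd_factorial).1 hd), hp⟩
    · rintro ⟨hl, hp⟩; exact ⟨hp, (hp.dvd_factorial).2 ⋆, Nat.factorial_ne_zero n⟩
  rw [h1, h2, log_prod (by
    intro p hp; have := (mem_filter.1 hp).2.pos; positivity)]
  exact sum_congr rfl fun p hp ↦ by rw [log_pow]

theorem fact_val_le {n p : ℕ} (hp : p.Prime) : (n.factorial.factorization p : ℝ) ≤ n / (p°-1) := by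
  have := Fact.mk hp
  have h := sub_one_mul_padicValNat_factorial (p := p) n
  have h1 : 1° < p := by exact_mod_cast hp.one_lt
  rw [le_div_iff₀ ♭, Nat.factorization_def _ hp]
  have h2 : (p-1) * padicValNat p n.factorial ≤ n := by omega
  have h3 : (((p-1) * padicValNat p n.factorial : ℕ):ℝ) ≤ n := by exact_mod_cast h2
  rw [Nat.cast_mul, Nat.cast_sub hp.one_lt.le] at h3
  push_cast at h3; linarith

theorem fact_val_ge {n p : ℕ} (hp : p.Prime) : n° / p - 1 ≤ (n.factorial.factorization p : ℝ) := by
  have h1 : p ^ (n / p) ∣ n.factorial := by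
    have h2 : (n/p).factorial * p^(n/p) ∣ (n/p*p).factorial := by
      have := Nat.factorial_mul_pow_sub_le_factorial (n := 0) (m := 0)
      clear this
      induction n/p with
      | zero => simp
      | succ k ih =>
        have e : (k+1)*p = (k*p + (p-1)) + 1 := by have := hp.one_lt; rw [add_mul]; omega
        have e2 : ((k+1)*p).factorial = ((k+1)*p) * (k*p+(p-1)).factorial := by
          rw [e, Nat.factorial_succ]
        rw [e2, Nat.factorial_succ, pow_succ]
        have := ih.trans (Nat.factorial_dvd_factorial (Nat.le_add_right (k*p) (p-1)))
        calc (k+1)*k.factorial*(p^k*p) = ((k+1)*p)*(k.factorial*p^k) := by ring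
          _ ∣ _ := mul_dvd_mul_left _ this
    exact ((dvd_mul_left _ _).trans h2).trans (Nat.factorial_dvd_factorial (Nat.div_mul_le_self n p))
  have h2 : n / p ≤ n.factorial.factorization p :=
    (hp.pow_dvd_iff_le_factorization (Nat.factorial_ne_zero n)).1 h1
  have h3 : ((n/p : ℕ):ℝ) ≤ (n.factorial.factorization p : ℝ) := by exact_mod_cast h2
  have h4 : n°/p < ((n/p:ℕ):ℝ) + 1 := by
    rw [← Nat.floor_div_eq_div (K := ℝ)]; exact Nat.lt_floor_add_one _
  linarith

def mertM (n : ℕ) : ℝ := ∑ p ∈ (range (n+1)).filter Nat.Prime, log p / p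

theorem mert_upper (n : ℕ) (hn : 1 ≤ n) : mertM n ≤ log n + 2 := by
  have hn' : 0° < n := by exact_mod_cast hn
  have h1 : n° * mertM n - Chebyshev.theta n ≤ n * log n := by
    calc n° * mertM n - Chebyshev.theta n = ∑ p ∈ (range (n+1)).filter Nat.Prime, (n°/p-1) * log p := by
          rw [Chebyshev.theta_eq_sum_Icc, mertM, mul_sum, Nat.floor_natCast, Nat.range_succ_eq_Icc_zero, ← sum_sub_distrib]
          exact sum_congr rfl fun p _ ↦ by ring
      _ ≤ ∑ p ∈ (range (n+1)).filter Nat.Prime, (n.factorial.factorization p : ℝ) * log p := by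
          apply sum_le_sum; intro p hp
          exact mul_le_mul_of_nonneg_right (fact_val_ge (mem_filter.1 hp).2) (log_natCast_nonneg p)
      _ = log n.factorial := (log_fact_eq n).symm
      _ ≤ n * log n := by
          rw [← log_pow]
          apply log_le_log (by exact_mod_cast Nat.factorial_pos n)
          exact_mod_cast Nat.factorial_le_pow n
  have h2 := Chebyshev.theta_le_log4_mul_x hn'.le
  have h3 : log 4 ≤ 2 := by
    rw [show 4° = 2^2 by norm_num, log_pow]; have := log_two_lt_d9; push_cast; linarith
  have : n° * mertM n ≤ n * (log n + 2) := by nlinarith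
  exact le_of_mul_le_mul_left this hn'

theorem mert_lower : ∃ K : ℝ, ∀ n : ℕ, 1 ≤ n → log n - K ≤ mertM n := by
  have hs : Summable fun n : ℕ => 4 * (n°^(3°/2))⁻¹ := by
    apply Summable.mul_left
    exact summable_nat_rpow_inv.2 ♮
  refine ⟨1 + ∑' n : ℕ, 4 * (n°^(3°/2))⁻¹, fun n hn ↦ ?_⟩
  have hn' : 0° < n := by exact_mod_cast hn
  have h1 : n * log n - n ≤ log n.factorial := by
    have := Stirling.le_log_factorial_stirling (n := n) ⋆
    have h2 : 0 ≤ log n := log_natCast_nonneg n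
    have h3 : 0 ≤ log (2*Real.pi) := log_nonneg (by nlinarith [pi_gt_three])
    linarith
  have h2 : log n.factorial ≤ n * (mertM n + ∑' n : ℕ, 4 * (n°^(3°/2))⁻¹) := by
    have h5 : ∑ p ∈ (range (n+1)).filter Nat.Prime, 4 * (p°^(3°/2))⁻¹ ≤ ∑' n : ℕ, 4 * (n°^(3°/2))⁻¹ :=
      hs.sum_le_tsum _ (fun i _ ↦ by positivity)
    refine le_trans ?_ (mul_le_mul_of_nonneg_left (add_le_add_right h5 _) hn'.le)
    rw [log_fact_eq, mertM, ← sum_add_distrib, mul_sum]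
    apply sum_le_sum; intro p hp
    have hp := (mem_filter.1 hp).2
    have hp2 : 2° ≤ p := by exact_mod_cast hp.two_le
    have h6 := fact_val_le (n := n) hp
    have hl : 0 ≤ log p := log_natCast_nonneg p
    refine (mul_le_mul_of_nonneg_right h6 hl).trans ?_
    have h7 : log p ≤ 2 * p°^(1°/2) := by
      have := log_le_rpow_div (x := p) (ε := 1/2) ♭ ♮
      linarith
    have h8 : p°^(3°/2) = p * p°^(1°/2) := by
      rw [show 3°/2 = 1 + 1/2 by norm_num, rpow_add ♭, rpow_one]
    have h9 : p°^(1°/2) * p°^(1°/2) = p := by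
      rw [← rpow_add ♭]; norm_num
    have h10 : 0° < p°^(1°/2) := by positivity
    rw [h8]
    set s := p°^(1°/2)
    have : n°/(p-1) * log p = n * (log p / (p-1)) := by ring
    rw [this]
    apply mul_le_mul_of_nonneg_left _ hn'.le
    have e1 : log p / (p-1) = log p / p + log p / (p*(p-1)) := by
      have : p°-1 ≠ 0 := by linarith
      field_simp; ring
    rw [e1]
    have e2 : log p / (p*(p-1)) ≤ 4 * (p*s)⁻¹ := by
      rw [← div_eq_mul_inv, div_le_div_iff₀ (by nlinarith) ♯]
      calc log p * (p*s) ≤ 2*s*(p*s) := by gcongr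
        _ = 2*p*p := by rw [← h9]; ring
        _ ≤ _ := by nlinarith
    linarith
  have : n° * (log n - (1 + ∑' n : ℕ, 4 * (n°^(3°/2))⁻¹)) ≤ n * mertM n := by nlinarith
  exact le_of_mul_le_mul_left this hn'

theorem mertens1 : ∃ K : ℝ, 0 < K ∧ ∀ t : ℝ, 1 ≤ t → |mertM ⌊t⌋₊ - log t| ≤ K := by
  obtain ⟨K, hK⟩ := mert_lower
  refine ⟨|K| + 3, by positivity, fun t ht ↦ ?_⟩
  have h1 : 1 ≤ ⌊t⌋₊ := Nat.one_le_floor_iff _ |>.2 ht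
  have h1' : 1° ≤ ⌊t⌋₊ := by exact_mod_cast h1
  have hf := Nat.floor_le (by linarith : 0 ≤ t)
  have hf2 := Nat.lt_floor_add_one t
  have a := mert_upper _ h1
  have b := hK _ h1
  have c : log ⌊t⌋₊ ≤ log t := log_le_log ♭ hf
  have d : log t ≤ log ⌊t⌋₊ + 1 := by
    have : log t ≤ log (2 * ⌊t⌋₊) := log_le_log ♭ ♭
    rw [log_mul ♮ ♭] at this
    have := log_two_lt_d9; linarith
  have := le_abs_self K
  have := abs_nonneg K
  rw [abs_le]; constructor <;> linarith

theorem mertens2 : ∃ K : ℝ, 0 < K ∧ ∀ a b : ℝ, 2 ≤ a → a ≤ b →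
    |∑ p ∈ (Ioc ⌊a⌋₊ ⌊b⌋₊).filter Nat.Prime, 1°/p - (log (log b) - log (log a))| ≤ K / log a := by
  obtain ⟨K, hK0, hK⟩ := mertens1
  refine ⟨4*K, by positivity, fun a b ha hab ↦ ?_⟩
  set c : ℕ → ℝ := fun k ↦ if k.Prime then log k / k else 0 with hc
  have hM : ∀ n : ℕ, ∑ k ∈ Icc 0 n, c k = mertM n := by
    intro n; rw [mertM, sum_filter, Nat.range_succ_eq_Icc_zero]
  have hpos : ∀ t ∈ Set.Icc a b, 0 < log t ∧ 0 < t := fun t ht ↦ 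
    ⟨log_pos (by linarith [ht.1]), by linarith [ht.1]⟩
  set f : ℝ → ℝ := fun t ↦ (log t)⁻¹ with hf
  have hd : ∀ t ∈ Set.Icc a b, HasDerivAt f (-(t⁻¹)/(log t)^2) t := fun t ht ↦ by
    have := (hasDerivAt_log (hpos t ht).2.ne').inv (hpos t ht).1.ne'
    exact this
  have hcont : ContinuousOn (fun t : ℝ => -(t⁻¹)/(log t)^2) (Set.Icc a b) := by
    intro t ht
    have := hpos t ht
    have h1 : t ≠ 0 := this.2.ne'
    have h2 : log t ^ 2 ≠ 0 := by have := this.1; positivity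
    apply ContinuousAt.continuousWithinAt
    apply ContinuousAt.div
    · exact (continuousAt_inv₀ h1).neg
    · exact (continuousAt_log h1).pow 2
    · exact h2
  have hdc : Set.EqOn (deriv f) (fun t : ℝ => -(t⁻¹)/(log t)^2) (Set.Icc a b) := fun t ht ↦ (hd t ht).deriv
  have hint : MeasureTheory.IntegrableOn (deriv f) (Set.Icc a b) :=
    (hcont.integrableOn_Icc).congr_fun hdc.symm measurableSet_Icc
  have key := sum_mul_eq_sub_sub_integral_mul (f := f) c (by linarith : 0 ≤ a) hab
    (fun t ht ↦ (hd t ht).differentiableAt) hint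
  have hlhs : ∑ k ∈ Ioc ⌊a⌋₊ ⌊b⌋₊, f k * c k = ∑ p ∈ (Ioc ⌊a⌋₊ ⌊b⌋₊).filter Nat.Prime, 1°/p := by
    rw [sum_filter]; apply sum_congr rfl; intro p _
    simp only [hc, hf]
    split_ifs with hp
    · have : log p ≠ 0 := (log_pos (by exact_mod_cast hp.one_lt)).ne'
      field_simp
    · simp
  rw [hlhs] at key
  simp only [hM] at key
  have hI1 : MeasureTheory.IntegrableOn (fun t ↦ deriv f t * mertM ⌊t⌋₊) (Set.Ioc a b) := by
    have := integrableOn_mul_sum_Icc (m := 0) c (by linarith : 0 ≤ a) hint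
    simp only [hM] at this
    exact this.mono_set Set.Ioc_subset_Icc_self
  have hI2 : MeasureTheory.IntegrableOn (fun t ↦ deriv f t * log t) (Set.Ioc a b) := by
    refine MeasureTheory.IntegrableOn.mono_set (t := Set.Icc a b) ?_ Set.Ioc_subset_Icc_self
    refine MeasureTheory.IntegrableOn.congr_fun (f := fun t ↦ -(t⁻¹)/(log t)^2 * log t) ?_ (fun t ht ↦ by simp only [hdc ht]) measurableSet_Icc
    apply ContinuousOn.integrableOn_Icc
    apply hcont.mul
    exact fun t ht ↦ (continuousAt_log (hpos t ht).2.ne').continuousWithinAt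
  have hJ2 : ∫ t in Set.Ioc a b, deriv f t * log t = -(log (log b) - log (log a)) := by
    rw [← intervalIntegral.integral_of_le hab]
    have := intervalIntegral.integral_eq_sub_of_hasDerivAt (a := a) (b := b) (f := fun t ↦ - log (log t))
      (f' := fun t ↦ deriv f t * log t) (fun t ht ↦ by
        rw [Set.uIcc_of_le hab] at ht
        have h := hpos t ht
        have h3 := ((hasDerivAt_log h.2.ne').log h.1.ne').neg
        have e : deriv f t * log t = -(t⁻¹ / log t) := by
          simp only [hdc ht]; have := h.1.ne'; field_simp
        rw [e]; exact h3) (by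
        rw [intervalIntegrable_iff_integrableOn_Ioc_of_le hab]; exact hI2)
    rw [this]; ring
  have hJ3 : ∫ t in Set.Ioc a b, -(deriv f t) = f a - f b := by
    rw [MeasureTheory.integral_neg, ← intervalIntegral.integral_of_le hab,
      intervalIntegral.integral_eq_sub_of_hasDerivAt (f := f) (fun t ht ↦ by
        rw [Set.uIcc_of_le hab] at ht; exact (hd t ht).differentiableAt.hasDerivAt) (by
        rw [intervalIntegrable_iff_integrableOn_Ioc_of_le hab]; exact hint.mono_set Set.Ioc_subset_Icc_self)]
    ring
  have hdiff : |(∫ t in Set.Ioc a b, deriv f t * mertM ⌊t⌋₊) - ∫ t in Set.Ioc a b, deriv f t * log t| ≤ K * (f a - f b) := by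
    rw [← MeasureTheory.integral_sub hI1 hI2, ← hJ3, ← MeasureTheory.integral_const_mul, ← norm_eq_abs]
    apply MeasureTheory.norm_integral_le_of_norm_le
    · exact ((hint.mono_set Set.Ioc_subset_Icc_self).neg).const_mul K
    · refine MeasureTheory.ae_restrict_of_forall_mem measurableSet_Ioc fun t ht ↦ ?_
      have ht' := Set.Ioc_subset_Icc_self ht
      have h := hpos t ht'
      rw [← mul_sub, norm_eq_abs, abs_mul, hdc ht']
      have h1 : |-(t⁻¹)/(log t)^2| = -(-(t⁻¹)/(log t)^2) := by
        apply abs_of_nonpos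
        rw [neg_div]; have := h.2; have := h.1; simp only [Left.neg_nonpos_iff]; positivity
      rw [h1, mul_comm]
      have h2 : 0 ≤ -(-(t⁻¹)/(log t)^2) := by rw [← h1]; positivity
      exact mul_le_mul_of_nonneg_right (hK t (by linarith [ht.1])) h2
  have hla := (hpos a ⟨le_rfl, hab⟩).1
  have hlb := (hpos b ⟨hab, le_rfl⟩).1
  have hfa : 0 < f a := inv_pos.2 hla
  have hfb : 0 < f b := inv_pos.2 hlb
  have hfab : f b ≤ f a := by
    apply inv_anti₀ hla; exact log_le_log ♭ hab
  have e1 : f b * mertM ⌊b⌋₊ = 1 + f b * (mertM ⌊b⌋₊ - log b) := by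
    simp only [hf]; field_simp; ring
  have e2 : f a * mertM ⌊a⌋₊ = 1 + f a * (mertM ⌊a⌋₊ - log a) := by
    simp only [hf]; field_simp; ring
  have k1 : |f b * (mertM ⌊b⌋₊ - log b)| ≤ f a * K := by
    rw [abs_mul, abs_of_pos hfb]; exact mul_le_mul hfab (hK b ♭) (abs_nonneg _) hfa.le
  have k2 : |f a * (mertM ⌊a⌋₊ - log a)| ≤ f a * K := by
    rw [abs_mul, abs_of_pos hfa]; exact mul_le_mul le_rfl (hK a ♭) (abs_nonneg _) hfa.le
  rw [hJ2] at hdiff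
  have e4 : 4*K/log a = 4 * K * f a := by rw [div_eq_mul_inv]
  rw [key, e1, e2, e4]
  have := mul_nonneg ((abs_nonneg _).trans (hK b ♭)) hfb.le
  rw [abs_le] at *
  have : 0 < K * f b := by positivity
  constructor <;> linarith [k1.1, k1.2, k2.1, k2.2, hdiff.1, hdiff.2]

end

open Finset Real
noncomputable section

theorem EE_pos (t : ℝ) : 0 < EE t := exp_pos _
theorem one_lt_EE (t : ℝ) : 1 < EE t := by unfold EE; exact one_lt_exp_iff.2 (exp_pos t)
theorem EE_mono {s t : ℝ} (h : s ≤ t) : EE s ≤ EE t := exp_le_exp.2 (exp_le_exp.2 h)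
theorem log_EE (t : ℝ) : log (EE t) = exp t := log_exp _
theorem two_lt_EE {t : ℝ} (ht : 0 ≤ t) : 2 < EE t := by
  have h1 : 1° ≤ exp t := one_le_exp ht
  have h2 : exp 1 ≤ EE t := exp_le_exp.2 h1
  have := exp_one_gt_d9; linarith

theorem lev_le_iff {p b : ℕ} (hp : 2 ≤ p) : lev p ≤ b ↔ p° ≤ EE (b+1) := by
  have h1 : 1° < p := by exact_mod_cast hp
  have h2 : 0 < log p := log_pos h1
  rw [lev, Nat.sub_le_iff_le_add, Nat.ceil_le, EE, log_le_iff_le_exp h2, log_le_iff_le_exp ♭]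
  push_cast; rfl

theorem lev_lt_of {p l : ℕ} (hl : 1 ≤ l) (h : l ≤ lev p) : EE l < p := by
  have h0 : l < ⌈log (log p)⌉₊ := by unfold lev at h; omega
  have h1 := Nat.lt_ceil.1 h0
  have hl' : 1° ≤ l := by exact_mod_cast hl
  by_contra hc
  push Not at hc
  rcases Nat.lt_or_ge p 2 with hp | hp
  · interval_cases p <;> simp at h1 <;> linarith
  · have h2 : 0 < log p := log_pos (by exact_mod_cast hp)
    rw [lt_log_iff_exp_lt h2, lt_log_iff_exp_lt ♯] at h1
    unfold EE at hc; linarith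

theorem mem_PR {p b : ℕ} : p ∈ PR b ↔ p.Prime ∧ lev p ≤ b := by
  rw [PR, mem_filter, mem_range, Nat.lt_succ_iff, Nat.le_floor_iff (EE_pos _).le]
  constructor
  · rintro ⟨h, hp⟩; exact ⟨hp, (lev_le_iff hp.two_le).2 h⟩
  · rintro ⟨hp, h⟩; exact ⟨(lev_le_iff hp.two_le).1 h, hp⟩

theorem mem_LP {p l : ℕ} : p ∈ LP l ↔ p.Prime ∧ lev p = l := by
  rw [LP, mem_filter, mem_PR]
  constructor
  · rintro ⟨⟨h, _⟩, h'⟩; exact ⟨h, h'⟩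
  · rintro ⟨h, h'⟩; exact ⟨⟨h, h'.le⟩, h'⟩

theorem LP_eq {l : ℕ} (hl : 1 ≤ l) : LP l = (Ioc ⌊EE l⌋₊ ⌊EE (l+1)⌋₊).filter Nat.Prime := by
  ext p
  rw [mem_LP, mem_filter, mem_Ioc, Nat.floor_lt (EE_pos _).le, Nat.le_floor_iff (EE_pos _).le]
  constructor
  · rintro ⟨hp, h⟩; exact ⟨⟨lev_lt_of hl h.ge, (lev_le_iff hp.two_le).1 h.le⟩, hp⟩
  · rintro ⟨⟨h1, h2⟩, hp⟩
    refine ⟨hp, le_antisymm ((lev_le_iff hp.two_le).2 h2) ?_⟩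
    by_contra hc
    have : lev p ≤ l - 1 := by omega
    rw [lev_le_iff hp.two_le, Nat.cast_sub hl] at this
    push_cast at this; rw [sub_add_cancel] at this; linarith

theorem level_sum : ∃ M : ℝ, 1 ≤ M ∧ ∀ l : ℕ, |∑ p ∈ LP l, 1°/p - 1| ≤ M * exp (-l) := by
  obtain ⟨K, hK0, hK⟩ := mertens2
  refine ⟨1 + K + |∑ p ∈ LP 0, 1°/p - 1|, by linarith [abs_nonneg (∑ p ∈ LP 0, 1°/p - 1)], fun l ↦ ?_⟩
  rcases Nat.eq_zero_or_pos l with rfl | hl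
  · simp only [Nat.cast_zero, neg_zero, exp_zero, mul_one]; linarith
  · rw [LP_eq hl]
    have h := hK (EE l) (EE (l+1)) (two_lt_EE ♯).le (EE_mono ♭)
    rw [log_EE, log_EE, log_exp, log_exp, add_sub_cancel_left, div_eq_mul_inv, ← exp_neg] at h
    refine h.trans (mul_le_mul_of_nonneg_right ?_ (exp_pos _).le)
    linarith [abs_nonneg (∑ p ∈ LP 0, 1°/p - 1)]

theorem sum_PR (b : ℕ) (f : ℕ → ℝ) : ∑ p ∈ PR b, f p = ∑ l ∈ range (b+1), ∑ p ∈ LP l, f p := by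
  rw [← sum_fiberwise_of_maps_to (s := PR b) (t := range (b+1)) (g := lev)
    (fun p hp ↦ mem_range.2 (Nat.lt_succ_of_le (mem_PR.1 hp).2))]
  apply sum_congr rfl; intro l hl
  apply sum_congr _ (fun _ _ ↦ rfl)
  ext p; rw [mem_filter, mem_PR, mem_LP]
  have := mem_range.1 hl
  constructor
  · rintro ⟨⟨h, _⟩, h'⟩; exact ⟨h, h'⟩
  · rintro ⟨h, h'⟩; exact ⟨⟨h, by omega⟩, h'⟩

theorem sum_exp_neg_le (n : ℕ) : ∑ l ∈ range n, exp (-l°) ≤ 2 := by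
  have h : ∀ l : ℕ, exp (-l°) ≤ (1/2)^l := by
    intro l
    rw [show -l° = l * (-1) by ring, exp_nat_mul]
    gcongr
    rw [exp_neg, one_div]; apply inv_anti₀ ♮; linarith [exp_one_gt_d9]
  refine (sum_le_sum fun l _ ↦ h l).trans ?_
  have := sum_geometric_two_le n
  exact this

theorem levsum : ∃ M : ℝ, 1 ≤ M ∧ ∀ (b : ℕ) (u : ℕ → ℝ) (B : ℝ), (∀ l ≤ b, 0 ≤ u l ∧ u l ≤ B) →
    |∑ p ∈ PR b, u (lev p) / p - ∑ l ∈ range (b+1), u l| ≤ M * B := by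
  obtain ⟨M, hM1, hM⟩ := level_sum
  refine ⟨2*M, by linarith, fun b u B hu ↦ ?_⟩
  have hB : 0 ≤ B := (hu 0 (Nat.zero_le _)).1.trans (hu 0 (Nat.zero_le _)).2
  rw [sum_PR, ← sum_sub_distrib]
  have : ∀ l ∈ range (b+1), |∑ p ∈ LP l, u (lev p) / p - u l| ≤ B * M * exp (-l°) := by
    intro l hl
    have hl' : l ≤ b := by have := mem_range.1 hl; omega
    have e : ∑ p ∈ LP l, u (lev p) / p - u l = u l * (∑ p ∈ LP l, 1°/p - 1) := by
      rw [mul_sub, mul_one, mul_sum]; congr 1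
      apply sum_congr rfl; intro p hp; rw [(mem_LP.1 hp).2]; ring
    rw [e, abs_mul, abs_of_nonneg (hu l hl').1, mul_assoc]
    exact mul_le_mul (hu l hl').2 (hM l) (abs_nonneg _) hB
  refine (abs_sum_le_sum_abs _ _).trans ((sum_le_sum this).trans ?_)
  rw [← mul_sum]
  have := sum_exp_neg_le (b+1)
  nlinarith [mul_nonneg hB (by linarith : 0° ≤ M)]

theorem sum_inv_mul_pred (s : Finset ℕ) (m : ℕ) (hm : 1 ≤ m) (hs : ∀ p ∈ s, m < p) :
    ∑ p ∈ s, 1°/(p*(p°-1)) ≤ 1/m := by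
  have hm' : 0° < m := by exact_mod_cast hm
  have h1 : ∀ k : ℕ, ∑ p ∈ Ioc m (m+k), 1°/(p*(p°-1)) = 1/m - 1/(m+k:ℕ) := by
    intro k; induction k with
    | zero => simp
    | succ k ih =>
      rw [← add_assoc, sum_Ioc_succ_top ⋆, ih]
      push_cast
      have : m°+k ≠ 0 := by positivity
      have h3 : m°+k+1-1 = m+k := by ring
      rw [h3]; field_simp; ring
  obtain ⟨k, hk⟩ : ∃ k, s ⊆ Ioc m (m+k) := by
    refine ⟨s.sup id, fun p hp ↦ mem_Ioc.2 ⟨hs p hp, ?_⟩⟩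
    have := le_sup (f := id) hp; simp at this; omega
  refine (sum_le_sum_of_subset_of_nonneg hk (fun i hi _ ↦ ?_)).trans ?_
  · have : 1° ≤ i := by have := (mem_Ioc.1 hi).1; exact_mod_cast (by omega : 1 ≤ i)
    apply div_nonneg zero_le_one; apply mul_nonneg <;> linarith
  · rw [h1]; have : 0° ≤ 1/(m+k:ℕ) := by positivity
    linarith

end

open Finset Real
noncomputable section

theorem EP (P : Finset ℕ) (c : ℕ → ℕ → ℝ) (S : ℕ → ℝ) (hc : ∀ p ∈ P, ∀ e, 0 ≤ c p e)
    (hS : ∀ p ∈ P, ∀ n, ∑ e ∈ Icc 1 n, c p e ≤ S p) (A : Finset ℕ)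
    (hA : ∀ N ∈ A, N ≠ 0 ∧ N.primeFactors ⊆ P) :
    ∑ N ∈ A, mval c N ≤ ∏ p ∈ P, (1 + S p) := by
  classical
  set c' : ℕ → ℕ → ℝ := fun p e ↦ if e = 0 then 1 else c p e with hc'
  have hm : ∀ N ∈ A, mval c N = ∏ p ∈ P, c' p (N.factorization p) := by
    intro N hN
    rw [mval]
    have h1 : ∏ p ∈ N.primeFactors, c p (N.factorization p) = ∏ p ∈ N.primeFactors, c' p (N.factorization p) := by
      apply prod_congr rfl; intro p hp
      have : N.factorization p ≠ 0 := by
        rw [← Nat.support_factorization] at hp; exact Finsupp.mem_support_iff.1 hp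
      simp [hc', this]
    rw [h1]
    apply prod_subset (hA N hN).2
    intro p _ hp
    have : N.factorization p = 0 := by
      rw [← Nat.support_factorization] at hp; exact Finsupp.notMem_support_iff.1 hp
    simp [hc', this]
  rw [sum_congr rfl hm]
  set K := A.sup id with hK
  have hle : ∏ p ∈ P, ∑ e ∈ range (K+1), c' p e ≤ ∏ p ∈ P, (1 + S p) := by
    apply prod_le_prod
    · intro p hp; apply sum_nonneg; intro e _; simp only [hc']; split_ifs; exacts [zero_le_one, hc p hp e]
    · intro p hp
      rw [sum_range_succ', add_comm]
      simp only [hc']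
      have : ∑ e ∈ range K, (if e + 1 = 0 then 1 else c p (e+1)) = ∑ e ∈ Icc 1 K, c p e := by
        clear * -
        induction K with
        | zero => simp
        | succ n ih => rw [sum_range_succ, ih, sum_Icc_succ_top ⋆]; simp
      simp only [if_true]
      linarith [hS p hp K]
  refine le_trans ?_ hle
  rw [prod_sum]
  have hP : ∀ N : ℕ, ∏ p ∈ P, c' p (N.factorization p) = (fun g : (∀ p ∈ P, ℕ) => ∏ x ∈ P.attach, c' x.1 (g x.1 x.2)) (fun p _ ↦ N.factorization p) := by
    intro N; exact (prod_attach P (fun p ↦ c' p (N.factorization p))).symm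
  simp only [hP]
  rw [← sum_image (f := fun g : (∀ p ∈ P, ℕ) => ∏ x ∈ P.attach, c' x.1 (g x.1 x.2)) (g := fun N : ℕ => (fun p (_ : p ∈ P) => N.factorization p))]
  · apply sum_le_sum_of_subset_of_nonneg
    · intro g hg
      obtain ⟨N, hN, rfl⟩ := mem_image.1 hg
      rw [mem_pi]; intro p hp
      rw [mem_range, Nat.lt_succ_iff]
      have h1 : N ≤ K := le_sup (f := id) hN
      exact ((Nat.factorization_lt p (hA N hN).1).le).trans h1
    · intro g _ _
      apply prod_nonneg; intro x _; simp only [hc']; split_ifs; exacts [zero_le_one, hc _ x.2 _]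
  · intro N hN N' hN' h
    apply Nat.eq_of_factorization_eq (hA N hN).1 (hA N' hN').1
    intro p
    by_cases hp : p ∈ P
    · exact congr_fun (congr_fun h p) hp
    · have z : ∀ n ∈ A, n.factorization p = 0 := fun n hn ↦ by
        rw [← Finsupp.notMem_support_iff, Nat.support_factorization]; exact fun h ↦ hp ((hA n hn).2 h)
      rw [z N hN, z N' hN']

/-- completely multiplicative function with values `u p` at primes -/
def cm (u : ℕ → ℝ) (n : ℕ) : ℝ := mval (fun p e ↦ u p ^ e) n

theorem cm_eq (u : ℕ → ℝ) (n : ℕ) : cm u n = n.factorization.prod (fun p e ↦ u p ^ e) := by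
  rw [Finsupp.prod, Nat.support_factorization]; rfl

theorem cm_one (u : ℕ → ℝ) : cm u 1 = 1 := by simp [cm_eq]

theorem cm_mul (u : ℕ → ℝ) {a b : ℕ} (ha : a ≠ 0) (hb : b ≠ 0) : cm u (a*b) = cm u a * cm u b := by
  rw [cm_eq, cm_eq, cm_eq, Nat.factorization_mul ha hb, Finsupp.prod_add_index' (by simp) (by intros; rw [pow_add])]

theorem cm_prime (u : ℕ → ℝ) {p : ℕ} (hp : p.Prime) : cm u p = u p := by
  rw [cm_eq, hp.factorization, Finsupp.prod_single_index (by simp), pow_one]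

theorem cm_nonneg {u : ℕ → ℝ} {n : ℕ} (h : ∀ p ∈ n.primeFactors, 0 ≤ u p) : 0 ≤ cm u n :=
  prod_nonneg fun p hp ↦ pow_nonneg (h p hp) _

theorem cm_pos {u : ℕ → ℝ} {n : ℕ} (h : ∀ p ∈ n.primeFactors, 0 < u p) : 0 < cm u n :=
  prod_pos fun p hp ↦ pow_pos (h p hp) _

theorem cm_mul_fun (u v : ℕ → ℝ) (n : ℕ) : cm (fun p ↦ u p * v p) n = cm u n * cm v n := by
  unfold cm mval; rw [← prod_mul_distrib]; simp only [mul_pow]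

theorem cm_mono {u v : ℕ → ℝ} {n : ℕ} (h : ∀ p ∈ n.primeFactors, 0 ≤ u p ∧ u p ≤ v p) : cm u n ≤ cm v n :=
  prod_le_prod (fun p hp ↦ pow_nonneg (h p hp).1 _) (fun p hp ↦ pow_le_pow_left₀ (h p hp).1 (h p hp).2 _)

theorem cm_congr {u v : ℕ → ℝ} {n : ℕ} (h : ∀ p ∈ n.primeFactors, u p = v p) : cm u n = cm v n :=
  by unfold cm mval; exact prod_congr rfl (fun p hp ↦ by dsimp only; rw [h p hp])

theorem cm_id {n : ℕ} (hn : n ≠ 0) : cm (fun p ↦ p°) n = n := by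
  have h0 := Nat.prod_factorization_pow_eq_self hn
  rw [cm_eq, Finsupp.prod]; rw [Finsupp.prod] at h0; exact_mod_cast h0

theorem cm_rpow {n : ℕ} (hn : n ≠ 0) (s : ℝ) : cm (fun p ↦ p°^s) n = n°^s := by
  rw [← cm_id hn, cm, cm, mval, mval, ← finsetProd_rpow _ _ (fun p _ ↦ by positivity)]
  apply prod_congr rfl; intro p _
  rw [← rpow_natCast, ← rpow_mul ♯, mul_comm, rpow_mul ♯, rpow_natCast]

theorem cm_inv {n : ℕ} (hn : n ≠ 0) : cm (fun p ↦ 1/p°) n = 1/n := by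
  have := cm_rpow hn (-1); rw [rpow_neg_one] at this
  rw [one_div, ← this]; exact cm_congr fun p _ ↦ by rw [rpow_neg_one, one_div]

theorem cm_div {n : ℕ} (hn : n ≠ 0) (v : ℕ → ℝ) : cm (fun p ↦ v p/p°) n = cm v n/n := by
  have : (fun p : ℕ => v p/p°) = fun p ↦ v p * (1/p°) := by ext p; ring
  rw [this, cm_mul_fun, cm_inv hn]; ring

theorem cm_sum (P : Finset ℕ) (u : ℕ → ℝ) (hu : ∀ p ∈ P, 0 ≤ u p ∧ u p ≤ 9/10) (A : Finset ℕ)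
    (hA : ∀ N ∈ A, N ≠ 0 ∧ N.primeFactors ⊆ P) :
    ∑ N ∈ A, cm u N ≤ exp (∑ p ∈ P, (u p + 10 * (u p)^2)) := by
  have h := EP P (fun p e ↦ u p ^ e) (fun p ↦ u p + 10 * (u p)^2) (fun p hp e ↦ pow_nonneg (hu p hp).1 _) ?_ A hA
  · refine h.trans ?_
    rw [exp_sum]
    apply prod_le_prod
    · intro p hp; have := (hu p hp).1; positivity
    · intro p hp; have := add_one_le_exp (u p + 10*(u p)^2); linarith
  · intro p hp n
    obtain ⟨h0, h1⟩ := hu p hp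
    have e : ∀ n, (1 - u p) * ∑ e ∈ Icc 1 n, u p ^ e = u p - u p^(n+1) := by
      intro n; induction n with
      | zero => simp
      | succ n ih => rw [sum_Icc_succ_top ⋆, mul_add, ih]; ring
    have e1 := e n
    have e2 : 0 ≤ u p^(n+1) := by positivity
    set T := ∑ e ∈ Icc 1 n, u p ^ e
    have e3 : (1 - u p) * T ≤ (1 - u p) * (u p + 10*(u p)^2) := by
      rw [e1]; nlinarith [mul_nonneg h0 h0]
    exact le_of_mul_le_mul_left e3 ♭

/-- weights depending on the level only -/
theorem cm_lev_sum : ∃ M : ℝ, 1 ≤ M ∧ ∀ (b : ℕ) (v : ℕ → ℝ) (B : ℝ), 1 ≤ B → (∀ l ≤ b, 0 ≤ v l ∧ v l ≤ B) →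
    (∀ p ∈ PR b, v (lev p) / p ≤ 9/10) → ∀ A : Finset ℕ, (∀ N ∈ A, N ≠ 0 ∧ N.primeFactors ⊆ PR b) →
    ∑ N ∈ A, cm (fun p ↦ v (lev p)) N / N ≤ exp (∑ l ∈ range (b+1), v l + M * B^2) := by
  obtain ⟨M, hM1, hM⟩ := levsum
  refine ⟨M + 20, by linarith, fun b v B hB hv hv2 A hA ↦ ?_⟩
  have h := cm_sum (PR b) (fun p ↦ v (lev p)/p) (fun p hp ↦ ⟨by
    have := (hv _ (mem_PR.1 hp).2).1; positivity, hv2 p hp⟩) A hA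
  have e : ∀ N ∈ A, cm (fun p ↦ v (lev p)/p) N = cm (fun p ↦ v (lev p)) N / N := fun N hN ↦ cm_div (hA N hN).1 _
  rw [← sum_congr rfl e]
  refine h.trans (exp_le_exp.2 ?_)
  rw [sum_add_distrib]
  have h1 := (abs_le.1 (hM b v B hv)).2
  have h2 : ∑ p ∈ PR b, 10 * (v (lev p)/p)^2 ≤ 10 * B^2 * ∑ p ∈ PR b, 1°/(p*(p°-1)) := by
    rw [mul_sum]; apply sum_le_sum; intro p hp
    have hp2 : 2° ≤ p := by exact_mod_cast (mem_PR.1 hp).1.two_le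
    have hv := hv _ (mem_PR.1 hp).2
    rw [div_pow, mul_one_div, ← mul_div_assoc]
    apply div_le_div₀ ♯
    · have := pow_le_pow_left₀ hv.1 hv.2 2; linarith
    · nlinarith
    · nlinarith
  have h3 := sum_inv_mul_pred (PR b) 1 le_rfl (fun p hp ↦ (mem_PR.1 hp).1.one_lt)
  norm_num at h3
  norm_num at h2
  have h4 : 10 * B^2 * ∑ x ∈ PR b, (x°-1)⁻¹ * x°⁻¹ ≤ 10 * B^2 * 1 := mul_le_mul_of_nonneg_left h3 ♯
  have h5 : M * B ≤ M * B^2 := by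
    apply mul_le_mul_of_nonneg_left _ ♭; nlinarith
  have h6 : (M+20) * B^2 = M*B^2+20*B^2 := by ring
  rw [h6]
  have h7 : 0 ≤ B^2 := by positivity
  linarith

end

open Finset Real
noncomputable section

theorem ap_count (a N d c : ℕ) (hd : 0 < d) :
    |(((Ico a (a+N)).filter (fun n ↦ n ≡ c [MOD d])).card : ℝ) - N/d| ≤ 1 := by
  have h := Nat.Ico_filter_modEq_card a (a+N) hd c
  have hd' : (0:ℚ) < d := by exact_mod_cast hd
  have e : (((a+N:ℕ):ℚ) - c)/d = ((a:ℚ)-c)/d + N/d := by push_cast; ring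
  rw [e] at h
  set u := ((a:ℚ)-c)/d
  set v := (N:ℚ)/d with hv
  have hv0 : 0 ≤ v := by positivity
  have h1 := Int.le_ceil u
  have h2 := Int.ceil_lt_add_one u
  have h3 := Int.le_ceil (u+v)
  have h4 := Int.ceil_lt_add_one (u+v)
  have h5 : ⌈u⌉ ≤ ⌈u+v⌉ := Int.ceil_le_ceil ♭
  rw [max_eq_left ⋆] at h
  have h6 : ((((Ico a (a+N)).filter (fun n ↦ n ≡ c [MOD d])).card : ℤ) : ℚ) = ((⌈u+v⌉ - ⌈u⌉ : ℤ) : ℚ) := by rw [h]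
  have h7 : |((((Ico a (a+N)).filter (fun n ↦ n ≡ c [MOD d])).card : ℤ) : ℚ) - v| ≤ 1 := by
    rw [h6, abs_le]; push_cast; constructor <;> linarith
  have h8 : ((N:ℚ)/d : ℚ) = v := rfl
  have h9 : (((|((((Ico a (a+N)).filter (fun n ↦ n ≡ c [MOD d])).card : ℤ) : ℚ) - v| : ℚ)) : ℝ) ≤ ((1:ℚ):ℝ) := by exact_mod_cast h7
  rw [hv] at h9
  push_cast at h9; exact h9

theorem crt_count (a N : ℕ) (Ω : ℕ → Finset ℕ) (k : ℕ) (D : Finset ℕ) (hD : ∀ p ∈ D, p.Prime)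
    (hΩ : ∀ p ∈ D, Ω p ⊆ range p ∧ (Ω p).card = k) : ∀ (d c : ℕ), 0 < d → (∀ p ∈ D, Nat.Coprime d p) →
    |(((Ico a (a+N)).filter (fun n ↦ n ≡ c [MOD d] ∧ ∀ p ∈ D, n % p ∈ Ω p)).card : ℝ)
      - N/d * ∏ p ∈ D, (k°/p)| ≤ k^D.card := by
  induction D using Finset.induction_on with
  | empty =>
    intro d c hd _
    have := ap_count a N d c hd
    simpa using this
  | insert q D hq ih =>
    intro d c hd hcop
    have hqp := hD q (mem_insert_self q D)
    have ih' := ih (fun p hp ↦ hD p (mem_insert_of_mem hp)) (fun p hp ↦ hΩ p (mem_insert_of_mem hp))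
    have hdq := hcop q (mem_insert_self q D)
    set F : ℕ → Finset ℕ := fun w ↦ (Ico a (a+N)).filter (fun n ↦ n ≡ (Nat.chineseRemainder hdq c w : ℕ) [MOD d*q] ∧ ∀ p ∈ D, n % p ∈ Ω p) with hF
    have hmod : ∀ n w : ℕ, w ∈ Ω q → (n ≡ (Nat.chineseRemainder hdq c w : ℕ) [MOD d*q] ↔ n ≡ c [MOD d] ∧ n % q = w) := by
      intro n w hw
      have hwq : w < q := mem_range.1 ((hΩ q (mem_insert_self q D)).1 hw)
      have h1 := (Nat.chineseRemainder hdq c w).2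
      rw [← Nat.modEq_and_modEq_iff_modEq_mul hdq]
      constructor
      · rintro ⟨x, y⟩
        refine ⟨x.trans h1.1, ?_⟩
        have := y.trans h1.2
        rw [Nat.ModEq, Nat.mod_eq_of_lt hwq] at this; exact this
      · rintro ⟨x, y⟩
        refine ⟨x.trans h1.1.symm, ?_⟩
        refine Nat.ModEq.trans ?_ h1.2.symm
        rw [Nat.ModEq, Nat.mod_eq_of_lt hwq, y]
    have hcard : ((Ico a (a+N)).filter (fun n ↦ n ≡ c [MOD d] ∧ ∀ p ∈ insert q D, n % p ∈ Ω p)).card = ∑ w ∈ Ω q, (F w).card := by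
      rw [card_eq_sum_card_fiberwise (f := fun n ↦ n % q) (t := Ω q)]
      · apply sum_congr rfl; intro w hw
        congr 1; ext n
        simp only [hF, mem_filter, hmod n w hw, forall_mem_insert]
        constructor
        · rintro ⟨⟨h1, h2, h3, h4⟩, h5⟩; exact ⟨h1, ⟨h2, h5⟩, h4⟩
        · rintro ⟨h1, ⟨h2, h5⟩, h4⟩; exact ⟨⟨h1, h2, by rw [h5]; exact hw, h4⟩, h5⟩
      · intro n hn
        have := (mem_filter.1 hn).2.2; exact this q (mem_insert_self q D)
    rw [hcard, card_insert_of_notMem hq, prod_insert hq]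
    have hkq : ((Ω q).card : ℝ) = k := by rw [(hΩ q (mem_insert_self q D)).2]
    have e : N°/d * (k°/q * ∏ p ∈ D, (k°/p)) = ∑ w ∈ Ω q, N°/((d*q : ℕ):ℝ) * ∏ p ∈ D, (k°/p) := by
      rw [sum_const, nsmul_eq_mul, hkq]; push_cast
      have := hqp.pos; field_simp
    rw [e]; push_cast; rw [← sum_sub_distrib]
    refine (abs_sum_le_sum_abs _ _).trans ?_
    have : ∀ w ∈ Ω q, |((F w).card : ℝ) - N°/(d°*(q : ℝ)) * ∏ p ∈ D, (k°/p)| ≤ k°^D.card := by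
      intro w hw
      have := ih' (d*q) (Nat.chineseRemainder hdq c w) (Nat.mul_pos hd hqp.pos) (fun p hp ↦ by
        apply Nat.Coprime.mul_left (hcop p (mem_insert_of_mem hp))
        exact (Nat.coprime_primes hqp (hD p (mem_insert_of_mem hp))).2 (fun h ↦ hq (h ▸ hp)))
      push_cast at this; exact this
    refine (sum_le_sum this).trans ?_
    rw [sum_const, nsmul_eq_mul, hkq, pow_succ']

theorem bonferroni {α : Type*} [DecidableEq α] (S : Finset α) (r : ℕ) (hr : Even r) :
    (if S = ∅ then 1° else 0) ≤ ∑ D ∈ S.powerset.filter (fun D ↦ D.card ≤ r), (-1:ℝ)^D.card := by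
  have h1 : ∑ D ∈ S.powerset.filter (fun D ↦ D.card ≤ r), (-1:ℝ)^D.card = ∑ i ∈ range (r+1), (-1:ℝ)^i * (S.card.choose i) := by
    rw [sum_filter, sum_powerset_apply_card (fun i ↦ if i ≤ r then (-1:ℝ)^i else 0)]
    have : ∀ n, ∑ m ∈ range n, S.card.choose m • (if m ≤ r then (-1:ℝ)^m else 0) = ∑ m ∈ (range n).filter (· ≤ r), (-1:ℝ)^m * (S.card.choose m) := by
      intro n; rw [sum_filter]; apply sum_congr rfl; intro m _
      split_ifs <;> simp [mul_comm]
    rw [this]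
    have h2 : (range (S.card+1)).filter (· ≤ r) ⊆ range (r+1) := by
      intro m hm; have := (mem_filter.1 hm).2; exact mem_range.2 ⋆
    apply sum_subset h2
    intro m hm hm2
    have : S.card < m := by
      by_contra hc; exact hm2 (mem_filter.2 ⟨mem_range.2 ⋆, by have := mem_range.1 hm; omega⟩)
    rw [Nat.choose_eq_zero_of_lt this]; simp
  rw [h1]
  split_ifs with hS
  · subst hS
    rw [sum_range_succ']
    simp
  · have hc : 0 < S.card := card_pos.2 (nonempty_iff_ne_empty.2 hS)
    obtain ⟨s, hs⟩ : ∃ s, S.card = s + 1 := ⟨S.card - 1, by omega⟩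
    have := Int.alternating_sum_range_choose_eq_choose (n := s) (m := r)
    have h3 : ((∑ i ∈ range (r+1), ((-1)^i * (s+1).choose i : ℤ) : ℤ) : ℝ) = (((-1)^r * s.choose r : ℤ) : ℝ) := by rw [this]
    push_cast at h3
    rw [hs, h3, hr.neg_one_pow]; positivity

theorem brun (a N : ℕ) (Ω : ℕ → Finset ℕ) (k : ℕ) (P : Finset ℕ) (hP : ∀ p ∈ P, p.Prime ∧ k ≤ p)
    (hΩ : ∀ p ∈ P, Ω p ⊆ range p ∧ (Ω p).card = k) (r : ℕ) (hr : Even r) (T : Finset ℕ) (hT : T ⊆ Ico a (a+N))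
    (hT2 : ∀ n ∈ T, ∀ p ∈ P, n % p ∉ Ω p) :
    (T.card : ℝ) ≤ N * (exp (-(k * ∑ p ∈ P, 1°/p)) + exp (-r + 3 * k * ∑ p ∈ P, 1°/p)) + (P.card+1)^r * exp k := by
  classical
  set S : ℕ → Finset ℕ := fun n ↦ P.filter (fun p ↦ n % p ∈ Ω p) with hS
  set Q := P.powerset.filter (fun D ↦ D.card ≤ r) with hQ
  have hprod0 : ∀ D ⊆ P, 0 ≤ ∏ p ∈ D, (k°/p) := fun D _ ↦ prod_nonneg fun p _ ↦ by positivity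
  have h1 : (T.card : ℝ) ≤ ∑ n ∈ Ico a (a+N), if S n = ∅ then 1° else 0 := by
    rw [← sum_filter, sum_const, nsmul_eq_mul, mul_one]
    exact_mod_cast card_le_card (fun n hn ↦ mem_filter.2 ⟨hT hn, filter_eq_empty_iff.2 fun p hp ↦ hT2 n hn p hp⟩)
  have h2 : ∑ n ∈ Ico a (a+N), (if S n = ∅ then 1° else 0) ≤ ∑ D ∈ Q, (-1:ℝ)^D.card * ((Ico a (a+N)).filter (fun n ↦ ∀ p ∈ D, n % p ∈ Ω p)).card := by
    refine (sum_le_sum fun n _ ↦ bonferroni (S n) r hr).trans (le_of_eq ?_)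
    have e : ∀ n, ∑ D ∈ (S n).powerset.filter (fun D ↦ D.card ≤ r), (-1:ℝ)^D.card = ∑ D ∈ Q, if (∀ p ∈ D, n % p ∈ Ω p) then (-1:ℝ)^D.card else 0 := by
      intro n; rw [← sum_filter]; apply sum_congr _ (fun _ _ ↦ rfl)
      ext D; simp only [hQ, mem_filter, mem_powerset, hS]
      constructor
      · rintro ⟨h, h'⟩; exact ⟨⟨h.trans (filter_subset _ _), h'⟩, fun p hp ↦ (mem_filter.1 (h hp)).2⟩
      · rintro ⟨⟨h, h'⟩, h''⟩; exact ⟨fun p hp ↦ mem_filter.2 ⟨h hp, h'' p hp⟩, h'⟩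
    simp only [e]
    rw [sum_comm]; apply sum_congr rfl; intro D _
    rw [← sum_filter, sum_const, nsmul_eq_mul, mul_comm]
  have h3 : ∀ D ∈ Q, (-1:ℝ)^D.card * ((Ico a (a+N)).filter (fun n ↦ ∀ p ∈ D, n % p ∈ Ω p)).card ≤ N * ((-1:ℝ)^D.card * ∏ p ∈ D, (k°/p)) + k^D.card := by
    intro D hD
    have hDP := mem_powerset.1 (mem_filter.1 hD).1
    have := crt_count a N Ω k D (fun p hp ↦ (hP p (hDP hp)).1) (fun p hp ↦ hΩ p (hDP hp)) 1 0 one_pos (fun p _ ↦ Nat.coprime_one_left p)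
    simp only [Nat.modEq_one, true_and, Nat.cast_one, div_one] at this
    have h4 := abs_le.1 this
    rcases neg_one_pow_eq_or ℝ D.card with h | h <;> rw [h] <;> [linarith [h4.2]; linarith [h4.1]]
  have h5 : ∑ D ∈ Q, (-1:ℝ)^D.card * ∏ p ∈ D, (k°/p) ≤ exp (-(k * ∑ p ∈ P, 1°/p)) + exp (-r + 3 * k * ∑ p ∈ P, 1°/p) := by
    have f1 : ∑ D ∈ P.powerset, (-1:ℝ)^D.card * ∏ p ∈ D, (k°/p) = ∏ p ∈ P, (1 + -(k°/p)) := by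
      rw [prod_one_add]; apply sum_congr rfl; intro D _; rw [prod_neg]
    have f2 := sum_filter_add_sum_filter_not P.powerset (fun D ↦ D.card ≤ r) (fun D ↦ (-1:ℝ)^D.card * ∏ p ∈ D, (k°/p))
    have f3 : ∏ p ∈ P, (1 + -(k°/p)) ≤ exp (-(k * ∑ p ∈ P, 1°/p)) := by
      rw [mul_sum, ← sum_neg_distrib, exp_sum]
      apply prod_le_prod
      · intro p hp
        have : k° ≤ p := by exact_mod_cast (hP p hp).2
        have h0 : 0° < p := by exact_mod_cast (hP p hp).1.pos
        have := (div_le_one h0).2 this; linarith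
      · intro p _
        have := add_one_le_exp (-(k°*(1/p))); rw [mul_one_div] at *; linarith
    have f4 : -∑ D ∈ P.powerset.filter (fun D ↦ ¬ D.card ≤ r), (-1:ℝ)^D.card * ∏ p ∈ D, (k°/p) ≤ exp (-r + 3 * k * ∑ p ∈ P, 1°/p) := by
      rw [← sum_neg_distrib]
      have g1 : ∀ D ∈ P.powerset.filter (fun D ↦ ¬ D.card ≤ r), -((-1:ℝ)^D.card * ∏ p ∈ D, (k°/p)) ≤ exp (-r) * ∏ p ∈ D, (exp 1 * (k°/p)) := by
        intro D hD
        obtain ⟨hD1, hD2⟩ := mem_filter.1 hD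
        have h0 := hprod0 D (mem_powerset.1 hD1)
        rw [prod_mul_distrib, prod_const, ← mul_assoc, ← exp_nat_mul, ← exp_add]
        have : 1 ≤ exp (-r + (D.card:ℝ)*1) := by
          apply one_le_exp
          have : r° ≤ D.card := by exact_mod_cast (by omega : r ≤ D.card)
          linarith
        rcases neg_one_pow_eq_or ℝ D.card with h | h <;> rw [h] <;> nlinarith
      refine (sum_le_sum g1).trans ?_
      rw [← mul_sum, exp_add]
      apply mul_le_mul_of_nonneg_left _ (exp_pos _).le
      refine (sum_le_sum_of_subset_of_nonneg (filter_subset _ _) (fun D _ _ ↦ prod_nonneg fun p _ ↦ by positivity)).trans ?_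
      rw [← prod_one_add, mul_sum, exp_sum]
      apply prod_le_prod
      · intro p _; positivity
      · intro p _
        have h1 := add_one_le_exp (3 * k * (1°/p))
        have h2 : exp 1 * (k°/p) ≤ 3 * (k/p) := mul_le_mul_of_nonneg_right exp_one_lt_three.le ♯
        have h3 : 3 * k° * (1°/p) = 3 * (k/p) := by ring
        rw [h3] at h1 ⊢; linarith
    rw [f1] at f2; linarith
  have h6 : ∑ D ∈ Q, k°^D.card ≤ (P.card+1)^r * exp k := by
    set Y : ℝ := P.card + 1 with hY
    have hY1 : 1 ≤ Y := by rw [hY]; linarith [(Nat.cast_nonneg P.card : 0° ≤ P.card)]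
    have g : ∀ D ∈ Q, k°^D.card ≤ Y^r * ∏ p ∈ D, (k°/Y) := by
      intro D hD
      rw [prod_const, div_pow, mul_div_assoc', le_div_iff₀ ♯, mul_comm]
      exact mul_le_mul_of_nonneg_right (pow_le_pow_right₀ hY1 (mem_filter.1 hD).2) ♯
    refine (sum_le_sum g).trans ?_
    rw [← mul_sum]
    apply mul_le_mul_of_nonneg_left _ ♯
    refine (sum_le_sum_of_subset_of_nonneg (filter_subset _ _) (fun D _ _ ↦ prod_nonneg fun p _ ↦ by positivity)).trans ?_
    rw [← prod_one_add, prod_const]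
    calc (1 + k°/Y)^P.card ≤ (exp (k/Y))^P.card := by
          gcongr; have := add_one_le_exp (k°/Y); linarith
      _ = exp (P.card * (k/Y)) := by rw [exp_nat_mul]
      _ ≤ exp k := by
          apply exp_le_exp.2
          rw [mul_div_assoc', div_le_iff₀ ♭]
          have : 0° ≤ k := by positivity
          rw [hY]; nlinarith
  calc (T.card:ℝ) ≤ _ := h1.trans h2
    _ ≤ _ := sum_le_sum h3
    _ = N * ∑ D ∈ Q, (-1:ℝ)^D.card * ∏ p ∈ D, (k°/p) + ∑ D ∈ Q, k°^D.card := by rw [sum_add_distrib, mul_sum]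
    _ ≤ _ := add_le_add (mul_le_mul_of_nonneg_left h5 ♯) h6
end

open Finset Real
noncomputable section

theorem omega_le_log {D : ℕ} (hD : D ≠ 0) : (D.primeFactors.card : ℝ) ≤ 2 * log D := by
  have h1 : 2^D.primeFactors.card ≤ D := by
    calc 2^D.primeFactors.card = ∏ p ∈ D.primeFactors, 2 := by rw [prod_const]
      _ ≤ ∏ p ∈ D.primeFactors, p := prod_le_prod' fun p hp ↦ (Nat.prime_of_mem_primeFactors hp).two_le
      _ ≤ D := Nat.le_of_dvd (Nat.pos_of_ne_zero hD) (Nat.prod_primeFactors_dvd D)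
  have h2 : log (2°^D.primeFactors.card) ≤ log D := log_le_log ♯ (by exact_mod_cast h1)
  rw [log_pow] at h2
  have := log_two_gt_d9
  have : 0° ≤ D.primeFactors.card := by positivity
  nlinarith

theorem pow_log_le : ∃ C : ℝ, 1 ≤ C ∧ ∀ x : ℝ, 1 ≤ x → x^51 ≤ C * exp (x * (3/4)) := by
  refine ⟨(Nat.factorial 51) * (4/3)^51, ?_, fun x hx ↦ ?_⟩
  · have : 1° ≤ Nat.factorial 51 := by exact_mod_cast Nat.one_le_iff_ne_zero.2 (Nat.factorial_ne_zero 51)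
    have h2 : 1° ≤ (4/3)^51 := one_le_pow₀ ♮
    nlinarith
  · have := pow_div_factorial_le_exp (x*(3/4)) ♭ 51
    rw [div_le_iff₀ ♯, mul_pow] at this
    calc x^51 = (x^51 * (3/4)^51) * (4/3)^51 := by rw [mul_assoc, ← mul_pow]; norm_num
      _ ≤ (exp (x*(3/4)) * (Nat.factorial 51)) * (4/3)^51 := by gcongr
      _ = _ := by ring

set_option maxHeartbeats 2000000 in
theorem sieve : ∃ C : ℝ, 1 ≤ C ∧ ∀ k : ℕ, 1 ≤ k → k ≤ 3 → ∀ (B : ℝ) (a N D : ℕ) (Ω : ℕ → Finset ℕ) (T : Finset ℕ),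
    1 ≤ B → 3 ≤ N → D ≠ 0 → log D ≤ exp B →
    (∀ p, p.Prime → ¬ p ∣ D → Ω p ⊆ range p ∧ (Ω p).card = k) → T ⊆ Ico a (a+N) →
    (∀ n ∈ T, ∀ p, p.Prime → ¬ p ∣ D → p^2 ≤ N → n % p ∉ Ω p) →
    (T.card : ℝ) ≤ C * N * ((B + loglog N)^2 / log N)^k := by
  obtain ⟨K, hK0, hK⟩ := mertens2
  obtain ⟨C1, hC1, hpow⟩ := pow_log_le
  set C : ℝ := 400^3 * exp (3*(K+1)) + exp (9*K) + exp 33 * C1 * exp 3 + 400^3 with hC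
  have hCa : 0 < 400^3 * exp (3*(K+1)) := by positivity
  have hCb : 0 < exp (9*K) := by positivity
  have hCc : 0 < exp 33 * C1 * exp 3 := by positivity
  refine ⟨C, by linarith, fun k hk1 hk3 B a N D Ω T hB hN hD hDB hΩ hT hT2 ↦ ?_⟩
  have hNr : 3° ≤ N := by exact_mod_cast hN
  have hx1 : 1 ≤ log N := by
    rw [le_log_iff_exp_le ♭]; linarith [exp_one_lt_three]
  set x := log N with hx
  set l := loglog N with hl
  have hl0 : 0 ≤ l := log_nonneg hx1
  have hexl : exp l = x := exp_log ♭
  set r : ℕ := 2 * ⌈10*(l+1)⌉₊ with hr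
  have hr1 : 20*(l+1) ≤ r° := by rw [hr]; push_cast; linarith [Nat.le_ceil (10*(l+1))]
  have hr2 : r° ≤ 20*(l+1)+2 := by rw [hr]; push_cast; linarith [Nat.ceil_lt_add_one (by linarith : 0 ≤ 10*(l+1))]
  set V : ℝ := (B+l)^2/x with hV
  have hBl : 1 ≤ B + l := by linarith
  have hV0 : 0 < V := by positivity
  have hkr : k° ≤ 3 := by exact_mod_cast hk3
  have hTN : (T.card:ℝ) ≤ N := by
    have := card_le_card hT; rw [Nat.card_Ico, Nat.add_sub_cancel_left] at this; exact_mod_cast this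
  set z : ℝ := exp (x/(4*r)) with hz
  set m : ℝ := 8 * exp B with hm
  have hr0 : 0° < r := by linarith
  have hlm : log m = B + log 8 := by
    rw [hm, log_mul ♮ (exp_pos _).ne', log_exp, add_comm]
  have hl8 : log 8 ≤ 3 := by
    rw [show 8° = 2^3 by norm_num, log_pow]; push_cast; linarith [log_two_lt_d9]
  have hl8' : 1 ≤ log 8 := by
    rw [show 8° = 2^3 by norm_num, log_pow]; push_cast; linarith [log_two_gt_d9]
  have hlz : log z = x/(4*r) := log_exp _
  have hratio : log m * (4*r) / x ≤ 400 * V := by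
    rw [hV, mul_div_assoc']
    apply div_le_div_of_nonneg_right _ ♭
    rw [hlm]
    calc (B + log 8) * (4*r) ≤ (4*(B+l)) * (4 * (22 * (B+l))) := by
          exact mul_le_mul ♭ ♭ ♭ ♭
      _ = 352 * (B+l)^2 := by ring
      _ ≤ _ := mul_le_mul_of_nonneg_right ♮ (sq_nonneg _)
  have hpk : (400*V)^k ≤ 400^3 * V^k := by
    rw [mul_pow]; apply mul_le_mul_of_nonneg_right _ ♯
    exact pow_le_pow_right₀ ♮ hk3
  have hVk : 0 < V^k := by positivity
  rcases le_or_gt z m with hzm | hzm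
  · -- trivial case
    have h1 : log z ≤ log m := log_le_log (exp_pos _) hzm
    rw [hlz, div_le_iff₀ ♯] at h1
    have h2 : 1 ≤ log m * (4*r)/x := by rw [one_le_div ♭]; exact h1
    have h3 : 1 ≤ (400*V)^k := one_le_pow₀ (h2.trans hratio)
    have h4 : 1 ≤ C * V^k := by
      have : 400^3 * V^k ≤ C * V^k := by gcongr; linarith
      linarith
    calc (T.card:ℝ) ≤ N * 1 := by linarith
      _ ≤ N * (C*V^k) := by gcongr
      _ = _ := by ring
  · have hm8 : 8 < m := by rw [hm]; have := one_lt_exp_iff.2 (by linarith : 0 < B); linarith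
    set P := ((Ioc ⌊m⌋₊ ⌊z⌋₊).filter Nat.Prime).filter (fun p ↦ ¬ p ∣ D) with hP
    have hPm : ∀ p ∈ P, p.Prime ∧ ¬ p ∣ D ∧ m < p ∧ p° ≤ z := by
      intro p hp
      obtain ⟨h1, h2⟩ := mem_filter.1 hp
      obtain ⟨h3, h4⟩ := mem_filter.1 h1
      obtain ⟨h5, h6⟩ := mem_Ioc.1 h3
      exact ⟨h4, h2, (Nat.floor_lt ♭).1 h5, (Nat.le_floor_iff (exp_pos _).le).1 h6⟩
    have hzN : z^2 ≤ N := by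
      rw [hz, ← exp_nat_mul, ← exp_log (by linarith : 0° < N)]
      apply exp_le_exp.2
      rw [← hx]; push_cast
      rw [mul_div_assoc', div_le_iff₀ ♭, mul_comm]
      exact mul_le_mul_of_nonneg_left ♭ ♭
    have hb := brun a N Ω k P (fun p hp ↦ ⟨(hPm p hp).1, by
        have := (hPm p hp).2.2.1
        have : 8° < p := by linarith
        have : 8 < p := by exact_mod_cast this
        omega⟩)
      (fun p hp ↦ hΩ p (hPm p hp).1 (hPm p hp).2.1) r ⟨⌈10*(l+1)⌉₊, by omega⟩ T hT (fun n hn p hp ↦ hT2 n hn p (hPm p hp).1 (hPm p hp).2.1 (by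
        have h1 := (hPm p hp).2.2.2
        have h2 : p°^2 ≤ N := (pow_le_pow_left₀ ♯ h1 2).trans hzN
        exact_mod_cast h2))
    have hM := abs_le.1 (hK m z ♭ hzm.le)
    have hlm1 : 1 ≤ log m := by rw [hlm]; linarith
    have hKm : K / log m ≤ K := div_le_self hK0.le hlm1
    set s := ∑ p ∈ P, 1°/p with hs
    have hs1 : s ≤ l + K := by
      have h1 : s ≤ ∑ p ∈ (Ioc ⌊m⌋₊ ⌊z⌋₊).filter Nat.Prime, 1°/p :=
        sum_le_sum_of_subset_of_nonneg (filter_subset _ _) fun p _ _ ↦ by positivity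
      have h2 : log (log z) ≤ l := by
        apply log_le_log
        · rw [hlz]; positivity
        · rw [hlz]; apply div_le_self ♭; linarith
      have h3 : 0 ≤ log (log m) := log_nonneg hlm1
      linarith [hM.2]
    have hs2 : log (log z) - log (log m) - K - 1 ≤ s := by
      have h1 := sum_filter_add_sum_filter_not ((Ioc ⌊m⌋₊ ⌊z⌋₊).filter Nat.Prime) (fun p ↦ ¬ p ∣ D) (fun p ↦ 1°/p)
      have h2 : ∑ p ∈ ((Ioc ⌊m⌋₊ ⌊z⌋₊).filter Nat.Prime).filter (fun p ↦ ¬ ¬ p ∣ D), 1°/p ≤ 1 := by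
        have h3 : ∑ p ∈ ((Ioc ⌊m⌋₊ ⌊z⌋₊).filter Nat.Prime).filter (fun p ↦ ¬ ¬ p ∣ D), 1°/p ≤ ∑ p ∈ D.primeFactors, 1/m := by
          have h5 : ((Ioc ⌊m⌋₊ ⌊z⌋₊).filter Nat.Prime).filter (fun p ↦ ¬ ¬ p ∣ D) ⊆ D.primeFactors := by
            intro p hp
            obtain ⟨h1, h2⟩ := mem_filter.1 hp
            exact Nat.mem_primeFactors.2 ⟨(mem_filter.1 h1).2, not_not.1 h2, hD⟩
          refine le_trans (sum_le_sum fun p hp ↦ ?_) (sum_le_sum_of_subset_of_nonneg h5 fun _ _ _ ↦ by positivity)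
          have := (mem_Ioc.1 (mem_filter.1 (mem_filter.1 hp).1).1).1
          exact one_div_le_one_div_of_le ♭ ((Nat.floor_lt ♭).1 this).le
        refine h3.trans ?_
        rw [sum_const, nsmul_eq_mul, mul_one_div, div_le_one ♭]
        have := omega_le_log hD
        linarith [exp_pos B]
      linarith [hM.1]
    have hlz0 : 0 < log z := by rw [hlz]; positivity
    have t1 : exp (-(k*s)) ≤ 400^3 * exp (3*(K+1)) * V^k := by
      have h1 : exp (-s) ≤ exp (K+1) * (400 * V) := by
        calc exp (-s) ≤ exp ((K+1) + (log (log m) - log (log z))) := exp_le_exp.2 ♭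
          _ = exp (K+1) * (log m * (4*r)/x) := by
            rw [exp_add, exp_sub, exp_log ♭, exp_log hlz0, hlz]; field_simp
          _ ≤ _ := by gcongr
      calc exp (-(k*s)) = (exp (-s))^k := by rw [← exp_nat_mul]; ring_nf
        _ ≤ (exp (K+1) * (400 * V))^k := by gcongr
        _ = (exp (K+1))^k * (400*V)^k := by rw [mul_pow]
        _ ≤ (exp (K+1))^3 * (400^3 * V^k) := by
            gcongr
            exact one_le_exp ♭
        _ = _ := by rw [← exp_nat_mul]; push_cast; ring
    have hxk : (1/x)^3 ≤ V^k := by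
      calc (1/x)^3 ≤ (1/x)^k := pow_le_pow_of_le_one ♯ ((div_le_one ♭).2 hx1) hk3
        _ ≤ V^k := by
          apply pow_le_pow_left₀ ♯
          rw [hV]; gcongr; exact one_le_pow₀ hBl
    have hx3 : (1/x)^3 = exp (-3*l) := by
      rw [← hexl, one_div, ← exp_neg, ← exp_nat_mul]; push_cast; ring_nf
    have t2 : exp (-r + 3*k*s) ≤ exp (9*K) * V^k := by
      have hs0 : 0 ≤ s := sum_nonneg fun p _ ↦ by positivity
      have : -r° + 3*k*s ≤ 9*K + -3*l := by
        have : k°*s ≤ 3*(l+K) := mul_le_mul hkr hs1 hs0 ♮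
        linarith
      calc exp (-r + 3*k*s) ≤ exp (9*K + -3*l) := exp_le_exp.2 this
        _ = exp (9*K) * (1/x)^3 := by rw [exp_add, hx3]
        _ ≤ _ := by gcongr
    have t3 : ((P.card:ℝ)+1)^r * exp k ≤ N * (exp 33 * C1 * exp 3 * V^k) := by
      have h1 : (P.card:ℝ) ≤ z := by
        have : P.card ≤ ⌊z⌋₊ := by
          calc P.card ≤ (Ioc ⌊m⌋₊ ⌊z⌋₊).card := card_le_card ((filter_subset _ _).trans (filter_subset _ _))
            _ ≤ ⌊z⌋₊ := by rw [Nat.card_Ioc]; omega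
        exact (Nat.cast_le.2 this).trans (Nat.floor_le (exp_pos _).le)
      have hz1 : 1 ≤ z := by linarith
      have h2 : ((P.card:ℝ)+1)^r ≤ exp (22*(l+1)+11) * exp (x/4) := by
        calc ((P.card:ℝ)+1)^r ≤ (exp 1 * z)^r := by
              refine pow_le_pow_left₀ (Nat.cast_add_one_pos _).le ?_ _
              have : 2*z ≤ exp 1 * z := mul_le_mul_of_nonneg_right (by linarith [exp_one_gt_d9]) ♭
              linarith
          _ = exp r * exp (x/4) := by
              rw [mul_pow, hz, ← exp_nat_mul, ← exp_nat_mul]; congr 2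
              · ring
              · field_simp
          _ ≤ _ := by gcongr; linarith
      have h3 : exp (22*(l+1)+11) = exp 33 * x^22 := by
        rw [← hexl, ← exp_nat_mul, ← exp_add]; push_cast; ring_nf
      have h4 := hpow x hx1
      have h5 : x^22 ≤ C1 * exp (x*(3/4)) * (1/x)^3 := by
        have : x^22 ≤ x^51 * (1/x)^3 := by
          have e : x^51 * (1/x)^3 = x^48 := by field_simp
          rw [e]; exact pow_le_pow_right₀ hx1 ♮
        exact this.trans (by gcongr)
      have h6 : exp (x*(3/4)) * exp (x/4) = N := by
        rw [← exp_add, hx]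
        rw [show log N * (3/4) + log N/4 = log N by ring, exp_log ♭]
      calc ((P.card:ℝ)+1)^r * exp k ≤ (exp 33 * (C1 * exp (x*(3/4)) * (1/x)^3) * exp (x/4)) * exp 3 := by
            rw [h3] at h2
            apply mul_le_mul (h2.trans _) (exp_le_exp.2 hkr) (exp_pos _).le ♯
            gcongr
        _ = (exp (x*(3/4)) * exp (x/4)) * (exp 33 * C1 * exp 3 * (1/x)^3) := by ring
        _ ≤ _ := by rw [h6]; gcongr
    calc (T.card:ℝ) ≤ _ := hb
      _ ≤ N * (400^3 * exp (3*(K+1)) * V^k + exp (9*K) * V^k) + N * (exp 33 * C1 * exp 3 * V^k) := by gcongr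
      _ = N * ((400^3 * exp (3*(K+1)) + exp (9*K) + exp 33 * C1 * exp 3) * V^k) := by ring
      _ ≤ N * (C * V^k) := by gcongr; rw [hC]; linarith
      _ = _ := by ring
end

open Finset Real
noncomputable section

theorem sieve_sum : ∃ C : ℝ, 1 ≤ C ∧ ∀ k : ℕ, 1 ≤ k → k ≤ 3 → ∀ (B Z Q : ℝ) (D : ℕ) (Ω : ℕ → Finset ℕ) (T : Finset ℕ),
    1 ≤ B → 16 ≤ Z → Z ≤ Q → D ≠ 0 → log D ≤ exp B →
    (∀ p, p.Prime → ¬ p ∣ D → Ω p ⊆ range p ∧ (Ω p).card = k) → (∀ n ∈ T, Z < n° ∧ n° ≤ Q) →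
    (∀ n ∈ T, ∀ p, p.Prime → ¬ p ∣ D → p^2 ≤ n → n % p ∉ Ω p) →
    ∑ n ∈ T, 1°/n ≤ C * log Q * ((B + loglog Q)^2 / log Z)^k := by
  obtain ⟨C, hC1, hC⟩ := sieve
  refine ⟨C * 8 * 3, by linarith, fun k hk1 hk3 B Z Q D Ω T hB hZ hZQ hD hDB hΩ hT hT2 ↦ ?_⟩
  have hlZ : 0 < log Z := log_pos ♭
  set W : ℝ := ((B + loglog Q)^2 / log Z)^k with hW
  have hcount : ∀ j ∈ T.image (Nat.log 2), ∑ n ∈ T.filter (fun n ↦ Nat.log 2 n = j), 1°/n ≤ C * 8 * W := by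
    intro j hj
    obtain ⟨n0, hn0, hjn⟩ := mem_image.1 hj
    set N := 2^j with hN
    have hn0' := hT n0 hn0
    have hn00 : n0 ≠ 0 := by rintro rfl; norm_num at hn0'; linarith
    have h1 : N ≤ n0 := by rw [hN, ← hjn]; exact Nat.pow_log_le_self 2 hn00
    have h2 : n0 < 2 * N := by rw [hN, ← hjn, ← pow_succ']; exact Nat.lt_pow_succ_log_self ♮ n0
    have h2' : n0° < 2 * N := by exact_mod_cast h2
    have h1' : N° ≤ n0 := by exact_mod_cast h1
    have hN8 : 8° < N := by linarith
    have hN3 : 3 ≤ N := by have : 8 < N := by exact_mod_cast hN8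
                           omega
    have hmem : ∀ n ∈ T.filter (fun n ↦ Nat.log 2 n = j), N ≤ n ∧ n < N + N := by
      intro n hn
      obtain ⟨ha, hb⟩ := mem_filter.1 hn
      have : n ≠ 0 := by rintro rfl; have := (hT 0 ha).1; norm_num at this; linarith
      refine ⟨by rw [hN, ← hb]; exact Nat.pow_log_le_self 2 this, ?_⟩
      rw [← two_mul, hN, ← hb, ← pow_succ']; exact Nat.lt_pow_succ_log_self ♮ n
    have hs := hC k hk1 hk3 B N N D Ω (T.filter (fun n ↦ Nat.log 2 n = j)) hB hN3 hD hDB hΩ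
      (fun n hn ↦ mem_Ico.2 (hmem n hn))
      (fun n hn p hp hpD hpN ↦ hT2 n (mem_filter.1 hn).1 p hp hpD (hpN.trans (hmem n hn).1))
    have hlogN : log Z / 2 ≤ log N := by
      have : log Z ≤ log (N°^2) := log_le_log ♭ (by nlinarith)
      rw [log_pow] at this; push_cast at this; linarith
    have hl1 : 1 ≤ log N := by
      rw [le_log_iff_exp_le ♭]; linarith [exp_one_lt_three]
    have hll : loglog N ≤ loglog Q := log_le_log ♭ (log_le_log ♭ ♭)
    have hll0 : 0 ≤ loglog N := log_nonneg hl1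
    have hb : ((B + loglog N)^2 / log N)^k ≤ 8 * W := by
      calc ((B + loglog N)^2 / log N)^k ≤ (2 * ((B + loglog Q)^2 / log Z))^k := by
            apply pow_le_pow_left₀ ♯
            calc (B + loglog N)^2 / log N ≤ (B + loglog Q)^2 / (log Z/2) := by
                  apply div_le_div₀ ♯ _ ♭ hlogN
                  exact pow_le_pow_left₀ ♭ ♭ 2
              _ = _ := by field_simp
        _ = 2^k * W := by rw [mul_pow]
        _ ≤ 2^3 * W := by
            apply mul_le_mul_of_nonneg_right (pow_le_pow_right₀ ♮ hk3) ♯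
        _ = 8 * W := by norm_num
    calc ∑ n ∈ T.filter (fun n ↦ Nat.log 2 n = j), 1°/n ≤ ∑ n ∈ T.filter (fun n ↦ Nat.log 2 n = j), 1°/N := by
          apply sum_le_sum; intro n hn
          exact one_div_le_one_div_of_le ♭ (by exact_mod_cast (hmem n hn).1)
      _ = (T.filter (fun n ↦ Nat.log 2 n = j)).card / N := by rw [sum_const, nsmul_eq_mul, mul_one_div]
      _ ≤ (C * N * (8 * W)) / N := by gcongr; exact hs.trans (by gcongr)
      _ = _ := by field_simp
  rw [← sum_fiberwise_of_maps_to (s := T) (t := T.image (Nat.log 2)) (g := Nat.log 2) (fun n hn ↦ mem_image_of_mem _ hn)]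
  refine (sum_le_sum hcount).trans ?_
  rw [sum_const, nsmul_eq_mul]
  have hcard : ((T.image (Nat.log 2)).card : ℝ) ≤ 3 * log Q := by
    have h1 : T.image (Nat.log 2) ⊆ range (⌊2 * log Q⌋₊ + 1) := by
      intro j hj
      obtain ⟨n, hn, rfl⟩ := mem_image.1 hj
      rw [mem_range, Nat.lt_succ_iff]
      apply Nat.le_floor
      have hn' := hT n hn
      have hn0 : n ≠ 0 := by rintro rfl; norm_num at hn'; linarith
      have h2 : ((2^(Nat.log 2 n) : ℕ):ℝ) ≤ Q := (Nat.cast_le.2 (Nat.pow_log_le_self 2 hn0)).trans hn'.2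
      have h3 := log_le_log ♯ h2
      push_cast at h3; rw [log_pow] at h3
      have := log_two_gt_d9
      have : 0° ≤ Nat.log 2 n := by positivity
      nlinarith
    have h2 := card_le_card h1
    rw [card_range] at h2
    have h3 : ((T.image (Nat.log 2)).card : ℝ) ≤ ⌊2 * log Q⌋₊ + 1 := by exact_mod_cast h2
    have h4 : 1 ≤ log Q := by
      rw [le_log_iff_exp_le ♭]; linarith [exp_one_lt_three]
    linarith [Nat.floor_le (by linarith : 0 ≤ 2 * log Q)]
  calc ((T.image (Nat.log 2)).card : ℝ) * (C*8*W) ≤ (3 * log Q) * (C*8*W) := by gcongr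
    _ = _ := by ring

/-- root of `A n + 1` mod `p` -/
def rho (A p : ℕ) : ℕ := (-(A:ZMod p)⁻¹).val

theorem rho_lt {A p : ℕ} (hp : p.Prime) : rho A p < p := by
  have := Fact.mk hp
  exact ZMod.val_lt _

theorem rho_dvd {A p n : ℕ} (hp : p.Prime) (hA : ¬ p ∣ A) (h : n % p = rho A p) : p ∣ A*n+1 := by
  have := Fact.mk hp
  have hA' : (A:ZMod p) ≠ 0 := fun h ↦ hA ((ZMod.natCast_eq_zero_iff A p).1 h)
  rw [← ZMod.natCast_eq_zero_iff]
  have : (n:ZMod p) = -(A:ZMod p)⁻¹ := by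
    rw [← ZMod.natCast_mod, h, rho, ZMod.natCast_zmod_val]
  push_cast; rw [this]; field_simp; ring

theorem rho_ne_zero {A p : ℕ} (hp : p.Prime) (hA : ¬ p ∣ A) : rho A p ≠ 0 := by
  intro h
  have := rho_dvd (n := 0) hp hA (by rw [h]; simp)
  simp at this; exact hp.one_lt.ne' this

theorem rho_ne {A B p : ℕ} (hp : p.Prime) (hA : ¬ p ∣ A) (hB : ¬ p ∣ B) (hAB : A ≠ B) (hd : ¬ p ∣ Nat.dist A B) : rho A p ≠ rho B p := by
  have := Fact.mk hp
  intro h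
  have h2 : (A:ZMod p)⁻¹ = (B:ZMod p)⁻¹ := neg_injective (ZMod.val_injective p h)
  have h3 := inv_injective h2
  rw [ZMod.natCast_eq_natCast_iff] at h3
  apply hd
  rcases le_total A B with hl | hl
  · rw [Nat.dist_eq_sub_of_le hl]; exact (Nat.modEq_iff_dvd' hl).1 h3
  · rw [Nat.dist_eq_sub_of_le_right hl]; exact (Nat.modEq_iff_dvd' hl).1 h3.symm

theorem not_dvd_of_form {A p n : ℕ} (hp : p.Prime) (hA : 0 < A) (hn : p^2 ≤ n) (hq : (A*n+1).Prime) : ¬ p ∣ A*n+1 := by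
  intro h
  have h1 := (Nat.prime_dvd_prime_iff_eq hp hq).1 h
  have : n ≤ A*n := Nat.le_mul_of_pos_left n hA
  have := hp.one_lt
  nlinarith

theorem log_D_le {A B : ℕ} (hA : A ≠ 0) (hB : B ≠ 0) (hAB : A ≠ B) {t : ℝ} (h1 : log A ≤ exp t) (h2 : log B ≤ exp t) :
    A * B * Nat.dist A B ≠ 0 ∧ log ((A * B * Nat.dist A B : ℕ) : ℝ) ≤ exp (t+2) := by
  have hd : Nat.dist A B ≠ 0 := fun h ↦ hAB (Nat.eq_of_dist_eq_zero h)
  refine ⟨by positivity, ?_⟩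
  push_cast
  rw [log_mul ♯ ♯, log_mul ♯ ♯]
  have h3 : log (Nat.dist A B) ≤ exp t := by
    rcases le_total A B with hl | hl
    · refine le_trans (log_le_log ♯ ?_) h2
      rw [Nat.dist_eq_sub_of_le hl]; exact_mod_cast Nat.sub_le _ _
    · refine le_trans (log_le_log ♯ ?_) h1
      rw [Nat.dist_eq_sub_of_le_right hl]; exact_mod_cast Nat.sub_le _ _
  rw [exp_add]
  have : 3° ≤ exp 2 := by linarith [add_one_le_exp 2°]
  nlinarith [exp_pos t]

theorem S2 : ∃ C : ℝ, 1 ≤ C ∧ ∀ (t Z Q : ℝ) (A : ℕ) (T : Finset ℕ), 1 ≤ t → 16 ≤ Z → Z ≤ Q → A ≠ 0 →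
    log A ≤ exp t → (∀ n ∈ T, n.Prime ∧ (A*n+1).Prime ∧ Z < n° ∧ n° ≤ Q) →
    ∑ n ∈ T, 1°/n ≤ C * log Q * ((t + loglog Q)^2 / log Z)^2 := by
  obtain ⟨C, hC1, hC⟩ := sieve_sum
  refine ⟨C, hC1, fun t Z Q A T ht hZ hZQ hA hAt hT ↦ ?_⟩
  refine hC 2 ♮ ♮ t Z Q A (fun p ↦ {0, rho A p}) T ht hZ hZQ hA hAt (fun p hp hpA ↦ ⟨?_, ?_⟩) (fun n hn ↦ (hT n hn).2.2) ?_
  · intro x hx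
    rcases mem_insert.1 hx with rfl | hx
    · exact mem_range.2 hp.pos
    · rw [mem_singleton.1 hx]; exact mem_range.2 (rho_lt hp)
  · exact card_pair (rho_ne_zero hp hpA).symm
  · intro n hn p hp hpA hpn hmem
    obtain ⟨h1, h2, h3, h4⟩ := hT n hn
    rcases mem_insert.1 hmem with h | h
    · have := (Nat.prime_dvd_prime_iff_eq hp h1).1 (Nat.dvd_of_mod_eq_zero h)
      have := hp.one_lt; nlinarith
    · exact not_dvd_of_form hp (Nat.pos_of_ne_zero hA) hpn h2 (rho_dvd hp hpA (mem_singleton.1 h))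

theorem S3 : ∃ C : ℝ, 1 ≤ C ∧ ∀ (t Z Q : ℝ) (A B : ℕ) (T : Finset ℕ), 1 ≤ t → 16 ≤ Z → Z ≤ Q → A ≠ 0 → B ≠ 0 → A ≠ B →
    log A ≤ exp t → log B ≤ exp t →
    (∀ n ∈ T, n.Prime ∧ (A*n+1).Prime ∧ (B*n+1).Prime ∧ Z < n° ∧ n° ≤ Q) →
    ∑ n ∈ T, 1°/n ≤ C * log Q * ((t + 2 + loglog Q)^2 / log Z)^3 := by
  obtain ⟨C, hC1, hC⟩ := sieve_sum
  refine ⟨C, hC1, fun t Z Q A B T ht hZ hZQ hA hB hAB hAt hBt hT ↦ ?_⟩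
  obtain ⟨hD, hlD⟩ := log_D_le hA hB hAB hAt hBt
  have hnd : ∀ p, ¬ p ∣ A * B * Nat.dist A B → ¬ p ∣ A ∧ ¬ p ∣ B ∧ ¬ p ∣ Nat.dist A B := fun p h ↦ 
    ⟨fun h' ↦ h ((h'.mul_right _).mul_right _), fun h' ↦ h ((h'.mul_left _).mul_right _), fun h' ↦ h (h'.mul_left _)⟩
  refine hC 3 ♮ ♮ (t+2) Z Q _ (fun p ↦ {0, rho A p, rho B p}) T ♭ hZ hZQ hD hlD (fun p hp hpD ↦ ⟨?_, ?_⟩) (fun n hn ↦ (hT n hn).2.2.2) ?_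
  · intro x hx
    simp only [mem_insert, mem_singleton] at hx
    rcases hx with rfl | rfl | rfl
    · exact mem_range.2 hp.pos
    · exact mem_range.2 (rho_lt hp)
    · exact mem_range.2 (rho_lt hp)
  · obtain ⟨a1, a2, a3⟩ := hnd p hpD
    exact card_eq_three.2 ⟨_, _, _, (rho_ne_zero hp a1).symm, (rho_ne_zero hp a2).symm, rho_ne hp a1 a2 hAB a3, rfl⟩
  · intro n hn p hp hpD hpn hmem
    obtain ⟨a1, a2, a3⟩ := hnd p hpD
    obtain ⟨h1, h2, h2', h3, h4⟩ := hT n hn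
    simp only [mem_insert, mem_singleton] at hmem
    rcases hmem with h | h | h
    · have := (Nat.prime_dvd_prime_iff_eq hp h1).1 (Nat.dvd_of_mod_eq_zero h)
      have := hp.one_lt; nlinarith
    · exact not_dvd_of_form hp (Nat.pos_of_ne_zero hA) hpn h2 (rho_dvd hp a1 h)
    · exact not_dvd_of_form hp (Nat.pos_of_ne_zero hB) hpn h2' (rho_dvd hp a2 h)

theorem S2' : ∃ C : ℝ, 1 ≤ C ∧ ∀ (t : ℝ) (N A B : ℕ) (T : Finset ℕ), 1 ≤ t → 3 ≤ N → A ≠ 0 → B ≠ 0 → A ≠ B →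
    log A ≤ exp t → log B ≤ exp t →
    (∀ n ∈ T, (A*n+1).Prime ∧ (B*n+1).Prime ∧ n ≤ N) →
    (T.card : ℝ) ≤ C * N * ((t + 2 + loglog N)^2 / log N)^2 := by
  obtain ⟨C, hC1, hC⟩ := sieve
  refine ⟨C + 32, by linarith, fun t N A B T ht hN hA hB hAB hAt hBt hT ↦ ?_⟩
  obtain ⟨hD, hlD⟩ := log_D_le hA hB hAB hAt hBt
  have hnd : ∀ p, ¬ p ∣ A * B * Nat.dist A B → ¬ p ∣ A ∧ ¬ p ∣ B ∧ ¬ p ∣ Nat.dist A B := fun p h ↦ 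
    ⟨fun h' ↦ h ((h'.mul_right _).mul_right _), fun h' ↦ h ((h'.mul_left _).mul_right _), fun h' ↦ h (h'.mul_left _)⟩
  have hs := hC 2 ♮ ♮ (t+2) (Nat.sqrt N + 1) N _ (fun p ↦ {rho A p, rho B p}) (T.filter (fun n ↦ Nat.sqrt N < n)) ♭ hN hD hlD (fun p hp hpD ↦ ⟨?_, ?_⟩) ?_ ?_
  · have h1 : (T.card : ℝ) ≤ (T.filter (fun n ↦ Nat.sqrt N < n)).card + (Nat.sqrt N + 1 : ℕ) := by
      have e := card_filter_add_card_filter_not (s := T) (fun n ↦ Nat.sqrt N < n)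
      have : (T.filter (fun n ↦ ¬ Nat.sqrt N < n)).card ≤ Nat.sqrt N + 1 := by
        rw [← card_range (Nat.sqrt N + 1)]
        exact card_le_card fun n hn ↦ mem_range.2 (by have := (mem_filter.1 hn).2; omega)
      exact_mod_cast (by omega : T.card ≤ (T.filter (fun n ↦ Nat.sqrt N < n)).card + (Nat.sqrt N + 1))
    have hNr : 3° ≤ N := by exact_mod_cast hN
    have hl1 : 1 ≤ log N := by
      rw [le_log_iff_exp_le ♭]; linarith [exp_one_lt_three]
    have hll0 : 0 ≤ loglog N := log_nonneg hl1
    set x := log N with hx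
    have hxs : x^2 ≤ 16 * sqrt N := by
      have := log_le_rpow_div (x := N) (ε := 1/4) ♯ ♮
      have h2 : x ≤ 4 * N°^(1°/4) := by rw [← hx] at this; linarith
      have h3 : (N°^(1°/4))^2 = sqrt N := by
        rw [sqrt_eq_rpow, ← rpow_natCast, ← rpow_mul ♯]; norm_num
      calc x^2 ≤ (4 * N°^(1°/4))^2 := by gcongr
        _ = _ := by rw [mul_pow, h3]; norm_num
    have h2 : ((Nat.sqrt N + 1 : ℕ):ℝ) ≤ 2 * sqrt N := by
      have a1 : ((Nat.sqrt N : ℕ):ℝ) ≤ sqrt N := nat_sqrt_le_real_sqrt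
      have a2 : 1 ≤ sqrt N := one_le_sqrt.2 ♭
      push_cast; linarith
    have h3 : 2 * sqrt N ≤ 32 * N * (1/x^2) := by
      have : sqrt N * sqrt N = N := mul_self_sqrt ♯
      rw [mul_one_div, le_div_iff₀ ♯]
      have := mul_le_mul_of_nonneg_left hxs (sqrt_nonneg N)
      nlinarith
    have h4 : 1/x^2 ≤ ((t + 2 + loglog N)^2 / x)^2 := by
      rw [div_pow]; gcongr; exact one_le_pow₀ (one_le_pow₀ ♭)
    have h5 : 32 * N * (1/x^2) ≤ 32 * N * ((t + 2 + loglog N)^2 / x)^2 := by gcongr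
    have : (C+32) * N * ((t + 2 + loglog N)^2 / x)^2 = C * N * ((t + 2 + loglog N)^2 / x)^2 + 32 * N * ((t + 2 + loglog N)^2 / x)^2 := by ring
    linarith
  · intro x hx
    simp only [mem_insert, mem_singleton] at hx
    rcases hx with rfl | rfl
    · exact mem_range.2 (rho_lt hp)
    · exact mem_range.2 (rho_lt hp)
  · obtain ⟨a1, a2, a3⟩ := hnd p hpD
    exact card_pair (rho_ne hp a1 a2 hAB a3)
  · intro n hn
    obtain ⟨h1, h2⟩ := mem_filter.1 hn
    have := (hT n h1).2.2
    exact mem_Ico.2 ⟨by omega, by omega⟩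
  · intro n hn p hp hpD hpn hmem
    obtain ⟨h0, h00⟩ := mem_filter.1 hn
    obtain ⟨a1, a2, a3⟩ := hnd p hpD
    obtain ⟨h2, h2', h4⟩ := hT n h0
    have hps : p < n := lt_of_le_of_lt (Nat.le_sqrt'.2 hpn) h00
    have key : ∀ A : ℕ, A ≠ 0 → (A*n+1).Prime → ¬ p ∣ A*n+1 := by
      intro A hA hq h
      have h1 := (Nat.prime_dvd_prime_iff_eq hp hq).1 h
      have : n ≤ A*n := Nat.le_mul_of_pos_left n (Nat.pos_of_ne_zero hA)
      omega
    simp only [mem_insert, mem_singleton] at hmem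
    rcases hmem with h | h
    · exact key A hA h2 (rho_dvd hp a1 h)
    · exact key B hB h2' (rho_dvd hp a2 h)
end

open Finset Real
noncomputable section

def Zof (a : ℕ) : ℝ := exp (exp a / a°^2)

theorem exp_ge_sq {a : ℕ} (ha : 10 ≤ a) : 4 * a°^2 ≤ exp a := by
  have h := pow_div_factorial_le_exp a° ♯ 4
  have ha' : 10° ≤ a := by exact_mod_cast ha
  have h2 : 100° ≤ a°^2 := by nlinarith
  have h3 : 100° * a°^2 ≤ a°^4 := by nlinarith [sq_nonneg a°]
  norm_num [Nat.factorial] at h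
  nlinarith

theorem log_Zof (a : ℕ) : log (Zof a) = exp a / a°^2 := log_exp _

theorem log_Zof_ge {a : ℕ} (ha : 10 ≤ a) : 4 ≤ exp a / a°^2 := by
  have ha' : 10° ≤ a := by exact_mod_cast ha
  rw [le_div_iff₀ ♯]; exact exp_ge_sq ha

theorem Zof_ge {a : ℕ} (ha : 10 ≤ a) : 16 ≤ Zof a := by
  have h1 : exp 4 ≤ Zof a := exp_le_exp.2 (log_Zof_ge ha)
  have h2 : exp 4 = (exp 1)^4 := by rw [← exp_nat_mul]; norm_num
  have := exp_one_gt_d9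
  have h3 : 2°^4 ≤ (exp 1)^4 := by gcongr; linarith
  linarith

theorem Zof_le {a : ℕ} (ha : 10 ≤ a) : Zof a ≤ EE a := by
  have ha' : 10° ≤ a := by exact_mod_cast ha
  unfold Zof EE
  apply exp_le_exp.2
  apply div_le_self (exp_pos _).le
  nlinarith

theorem mem_PR_of_dvd {q p b : ℕ} (hq : 2 ≤ q) (hb : lev q ≤ b) (hp : p.Prime) (h : p ∣ q - 1) : p ∈ PR b := by
  have h1 : p ≤ q - 1 := Nat.le_of_dvd ⋆ h
  refine mem_PR.2 ⟨hp, (lev_le_iff hp.two_le).2 ?_⟩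
  have := (lev_le_iff hq).1 hb
  have h2 : p° ≤ q := by exact_mod_cast (by omega : p ≤ q)
  linarith

/-- Rankin: smooth shifted primes -/
theorem T1 : ∃ C : ℝ, 1 ≤ C ∧ ∀ (a b : ℕ) (v : ℕ → ℝ) (T : Finset ℕ), 10 ≤ a → (∀ l, 0 ≤ v l ∧ v l ≤ 11/10) →
    (∀ q ∈ T, q.Prime ∧ a ≤ lev q ∧ lev q ≤ b ∧ ∀ p, p.Prime → p ∣ q - 1 → p° ≤ Zof a) →
    ∑ q ∈ T, cm (fun p ↦ v (lev p)) (q-1) / (q°-1) ≤ C * exp (-a°^2 + 4*(b+1)) := by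
  obtain ⟨M, hM1, hM⟩ := levsum
  refine ⟨2 * exp (M*4+120), by have := add_one_le_exp (M*4+120); linarith, fun a b v T ha hv hT ↦ ?_⟩
  have ha' : 10° ≤ a := by exact_mod_cast ha
  set σ : ℝ := 1 / (exp a / a°^2) with hσ
  have hZ4 := log_Zof_ge ha
  have hσ0 : 0 < σ := by positivity
  have hσ1 : σ ≤ 1/2 := by
    rw [hσ]; apply one_div_le_one_div_of_le ♮; linarith
  have hpow : ∀ p : ℕ, 2 ≤ p → p° ≤ Zof a → p°^σ ≤ 3 := by
    intro p hp h
    calc p°^σ ≤ (Zof a)^σ := rpow_le_rpow ♯ h hσ0.le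
      _ = exp 1 := by
          rw [Zof, ← exp_mul]; congr 1; rw [hσ]; field_simp
      _ ≤ 3 := by have := exp_one_lt_d9; linarith
  set P := (PR b).filter (fun p : ℕ => p° ≤ Zof a) with hP
  set u : ℕ → ℝ := fun p ↦ (11/10 * p°^σ) / p with hu
  have hP2 : ∀ p ∈ P, 2 ≤ p := fun p hp ↦ (mem_PR.1 (mem_filter.1 hp).1).1.two_le
  have hu1 : ∀ p ∈ P, 0 ≤ u p ∧ u p ≤ 9/10 := by
    intro p hp
    refine ⟨by positivity, ?_⟩
    have h2 := hP2 p hp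
    have h2' : 2° ≤ p := by exact_mod_cast h2
    have h3 : p°^σ ≤ p°^(1°/2) := rpow_le_rpow_of_exponent_le ♭ hσ1
    rw [← sqrt_eq_rpow] at h3
    have h4 : (7/5:ℝ) ≤ √p° := le_sqrt_of_sq_le (by norm_num; linarith)
    have h5 := mul_self_sqrt (show 0° ≤ p by positivity)
    rw [hu]; dsimp only
    rw [div_le_iff₀ ♭]
    nlinarith
  have hu3 : ∀ p ∈ P, u p ≤ 3.3/p := by
    intro p hp
    have := hpow p (hP2 p hp) (mem_filter.1 hp).2
    rw [hu]; dsimp only; gcongr; linarith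
  have hsum : ∑ p ∈ P, (u p + 10 * (u p)^2) ≤ 4*(b+1) + (M*4 + 120) := by
    have hpt : ∀ p ∈ P, u p + 10*(u p)^2 ≤ 3.3/p + 110 * (1/(p*(p°-1))) := by
      intro p hp
      have h1 := hu3 p hp
      have h0 := (hu1 p hp).1
      have h2' : 2° ≤ p := by exact_mod_cast hP2 p hp
      have : (u p)^2 ≤ (3.3/p)^2 := by gcongr
      have h4 : 10*(3.3/p°)^2 ≤ 110 * (1/(p*(p°-1))) := by
        rw [div_pow, mul_one_div, mul_div_assoc', div_le_div_iff₀ ♯ (by nlinarith)]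
        nlinarith
      linarith
    refine (sum_le_sum hpt).trans ?_
    rw [sum_add_distrib, ← mul_sum]
    have k1 := (abs_le.1 (hM b (fun _ ↦ 3.3) 3.3 (fun l _ ↦ by norm_num))).2
    have k2 : ∑ p ∈ P, (3.3:ℝ)/p ≤ ∑ p ∈ PR b, (3.3:ℝ)/p :=
      sum_le_sum_of_subset_of_nonneg (filter_subset _ _) (fun p _ _ ↦ by positivity)
    have k3 := sum_inv_mul_pred P 1 le_rfl (fun p hp ↦ hP2 p hp)
    rw [sum_const, card_range, nsmul_eq_mul] at k1
    push_cast at k1 k3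
    have : 0° ≤ b := by positivity
    linarith
  have hinj : Set.InjOn (fun q : ℕ => q - 1) (T : Set ℕ) := by
    intro q hq q' hq' h
    have h1 := (hT q hq).1.two_le; have h2 := (hT q' hq').1.two_le
    dsimp only at h; omega
  have hA := cm_sum P u hu1 (T.image (fun q ↦ q - 1)) ?_
  · rw [sum_image hinj] at hA
    have hq : ∀ q ∈ T, cm (fun p ↦ v (lev p)) (q-1) / (q°-1) ≤ 2 * exp (-a°^2) * cm u (q-1) := by
      intro q hq
      obtain ⟨hqp, hqa, hqb, hqs⟩ := hT q hq
      have h2 := hqp.two_le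
      have hq0 : q - 1 ≠ 0 := by omega
      have ecast : ((q-1:ℕ):ℝ) = q°-1 := by push_cast [hqp.one_le]; ring
      have e1 : cm u (q-1) = cm (fun p ↦ 11/10 * p°^σ) (q-1) / ((q-1:ℕ):ℝ) := cm_div hq0 _
      rw [e1, cm_mul_fun, cm_rpow hq0, ecast]
      have hq1 : 1° ≤ q° - 1 := by rw [← ecast]; exact_mod_cast (by omega : 1 ≤ q-1)
      have h3 : cm (fun p ↦ v (lev p)) (q-1) ≤ cm (fun _ ↦ 11/10) (q-1) := cm_mono fun p _ ↦ hv _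
      have h5 : 0 ≤ cm (fun _ ↦ (11/10:ℝ)) (q-1) := cm_nonneg fun p _ ↦ by norm_num
      have h4 : 1 ≤ 2 * exp (-a°^2) * (q°-1)^σ := by
        have g1 := lev_lt_of (by omega : 1 ≤ a) hqa
        have g2 : EE a / 2 ≤ q° - 1 := by linarith
        have g3 : (EE a / 2)^σ ≤ (q°-1)^σ := rpow_le_rpow (by have := EE_pos a; positivity) g2 hσ0.le
        have g4 : (EE a)^σ = exp (a°^2) := by
          rw [EE, ← exp_mul]; congr 1; rw [hσ]; field_simp
        have g5 : 2°^σ ≤ 2 := by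
          calc 2°^σ ≤ 2^1° := rpow_le_rpow_of_exponent_le ♮ ♭
            _ = 2 := by norm_num
        rw [div_rpow (EE_pos a).le ♮, g4] at g3
        have g6 : exp (a°^2) / 2 ≤ exp (a°^2)/2^σ :=
          div_le_div_of_nonneg_left (exp_pos _).le ♯ g5
        have g7 : 2 * exp (-a°^2) * (exp (a°^2)/2) = 1 := by
          have : exp (-a°^2) * exp (a°^2) = 1 := by rw [← exp_add]; simp
          linear_combination this
        have : 2 * exp (-a°^2) * (exp (a°^2)/2) ≤ 2 * exp (-a°^2) * (q°-1)^σ :=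
          mul_le_mul_of_nonneg_left (g6.trans g3) ♯
        linarith
      rw [mul_div_assoc', div_le_div_iff_of_pos_right ♭]
      calc _ ≤ cm (fun _ ↦ (11/10:ℝ)) (q-1) * 1 := by linarith
        _ ≤ cm (fun _ ↦ (11/10:ℝ)) (q-1) * (2 * exp (-a°^2) * (q°-1)^σ) := mul_le_mul_of_nonneg_left h4 h5
        _ = _ := by ring
    refine (sum_le_sum hq).trans ?_
    rw [← mul_sum]
    calc _ ≤ 2 * exp (-a°^2) * exp (4*(b+1) + (M*4 + 120)) :=
          mul_le_mul_of_nonneg_left (hA.trans (exp_le_exp.2 hsum)) ♯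
      _ = _ := by rw [exp_add (4*(b°+1)), exp_add (-a°^2)]; ring
  · intro n hn
    obtain ⟨q, hq, rfl⟩ := mem_image.1 hn
    obtain ⟨hqp, hqa, hqb, hqs⟩ := hT q hq
    have h2 := hqp.two_le
    refine ⟨by omega, fun p hp ↦ ?_⟩
    rw [Nat.mem_primeFactors] at hp
    exact mem_filter.2 ⟨mem_PR_of_dvd h2 hqb hp.1 hp.2.1, hqs p hp.1 hp.2.1⟩

/-- shifted primes with a large prime factor -/
theorem T2 : ∃ C : ℝ, 1 ≤ C ∧ ∀ (a b : ℕ) (v : ℕ → ℝ) (T : Finset ℕ), 10 ≤ a → a ≤ b → (∀ l, 0 ≤ v l ∧ v l ≤ 11/10) →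
    (∀ q ∈ T, q.Prime ∧ lev q ≤ b ∧ ∃ p, p.Prime ∧ p ∣ q - 1 ∧ Zof a < p°) →
    ∑ q ∈ T, cm (fun p ↦ v (lev p)) (q-1) / (q°-1) ≤
      C * (b+1:ℝ)^8 * exp (2*(b°-a)) * exp (∑ l ∈ range (b+1), (v l - 1)) := by
  obtain ⟨C, hC1, hC⟩ := S2
  obtain ⟨M, hM1, hM⟩ := cm_lev_sum
  refine ⟨11/10 * C * exp 2 * 16 * exp (M*(11/10)^2), ?_, fun a b v T ha hab hv hT ↦ ?_⟩
  · have h1 : 1 ≤ exp 2 := one_le_exp ♮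
    have h2 : 1 ≤ exp (M*(11/10)^2) := one_le_exp ♯
    have h3 : 1 ≤ C * exp 2 := one_le_mul_of_one_le_of_one_le hC1 h1
    have h4 := one_le_mul_of_one_le_of_one_le h3 h2
    nlinarith
  have ha' : 10° ≤ a := by exact_mod_cast ha
  have hab' : a° ≤ b := by exact_mod_cast hab
  choose! X hX using fun q hq ↦ (hT q hq).2.2
  set Af : ℕ → ℕ := fun q ↦ (q-1)/X q with hAf
  have hAX : ∀ q ∈ T, q - 1 = Af q * X q := fun q hq ↦ (Nat.div_mul_cancel (hX q hq).2.1).symm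
  have hq0 : ∀ q ∈ T, q - 1 ≠ 0 := fun q hq ↦ by have := (hT q hq).1.two_le; omega
  have hA0 : ∀ q ∈ T, Af q ≠ 0 := fun q hq h ↦ hq0 q hq (by rw [hAX q hq, h, zero_mul])
  have hqAX : ∀ q ∈ T, q = Af q * X q + 1 := fun q hq ↦ by
    rw [← hAX q hq]; have := (hT q hq).1.two_le; omega
  set K : ℝ := 11/10 * (C * exp (b+1) * (((b+1:ℝ) + (b+1))^2 / (exp a / a°^2))^2) with hK
  have hqle : ∀ q ∈ T, q° ≤ EE (b+1) := fun q hq ↦ (lev_le_iff (hT q hq).1.two_le).1 (hT q hq).2.1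
  have hlog : log (EE (b+1)) = exp (b+1) := log_EE _
  have hloglog : loglog (EE (b+1)) = b+1 := by rw [loglog, hlog, log_exp]
  have hfib : ∀ A ∈ T.image Af, ∑ q ∈ T.filter (fun q ↦ Af q = A), cm (fun p ↦ v (lev p)) (q-1) / (q°-1) ≤
      cm (fun p ↦ v (lev p)) A / A * K := by
    intro A hA
    obtain ⟨q0, hq0T, rfl⟩ := mem_image.1 hA
    set A := Af q0 with hAdef
    have hAne := hA0 q0 hq0T
    have hAle : A° ≤ EE (b+1) := by
      refine le_trans ?_ (hqle q0 hq0T)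
      have : A ≤ q0 := by
        have := hqAX q0 hq0T; have h2 := (hX q0 hq0T).1.pos
        calc A ≤ A * X q0 := Nat.le_mul_of_pos_right _ h2
          _ ≤ q0 := by rw [← hAdef] at this; omega
      exact_mod_cast this
    have hinj : Set.InjOn X (T.filter (fun q ↦ Af q = A) : Set ℕ) := by
      intro q hq q' hq' h
      have hq := mem_filter.1 hq; have hq' := mem_filter.1 hq'
      rw [hqAX q hq.1, hqAX q' hq'.1, hq.2, hq'.2, h]
    have hS := hC (b+1) (Zof a) (EE (b+1)) A ((T.filter (fun q ↦ Af q = A)).image X) ♭ (Zof_ge ha)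
      ((Zof_le ha).trans (EE_mono ♭)) hAne (by
        rw [← hlog]; exact log_le_log ♯ hAle) (by
        intro n hn
        obtain ⟨q, hq, rfl⟩ := mem_image.1 hn
        obtain ⟨hq, hqA⟩ := mem_filter.1 hq
        refine ⟨(hX q hq).1, ?_, (hX q hq).2.2, ?_⟩
        · rw [← hqA, ← hqAX q hq]; exact (hT q hq).1
        · refine le_trans ?_ (hqle q hq)
          exact_mod_cast (Nat.le_of_dvd (Nat.pos_of_ne_zero (hq0 q hq)) (hX q hq).2.1).trans (Nat.sub_le _ _))
    rw [sum_image hinj, hlog, hloglog, log_Zof] at hS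
    have hcA : 0 ≤ cm (fun p ↦ v (lev p)) A := cm_nonneg fun p _ ↦ (hv _).1
    have hpt : ∀ q ∈ T.filter (fun q ↦ Af q = A), cm (fun p ↦ v (lev p)) (q-1) / (q°-1) ≤
        cm (fun p ↦ v (lev p)) A / A * (11/10) * (1/(X q:ℝ)) := by
      intro q hq
      obtain ⟨hq, hqA⟩ := mem_filter.1 hq
      have hXp := (hX q hq).1
      have ecast : q°-1 = A * X q := by
        have := hqAX q hq; rw [hqA] at this
        have h' : q° = A * X q + 1 := by exact_mod_cast this
        linarith
      rw [ecast, hAX q hq, hqA, cm_mul _ hAne hXp.ne_zero, cm_prime _ hXp, mul_div_mul_comm]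
      rw [mul_assoc]
      apply mul_le_mul_of_nonneg_left _ ♯
      rw [mul_one_div]; exact div_le_div_of_nonneg_right (hv _).2 ♯
    refine (sum_le_sum hpt).trans ?_
    rw [← mul_sum, hK, mul_assoc]
    apply mul_le_mul_of_nonneg_left _ ♯
    exact mul_le_mul_of_nonneg_left hS ♮
  rw [← sum_fiberwise_of_maps_to (fun q hq ↦ mem_image_of_mem Af hq)]
  refine (sum_le_sum hfib).trans ?_
  rw [← sum_mul]
  have hE := hM b v (11/10) ♮ (fun l _ ↦ hv l) (fun p hp ↦ by
    have h2 : 2° ≤ p := by exact_mod_cast (mem_PR.1 hp).1.two_le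
    rw [div_le_iff₀ ♭]; have := (hv (lev p)).2; linarith) (T.image Af) (by
    intro A hA
    obtain ⟨q, hq, rfl⟩ := mem_image.1 hA
    refine ⟨hA0 q hq, fun p hp ↦ ?_⟩
    rw [Nat.mem_primeFactors] at hp
    exact mem_PR_of_dvd (hT q hq).1.two_le (hT q hq).2.1 hp.1 (by rw [hAX q hq]; exact hp.2.1.mul_right _))
  have hK0 : 0 ≤ K := by rw [hK]; positivity
  refine (mul_le_mul_of_nonneg_right hE hK0).trans ?_
  have e1 : ∑ l ∈ range (b+1), (v l - 1) = ∑ l ∈ range (b+1), v l - (b+1) := by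
    rw [sum_sub_distrib]; simp
  have e2 : exp (2*(b°-a)) * exp (∑ l ∈ range (b+1), (v l - 1)) =
      exp (∑ l ∈ range (b+1), v l) * exp (b+1) * exp (-2*a) * exp (-2) := by
    rw [e1, ← exp_add, ← exp_add, ← exp_add, ← exp_add]; congr 1; ring
  have e3 : K = 11/10 * C * 16 * exp (b+1) * ((b°+1)^4 * a°^4) * exp (-2*a) := by
    rw [hK]
    have : exp (-2*a°) = (exp a ^2)⁻¹ := by rw [← exp_nat_mul, ← exp_neg]; congr 1; push_cast; ring
    rw [this]; field_simp; ring
  have e4 : a°^4 ≤ (b°+1)^4 := by gcongr; linarith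
  have e5 : exp 2 * exp (-2) = 1 := by rw [← exp_add]; simp
  have e6 : K ≤ 11/10 * C * 16 * exp (b+1) * ((b°+1)^4 * (b°+1)^4) * exp (-2*a) := by
    rw [e3]; gcongr
  calc _ ≤ exp (∑ l ∈ range (b+1), v l + M*(11/10)^2) * (11/10 * C * 16 * exp (b+1) * ((b°+1)^4 * (b°+1)^4) * exp (-2*a)) :=
        mul_le_mul_of_nonneg_left e6 (exp_pos _).le
    _ = 11/10 * C * (exp 2 * exp (-2)) * 16 * exp (M*(11/10)^2) * (b+1:ℝ)^8 * (exp (∑ l ∈ range (b+1), v l) * exp (b+1) * exp (-2*a)) := by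
        rw [e5, exp_add]; ring
    _ = 11/10 * C * exp 2 * 16 * exp (M*(11/10)^2) * (b+1:ℝ)^8 * (exp (2*(b°-a)) * exp (∑ l ∈ range (b+1), (v l - 1))) := by
        rw [e2]; ring
    _ = _ := by ring

/-- Lemma T -/
theorem lemT : ∃ C : ℝ, 1 ≤ C ∧ ∀ (a b : ℕ) (v : ℕ → ℝ) (T : Finset ℕ), 10 ≤ a → a ≤ b → (∀ l, 0 ≤ v l ∧ v l ≤ 11/10) →
    (∀ q ∈ T, q.Prime ∧ a ≤ lev q ∧ lev q ≤ b) →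
    ∑ q ∈ T, cm (fun p ↦ v (lev p)) (q-1) / (q°-1) ≤
      C * (exp (-a°^2 + 4*(b+1)) +
      (b+1:ℝ)^8 * exp (2*(b°-a)) * exp (∑ l ∈ range (b+1), (v l - 1))) := by
  classical
  obtain ⟨C1, hC11, hC1⟩ := T1
  obtain ⟨C2, hC21, hC2⟩ := T2
  refine ⟨C1 + C2, by linarith, fun a b v T ha hab hv hT ↦ ?_⟩
  rw [← sum_filter_add_sum_filter_not T (fun q ↦ ∀ p, p.Prime → p ∣ q - 1 → p° ≤ Zof a)]
  have h1 := hC1 a b v (T.filter (fun q ↦ ∀ p, p.Prime → p ∣ q - 1 → p° ≤ Zof a)) ha hv (fun q hq ↦ by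
    obtain ⟨h, h'⟩ := mem_filter.1 hq; obtain ⟨x, y, z⟩ := hT q h; exact ⟨x, y, z, h'⟩)
  have h2 := hC2 a b v (T.filter (fun q ↦ ¬ ∀ p, p.Prime → p ∣ q - 1 → p° ≤ Zof a)) ha hab hv (fun q hq ↦ by
    obtain ⟨h, h'⟩ := mem_filter.1 hq; obtain ⟨x, y, z⟩ := hT q h
    push Not at h'; exact ⟨x, z, h'⟩)
  have p1 : 0 ≤ exp (-a°^2 + 4*(b+1)) := by positivity
  have p2 : 0 ≤ (b+1:ℝ)^8 * exp (2*(b°-a)) * exp (∑ l ∈ range (b+1), (v l - 1)) := by positivity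
  have q1 : 0 ≤ C2 * exp (-a°^2 + 4*(b+1)) := by positivity
  have q2 : 0 ≤ C1 * ((b+1:ℝ)^8 * exp (2*(b°-a)) * exp (∑ l ∈ range (b+1), (v l - 1))) := by positivity
  linarith
end

open Finset Real
noncomputable section

theorem fordA_zero : fordA 0 = -1 := by simp [fordA]

theorem fordA_le (n : ℕ) : fordA n ≤ log (n+1) := by
  unfold fordA
  rcases Nat.eq_zero_or_pos n with rfl | hn
  · simp
  have hn' : 1° ≤ n := by exact_mod_cast hn
  have h1 : log ((n+1)/n) ≤ (n+1)/n - 1 := log_le_sub_one_of_pos ♯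
  rw [log_div ♯ ♯] at h1
  have h2 : (n°+1)/n - 1 = 1/n := by field_simp; ring
  have h3 : n° * (log (n+1) - log n) ≤ n * (1/n) := by rw [h2] at h1; gcongr
  rw [mul_one_div_cancel ♯] at h3
  linarith

theorem log_succ_le (n : ℕ) : log (n°+1) ≤ n := by
  have := log_le_sub_one_of_pos (show 0° < n°+1 by positivity); linarith

theorem fordA_le' (n : ℕ) : fordA n ≤ n := (fordA_le n).trans (log_succ_le n)

theorem fordA_succ_pos (n : ℕ) : 0 < fordA (n+1) := by
  unfold fordA
  have hn' : 0° < (n+1:ℕ) := by positivity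
  set m : ℝ := ((n+1:ℕ):ℝ) with hm
  have hm1 : 1 ≤ m := by rw [hm]; push_cast; have : 0° ≤ n := by positivity
                         linarith
  have h1 : log (m/(m+1)) ≤ m/(m+1) - 1 := log_le_sub_one_of_pos ♯
  rw [log_div ♯ ♯] at h1
  have h2 : m/(m+1) - 1 = -(1/(m+1)) := by field_simp; ring
  have h4 : 0 < log (m+1) := log_pos ♭
  rcases eq_or_lt_of_le hm1 with h | h
  · rw [← h]; have := log_two_gt_d9; norm_num; linarith
  · have h5 : 0 < log m := log_pos h
    have h6 : log (m+1) ≥ log m + 1/(m+1) := by linarith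
    have h7 : (m+1) * (log m + 1/(m+1)) ≤ (m+1) * log (m+1) := by gcongr
    rw [mul_add, mul_one_div_cancel ♯] at h7
    linarith

theorem fordA_nonneg {n : ℕ} (hn : 1 ≤ n) : 0 ≤ fordA n := by
  obtain ⟨m, rfl⟩ := Nat.exists_eq_add_of_le' hn; exact (fordA_succ_pos m).le

/-- `n - n log n = 1 - Σ_{1≤k<n} a_k` -/
theorem ford_tele (n : ℕ) : ((n+1:ℕ):ℝ) - (n+1:ℕ) * log (n+1:ℕ) = 1 - ∑ k ∈ range n, fordA (k+1) := by
  induction n with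
  | zero => simp
  | succ n ih =>
    rw [sum_range_succ, ← sub_sub, ← ih]; unfold fordA; push_cast; ring

structure FordData (ϱ : ℝ) : Prop where
  pos : 0 < ϱ
  lt : ϱ < 1
  sum : ∑' n : ℕ, fordA (n+1) * ϱ^(n+1) = 1

theorem FordData.summable {ϱ : ℝ} (h : FordData ϱ) : Summable (fun n : ℕ => fordA (n+1) * ϱ^(n+1)) := by
  by_contra hc
  have := tsum_eq_zero_of_not_summable hc
  rw [h.sum] at this; norm_num at this

theorem FordData.psum_le {ϱ : ℝ} (h : FordData ϱ) (n : ℕ) : ∑ k ∈ range n, fordA (k+1) * ϱ^(k+1) ≤ 1 := by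
  rw [← h.sum]
  exact h.summable.sum_le_tsum _ (fun k _ ↦ mul_nonneg (fordA_succ_pos k).le (pow_nonneg h.pos.le _))

theorem FordData.tail {ϱ : ℝ} (h : FordData ϱ) : ∃ D r : ℝ, 0 < D ∧ 0 < r ∧ r < 1 ∧
    ∀ n : ℕ, 1 - D * r^n ≤ ∑ k ∈ range n, fordA (k+1) * ϱ^(k+1) := by
  set r := √ϱ with hr
  have hr0 : 0 < r := sqrt_pos.2 h.pos
  have hr1 : r < 1 := by rw [hr, sqrt_lt' one_pos]; simpa using h.lt
  have hr2 : r^2 = ϱ := sq_sqrt h.pos.le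
  have hs : Summable (fun n : ℕ => (n°)^1 * r^n) := summable_pow_mul_geometric_of_norm_lt_one 1 (by
    rw [norm_of_nonneg hr0.le]; exact hr1)
  simp only [pow_one] at hs
  refine ⟨∑' n : ℕ, n° * r^n + 1, r, ?_, hr0, hr1, fun n ↦ ?_⟩
  · have : 0 ≤ ∑' n : ℕ, n° * r^n := tsum_nonneg fun n ↦ by positivity
    linarith
  have h1 := h.summable.sum_add_tsum_nat_add n
  rw [h.sum] at h1
  have h2 : ∑' k : ℕ, fordA (k+n+1) * ϱ^(k+n+1) ≤ (∑' n : ℕ, n° * r^n) * r^n := by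
    have hs1 : Summable (fun k : ℕ => ((k+n+1:ℕ):ℝ) * r^(k+n+1)) := by
      have := (summable_nat_add_iff (n+1)).2 hs; simpa [add_assoc] using this
    have key : ∀ k : ℕ, fordA (k+n+1) * ϱ^(k+n+1) ≤ (((k+n+1:ℕ):ℝ) * r^(k+n+1)) * r^n := by
      intro k
      have a1 := fordA_le' (k+n+1)
      rw [← hr2, ← pow_mul]
      have a2 : r^(2*(k+n+1)) ≤ r^(k+n+1) * r^n := by
        rw [← pow_add]; exact pow_le_pow_of_le_one hr0.le hr1.le ⋆
      calc _ ≤ ((k+n+1:ℕ):ℝ) * (r^(k+n+1) * r^n) :=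
            mul_le_mul a1 a2 ♯ ♯
        _ = _ := by ring
    have b1 : ∑' k : ℕ, fordA (k+n+1) * ϱ^(k+n+1) ≤ ∑' k : ℕ, (((k+n+1:ℕ):ℝ) * r^(k+n+1)) * r^n := by
      have hs2 : Summable fun k : ℕ ↦ fordA (k+n+1) * ϱ^(k+n+1) := (summable_nat_add_iff (f := fun k ↦ fordA (k+1) * ϱ^(k+1)) n).2 h.summable
      exact hs2.tsum_le_tsum key (hs1.mul_right (r^n))
    rw [tsum_mul_right] at b1
    refine b1.trans (mul_le_mul_of_nonneg_right ?_ ♯)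
    have := hs.sum_add_tsum_nat_add (n+1)
    have h0 : 0 ≤ ∑ i ∈ range (n+1), i° * r^i := sum_nonneg fun i _ ↦ by positivity
    have e : ∑' k : ℕ, ((k+n+1:ℕ):ℝ) * r^(k+n+1) = ∑' k : ℕ, ((k+(n+1):ℕ):ℝ) * r^(k+(n+1)) := by simp only [add_assoc]
    rw [e]; linarith
  have h3 : 0 ≤ r^n := by positivity
  nlinarith

/-- lower bound for the renewal sequence -/
theorem FordData.renewal {ϱ : ℝ} (h : FordData ϱ) : ∃ c : ℝ, 0 < c ∧ c ≤ 1 ∧ ∀ (N : ℕ) (f : ℕ → ℝ), f 0 = 1 →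
    (∀ n, n < N → ∑ k ∈ range (n+1), fordA (k+1) * ϱ^(k+1) * f (n-k) ≤ f (n+1)) → ∀ n ≤ N, c ≤ f n := by
  obtain ⟨D, r, hD, hr0, hr1, hT⟩ := h.tail
  obtain ⟨K, hK⟩ : ∃ K : ℕ, D * (r^K * (1-r)⁻¹) ≤ 1/2 := by
    have : Filter.Tendsto (fun K : ℕ => D * (r^K * (1-r)⁻¹)) Filter.atTop (nhds (D * (0 * (1-r)⁻¹))) :=
      ((tendsto_pow_atTop_nhds_zero_of_lt_one hr0.le hr1).mul_const _).const_mul _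
    rw [zero_mul, mul_zero] at this
    exact ((this.eventually_lt_const (by norm_num : 0° < 1/2)).exists).imp fun _ ↦ le_of_lt
  set P : ℕ → ℝ := fun n ↦ ∑ k ∈ range (n+1), fordA (k+1) * ϱ^(k+1) with hP
  set p1 := fordA 1 * ϱ with hp1
  have hp1pos : 0 < p1 := mul_pos (fordA_succ_pos 0) h.pos
  have hPge : ∀ n, p1 ≤ P n := by
    intro n; rw [hP]; dsimp only; rw [sum_range_succ']
    have : 0 ≤ ∑ k ∈ range n, fordA (k+1+1) * ϱ^(k+1+1) := sum_nonneg fun k _ ↦ mul_nonneg (fordA_succ_pos _).le (pow_nonneg h.pos.le _)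
    simp only [zero_add, pow_one]; linarith
  have hPle : ∀ n, P n ≤ 1 := fun n ↦ h.psum_le _
  have hp1le : p1 ≤ 1 := (hPge 0).trans (hPle 0)
  have hprod : ∀ n, p1^K * (1/2) ≤ ∏ k ∈ range n, P k := by
    intro n
    have hgeo : ∀ n, ∑ i ∈ range n, D * r^(K+i) ≤ 1/2 := by
      intro n; rw [← mul_sum]; simp only [pow_add]; rw [← mul_sum]
      refine le_trans ?_ hK
      have : ∑ i ∈ range n, r^i ≤ (1-r)⁻¹ := by
        rw [← tsum_geometric_of_lt_one hr0.le hr1]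
        exact (summable_geometric_of_lt_one hr0.le hr1).sum_le_tsum _ (fun i _ ↦ by positivity)
      gcongr
    have hbig : ∀ n, p1^K * (1 - ∑ i ∈ range n, D * r^(K+i)) ≤ ∏ k ∈ range (K+n), P k := by
      intro n
      rw [prod_range_add]
      have a1 : p1^K ≤ ∏ k ∈ range K, P k := by
        rw [← card_range K, ← prod_const]; simp only [card_range]
        exact prod_le_prod (fun _ _ ↦ hp1pos.le) (fun k _ ↦ hPge k)
      have a2 : 1 - ∑ i ∈ range n, D * r^(K+i) ≤ ∏ i ∈ range n, P (K+i) := by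
        induction n with
        | zero => simp
        | succ n ih =>
          rw [sum_range_succ, prod_range_succ]
          have b1 := hT (K+n+1)
          have b2 : 1 - D * r^(K+n) ≤ P (K+n) := by
            have : D * r^(K+n+1) ≤ D * r^(K+n) := by
              gcongr ?_ * ?_; exact pow_le_pow_of_le_one hr0.le hr1.le ⋆
            have : P (K+n) = ∑ k ∈ range (K+n+1), fordA (k+1) * ϱ^(k+1) := rfl
            linarith
          have b3 : ∏ i ∈ range n, P (K+i) ≤ 1 := prod_le_one (fun i _ ↦ hp1pos.le.trans (hPge _)) (fun i _ ↦ hPle _)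
          have b4 : 0 ≤ ∏ i ∈ range n, P (K+i) := prod_nonneg (fun i _ ↦ hp1pos.le.trans (hPge _))
          have b5 : 0 ≤ D * r^(K+n) := by positivity
          nlinarith [mul_le_mul_of_nonneg_left b2 b4]
      have a3 := hgeo n
      exact mul_le_mul a1 a2 ♭ (prod_nonneg (fun i _ ↦ hp1pos.le.trans (hPge _)))
    have h1 := hbig n
    have h2 : ∏ k ∈ range (K+n), P k ≤ ∏ k ∈ range n, P k := by
      rw [add_comm, prod_range_add]
      exact mul_le_of_le_one_right (prod_nonneg (fun i _ ↦ hp1pos.le.trans (hPge _))) (prod_le_one (fun i _ ↦ hp1pos.le.trans (hPge _)) (fun i _ ↦ hPle _))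
    refine le_trans ?_ (h1.trans h2)
    have := hgeo n
    have : 0 < p1^K := by positivity
    gcongr; linarith
  refine ⟨p1^K * (1/2), by positivity, ?_, fun N f hf0 hf ↦ ?_⟩
  · have : p1^K ≤ 1 := pow_le_one₀ hp1pos.le hp1le
    linarith
  have main : ∀ n ≤ N, ∏ k ∈ range n, P k ≤ f n := by
    intro n
    induction n using Nat.strong_induction_on with
    | _ n ih =>
      intro hn
      rcases n with _ | n
      · simp [hf0]
      refine le_trans ?_ (hf n ⋆)
      rw [prod_range_succ]
      have e : P n = ∑ k ∈ range (n+1), fordA (k+1) * ϱ^(k+1) := rfl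
      rw [e, mul_sum]
      refine sum_le_sum fun k hk ↦ ?_
      have b1 := ih (n-k) ⋆ ⋆
      have b2 : ∏ k ∈ range n, P k ≤ ∏ k ∈ range (n-k), P k := by
        obtain ⟨j, hj⟩ : ∃ j, n = (n-k) + j := ⟨k, by have := mem_range.1 hk; omega⟩
        conv_lhs => rw [hj]
        rw [prod_range_add]
        exact mul_le_of_le_one_right (prod_nonneg (fun i _ ↦ hp1pos.le.trans (hPge _))) (prod_le_one (fun i _ ↦ hp1pos.le.trans (hPge _)) (fun i _ ↦ hPle _))
      rw [mul_comm]
      exact mul_le_mul_of_nonneg_left (b2.trans b1) (mul_nonneg (fordA_succ_pos _).le (pow_nonneg h.pos.le _))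
  intro n hn
  exact (hprod n).trans (main n hn)

/-- arithmetic progression positive part sum -/
theorem pos_sum (lam : ℝ) (hl : 0 < lam) (R : ℕ) : ∀ G : ℝ, ∑ i ∈ range R, max 0 (G - i*lam) ≤ (max 0 G)^2/(2*lam) + max 0 G := by
  induction R with
  | zero => intro G; simp; positivity
  | succ R ih =>
    intro G
    rw [sum_range_succ']
    have e : ∀ i : ℕ, max 0 (G - ((i+1:ℕ):ℝ)*lam) = max 0 ((G - lam) - i*lam) := by intro i; congr 1; push_cast; ring
    simp only [e]
    have := ih (G - lam)
    simp only [Nat.cast_zero, zero_mul, sub_zero]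
    rcases le_total G lam with h | h
    · rw [max_eq_left (by linarith : G - lam ≤ 0)] at this
      have h2 : 0 ≤ (max 0 G)^2/(2*lam) := by positivity
      norm_num at this
      linarith
    · rw [max_eq_right (by linarith : 0 ≤ G - lam)] at this
      rw [max_eq_right (by linarith : 0 ≤ G)]
      have : (G-lam)^2/(2*lam) = G^2/(2*lam) - G + lam/2 := by field_simp; ring
      linarith
end

open Finset Real
noncomputable section

theorem sum_cover {ι κ : Type*} [DecidableEq κ] (W : Finset κ) (I : Finset ι) (g : ι → κ) (h : κ → ℝ) (h0 : ∀ n, 0 ≤ h n)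
    (hc : ∀ w ∈ W, ∃ i ∈ I, g i = w) : ∑ w ∈ W, h w ≤ ∑ i ∈ I, h (g i) := by
  have h1 : W ⊆ I.image g := fun w hw ↦ by
    obtain ⟨i, hi, e⟩ := hc w hw; exact mem_image.2 ⟨i, hi, e⟩
  refine (sum_le_sum_of_subset_of_nonneg h1 (fun i _ _ ↦ h0 i)).trans ?_
  exact sum_image_le_of_nonneg (fun i _ ↦ h0 _)

def wl (L : List ℕ) : ℕ := (L.map (fun q ↦ q-1)).prod

def Vs (t : ℕ) : Finset ℕ := (PR t).powerset.image (fun S ↦ ∏ p ∈ S, (p-1))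

def Rs (t : ℕ) : ℝ := ∑ w ∈ Vs t, 1°/w

theorem wl_cons (q : ℕ) (L : List ℕ) : wl (q::L) = (q-1) * wl L := by simp [wl]

theorem wl_nil : wl [] = 1 := rfl

theorem mem_Vs {t w : ℕ} : w ∈ Vs t ↔ ∃ L : List ℕ, L.Pairwise (· > ·) ∧ (∀ q ∈ L, q ∈ PR t) ∧ wl L = w := by
  unfold Vs; rw [mem_image]
  constructor
  · rintro ⟨S, hS, rfl⟩
    rw [mem_powerset] at hS
    refine ⟨S.sort (· ≥ ·), ?_, fun q hq ↦ hS ((mem_sort _).1 hq), ?_⟩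
    · exact (S.sortedGT_sort).pairwise
    · unfold wl
      have : (∏ p ∈ S, (p-1)) = ((S.sort (· ≥ ·)).map (fun q ↦ q-1)).prod := by
        rw [← List.prod_toFinset _ (S.sort_nodup (· ≥ ·)), sort_toFinset]
      exact this.symm
  · rintro ⟨L, hp, hL, rfl⟩
    have hn : L.Nodup := hp.imp (fun h ↦ (ne_of_gt h))
    exact ⟨L.toFinset, mem_powerset.2 (fun q hq ↦ hL q (List.mem_toFinset.1 hq)), List.prod_toFinset _ hn⟩

theorem wl_pos {L : List ℕ} {t : ℕ} (h : ∀ q ∈ L, q ∈ PR t) : 0 < wl L := by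
  induction L with
  | nil => simp [wl]
  | cons q L ih =>
    rw [wl_cons]
    have := (mem_PR.1 (h q (by simp))).1.two_le
    exact Nat.mul_pos ⋆ (ih fun q hq ↦ h q (by simp [hq]))

theorem Vs_pos {t w : ℕ} (h : w ∈ Vs t) : 0 < w := by
  obtain ⟨L, _, h1, rfl⟩ := mem_Vs.1 h; exact wl_pos h1

theorem wl_factors {L : List ℕ} {b : ℕ} (h : ∀ q ∈ L, q.Prime ∧ lev q ≤ b) : (wl L).primeFactors ⊆ PR b := by
  induction L with
  | nil => simp [wl]
  | cons q L ih =>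
    rw [wl_cons]
    obtain ⟨h1, h2⟩ := h q (by simp)
    intro p hp
    rw [Nat.mem_primeFactors] at hp
    rcases (hp.1.dvd_mul).1 hp.2.1 with h3 | h3
    · exact mem_PR_of_dvd h1.two_le h2 hp.1 h3
    · apply ih (fun q hq ↦ h q (by simp [hq]))
      rw [Nat.mem_primeFactors]
      refine ⟨hp.1, h3, fun h0 ↦ hp.2.2 (by rw [h0, mul_zero])⟩

theorem Rs_nonneg (t : ℕ) : 0 ≤ Rs t := sum_nonneg fun _ _ ↦ by positivity

theorem one_le_Rs (t : ℕ) : 1 ≤ Rs t := by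
  have h : 1 ∈ Vs t := mem_Vs.2 ⟨[], by simp, by simp, rfl⟩
  have := single_le_sum (f := fun w : ℕ => 1°/w) (fun _ _ ↦ by positivity) h
  unfold Rs; simpa using this

theorem Rs_mono {s t : ℕ} (h : s ≤ t) : Rs s ≤ Rs t := by
  refine sum_le_sum_of_subset_of_nonneg (fun w hw ↦ ?_) (fun _ _ _ ↦ by positivity)
  obtain ⟨L, h1, h2, h3⟩ := mem_Vs.1 hw
  exact mem_Vs.2 ⟨L, h1, fun q hq ↦ mem_PR.2 ⟨(mem_PR.1 (h2 q hq)).1, (mem_PR.1 (h2 q hq)).2.trans h⟩, h3⟩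

/-- trivial bound -/
theorem Rs_trivial : ∃ M : ℝ, 1 ≤ M ∧ ∀ t : ℕ, Rs t ≤ exp (t + M) := by
  obtain ⟨M, hM1, hM⟩ := cm_lev_sum
  refine ⟨M+1, by linarith, fun t ↦ ?_⟩
  have h := hM t (fun _ ↦ 1) 1 le_rfl (fun _ _ ↦ by norm_num) (fun p hp ↦ by
    have h2 : 2° ≤ p := by exact_mod_cast (mem_PR.1 hp).1.two_le
    rw [div_le_iff₀ ♭]; linarith) (Vs t) (fun w hw ↦ by
    refine ⟨(Vs_pos hw).ne', ?_⟩
    obtain ⟨L, _, h1, rfl⟩ := mem_Vs.1 hw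
    exact wl_factors (fun q hq ↦ mem_PR.1 (h1 q hq)))
  have e : ∀ n, cm (fun _ ↦ 1°) n = 1 := fun n ↦ by simp [cm, mval]
  simp only [e] at h
  refine h.trans (exp_le_exp.2 ?_)
  simp; linarith

/-! ### good prefixes -/
def dotL (c : ℕ → ℝ) (L : List ℕ) : ℝ := ∑ i ∈ range L.length, c i * (L.getD i 0 : ℕ)

theorem dotL_nil (c : ℕ → ℝ) : dotL c [] = 0 := by simp [dotL]

theorem dotL_cons (c : ℕ → ℝ) (a : ℕ) (L : List ℕ) : dotL c (a::L) = c 0 * a + dotL (fun n ↦ c (n+1)) L := by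
  unfold dotL; rw [List.length_cons, sum_range_succ']
  simp [add_comm]

def Zw (b : ℕ → ℝ) : (ℕ → ℝ) → List ℕ → ℝ
  | _, [] => 0
  | θ, a::L => θ 0 * (a - dotL (fun n ↦ b (n+1)) L) + Zw b (fun n ↦ θ (n+1)) L

theorem Zw_eq (b : ℕ → ℝ) (L : List ℕ) : ∀ θ : ℕ → ℝ,
    Zw b θ L = dotL (fun n ↦ θ n - ∑ k ∈ range n, b (k+1) * θ (n-1-k)) L := by
  induction L with
  | nil => intro θ; simp [Zw, dotL]
  | cons a L ih =>
    intro θ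
    rw [Zw, ih, dotL_cons]
    simp only [range_zero, sum_empty, sub_zero]
    have : dotL (fun n ↦ θ (n+1) - ∑ k ∈ range (n+1), b (k+1) * θ (n+1-1-k)) L =
        dotL (fun n ↦ θ (n+1) - ∑ k ∈ range n, b (k+1) * θ (n-1-k+1)) L - θ 0 * dotL (fun n ↦ b (n+1)) L := by
      unfold dotL; rw [mul_sum, ← sum_sub_distrib]
      refine sum_congr rfl fun n _ ↦ ?_
      dsimp only
      rw [sum_range_succ]
      have e : ∑ k ∈ range n, b (k+1) * θ (n+1-1-k) = ∑ k ∈ range n, b (k+1) * θ (n-1-k+1) := by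
        refine sum_congr rfl fun k hk ↦ ?_
        have := mem_range.1 hk
        rw [show n+1-1-k = n-1-k+1 by omega]
      rw [e]; simp only [Nat.add_sub_cancel, Nat.sub_self]; ring
    rw [this]; ring

/-- lists of primes satisfying the prefix inequalities -/
def PG (b : ℕ → ℝ) (t : ℕ) : ℕ → Finset (List ℕ)
  | 0 => {[]}
  | m+1 => by classical exact ((PR t ×ˢ PG b t m).filter
      (fun x ↦ dotL (fun n ↦ b (n+1)) (x.2.map lev) ≤ (lev x.1 : ℝ))).image (fun x ↦ x.1 :: x.2)

theorem PG_succ (b : ℕ → ℝ) (t m : ℕ) [DecidablePred (fun x : ℕ × List ℕ => dotL (fun n ↦ b (n+1)) (x.2.map lev) ≤ (lev x.1 : ℝ))] :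
    PG b t (m+1) = ((PR t ×ˢ PG b t m).filter
      (fun x ↦ dotL (fun n ↦ b (n+1)) (x.2.map lev) ≤ (lev x.1 : ℝ))).image (fun x ↦ x.1 :: x.2) := by
  rw [PG]; congr

theorem mem_PG_cons {b : ℕ → ℝ} {t m q : ℕ} {M : List ℕ} : q::M ∈ PG b t (m+1) ↔
    q ∈ PR t ∧ M ∈ PG b t m ∧ dotL (fun n ↦ b (n+1)) (M.map lev) ≤ (lev q : ℝ) := by
  classical
  rw [PG_succ, mem_image]
  constructor
  · rintro ⟨⟨q', M'⟩, h, e⟩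
    simp only [List.cons.injEq] at e
    obtain ⟨rfl, rfl⟩ := e
    rw [mem_filter, mem_product] at h
    exact ⟨h.1.1, h.1.2, h.2⟩
  · rintro ⟨h1, h2, h3⟩
    exact ⟨(q, M), mem_filter.2 ⟨mem_product.2 ⟨h1, h2⟩, h3⟩, rfl⟩

theorem mem_PG_len {b : ℕ → ℝ} {t : ℕ} : ∀ {m : ℕ} {M : List ℕ}, M ∈ PG b t m → M.length = m := by
  intro m
  induction m with
  | zero => intro M h; simp [PG] at h; simp [h]
  | succ m ih =>
    intro M h
    cases M with
    | nil => simp [PG] at h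
    | cons q M => rw [List.length_cons, ih (mem_PG_cons.1 h).2.1]

/-- each level sum with p-1 -/
theorem LP_pred : ∃ K : ℝ, 1 ≤ K ∧ ∀ l, ∑ p ∈ LP l, 1°/(p°-1) ≤ K := by
  obtain ⟨M, hM1, hM⟩ := level_sum
  refine ⟨2*(M+1), by linarith, fun l ↦ ?_⟩
  have h1 := (abs_le.1 (hM l)).2
  have h2 : exp (-l°) ≤ 1 := exp_le_one_iff.2 (by simp)
  have h3 : ∑ p ∈ LP l, 1°/(p°-1) ≤ 2 * ∑ p ∈ LP l, 1°/p := by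
    rw [mul_sum]; refine sum_le_sum fun p hp ↦ ?_
    have h2 : 2° ≤ p := by exact_mod_cast (mem_LP.1 hp).1.two_le
    rw [mul_one_div, div_le_div_iff₀ ♭ ♭]; linarith
  nlinarith

theorem geom_peel {θ B : ℝ} (hθ : 0 < θ) (n : ℕ) : ∑ l ∈ (range n).filter (fun l : ℕ => B ≤ l), exp (-(θ*(l-B))) ≤ 1 + 1/θ := by
  have key : ∀ n : ℕ, B ≤ n → ∑ l ∈ (range n).filter (fun l : ℕ => B ≤ l), exp (-(θ*(l-B))) ≤ (1+1/θ) * (1 - exp (-(θ*(n-B)))) ∨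
      ∑ l ∈ (range n).filter (fun l : ℕ => B ≤ l), exp (-(θ*(l-B))) = 0 := by
    intro n
    induction n with
    | zero => intro _; right; simp
    | succ n ih =>
      intro h
      left
      rw [range_add_one, filter_insert]
      have hexp : exp (-θ) ≤ 1/(1+θ) := by
        rw [exp_neg, inv_eq_one_div]; apply one_div_le_one_div_of_le ♭; linarith [add_one_le_exp θ]
      have hk : 1 ≤ (1+1/θ) * (1 - exp (-θ)) := by
        have : (1+1/θ) * (1 - 1/(1+θ)) = 1 := by field_simp; ring
        have h2 : (1+1/θ) * (1 - 1/(1+θ)) ≤ (1+1/θ) * (1 - exp (-θ)) := by gcongr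
        linarith
      split_ifs with hB
      · rw [sum_insert (by simp)]
        have e : exp (-(θ*((n+1:ℕ)-B))) = exp (-(θ*(n-B))) * exp (-θ) := by
          rw [← exp_add]; congr 1; push_cast; ring
        rw [e]
        have hp := exp_pos (-(θ*(n-B)))
        set X := exp (-(θ*(n-B)))
        have hX : X ≤ 1 := exp_le_one_iff.2 (by
          have : 0 ≤ θ*(n-B) := mul_nonneg hθ.le ♭
          linarith)
        have h3 : X * 1 ≤ X * ((1+1/θ) * (1 - exp (-θ))) := by gcongr
        rcases ih hB with h4 | h4
        · nlinarith
        · rw [h4]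
          have : 0 ≤ (1+1/θ) * (1 - X) := mul_nonneg ♯ ♭
          nlinarith
      · have : (range n).filter (fun l : ℕ => B ≤ l) = ∅ := by
          apply filter_eq_empty_iff.2; intro l hl hBl
          apply hB; have := mem_range.1 hl
          have : l° ≤ n := by exact_mod_cast this.le
          linarith
        rw [this, sum_empty]
        apply mul_nonneg ♯
        have : exp (-(θ*((n+1:ℕ)-B))) ≤ 1 := exp_le_one_iff.2 (by
          have : 0 ≤ θ*((n+1:ℕ)-B) := mul_nonneg hθ.le ♭
          linarith)
        linarith
  have hpos : 0 ≤ 1 + 1/θ := by positivity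
  by_cases h : B ≤ n
  · rcases key n h with h1 | h1
    · have := exp_pos (-(θ*(n-B))); nlinarith
    · rw [h1]; exact hpos
  · have : (range n).filter (fun l : ℕ => B ≤ l) = ∅ := by
      apply filter_eq_empty_iff.2; intro l hl hBl
      apply h; have := mem_range.1 hl
      have : l° ≤ n := by exact_mod_cast this.le
      linarith
    rw [this, sum_empty]; exact hpos

theorem PG_sum : ∃ K : ℝ, 1 ≤ K ∧ ∀ (b : ℕ → ℝ) (t m : ℕ) (θ : ℕ → ℝ), (∀ i < m, 0 < θ i) →
    ∑ M ∈ PG b t m, 1°/(wl M) * exp (-(Zw b θ (M.map lev))) ≤ ∏ i ∈ range m, (K * (1 + 1/θ i)) := by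
  classical
  obtain ⟨K, hK1, hK⟩ := LP_pred
  refine ⟨K, hK1, fun b t m ↦ ?_⟩
  induction m with
  | zero => intro θ _; simp [PG, Zw, wl]
  | succ m ih =>
    intro θ hθ
    have hinj : Set.InjOn (fun x : ℕ × List ℕ => x.1 :: x.2) (((PR t ×ˢ PG b t m).filter
      (fun x ↦ dotL (fun n ↦ b (n+1)) (x.2.map lev) ≤ (lev x.1 : ℝ)) : Finset _) : Set (ℕ × List ℕ)) := by
      rintro ⟨a, b⟩ _ ⟨c, d⟩ _ h; simpa using h
    have e0 : PG b t (m+1) = ((PR t ×ˢ PG b t m).filter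
      (fun x ↦ dotL (fun n ↦ b (n+1)) (x.2.map lev) ≤ (lev x.1 : ℝ))).image (fun x ↦ x.1 :: x.2) := PG_succ _ _ _
    rw [e0, sum_image hinj, sum_filter, sum_product_right, prod_range_succ', mul_comm]
    have hb : ∀ M ∈ PG b t m, ∑ q ∈ PR t, (if dotL (fun n ↦ b (n+1)) (M.map lev) ≤ (lev q : ℝ) then
        1°/(wl (q::M)) * exp (-(Zw b θ ((q::M).map lev))) else 0) ≤
        K * (1+1/θ 0) * (1°/(wl M) * exp (-(Zw b (fun n ↦ θ (n+1)) (M.map lev)))) := by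
      intro M hM
      set B := dotL (fun n ↦ b (n+1)) (M.map lev) with hB
      have e1 : ∀ q ∈ PR t, (if B ≤ (lev q : ℝ) then 1°/(wl (q::M)) * exp (-(Zw b θ ((q::M).map lev))) else 0) =
          (1°/(wl M) * exp (-(Zw b (fun n ↦ θ (n+1)) (M.map lev)))) *
          ((if B ≤ (lev q : ℝ) then exp (-(θ 0*(lev q-B))) else 0) * (1/(q°-1))) := by
        intro q hq
        split_ifs with h
        · have h1 := (mem_PR.1 hq).1.one_le
          rw [wl_cons, List.map_cons, Zw, neg_add, exp_add, ← hB]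
          push_cast [h1]
          rw [one_div_mul_eq_div, one_div_mul_eq_div, mul_one_div, div_mul_div_comm]
          rw [mul_comm (exp _), mul_comm (q°-1)]
        · simp
      rw [sum_congr rfl e1, ← mul_sum, mul_comm]
      apply mul_le_mul_of_nonneg_right _ ♯
      rw [sum_PR]
      have e2 : ∀ l ∈ range (t+1), ∑ p ∈ LP l, (if B ≤ (lev p : ℝ) then exp (-(θ 0*(lev p-B))) else 0) * (1/(p°-1)) ≤
          K * (if B ≤ (l : ℝ) then exp (-(θ 0*(l-B))) else 0) := by
        intro l _
        have e3 : ∀ p ∈ LP l, (if B ≤ (lev p : ℝ) then exp (-(θ 0*(lev p-B))) else 0) * (1/(p°-1)) =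
          (if B ≤ (l : ℝ) then exp (-(θ 0*(l-B))) else 0) * (1/(p°-1)) := fun p hp ↦ by rw [(mem_LP.1 hp).2]
        rw [sum_congr rfl e3, ← mul_sum, mul_comm]
        apply mul_le_mul_of_nonneg_right (hK l)
        split_ifs <;> positivity
      refine (sum_le_sum e2).trans ?_
      rw [← mul_sum, ← sum_filter]
      exact mul_le_mul_of_nonneg_left (geom_peel (hθ 0 ⋆) _) ♭
    refine (sum_le_sum hb).trans ?_
    rw [← mul_sum]
    refine mul_le_mul_of_nonneg_left (ih (fun n ↦ θ (n+1)) (fun i hi ↦ hθ (i+1) ⋆)) ?_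
    have := hθ 0 ⋆; positivity
end

open Finset Real
noncomputable section

def bco (r k : ℕ) : ℝ := if k ≤ r then fordA k / (1 + 1/r°) else 0

theorem bco_nonneg (r k : ℕ) : 0 ≤ bco r (k+1) := by
  unfold bco; split_ifs
  · exact div_nonneg (fordA_succ_pos k).le ♯
  · exact le_rfl

def gren (b : ℕ → ℝ) : ℕ → ℝ
  | 0 => 1
  | n+1 => ∑ k : Fin (n+1), b (k+1) * gren b (n - k)
decreasing_by omega

theorem gren_zero (b : ℕ → ℝ) : gren b 0 = 1 := by rw [gren]

theorem gren_succ (b : ℕ → ℝ) (n : ℕ) : gren b (n+1) = ∑ k ∈ range (n+1), b (k+1) * gren b (n-k) := by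
  rw [gren, Finset.sum_range]

theorem FordData.gren_ge {ϱ : ℝ} (h : FordData ϱ) : ∃ c : ℝ, 0 < c ∧ c ≤ 1 ∧ ∀ r : ℕ, 1 ≤ r → ∀ n ≤ r, c * (1/ϱ)^n ≤ gren (bco r) n := by
  obtain ⟨c, hc0, hc1, hc⟩ := h.renewal
  refine ⟨c/3, by linarith, by linarith, fun r hr n hn ↦ ?_⟩
  have hr' : 1° ≤ r := by exact_mod_cast hr
  set u : ℝ := 1 + 1/r° with hu
  have hu1 : 1 ≤ u := by rw [hu]; have : 0 ≤ 1/r° := by positivity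
                         linarith
  have hg0 : ∀ n, 0 ≤ gren (bco r) n := by
    intro n
    induction n using Nat.strong_induction_on with
    | _ n ih =>
      rcases n with _ | n
      · rw [gren_zero]; norm_num
      · rw [gren_succ]; exact sum_nonneg fun k hk ↦ mul_nonneg (bco_nonneg _ _) (ih _ ⋆)
  have hf := hc r (fun n ↦ gren (bco r) n * (ϱ*u)^n) (by simp [gren_zero]) (by
    intro n hn
    rw [gren_succ, sum_mul]
    refine sum_le_sum fun k hk ↦ ?_
    have hk' := mem_range.1 hk
    have e1 : bco r (k+1) = fordA (k+1)/u := by rw [bco, if_pos ⋆]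
    have e2 : (ϱ*u)^(n+1) = ϱ^(k+1) * (ϱ*u)^(n-k) * (u^k * u) := by
      rw [show n+1 = (k+1)+(n-k) by omega, pow_add, mul_pow]; ring
    rw [e1, e2]
    have : fordA (k+1)/u * gren (bco r) (n-k) * (ϱ^(k+1) * (ϱ*u)^(n-k) * (u^k*u)) =
        fordA (k+1) * ϱ^(k+1) * (gren (bco r) (n-k) * (ϱ*u)^(n-k)) * u^k := by
      field_simp
    rw [this]
    apply le_mul_of_one_le_right
    · exact mul_nonneg (mul_nonneg (fordA_succ_pos k).le (pow_nonneg h.pos.le _)) (mul_nonneg (hg0 _) (pow_nonneg (mul_nonneg h.pos.le ♭) _))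
    · exact one_le_pow₀ hu1) n hn
  have hun : u^n ≤ 3 := by
    calc u^n ≤ u^r := pow_le_pow_right₀ hu1 hn
      _ ≤ (exp (1/r°))^r := by gcongr; rw [hu, add_comm]; exact add_one_le_exp _
      _ = exp 1 := by rw [← exp_nat_mul]; congr 1; field_simp
      _ ≤ 3 := by have := exp_one_lt_d9; linarith
  have hϱn : 0 < ϱ^n := pow_pos h.pos n
  rw [mul_pow] at hf
  have h3 : gren (bco r) n * (ϱ^n * u^n) ≤ gren (bco r) n * (ϱ^n * 3) := by
    have := hg0 n; gcongr
  rw [one_div, inv_pow, ← div_eq_mul_inv, div_le_iff₀ hϱn]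
  linarith

/-- heads of good lists are large -/
theorem good_head {b : ℕ → ℝ} (hb : ∀ k, 0 ≤ b (k+1)) {t : ℕ} : ∀ {m : ℕ} {M : List ℕ}, M ∈ PG b t m → (∀ q ∈ M, 1 ≤ lev q) →
    ∀ i n, i + n < m → gren b n ≤ ((M.map lev).getD i 0 : ℕ) := by
  intro m
  induction m with
  | zero => intro M _ _ i n h; omega
  | succ m ih =>
    intro M hM h1 i n hin
    cases M with
    | nil => have := mem_PG_len hM; simp at this
    | cons q M =>
      obtain ⟨hq, hM', hd⟩ := mem_PG_cons.1 hM
      have IH := ih hM' (fun q hq ↦ h1 q (by simp [hq]))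
      rcases i with _ | i
      · simp only [List.map_cons, List.getD_cons_zero]
        rcases n with _ | n
        · rw [gren_zero]; exact_mod_cast h1 q (by simp)
        · refine le_trans ?_ hd
          rw [gren_succ, dotL]
          have hl := mem_PG_len hM'
          have hsub : range (n+1) ⊆ range (M.map lev).length := range_subset_range.2 (by rw [List.length_map]; omega)
          refine le_trans ?_ (sum_le_sum_of_subset_of_nonneg hsub (fun i _ _ ↦ mul_nonneg (hb i) ♯))
          refine sum_le_sum fun k hk ↦ ?_
          have := mem_range.1 hk
          exact mul_le_mul_of_nonneg_left (IH k (n-k) ⋆) (hb k)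
      · simp only [List.map_cons, List.getD_cons_succ]
        exact IH i n ⋆

def Fail (b : ℕ → ℝ) (T : ℕ) (L : List ℕ) : Prop :=
  ∃ q L', L = q::L' ∧ T < lev q ∧ (lev q : ℝ) < dotL (fun n ↦ b (n+1)) (L'.map lev)

def Fset (b : ℕ → ℝ) (T t : ℕ) : Finset ℕ := by
  classical exact (Vs t).filter (fun w ↦ ∃ L : List ℕ, L.Pairwise (· > ·) ∧ (∀ q ∈ L, q ∈ PR t) ∧ wl L = w ∧ Fail b T L)

theorem lev_mono {p q : ℕ} (hp : 2 ≤ p) (h : p ≤ q) : lev p ≤ lev q := by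
  have := (lev_le_iff (b := lev q) (by omega : 2 ≤ q)).1 le_rfl
  refine (lev_le_iff hp).2 (le_trans ?_ this); exact_mod_cast h

theorem dotL_take {c : ℕ → ℝ} (hc : ∀ k, 0 ≤ c k) {M L : List ℕ} (h : M <+: L) : dotL c (M.map lev) ≤ dotL c (L.map lev) := by
  obtain ⟨N, rfl⟩ := h
  unfold dotL
  have hsub : range (M.map lev).length ⊆ range ((M++N).map lev).length := range_subset_range.2 (by simp)
  refine le_trans (le_of_eq ?_) (sum_le_sum_of_subset_of_nonneg hsub (fun i _ _ ↦ mul_nonneg (hc i) ♯))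
  refine sum_congr rfl fun i hi ↦ ?_
  have hi := mem_range.1 hi
  rw [List.map_append, List.getD_append _ _ _ _ hi]

theorem prefix_exists {b : ℕ → ℝ} (hb : ∀ k, 0 ≤ b (k+1)) {T t : ℕ} : ∀ L : List ℕ, L.Pairwise (· > ·) → (∀ q ∈ L, q ∈ PR t) →
    ∃ M w', M <+: L ∧ M ∈ PG b t M.length ∧ (∀ q ∈ M, T < lev q) ∧ wl L = wl M * w' ∧ (w' ∈ Vs T ∨ w' ∈ Fset b T t) := by
  classical
  intro L
  induction L with
  | nil => intro _ _; exact ⟨[], 1, by simp, by simp [PG], by simp, by simp [wl], Or.inl (mem_Vs.2 ⟨[], by simp, by simp, rfl⟩)⟩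
  | cons q L ih =>
    intro hp hL
    by_cases h1 : lev q ≤ T
    · refine ⟨[], wl (q::L), by simp, by simp [PG], by simp, by simp [wl_nil], Or.inl (mem_Vs.2 ⟨_, hp, ?_, rfl⟩)⟩
      intro p hpm
      have hpp := (mem_PR.1 (hL p hpm)).1
      refine mem_PR.2 ⟨hpp, ?_⟩
      rcases List.mem_cons.1 hpm with rfl | hm
      · exact h1
      · exact (lev_mono hpp.two_le (le_of_lt ((List.pairwise_cons.1 hp).1 p hm))).trans h1
    by_cases h2 : (lev q : ℝ) < dotL (fun n ↦ b (n+1)) (L.map lev)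
    · refine ⟨[], wl (q::L), by simp, by simp [PG], by simp, by simp [wl_nil], Or.inr ?_⟩
      rw [Fset, mem_filter]
      exact ⟨mem_Vs.2 ⟨_, hp, hL, rfl⟩, _, hp, hL, rfl, q, L, rfl, by omega, h2⟩
    · obtain ⟨M, w', hM1, hM2, hM3, hM4, hM5⟩ := ih (List.pairwise_cons.1 hp).2 (fun q hq ↦ hL q (by simp [hq]))
      refine ⟨q::M, w', by simpa using hM1, ?_, ?_, ?_, hM5⟩
      · rw [List.length_cons, mem_PG_cons]
        exact ⟨hL q (by simp), hM2, (dotL_take hb hM1).trans (not_lt.1 h2)⟩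
      · intro p hp'
        rcases List.mem_cons.1 hp' with rfl | h
        · omega
        · exact hM3 p h
      · rw [wl_cons, wl_cons, hM4]; ring

theorem stepA {b : ℕ → ℝ} (hb : ∀ k, 0 ≤ b (k+1)) {T t r : ℕ} (hr : t° < gren b r) :
    Rs t ≤ (∑ m ∈ range (r+1), ∑ M ∈ PG b t m, 1°/(wl M)) * (Rs T + ∑ w ∈ Fset b T t, 1°/w) := by
  classical
  set I := ((range (r+1)).biUnion (PG b t)) ×ˢ (Vs T ∪ Fset b T t) with hI
  have h := sum_cover (Vs t) I (fun x ↦ wl x.1 * x.2) (fun w ↦ 1°/w) (fun _ ↦ by positivity) (by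
    intro w hw
    obtain ⟨L, h1, h2, rfl⟩ := mem_Vs.1 hw
    obtain ⟨M, w', hM1, hM2, hM3, hM4, hM5⟩ := prefix_exists (T := T) hb L h1 h2
    refine ⟨(M, w'), ?_, hM4.symm⟩
    rw [hI, mem_product, mem_biUnion, mem_union]
    refine ⟨⟨M.length, ?_, hM2⟩, hM5⟩
    rw [mem_range]
    by_contra hc
    have g := good_head hb hM2 (fun q hq ↦ by have := hM3 q hq; omega) 0 r ⋆
    cases M with
    | nil => simp at hc
    | cons q M =>
      simp only [List.map_cons, List.getD_cons_zero] at g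
      have : lev q ≤ t := (mem_PR.1 (h2 q (hM1.subset (by simp)))).2
      have : (lev q:ℝ) ≤ t := by exact_mod_cast this
      linarith)
  refine h.trans ?_
  rw [hI, sum_product]
  have e : ∀ M ∈ (range (r+1)).biUnion (PG b t), ∑ w ∈ Vs T ∪ Fset b T t, 1°/((wl M * w : ℕ):ℝ) ≤
      1°/(wl M) * (Rs T + ∑ w ∈ Fset b T t, 1°/w) := by
    intro M _
    have : ∀ w ∈ Vs T ∪ Fset b T t, 1°/((wl M * w : ℕ):ℝ) = 1°/(wl M) * (1°/w) := fun w _ ↦ by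
      push_cast; rw [div_mul_div_comm, one_mul]
    rw [sum_congr rfl this, ← mul_sum]
    apply mul_le_mul_of_nonneg_left _ ♯
    have h3 := sum_union_inter (s₁ := Vs T) (s₂ := Fset b T t) (f := fun w : ℕ => 1°/w)
    have h4 : 0 ≤ ∑ w ∈ Vs T ∩ Fset b T t, 1°/w := sum_nonneg fun _ _ ↦ by positivity
    unfold Rs; linarith
  refine (sum_le_sum e).trans ?_
  rw [← sum_mul]
  apply mul_le_mul_of_nonneg_right
  · have := sum_cover ((range (r+1)).biUnion (PG b t)) ((range (r+1)).sigma (PG b t)) (fun x ↦ x.2) (fun M ↦ 1°/(wl M)) (fun _ ↦ by positivity) (by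
      intro M hM
      obtain ⟨m, hm, hM⟩ := mem_biUnion.1 hM
      exact ⟨⟨m, M⟩, mem_sigma.2 ⟨hm, hM⟩, rfl⟩)
    rw [sum_sigma] at this
    exact this
  · exact add_nonneg (Rs_nonneg T) (sum_nonneg fun _ _ ↦ by positivity)

/-- volume bound -/
theorem FordData.volA {ϱ : ℝ} (h : FordData ϱ) : ∃ A : ℝ, 1 ≤ A ∧ ∀ (r t : ℕ), 3 ≤ t → 1 ≤ r →
    ∑ m ∈ range (r+1), ∑ M ∈ PG (bco r) t m, 1°/(wl M) ≤
    exp (1/(2*log (1/ϱ)) * (log (t/log t))^2 + A * (r + log t)) := by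
  obtain ⟨K, hK1, hK⟩ := PG_sum
  obtain ⟨c, hc0, hc1, hc⟩ := h.gren_ge
  have hlam : 0 < log (1/ϱ) := log_pos (by rw [lt_div_iff₀ h.pos]; linarith [h.lt])
  set lam := log (1/ϱ) with hlamdef
  set A0 := log (K * (1 + 1/c)) with hA0
  have hKc : 1 ≤ K * (1+1/c) := one_le_mul_of_one_le_of_one_le hK1 (by have : 0 < 1/c := by positivity
                                                                       linarith)
  have hA0n : 0 ≤ A0 := log_nonneg hKc
  refine ⟨A0 + 2, by linarith, fun r t ht hr ↦ ?_⟩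
  have ht' : 3° ≤ t := by exact_mod_cast ht
  have hlt : 1 ≤ log t := by
    rw [le_log_iff_exp_le ♭]; have := exp_one_lt_d9; linarith
  have hltt : log t ≤ t := (log_le_sub_one_of_pos ♭).trans ♭
  set X := t°/log t with hX
  have hX1 : 1 ≤ X := by rw [hX, le_div_iff₀ ♭]; linarith
  set G := log X with hG
  have hG0 : 0 ≤ G := log_nonneg hX1
  have hGle : G ≤ log t := log_le_log ♭ (div_le_self ♭ hlt)
  set s := log t / t with hs
  have hs0 : 0 < s := by rw [hs]; positivity
  have hfac : ∀ i ≤ r, K * (1 + 1/(s * gren (bco r) i)) ≤ exp (A0 + max 0 (G - i*lam)) := by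
    intro i hi
    have hg := hc r hr i hi
    have hϱi : 0 < (1/ϱ)^i := by have := h.pos; positivity
    have e1 : 1/(s * gren (bco r) i) ≤ 1/c * (X * (1/ϱ)^(-(i:ℤ))) := by
      have : 1/c * (X * (1/ϱ)^(-(i:ℤ))) = 1/(s*(c*(1/ϱ)^i)) := by
        rw [zpow_neg, zpow_natCast, hX, hs]; field_simp
      rw [this]; gcongr
    have e2 : X * (1/ϱ)^(-(i:ℤ)) = exp (G - i*lam) := by
      rw [exp_sub, hG, exp_log ♭, exp_nat_mul, hlamdef, exp_log (by have := h.pos; positivity), zpow_neg, zpow_natCast]; rfl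
    have e3 : exp (G - i*lam) ≤ exp (max 0 (G - i*lam)) := exp_le_exp.2 (le_max_right _ _)
    have e4 : 1 ≤ exp (max 0 (G - i*lam)) := one_le_exp (le_max_left _ _)
    rw [exp_add, hA0, exp_log ♭]
    rw [e2] at e1
    have e5 : 1 + 1/(s * gren (bco r) i) ≤ (1+1/c) * exp (max 0 (G - i*lam)) := by
      have : 1/c * exp (G - i*lam) ≤ 1/c * exp (max 0 (G - i*lam)) := by gcongr
      linarith
    calc _ ≤ K * ((1+1/c) * exp (max 0 (G - i*lam))) := by gcongr
      _ = _ := by ring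
  have hm : ∀ m ∈ range (r+1), ∑ M ∈ PG (bco r) t m, 1°/(wl M) ≤
      exp (log t) * exp (r*A0 + (G^2/(2*lam) + G)) := by
    intro m hmr
    have hmr := mem_range.1 hmr
    have hgpos : ∀ i ≤ r, 0 < gren (bco r) i := fun i hi ↦ lt_of_lt_of_le (by have := h.pos; positivity) (hc r hr i hi)
    have h1 := hK (bco r) t m (fun i ↦ s * gren (bco r) i) (fun i hi ↦ mul_pos hs0 (hgpos i ⋆))
    have h2 : ∀ M ∈ PG (bco r) t m, 1°/(wl M) ≤ exp (log t) * (1°/(wl M) * exp (-(Zw (bco r) (fun i ↦ s * gren (bco r) i) (M.map lev)))) := by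
      intro M hM
      have hz : Zw (bco r) (fun i ↦ s * gren (bco r) i) (M.map lev) ≤ log t := by
        rw [Zw_eq]
        have e : ∀ n, s * gren (bco r) n - ∑ k ∈ range n, bco r (k+1) * (s * gren (bco r) (n-1-k)) = if n = 0 then s else 0 := by
          intro n
          rcases n with _ | n
          · simp [gren_zero]
          · rw [gren_succ, if_neg ⋆, mul_sum, sub_eq_zero]
            refine sum_congr rfl fun k hk ↦ ?_
            simp only [Nat.add_sub_cancel]; ring
        simp only [e]
        cases M with
        | nil => simp [dotL]; linarith
        | cons q M =>
          rw [List.map_cons, dotL_cons]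
          have z : dotL (fun n ↦ if n+1 = 0 then s else 0) (M.map lev) = 0 := by simp [dotL]
          rw [z, if_pos rfl, add_zero]
          cases m with
          | zero => have := mem_PG_len hM; simp at this
          | succ m =>
            have : lev q ≤ t := (mem_PR.1 (mem_PG_cons.1 hM).1).2
            have : (lev q:ℝ) ≤ t := by exact_mod_cast this
            calc s * lev q ≤ s * t := by gcongr
              _ = log t := by rw [hs]; field_simp
      have : 1 ≤ exp (log t) * exp (-(Zw (bco r) (fun i ↦ s * gren (bco r) i) (M.map lev))) := by
        rw [← exp_add]; exact one_le_exp ♭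
      calc 1°/(wl M) = 1/(wl M) * 1 := by ring
        _ ≤ 1/(wl M) * (exp (log t) * exp (-(Zw (bco r) (fun i ↦ s * gren (bco r) i) (M.map lev)))) := by gcongr
        _ = _ := by ring
    refine (sum_le_sum h2).trans ?_
    rw [← mul_sum]
    refine mul_le_mul_of_nonneg_left (h1.trans ?_) (exp_pos _).le
    have h3 : ∏ i ∈ range m, (K * (1 + 1/(s * gren (bco r) i))) ≤ ∏ i ∈ range m, exp (A0 + max 0 (G - i*lam)) :=
      prod_le_prod (fun i hi ↦ by
        have := hgpos i (by have := mem_range.1 hi; omega); positivity) (fun i hi ↦ hfac i (by have := mem_range.1 hi; omega))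
    refine h3.trans ?_
    rw [← exp_sum]
    apply exp_le_exp.2
    rw [sum_add_distrib, sum_const, card_range, nsmul_eq_mul]
    have h4 := pos_sum lam hlam m G
    rw [max_eq_right hG0] at h4
    have h5 : m° ≤ r := by exact_mod_cast (by omega : m ≤ r)
    have := mul_le_mul_of_nonneg_right h5 hA0n
    linarith
  refine (sum_le_sum hm).trans ?_
  rw [sum_const, card_range, nsmul_eq_mul, ← exp_add]
  have h6 : ((r+1:ℕ):ℝ) ≤ exp r := by push_cast; exact add_one_le_exp _
  refine (mul_le_mul_of_nonneg_right h6 (exp_pos _).le).trans ?_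
  rw [← exp_add]
  apply exp_le_exp.2
  have e : 1/(2*lam) * G^2 = G^2/(2*lam) := by ring
  rw [e]
  have hr' : 1° ≤ r := by exact_mod_cast hr
  nlinarith [mul_nonneg hA0n (by linarith : 0° ≤ log t)]
end

open Finset Real
noncomputable section

def ad (f : ℕ → ℝ) (n : ℕ) : ℝ := ∑ p ∈ n.primeFactors, (n.factorization p : ℝ) * f p

theorem cm_exp (f : ℕ → ℝ) (n : ℕ) : cm (fun p ↦ exp (f p)) n = exp (ad f n) := by
  unfold cm mval ad; rw [exp_sum]
  exact prod_congr rfl fun p _ ↦ by rw [exp_nat_mul]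

theorem ad_mul (f : ℕ → ℝ) {a b : ℕ} (ha : a ≠ 0) (hb : b ≠ 0) : ad f (a*b) = ad f a + ad f b := by
  apply exp_injective
  rw [exp_add, ← cm_exp, ← cm_exp, ← cm_exp, cm_mul _ ha hb]

theorem ad_smul (c : ℝ) (f : ℕ → ℝ) (n : ℕ) : ad (fun p ↦ c * f p) n = c * ad f n := by
  unfold ad; rw [mul_sum]; exact sum_congr rfl fun p _ ↦ by ring

theorem ad_nonneg {f : ℕ → ℝ} (h : ∀ p, 0 ≤ f p) (n : ℕ) : 0 ≤ ad f n :=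
  sum_nonneg fun p _ ↦ mul_nonneg ♯ (h p)

theorem ad_wl (f : ℕ → ℝ) {t : ℕ} {L : List ℕ} (h : ∀ q ∈ L, q ∈ PR t) : ad f (wl L) = (L.map (fun q ↦ ad f (q-1))).sum := by
  induction L with
  | nil => simp [wl, ad]
  | cons q L ih =>
    have h1 := wl_pos (fun x hx ↦ h x (List.mem_cons_of_mem _ hx))
    have := (mem_PR.1 (h q (by simp))).1.two_le
    rw [wl_cons, ad_mul f ⋆ h1.ne', ih (fun x hx ↦ h x (List.mem_cons_of_mem _ hx))]; simp

theorem getD_sum_le {f : ℕ → ℝ} (hf : ∀ n, 0 ≤ f n) (h0 : f 0 = 0) (L : List ℕ) (m : ℕ) :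
    ∑ i ∈ range m, f (L.getD i 0) ≤ (L.map f).sum := by
  induction L generalizing m with
  | nil => simp [h0]
  | cons q L ih =>
    cases m with
    | zero => simpa using add_nonneg (hf q) (List.sum_nonneg (by simp; intro a _; exact hf a))
    | succ m => rw [sum_range_succ']; have := ih m; simp at this ⊢; linarith

theorem LD : ∃ C : ℝ, 1 ≤ C ∧ ∀ (r a : ℕ) (g : ℕ → ℝ) (err : ℝ) (T : Finset ℕ), 20 ≤ r → 10 ≤ a → (∀ l, |g l| ≤ r) → 0 ≤ err →
    (∀ q ∈ T, q.Prime ∧ lev q = a ∧ ∑ l ∈ range a, g l + err ≤ ad (fun p ↦ g (lev p)) (q-1)) →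
    ∑ q ∈ T, 1/(q°-1) ≤ C * ((a+1:ℝ)^8 * exp (-(err/r^6) + (a+1)/r^10) + exp (-a°^2+5*a+5)) := by
  obtain ⟨C, hC1, hC⟩ := lemT
  refine ⟨C * exp 1, one_le_mul_of_one_le_of_one_le hC1 (one_le_exp ♮), fun r a g err T hr ha hg herr hT ↦ ?_⟩
  have hr' : 20° ≤ r := by exact_mod_cast hr
  have hr0 : 0° < r := by linarith
  set η : ℝ := 1/r°^6 with hη
  have hη0 : 0 < η := by positivity
  have hηr : η * r = 1/r°^5 := by rw [hη]; field_simp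
  have hηs : η * r ≤ 1/20 := by
    rw [hηr]; apply one_div_le_one_div_of_le ♮
    calc 20° ≤ r^1 := by simpa using hr'
      _ ≤ r^5 := pow_le_pow_right₀ ♭ ♮
  have hηg : ∀ l, |η * g l| ≤ η * r := fun l ↦ by
    rw [abs_mul, abs_of_pos hη0]; exact mul_le_mul_of_nonneg_left (hg l) hη0.le
  have hv1 : ∀ l, exp (η * g l) - 1 ≤ η * g l + 1/r°^10 := fun l ↦ by
    have h1 := abs_exp_sub_one_sub_id_le (x := η * g l) ((hηg l).trans ♭)
    have h2 : (η * g l)^2 ≤ (η*r)^2 := sq_le_sq' (by linarith [(abs_le.1 (hηg l)).1]) (abs_le.1 (hηg l)).2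
    have h3 : (η*r)^2 = 1/r°^10 := by rw [hηr]; field_simp
    linarith [(abs_le.1 h1).2]
  have h := hC a a (fun l ↦ exp (η * g l)) T ha le_rfl (fun l ↦ ⟨(exp_pos _).le, by
    have h1 := abs_exp_sub_one_sub_id_le (x := η * g l) ((hηg l).trans ♭)
    have h2 := (abs_le.1 (hηg l)).2
    have h3 : (η * g l)^2 ≤ (η*r)^2 := sq_le_sq' (by linarith [(abs_le.1 (hηg l)).1]) (abs_le.1 (hηg l)).2
    have h4 : (η*r)^2 ≤ 1/20*(1/20) := by rw [sq]; exact mul_le_mul hηs hηs ♯ ♮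
    linarith [(abs_le.1 h1).2]⟩) (fun q hq ↦ ⟨(hT q hq).1, (hT q hq).2.1.ge, (hT q hq).2.1.le⟩)
  set S := ∑ l ∈ range a, g l with hS
  have hSa : |η * S| ≤ a := by
    rw [hS, mul_sum]
    calc |∑ l ∈ range a, η * g l| ≤ ∑ l ∈ range a, |η * g l| := abs_sum_le_sum_abs _ _
      _ ≤ ∑ l ∈ range a, 1° := sum_le_sum fun l _ ↦ (hηg l).trans ♭
      _ = a := by simp
  have h1 : ∑ q ∈ T, 1/(q°-1) ≤ exp (-(η*(S+err))) * ∑ q ∈ T, cm (fun p ↦ exp (η * g (lev p))) (q-1) / (q°-1) := by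
    rw [mul_sum]; apply sum_le_sum; intro q hq
    have hq1 : 0° < q - 1 := by
      have : 2° ≤ q := by exact_mod_cast (hT q hq).1.two_le
      linarith
    rw [cm_exp (fun p ↦ η * g (lev p)), ad_smul, ← mul_div_assoc, ← exp_add]
    refine div_le_div_of_nonneg_right ?_ hq1.le
    apply one_le_exp
    have := mul_le_mul_of_nonneg_left (hT q hq).2.2 hη0.le
    linarith
  refine h1.trans ((mul_le_mul_of_nonneg_left h (exp_pos _).le).trans ?_)
  have h2 : ∑ l ∈ range (a+1), (exp (η * g l) - 1) ≤ η * S + 1 + (a+1)/r°^10 := by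
    have : ∑ l ∈ range (a+1), (exp (η * g l) - 1) ≤ ∑ l ∈ range (a+1), (η * g l + 1/r°^10) := sum_le_sum fun l _ ↦ hv1 l
    rw [sum_add_distrib, ← mul_sum, sum_range_succ g] at this
    have h3 := (abs_le.1 (hηg a)).2
    simp only [sum_const, card_range, nsmul_eq_mul] at this
    push_cast at this
    rw [mul_one_div] at this
    rw [← hS] at this
    linarith
  have e1 : exp (-(η*(S+err))) * exp (-a°^2+4*(a+1)) ≤ exp 1 * exp (-a°^2+5*a+5) := by
    rw [← exp_add, ← exp_add]; apply exp_le_exp.2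
    have := (abs_le.1 hSa).1
    have : 0 ≤ η * err := by positivity
    linarith
  have e2 : exp (-(η*(S+err))) * exp (∑ l ∈ range (a+1), (exp (η * g l) - 1)) ≤ exp 1 * exp (-(err/r^6) + (a+1)/r^10) := by
    rw [← exp_add, ← exp_add]; apply exp_le_exp.2
    have : err/r°^6 = η*err := by rw [hη]; ring
    rw [this]; linarith
  have e3 : exp (2*(a°-a)) = 1 := by simp
  rw [e3]
  have h8 : 0° ≤ (a+1:ℝ)^8 := by positivity
  calc _ = C * (exp (-(η*(S+err))) * exp (-a°^2+4*(a+1)) + (a+1:ℝ)^8*(exp (-(η*(S+err))) * exp (∑ l ∈ range (a+1), (exp (η * g l) - 1)))) := by ring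
    _ ≤ C * (exp 1 * exp (-a°^2+5*a+5) + (a+1:ℝ)^8*(exp 1 * exp (-(err/r^6) + (a+1)/r^10))) := by gcongr
    _ = _ := by ring

/-- pointwise exponent inequality -/
theorem expo (r τ : ℕ) (φ : ℕ → ℕ) (hφ : ∀ i j, i ≤ j → j ≤ r → φ j ≤ φ i) (h0 : φ 0 = τ) (n : ℕ → ℝ)
    (hn : ∀ l, n l = if r ≤ l then max 1 (((range (r+1)).filter (fun i ↦ l < φ i)).card : ℝ) else 1) :
    ∑ l ∈ range (τ+1), n l - ∑ i ∈ range (r+1), ∑ l ∈ range (φ i), log (n l) ≤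
      τ + 1 - ∑ k ∈ range r, fordA (k+1) * φ (k+1) + r°*r*r := by
  have e1 : ∑ i ∈ range (r+1), ∑ l ∈ range (φ i), log (n l) =
      ∑ l ∈ range τ, (((range (r+1)).filter (fun i ↦ l < φ i)).card : ℝ) * log (n l) := by
    calc _ = ∑ i ∈ range (r+1), ∑ l ∈ range τ, if l < φ i then log (n l) else 0 := by
          apply sum_congr rfl; intro i hi
          rw [← sum_filter]; apply sum_congr _ (fun _ _ ↦ rfl)
          ext l; simp only [mem_range, mem_filter]
          have := hφ 0 i ⋆ (by have := mem_range.1 hi; omega)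
          omega
      _ = _ := by
          rw [sum_comm]; apply sum_congr rfl; intro l _
          rw [← sum_filter, sum_const, nsmul_eq_mul]
  have e2 : ∀ l ∈ range τ, n l - (((range (r+1)).filter (fun i ↦ l < φ i)).card : ℝ) * log (n l) ≤
      1 - ∑ k ∈ range r, if r ≤ l ∧ l < φ (k+1) then fordA (k+1) else 0 := by
    intro l hl
    by_cases hrl : r ≤ l
    · have hex : ∃ k, r ≤ k ∨ φ (k+1) ≤ l := ⟨r, Or.inl le_rfl⟩
      set m := Nat.find hex with hm
      have hmr : m ≤ r := Nat.find_min' hex (Or.inl le_rfl)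
      have hlt : ∀ k < m, k < r ∧ l < φ (k+1) := fun k hk ↦ by
        have := Nat.find_min hex hk; push Not at this; exact this
      have hge : ∀ k, m ≤ k → k < r → φ (k+1) ≤ l := fun k hk hkr ↦ by
        rcases Nat.find_spec hex with h | h
        · omega
        · exact (hφ (m+1) (k+1) ⋆ ⋆).trans h
      have hcard : (range (r+1)).filter (fun i ↦ l < φ i) = range (m+1) := by
        ext i; simp only [mem_filter, mem_range]
        rcases i with _ | i
        · have := mem_range.1 hl; constructor
          · intro _; omega
          · intro _; exact ⟨by omega, by omega⟩
        · constructor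
          · rintro ⟨h1, h2⟩; by_contra hc; have := hge i ⋆ ⋆; omega
          · intro h1; have := hlt i ⋆; exact ⟨by omega, this.2⟩
      have hsum : ∑ k ∈ range r, (if r ≤ l ∧ l < φ (k+1) then fordA (k+1) else 0) = ∑ k ∈ range m, fordA (k+1) := by
        rw [← sum_filter]; apply sum_congr _ (fun _ _ ↦ rfl)
        ext k; simp only [mem_filter, mem_range]
        constructor
        · rintro ⟨h1, h2, h3⟩; by_contra hc; have := hge k ⋆ h1; omega
        · intro h1; exact ⟨(hlt k h1).1, hrl, (hlt k h1).2⟩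
      have hnl : n l = ((m+1:ℕ):ℝ) := by
        rw [hn l, if_pos hrl, hcard, card_range, max_eq_right]; push_cast; linarith [(Nat.cast_nonneg m : 0° ≤ m)]
      rw [hsum, ← ford_tele m, hcard, card_range, hnl]
    · rw [hn l, if_neg hrl, log_one]
      rw [sum_eq_zero (fun k _ ↦ if_neg (fun h ↦ hrl h.1))]; simp
  have e3 := sum_le_sum e2
  rw [sum_sub_distrib, sum_sub_distrib, sum_comm] at e3
  have hnτ : n τ = 1 := by
    rw [hn τ]; split_ifs
    · rw [filter_eq_empty_iff.2]
      · simp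
      · intro i hi; have := hφ 0 i ⋆ (by have := mem_range.1 hi; omega); omega
    · rfl
  have e4 : ∑ k ∈ range r, fordA (k+1) * φ (k+1) - r°*r*r ≤ ∑ k ∈ range r, ∑ l ∈ range τ, if r ≤ l ∧ l < φ (k+1) then fordA (k+1) else 0 := by
    have : r°*r*r = ∑ k ∈ range r, r°*r := by simp; ring
    rw [this, ← sum_sub_distrib]; apply sum_le_sum; intro k hk
    have hk' := mem_range.1 hk
    rw [← sum_filter, sum_const, nsmul_eq_mul]
    have hs : (range τ).filter (fun l ↦ r ≤ l ∧ l < φ (k+1)) = Finset.Ico r (φ (k+1)) := by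
      ext l; simp only [mem_filter, mem_range, mem_Ico]; have := hφ 0 (k+1) ⋆ ⋆; omega
    rw [hs, Nat.card_Ico]
    have h1 : (φ (k+1):ℝ) - r ≤ ((φ (k+1) - r : ℕ):ℝ) := by
      have : φ (k+1) ≤ (φ (k+1) - r) + r := by omega
      have : ((φ (k+1):ℕ):ℝ) ≤ ((φ (k+1) - r : ℕ):ℝ) + r := by exact_mod_cast this
      linarith
    have h2 := mul_le_mul_of_nonneg_right h1 (fordA_succ_pos k).le
    have h3 : fordA (k+1) ≤ r := (fordA_le' (k+1)).trans (by exact_mod_cast hk')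
    have h4 := mul_le_mul_of_nonneg_right h3 (Nat.cast_nonneg r : 0° ≤ r)
    linarith
  rw [sum_range_succ, hnτ, e1]
  simp only [sum_const, card_range, nsmul_eq_mul, mul_one] at e3
  linarith
end

open Finset Real
noncomputable section

theorem lev_zero : lev 0 = 0 := by simp [lev]

theorem prof_anti {t : ℕ} {L : List ℕ} (h : L.Pairwise (· > ·)) (h2 : ∀ q ∈ L, q ∈ PR t) {i j : ℕ} (hij : i ≤ j) :
    lev (L.getD j 0) ≤ lev (L.getD i 0) := by
  rcases lt_or_ge j L.length with hj | hj
  · rw [List.getD_eq_getElem _ _ hj, List.getD_eq_getElem _ _ ⋆]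
    apply lev_mono (mem_PR.1 (h2 _ (List.getElem_mem hj))).1.two_le
    rcases hij.eq_or_lt with rfl | hlt
    · exact le_rfl
    · exact (List.pairwise_iff_getElem.1 h i j ⋆ hj hlt).le
  · rw [List.getD_eq_default _ _ hj, lev_zero]; omega

theorem fail_ineq {r T : ℕ} {L : List ℕ} (h : Fail (bco r) T L) :
    T < lev (L.getD 0 0) ∧ (1+1/r°) * lev (L.getD 0 0) < ∑ k ∈ range r, fordA (k+1) * lev (L.getD (k+1) 0) := by
  obtain ⟨q, L', rfl, h1, h2⟩ := h
  refine ⟨h1, ?_⟩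
  have hr0 : 0° < 1+1/r° := by positivity
  have h3 : dotL (fun n ↦ bco r (n+1)) (L'.map lev) ≤ ∑ k ∈ range r, fordA (k+1)/(1+1/r°) * lev (L'.getD k 0) := by
    unfold dotL
    have e : ∀ i, (L'.map lev).getD i 0 = lev (L'.getD i 0) := fun i ↦ by
      rw [← List.getD_map (f := lev), lev_zero]
    simp only [e]
    rw [← sum_filter_of_ne (p := fun i ↦ i < r) (fun i _ hi ↦ by
      by_contra hc; exact hi (by rw [bco, if_neg ⋆, zero_mul]))]
    refine le_trans (sum_le_sum_of_subset_of_nonneg (t := range r) (fun i hi ↦ mem_range.2 (mem_filter.1 hi).2) (fun i _ _ ↦ 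
      mul_nonneg (bco_nonneg r i) ♯)) (le_of_eq (sum_congr rfl fun i hi ↦ ?_))
    rw [bco, if_pos (by have := mem_range.1 hi; omega)]
  have h4 := h2.trans_le h3
  simp only [List.getD_cons_zero, List.getD_cons_succ]
  have e : ∑ k ∈ range r, fordA (k+1)/(1+1/r°) * lev (L'.getD k 0) = (∑ k ∈ range r, fordA (k+1) * lev (L'.getD k 0))/(1+1/r°) := by
    rw [sum_div]; exact sum_congr rfl fun k _ ↦ by ring
  rw [e, lt_div_iff₀ hr0] at h4
  linarith

theorem EE_big {R : ℝ} (h : 20 ≤ R) : 2*(R+1) ≤ EE R := by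
  have h5 : exp R = exp (R/2)*exp (R/2) := by rw [← exp_add]; congr 1; ring
  have h6 := add_one_le_exp (R/2)
  have h7 : (R/2+1)*(R/2+1) ≤ exp (R/2)*exp (R/2) := mul_le_mul h6 h6 ♭ ♯
  have h8 : exp R ≤ EE R := by unfold EE; linarith [add_one_le_exp (exp R)]
  nlinarith

set_option maxHeartbeats 1000000 in
theorem fiber (κ : ℝ) (hκ : 1 ≤ κ) : ∃ r0 : ℕ, 20 ≤ r0 ∧ ∀ r ≥ r0, ∀ t : ℕ, (t+1:ℝ) ≤ exp (κ*r) → ∀ (φ : ℕ → ℕ) (W : Finset ℕ),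
    (∀ w ∈ W, ∃ L : List ℕ, L.Pairwise (· > ·) ∧ (∀ q ∈ L, q ∈ PR t) ∧ wl L = w ∧ Fail (bco r) (r^20) L ∧
      ∀ i ≤ r, lev (L.getD i 0) = φ i) → ∑ w ∈ W, 1°/w ≤ 2 * exp (-r°^10) * Rs t := by
  classical
  obtain ⟨C, hC1, hC⟩ := LD
  obtain ⟨M, hM1, hM⟩ := cm_lev_sum
  refine ⟨⌈2*C⌉₊ + ⌈9*κ⌉₊ + ⌈M⌉₊ + 20, by omega, fun r hr t ht φ W hW ↦ ?_⟩
  rcases W.eq_empty_or_nonempty with rfl | ⟨w0, hw0⟩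
  · rw [sum_empty]; exact mul_nonneg ♯ (Rs_nonneg t)
  have hr20 : 20° ≤ r := by exact_mod_cast (by omega : 20 ≤ r)
  have hrC : 2*C ≤ r := (Nat.le_ceil _).trans (by exact_mod_cast (by omega : ⌈2*C⌉₊ ≤ r))
  have hrκ : 9*κ ≤ r := (Nat.le_ceil _).trans (by exact_mod_cast (by omega : ⌈9*κ⌉₊ ≤ r))
  have hrM : M ≤ r := (Nat.le_ceil _).trans (by exact_mod_cast (by omega : ⌈M⌉₊ ≤ r))
  set R : ℝ := r° with hR
  have hR0 : 0 < R := by linarith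
  have hpm : ∀ i j : ℕ, i ≤ j → R^i ≤ R^j := fun i j h ↦ pow_le_pow_right₀ ♭ h
  set τ := φ 0 with hτ
  obtain ⟨L0, hL1, hL2, hL3, hL4, hL5⟩ := hW w0 hw0
  have hanti : ∀ i j, i ≤ j → j ≤ r → φ j ≤ φ i := fun i j hij hj ↦ by
    rw [← hL5 j hj, ← hL5 i ⋆]; exact prof_anti hL1 hL2 hij
  obtain ⟨hf1, hf2⟩ := fail_ineq hL4
  rw [hL5 0 ⋆, ← hτ] at hf1 hf2
  rw [sum_congr rfl (fun k hk ↦ by rw [hL5 (k+1) (by have := mem_range.1 hk; omega)])] at hf2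
  have hτr : R^20 ≤ τ := by rw [hR]; exact_mod_cast hf1.le
  have hτ0 : 0° < τ := lt_of_lt_of_le ♯ hτr
  have hlevτ : ∀ L : List ℕ, L.Pairwise (· > ·) → (∀ q ∈ L, q ∈ PR t) → lev (L.getD 0 0) = τ → ∀ q ∈ L, lev q ≤ τ := by
    intro L h1 h2 h3 q hq
    obtain ⟨i, hi, rfl⟩ := List.getElem_of_mem hq
    rw [← List.getD_eq_getElem L 0 hi, ← h3]; exact prof_anti h1 h2 (Nat.zero_le i)
  have hτt : τ ≤ t := by
    rw [hτ, ← hL5 0 ⋆]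
    obtain ⟨q, L', rfl, -⟩ := hL4
    exact (mem_PR.1 (hL2 q (by simp))).2
  set n : ℕ → ℝ := fun l ↦ if r ≤ l then max 1 (((range (r+1)).filter (fun i ↦ l < φ i)).card : ℝ) else 1 with hn
  have hn1 : ∀ l, 1 ≤ n l ∧ n l ≤ R+1 := fun l ↦ by
    simp only [hn]; split_ifs
    · refine ⟨le_max_left _ _, max_le ♭ ?_⟩
      have := card_filter_le (range (r+1)) (fun i ↦ l < φ i)
      rw [card_range] at this; rw [hR]; exact_mod_cast this
    · exact ⟨le_rfl, by linarith⟩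
  set g : ℕ → ℝ := fun l ↦ log (n l) with hg
  have hg0 : ∀ l, 0 ≤ g l ∧ g l ≤ R := fun l ↦ ⟨log_nonneg (hn1 l).1, by
    have := log_le_sub_one_of_pos (lt_of_lt_of_le one_pos (hn1 l).1); simp only [hg]; linarith [(hn1 l).2]⟩
  set e0 : ℝ := τ/R^3 with he0
  set u : ℝ := τ/R^9 with hu
  have hτu : τ° = u*R^9 := by rw [hu]; field_simp
  have hu11 : R^11 ≤ u := by rw [hu, le_div_iff₀ ♯]; rw [← pow_add]; exact hτr
  have hu0 : 0 < u := lt_of_lt_of_le ♯ hu11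
  have h2R : R^2 ≤ R^10 := hpm 2 10 ♮
  have h3R : R^3 ≤ R^10 := hpm 3 10 ♮
  have h11 : R^11 = R * R^10 := by ring
  have hX : 1° ≤ R^10 := one_le_pow₀ ♭
  set Tb := (PR t).filter (fun q ↦ lev q ≤ τ ∧ ad (fun p ↦ g (lev p)) (q-1) < ∑ l ∈ range (lev q), g l - e0) with hTb
  -- abnormal primes
  have hab : ∑ q ∈ Tb, 1/(q°-1) ≤ exp (-R^10) := by
    rw [← sum_fiberwise_of_maps_to (t := range (t+1)) (g := lev) (fun q hq ↦ by
      have := (mem_PR.1 (mem_filter.1 hq).1).2; exact mem_range.2 ⋆)]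
    have hb : ∀ a ∈ range (t+1), ∑ q ∈ Tb with lev q = a, 1/(q°-1) ≤ C * (2*(t+1:ℝ)^8 * exp (-(R^11/2))) := by
      intro a ha
      have hat : a° ≤ t := by have := mem_range.1 ha; exact_mod_cast (by omega : a ≤ t)
      rcases (Tb.filter (fun q ↦ lev q = a)).eq_empty_or_nonempty with he | ⟨q0, hq0⟩
      · rw [he, sum_empty]; positivity
      obtain ⟨hq0, hq0a⟩ := mem_filter.1 hq0
      obtain ⟨hq1, hq2, hq3⟩ := mem_filter.1 hq0
      rw [hq0a] at hq3 hq2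
      have h1 : e0 < a * R := by
        have h2 := ad_nonneg (f := fun p ↦ g (lev p)) (fun p ↦ (hg0 _).1) (q0-1)
        have h3 : ∑ l ∈ range a, g l ≤ a * R := by
          refine (sum_le_sum fun l _ ↦ (hg0 l).2).trans (by simp)
        linarith
      have haR : u * R^5 < a := by
        have : e0 = u*R^5*R := by rw [he0, hτu]; field_simp
        rw [this] at h1; exact lt_of_mul_lt_mul_right h1 hR0.le
      have ha16 : R^11 ≤ a := by
        have : u*1 ≤ u*R^5 := by gcongr; exact one_le_pow₀ ♭
        linarith
      have h20a : R ≤ a := by have := hpm 1 11 ♮; rw [pow_one] at this; linarith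
      have h := hC r a (fun l ↦ -g l) e0 (Tb.filter (fun q ↦ lev q = a)) ⋆ (by
        have : 10° ≤ a := by linarith
        exact_mod_cast this) (fun l ↦ by rw [abs_neg, abs_of_nonneg (hg0 l).1]; exact (hg0 l).2) ♯ (fun q hq ↦ by
        obtain ⟨hq0, hq0a⟩ := mem_filter.1 hq
        obtain ⟨hq1, hq2, hq3⟩ := mem_filter.1 hq0
        refine ⟨(mem_PR.1 hq1).1, hq0a, ?_⟩
        have : ad (fun p ↦ -g (lev p)) (q-1) = - ad (fun p ↦ g (lev p)) (q-1) := by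
          have := ad_smul (-1) (fun p ↦ g (lev p)) (q-1); simpa using this
        rw [this, sum_neg_distrib]; rw [hq0a] at hq3; linarith)
      refine h.trans (mul_le_mul_of_nonneg_left ?_ ♭)
      have h5 : exp (-(e0/r^6) + (a+1)/r^10) ≤ exp (-(R^11/2)) := by
        apply exp_le_exp.2
        have e1 : e0/r°^6 = u := by rw [he0, ← hR, hu]; field_simp
        have e2 : (a°+1)/r°^10 ≤ u/2 := by
          rw [← hR, div_le_iff₀ ♯]
          have h6 : a° ≤ τ := by exact_mod_cast hq2
          have h7 : u/2*R^10 = u*R^9 * (R/2) := by ring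
          rw [h7, ← hτu]
          have : τ°*2 ≤ τ*(R/2) := by gcongr; linarith
          have : 1° ≤ τ := by linarith [hpm 0 20 ♮, pow_zero R]
          linarith
        linarith
      have h6 : exp (-a°^2+5*a+5) ≤ exp (-(R^11/2)) := by
        apply exp_le_exp.2; clear * - ha16 h20a hr20; nlinarith
      have h7 : (a+1:ℝ)^8 ≤ (t+1:ℝ)^8 := by gcongr
      have h8 : 1° ≤ (t+1:ℝ)^8 := one_le_pow₀ (by linarith [(Nat.cast_nonneg t : 0° ≤ t)])
      calc _ ≤ (t+1:ℝ)^8 * exp (-(R^11/2)) + 1*exp (-(R^11/2)) := by gcongr; linarith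
        _ ≤ (t+1:ℝ)^8 * exp (-(R^11/2)) + (t+1:ℝ)^8 * exp (-(R^11/2)) := by gcongr
        _ = _ := by ring
    refine (sum_le_sum hb).trans ?_
    rw [sum_const, card_range, nsmul_eq_mul]; push_cast
    calc (t°+1) * (C * (2*(t+1:ℝ)^8 * exp (-(R^11/2)))) = 2*C * (t+1:ℝ)^9 * exp (-(R^11/2)) := by ring
      _ ≤ exp R * (exp (κ*R))^9 * exp (-(R^11/2)) := by
          have := add_one_le_exp R
          gcongr; linarith
      _ = exp (R + 9*(κ*R) - R^11/2) := by
          rw [← exp_nat_mul, ← exp_add, ← exp_add]; congr 1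
      _ ≤ exp (-R^10) := by
          apply exp_le_exp.2
          have := mul_le_mul_of_nonneg_right hrκ hR0.le
          have : 20*R^10 ≤ R*R^10 := by gcongr
          nlinarith
  choose! Lw hLw using hW
  set Wa := W.filter (fun w ↦ ∃ q ∈ Lw w, q ∈ Tb) with hWa
  rw [← sum_filter_add_sum_filter_not W (fun w ↦ ∃ q ∈ Lw w, q ∈ Tb)]
  have hA : ∑ w ∈ W with ∃ q ∈ Lw w, q ∈ Tb, 1°/w ≤ exp (-R^10) * Rs t := by
    have h := sum_cover (W.filter (fun w ↦ ∃ q ∈ Lw w, q ∈ Tb)) (Tb ×ˢ Vs t) (fun x ↦ (x.1-1)*x.2) (fun w ↦ 1°/w) (fun _ ↦ by positivity) (by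
      intro w hw
      obtain ⟨hw, q, hq, hqT⟩ := mem_filter.1 hw
      obtain ⟨h1, h2, h3, -, -⟩ := hLw w hw
      refine ⟨(q, wl ((Lw w).erase q)), mem_product.2 ⟨hqT, mem_Vs.2 ⟨_, h1.sublist List.erase_sublist, fun x hx ↦ h2 x (List.mem_of_mem_erase hx), rfl⟩⟩, ?_⟩
      dsimp only
      rw [← wl_cons]; refine Eq.trans ?_ h3
      exact (((List.perm_cons_erase hq).map _).prod_eq).symm)
    refine h.trans ?_
    rw [sum_product]
    have e : ∀ q ∈ Tb, ∑ w ∈ Vs t, 1°/(((q-1)*w : ℕ):ℝ) = 1/(q°-1) * Rs t := fun q hq ↦ by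
      rw [Rs, mul_sum]; apply sum_congr rfl; intro w _
      have := (mem_PR.1 (mem_filter.1 hq).1).1.two_le
      push_cast [Nat.cast_sub (by omega : 1 ≤ q)]; rw [div_mul_div_comm, one_mul]
    rw [sum_congr rfl e, ← sum_mul]
    exact mul_le_mul_of_nonneg_right hab (Rs_nonneg t)
  have hB : ∑ w ∈ W with ¬ ∃ q ∈ Lw w, q ∈ Tb, 1°/w ≤ exp (-R^10) * 1 := by
    set Wn := W.filter (fun w ↦ ¬ ∃ q ∈ Lw w, q ∈ Tb) with hWn
    set H : ℝ := ∑ i ∈ range (r+1), ∑ l ∈ range (φ i), g l - (R+1)*e0 with hH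
    have h1 : ∀ w ∈ Wn, H ≤ ad (fun p ↦ g (lev p)) w := by
      intro w hw
      obtain ⟨hw, hnq⟩ := mem_filter.1 hw
      obtain ⟨h1, h2, h3, h4, h5⟩ := hLw w hw
      rw [← h3, ad_wl _ h2]
      refine le_trans ?_ (getD_sum_le (f := fun q ↦ ad (fun p ↦ g (lev p)) (q-1)) (fun n ↦ ad_nonneg (fun p ↦ (hg0 _).1) _) (by simp [ad]) (Lw w) (r+1))
      have e : (R+1)*e0 = ∑ i ∈ range (r+1), e0 := by simp [hR]
      rw [hH, e, ← sum_sub_distrib]; apply sum_le_sum; intro i hi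
      have hi := mem_range.1 hi
      rw [← h5 i ⋆]
      rcases lt_or_ge i (Lw w).length with hil | hil
      · have hm : (Lw w).getD i 0 ∈ Lw w := by rw [List.getD_eq_getElem _ _ hil]; exact List.getElem_mem hil
        by_contra hc; push Not at hc
        exact hnq ⟨_, hm, mem_filter.2 ⟨h2 _ hm, hlevτ _ h1 h2 (h5 0 ⋆) _ hm, hc⟩⟩
      · rw [List.getD_eq_default _ _ hil, lev_zero]
        have : 0 ≤ e0 := by positivity
        simp [ad, this]
    have h2 := hM τ n (R+1) ♭ (fun l _ ↦ ⟨by linarith [(hn1 l).1], (hn1 l).2⟩) (fun p hp ↦ by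
      obtain ⟨hp1, hp2⟩ := mem_PR.1 hp
      have hp2' : 2° ≤ p := by exact_mod_cast hp1.two_le
      rw [div_le_iff₀ ♭]
      by_cases hl : r ≤ lev p
      · have h3 := lev_lt_of (l := r) ⋆ hl
        linarith [(hn1 (lev p)).2, EE_big hr20]
      · simp only [hn]; rw [if_neg hl]; linarith) Wn (fun w hw ↦ by
      obtain ⟨hw, hnq⟩ := mem_filter.1 hw
      obtain ⟨h1, h2, h3, h4, h5⟩ := hLw w hw
      rw [← h3]
      exact ⟨(wl_pos h2).ne', wl_factors fun q hq ↦ ⟨(mem_PR.1 (h2 q hq)).1, hlevτ _ h1 h2 (h5 0 ⋆) q hq⟩⟩)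
    have h3 : ∑ w ∈ Wn, 1°/w ≤ exp (-H) * ∑ w ∈ Wn, cm (fun p ↦ n (lev p)) w / w := by
      rw [mul_sum]; apply sum_le_sum; intro w hw
      have e : cm (fun p ↦ n (lev p)) w = exp (ad (fun p ↦ g (lev p)) w) := by
        rw [← cm_exp]; apply cm_congr; intro p _
        rw [hg, exp_log (lt_of_lt_of_le one_pos (hn1 _).1)]
      rw [e, ← mul_div_assoc, ← exp_add]
      exact div_le_div_of_nonneg_right (one_le_exp (by linarith [h1 w hw])) ♯
    refine h3.trans ((mul_le_mul_of_nonneg_left h2 (exp_pos _).le).trans ?_)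
    rw [mul_one, ← exp_add]; apply exp_le_exp.2
    have h4 := expo r τ φ hanti rfl n (fun l ↦ rfl)
    have h5 : (1+1/R)*τ = τ + u*R^8 := by rw [hτu]; field_simp
    have h6 : (R+1)*e0 = u*R^7 + u*R^6 := by rw [he0, hτu]; field_simp
    rw [← hR, h5] at hf2
    rw [← hR] at h4
    simp only [hg] at hH
    rw [hH, h6]
    have h7 : M*(R+1)^2 ≤ R*(2*R)^2 := by gcongr; linarith
    have h8 : u*R^6 ≤ u*R^7 := mul_le_mul_of_nonneg_left (hpm 6 7 ♮) hu0.le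
    have h9 : u*R^7*20 ≤ u*R^7*R := by gcongr
    have h10 : u*R^8 = u*R^7*R := by ring
    have h11' : u*1 ≤ u*R^7 := mul_le_mul_of_nonneg_left (one_le_pow₀ ♭) hu0.le
    have h12 : 20*R^10 ≤ R*R^10 := by gcongr
    have h13 : R*(2*R)^2 = 4*R^3 := by ring
    have h14 : R*R*R = R^3 := by ring
    linarith
  have h1R : 1 ≤ Rs t := one_le_Rs t
  have : exp (-R^10) * 1 ≤ exp (-R^10) * Rs t := mul_le_mul_of_nonneg_left h1R (exp_pos _).le
  linarith
end

open Finset Real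
noncomputable section

theorem FordData.Fbound (κ : ℝ) (hκ : 1 ≤ κ) : ∃ r0 : ℕ, 20 ≤ r0 ∧ ∀ r ≥ r0, ∀ t : ℕ, (t+1:ℝ) ≤ exp (κ*r) →
    ∑ w ∈ Fset (bco r) (r^20) t, 1°/w ≤ exp (κ*r*(r+1)) * (2 * exp (-r°^10) * Rs t) := by
  classical
  obtain ⟨r0, h20, H⟩ := fiber κ hκ
  refine ⟨r0, h20, fun r hr t ht ↦ ?_⟩
  have hF : ∀ w ∈ Fset (bco r) (r^20) t, ∃ L : List ℕ, L.Pairwise (· > ·) ∧ (∀ q ∈ L, q ∈ PR t) ∧ wl L = w ∧ Fail (bco r) (r^20) L :=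
    fun w hw ↦ by unfold Fset at hw; exact (mem_filter.1 hw).2
  choose! Lw hLw using hF
  set pr : ℕ → (Fin (r+1) → Fin (t+1)) := fun w i ↦ Fin.ofNat (t+1) (lev ((Lw w).getD i 0)) with hpr
  rw [← sum_fiberwise_of_maps_to (t := (univ : Finset (Fin (r+1) → Fin (t+1)))) (g := pr) (fun _ _ ↦ mem_univ _)]
  refine (sum_le_card_nsmul _ _ (2 * exp (-r°^10) * Rs t) (fun φ _ ↦ ?_)).trans ?_
  · refine H r hr t ht (fun i ↦ if h : i < r+1 then φ ⟨i, h⟩ else 0) _ (fun w hw ↦ ?_)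
    obtain ⟨hw, hφ⟩ := mem_filter.1 hw
    obtain ⟨h1, h2, h3, h4⟩ := hLw w hw
    refine ⟨Lw w, h1, h2, h3, h4, fun i hi ↦ ?_⟩
    rw [dif_pos ⋆, ← hφ, hpr]
    have : lev ((Lw w).getD i 0) ≤ t := by
      rcases lt_or_ge i (Lw w).length with hil | hil
      · rw [List.getD_eq_getElem _ _ hil]; exact (mem_PR.1 (h2 _ (List.getElem_mem hil))).2
      · rw [List.getD_eq_default _ _ hil, lev_zero]; omega
    simp only [Fin.ofNat]
    rw [Nat.mod_eq_of_lt ⋆]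
  · rw [nsmul_eq_mul]
    refine mul_le_mul_of_nonneg_right ?_ (mul_nonneg ♯ (Rs_nonneg t))
    rw [card_univ, Fintype.card_fun, Fintype.card_fin, Fintype.card_fin]; push_cast
    refine (pow_le_pow_left₀ ♯ ht _).trans (le_of_eq ?_)
    rw [← exp_nat_mul]; congr 1; push_cast; ring

theorem h5aux {C A κ r G l : ℝ} (hC : 0 ≤ C) (hA : 0 ≤ A) (hκ : 1 ≤ κ) (hr : 20 ≤ r) (hG : 0 ≤ G) (hG2 : G ≤ κ*r) (hl : l ≤ κ*r)
    (hB : C*κ^2 + A*(1+κ) + 2*κ + 2 ≤ r) : C*G^2 + A*(r + l) + κ*r*(r+1) + 2 ≤ r^10 := by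
  have a1 : C*G^2 ≤ C*(κ*r)^2 := by gcongr
  have a2 : A*(r+l) ≤ A*(r+κ*r) := by gcongr
  have hrr : r ≤ r^2 := by nlinarith
  have a3 : A*(1+κ)*r ≤ A*(1+κ)*r^2 := by gcongr
  have a4 : κ*r ≤ κ*r^2 := by gcongr
  have a5 : (C*κ^2 + A*(1+κ) + 2*κ + 2)*r^2 ≤ r*r^2 := by gcongr
  have a6 : r^3 ≤ r^10 := pow_le_pow_right₀ ♭ ♮
  linarith

set_option maxHeartbeats 800000 in
theorem FordData.stepR {ϱ : ℝ} (h : FordData ϱ) : ∃ K : ℝ, 1 ≤ K ∧ ∀ t : ℕ, 3 ≤ t → ∃ r : ℕ, 20 ≤ r ∧ r° ≤ K * log t ∧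
    Rs t ≤ exp (1/(2*log (1/ϱ)) * (log (t/log t))^2 + K * log t) * Rs (r^20) := by
  obtain ⟨A, hA1, hA⟩ := h.volA
  obtain ⟨c, hc0, hc1, hc⟩ := h.gren_ge
  have hlam : 0 < log (1/ϱ) := log_pos (by rw [lt_div_iff₀ h.pos]; linarith [h.lt])
  set lam := log (1/ϱ) with hlamdef
  set κ := max 1 lam with hκ
  obtain ⟨r0, hr20, hF⟩ := FordData.Fbound κ (le_max_left _ _)
  have hκ1 : 1 ≤ κ := le_max_left _ _
  set C := 1/(2*lam) with hC
  have hC0 : 0 < C := by positivity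
  set B := C*κ^2 + A*(1+κ) + 2*κ + 2 with hB
  have hB0 : 0 ≤ B := by positivity
  have hlc : 0 ≤ log (2/c) := log_nonneg (by rw [le_div_iff₀ hc0]; linarith)
  set K1 := 1/lam + log (2/c)/lam + 1 + (r0 + ⌈B⌉₊ : ℕ) with hK1
  have hK10 : 1 ≤ K1 := by rw [hK1]; have : 0 ≤ 1/lam := by positivity
                           have : 0 ≤ log (2/c)/lam := by positivity
                           have := (Nat.cast_nonneg (r0+⌈B⌉₊) : 0° ≤ _)
                           linarith
  refine ⟨A*(K1+1) + K1 + 1, by linarith [(by positivity : 0 ≤ A*(K1+1))], fun t ht ↦ ?_⟩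
  have ht' : 3° ≤ t := by exact_mod_cast ht
  have hlt : 1 ≤ log t := by
    rw [le_log_iff_exp_le ♭]; have := exp_one_lt_d9; linarith
  set r : ℕ := ⌈(log t + log (2/c))/lam⌉₊ + (r0 + ⌈B⌉₊) with hr
  have hx0 : 0 ≤ (log t + log (2/c))/lam := by positivity
  have hrK : r° ≤ K1 * log t := by
    have h1 := (Nat.ceil_lt_add_one hx0).le
    have h2 : r° = (⌈(log t + log (2/c))/lam⌉₊:ℝ) + (r0 + ⌈B⌉₊ : ℕ) := by rw [hr]; push_cast; ring
    have h3 : log (2/c)/lam + 1 + (r0 + ⌈B⌉₊ : ℕ) ≤ (log (2/c)/lam + 1 + (r0 + ⌈B⌉₊ : ℕ)) * log t :=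
      le_mul_of_one_le_right ♯ hlt
    rw [h2, hK1]
    have : (log t + log (2/c))/lam = 1/lam*log t + log (2/c)/lam := by ring
    linarith
  have hr20' : 20 ≤ r := by omega
  have hrl : log t + log (2/c) ≤ lam * r := by
    have h1 := Nat.le_ceil ((log t + log (2/c))/lam)
    have h2 : (⌈(log t + log (2/c))/lam⌉₊:ℝ) ≤ r := by rw [hr]; exact_mod_cast ⋆
    have := (div_le_iff₀ hlam).1 (h1.trans h2); linarith
  have h2t : 2/c*t ≤ exp (lam*r) := by
    rw [← log_le_iff_le_exp ♯, log_mul ♯ ♯]; linarith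
  have hgr : t° < gren (bco r) r := by
    refine lt_of_lt_of_le ?_ (hc r ⋆ r le_rfl)
    have : (1/ϱ)^r = exp (lam*r) := by
      rw [hlamdef, mul_comm, exp_nat_mul, exp_log (one_div_pos.2 h.pos)]
    rw [this]
    have h3 := mul_le_mul_of_nonneg_left h2t hc0.le
    have : c*(2/c*t) = 2*t := by field_simp
    linarith
  have hrR : 0° ≤ r := by positivity
  have htκ : (t+1:ℝ) ≤ exp (κ*r) := by
    have h3 : exp (lam*r) ≤ exp (κ*r) := exp_le_exp.2 (mul_le_mul_of_nonneg_right (le_max_right _ _) hrR)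
    have h4 : 2 ≤ 2/c := by rw [le_div_iff₀ hc0]; linarith
    have := mul_le_mul_of_nonneg_right h4 (by linarith : 0° ≤ t)
    linarith
  refine ⟨r, hr20', hrK.trans (mul_le_mul_of_nonneg_right (by linarith [(by positivity : 0 ≤ A*(K1+1))]) ♭), ?_⟩
  have h1 := stepA (b := bco r) (T := r^20) (bco_nonneg r) hgr
  have h2 := hA r t ht ⋆
  have h3 := hF r ⋆ t htκ
  set V := ∑ m ∈ range (r+1), ∑ M ∈ PG (bco r) t m, 1°/(wl M) with hV
  have hV0 : 0 ≤ V := sum_nonneg fun _ _ ↦ sum_nonneg fun _ _ ↦ by positivity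
  set G := log (t/log t) with hG
  have hGt : 0 ≤ G ∧ G ≤ log t := by
    have := log_le_sub_one_of_pos (by linarith : 0° < t)
    refine ⟨log_nonneg (by rw [le_div_iff₀ ♭]; linarith), log_le_log ♯ ?_⟩
    rw [div_le_iff₀ ♭]; exact le_mul_of_one_le_right ♭ hlt
  have hlκ : log t ≤ κ*r := by
    rw [log_le_iff_le_exp ♭]; linarith
  have hBr : B ≤ r := (Nat.le_ceil _).trans (by rw [hr]; exact_mod_cast ⋆)
  have hr20R : 20° ≤ r := by exact_mod_cast hr20'
  have h4 : V * (exp (κ*r*(r+1)) * (2 * exp (-r°^10))) ≤ 1/2 := by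
    have e4 : 4° ≤ exp 2 := le_trans ♮ (quadratic_le_exp_of_nonneg ♮)
    have h5 : C*G^2 + A*(r + log t) + κ*r*(r+1) + 2 ≤ r°^10 :=
      h5aux hC0.le ♭ hκ1 hr20R hGt.1 (hGt.2.trans hlκ) hlκ (by rw [← hB]; exact hBr)
    calc V * (exp (κ*r*(r+1)) * (2 * exp (-r°^10)))
        ≤ exp (C*G^2 + A*(r+log t)) * (exp (κ*r*(r+1)) * (2 * exp (-r°^10))) := by gcongr
      _ = 2 * exp (C*G^2 + A*(r+log t) + κ*r*(r+1) - r°^10) := by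
          rw [sub_eq_add_neg, exp_add _ (-r°^10), exp_add _ (κ*r*(r+1))]; ring
      _ ≤ 2 * exp (-2) := by gcongr; linarith
      _ ≤ 1/2 := by rw [exp_neg, ← div_eq_mul_inv, div_le_iff₀ ♯]; linarith
  have h5 : Rs t ≤ 2 * V * Rs (r^20) := by
    have h6 := mul_le_mul_of_nonneg_left h3 hV0
    have h7 := mul_le_mul_of_nonneg_right h4 (Rs_nonneg t)
    rw [mul_add] at h1
    linarith
  refine h5.trans (mul_le_mul_of_nonneg_right ?_ (Rs_nonneg _))
  calc 2*V ≤ exp 1 * exp (C*G^2 + A*(r+log t)) := by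
        have := add_one_le_exp 1
        gcongr; linarith
    _ ≤ _ := by
        rw [← exp_add]; apply exp_le_exp.2
        have : A*r ≤ A*(K1*log t) := by gcongr
        have : 1*1 ≤ K1*log t := mul_le_mul hK10 hlt ♮ ♭
        linarith

theorem FordData.Rs_bound {ϱ : ℝ} (h : FordData ϱ) : ∃ A : ℝ, 1 ≤ A ∧ ∀ t : ℕ, 3 ≤ t →
    Rs t ≤ exp (1/(2*log (1/ϱ)) * (log (t/log t))^2 + A * log t) := by
  obtain ⟨K, hK1, hK⟩ := h.stepR
  obtain ⟨M, hM1, hM⟩ := Rs_trivial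
  have hlam : 0 < log (1/ϱ) := log_pos (by rw [lt_div_iff₀ h.pos]; linarith [h.lt])
  set C := 1/(2*log (1/ϱ)) with hC
  have hC0 : 0 < C := by positivity
  obtain ⟨P, hP⟩ : ∃ P : ℝ, P = (K*20)^20 := ⟨_, rfl⟩
  obtain ⟨Q, hQ⟩ : ∃ Q : ℝ, Q = (Nat.factorial 20 : ℕ) := ⟨_, rfl⟩
  have hP0 : 0 ≤ P := by rw [hP]; positivity
  have hQ0 : 0 ≤ Q := by rw [hQ]; positivity
  set D : ℝ := C*20^2*2 + K*20 + P*Q + M with hD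
  have hD0 : 0 ≤ D := by positivity
  refine ⟨D*K + K, by nlinarith, fun t ht ↦ ?_⟩
  obtain ⟨r, hr20, hrK, hr⟩ := hK t ht
  have h20 : 3 ≤ r^20 := by
    calc 3 ≤ r^1 := by rw [pow_one]; omega
      _ ≤ r^20 := Nat.pow_le_pow_right ⋆ ♮
  obtain ⟨s, hs20, hsK, hs⟩ := hK (r^20) h20
  have hr1 : 20° ≤ r := by exact_mod_cast hr20
  set ℓ := log r with hℓ
  have hℓ0 : 0 ≤ ℓ := log_nonneg ♭
  have he : exp ℓ = r := exp_log ♭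
  have hlT : log ((r^20:ℕ):ℝ) = 20*ℓ := by rw [Nat.cast_pow, log_pow, Nat.cast_ofNat]
  rw [hlT] at hsK hs
  have p1 : ℓ ≤ r := by have := add_one_le_exp ℓ; linarith
  have p2 : ℓ^2 ≤ 2*r := by
    have := pow_div_factorial_le_exp ℓ hℓ0 2
    rw [he, div_le_iff₀ ♯] at this; simpa [mul_comm] using this
  have p20 : ℓ^20 ≤ Q * r := by
    rw [hQ]
    have := pow_div_factorial_le_exp ℓ hℓ0 20
    rw [he, div_le_iff₀ ♯] at this; linarith
  have h3 := hM (s^20)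
  have hs0 : ((s^20:ℕ):ℝ) ≤ P*(Q * r) := by
    push_cast; rw [hP]
    calc s°^20 ≤ (K*(20*ℓ))^20 := by gcongr
      _ = (K*20)^20*ℓ^20 := by ring
      _ ≤ _ := by gcongr
  have hG : (log (((r^20:ℕ):ℝ)/(20*ℓ)))^2 ≤ (20*ℓ)^2 := by
    have hl3 : 1 ≤ ℓ := by rw [hℓ, le_log_iff_exp_le ♭]; have := exp_one_lt_d9; linarith
    have hT : 0° < ((r^20:ℕ):ℝ) := by positivity
    apply sq_le_sq'
    · have : 0 ≤ log (((r^20:ℕ):ℝ)/(20*ℓ)) := by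
        apply log_nonneg; rw [le_div_iff₀ ♭, ← hlT]
        have := log_le_sub_one_of_pos hT; linarith
      linarith
    · rw [← hlT]; apply log_le_log (div_pos hT (by rw [hlT]; linarith)); rw [hlT, div_le_iff₀ ♭]
      nlinarith
  have h4 : Rs (r^20) ≤ exp (D*r) := by
    refine hs.trans ((mul_le_mul_of_nonneg_left h3 (exp_pos _).le).trans ?_)
    rw [← exp_add]; apply exp_le_exp.2
    have a1 : C*(log (((r^20:ℕ):ℝ)/(20*ℓ)))^2 ≤ C*(20^2*(2*r)) := by
      refine mul_le_mul_of_nonneg_left (hG.trans ?_) hC0.le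
      rw [mul_pow]; gcongr
    have a2 : K*(20*ℓ) ≤ K*(20*r) := by gcongr
    have a3 : M*1 ≤ M*r := by gcongr; linarith
    rw [hD]; linarith
  refine hr.trans ((mul_le_mul_of_nonneg_left h4 (exp_pos _).le).trans ?_)
  rw [← exp_add]; apply exp_le_exp.2
  have := mul_le_mul_of_nonneg_left hrK hD0
  linarith
end

open Finset Real
noncomputable section

def pf (p e : ℕ) : ℝ := (p°-1)/((Nat.gcd (Nat.gcd 2 (p-1)) e : ℕ) : ℝ)
    * (if e = 1 then 1 else if e = 2 then p°-1 else p°^(e-3)*(p°^2-1))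

theorem psi_eq (N : ℕ) : psiMin N = ∏ p ∈ N.primeFactors, pf p (N.factorization p) := rfl

theorem pf_one {p : ℕ} : pf p 1 = p°-1 := by simp [pf]

theorem pf_gcd (p e : ℕ) : 1° ≤ (Nat.gcd (Nat.gcd 2 (p-1)) e : ℕ) ∧ ((Nat.gcd (Nat.gcd 2 (p-1)) e : ℕ):ℝ) ≤ 2 := by
  have h1 : 0 < Nat.gcd (Nat.gcd 2 (p-1)) e := Nat.gcd_pos_of_pos_left _ (Nat.gcd_pos_of_pos_left _ ♮)
  have h2 : Nat.gcd (Nat.gcd 2 (p-1)) e ≤ 2 := Nat.le_of_dvd ♮ ((Nat.gcd_dvd_left _ _).trans (Nat.gcd_dvd_left _ _))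
  exact ⟨by exact_mod_cast h1, by exact_mod_cast h2⟩

theorem pf_ge {p e : ℕ} (hp : p.Prime) (he : 1 ≤ e) : p°-1 ≤ pf p e := by
  have h2 : 2° ≤ p := by exact_mod_cast hp.two_le
  obtain ⟨g1, g2⟩ := pf_gcd p e
  by_cases h1 : e = 1
  · rw [h1, pf_one]
  have hk : ((Nat.gcd (Nat.gcd 2 (p-1)) e : ℕ):ℝ) ≤ (if e = 1 then 1 else if e = 2 then p°-1 else p°^(e-3)*(p°^2-1)) := by
    rw [if_neg h1]; split_ifs
    · rcases hp.eq_two_or_odd with rfl | h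
      · simp; norm_num
      · have : 3 ≤ p := by have := hp.two_le; omega
        have : 3° ≤ p := by exact_mod_cast this
        linarith
    · have : 1° ≤ p°^(e-3) := one_le_pow₀ ♭
      have : 3° ≤ p°^2-1 := by nlinarith
      nlinarith
  unfold pf
  rw [div_mul_eq_mul_div, le_div_iff₀ ♭]
  exact mul_le_mul_of_nonneg_left hk ♭

theorem pf_ge8 {p e : ℕ} (hp : p.Prime) (he : 1 ≤ e) : p°^e ≤ 8 * pf p e := by
  have h2 : 2° ≤ p := by exact_mod_cast hp.two_le
  obtain ⟨g1, g2⟩ := pf_gcd p e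
  have h3 : p°/4 ≤ (p°-1)/((Nat.gcd (Nat.gcd 2 (p-1)) e : ℕ) : ℝ) := by
    rw [le_div_iff₀ ♭]; nlinarith
  have h4 : p°^(e-1)/2 ≤ (if e = 1 then 1 else if e = 2 then p°-1 else p°^(e-3)*(p°^2-1)) := by
    split_ifs with h h'
    · rw [h]; norm_num
    · rw [h']; norm_num; linarith
    · rw [show e-1 = (e-3)+2 by omega, pow_add]
      have : p°^2/2 ≤ p°^2-1 := by nlinarith
      rw [mul_div_assoc]; exact mul_le_mul_of_nonneg_left this ♯
  have h5 := mul_le_mul h3 h4 ♯ (le_trans ♯ h3)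
  have e1 : p°^e = p * p°^(e-1) := by rw [← pow_succ', Nat.sub_add_cancel he]
  unfold pf; rw [e1]; linarith

theorem fac_pos {N p : ℕ} (hp : p ∈ N.primeFactors) : 1 ≤ N.factorization p :=
  Nat.pos_of_ne_zero (Finsupp.mem_support_iff.1 (by rwa [Nat.support_factorization]))

theorem pf_mem {N p : ℕ} (hp : p ∈ N.primeFactors) : p°-1 ≤ pf p (N.factorization p) ∧ 1 ≤ pf p (N.factorization p) := by
  have h := Nat.prime_of_mem_primeFactors hp
  have h2 : 2° ≤ p := by exact_mod_cast h.two_le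
  have := pf_ge h (fac_pos hp)
  exact ⟨this, by linarith⟩

theorem one_le_psi (N : ℕ) : 1 ≤ psiMin N := by
  rw [psi_eq]; exact one_le_prod fun p hp ↦ (pf_mem hp).2

theorem prime_le_psi {N p : ℕ} (hp : p ∈ N.primeFactors) : p°-1 ≤ psiMin N := by
  rw [psi_eq, ← mul_prod_erase _ _ hp]
  refine (pf_mem hp).1.trans (le_mul_of_one_le_right (by linarith [(pf_mem hp).2]) ?_)
  exact one_le_prod fun q hq ↦ (pf_mem (mem_of_mem_erase hq)).2

theorem four_pow_le (N : ℕ) : 4°^(omega N) ≤ 8 * psiMin N := by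
  have h : ∀ p ∈ N.primeFactors, 4° ≤ (if p = 2 then 4 else 1) * (if p = 3 then 2 else 1) * pf p (N.factorization p) := by
    intro p hp
    obtain ⟨h1, h2⟩ := pf_mem hp
    have hp' := Nat.prime_of_mem_primeFactors hp
    split_ifs with h3 h4 h4
    · omega
    · linarith
    · subst h4; norm_num at h1 ⊢; linarith
    · have : 5 ≤ p := by
        have := hp'.two_le
        by_contra hc
        have : p = 4 := by omega
        subst this; exact absurd hp' ♮
      have : 5° ≤ p := by exact_mod_cast this
      linarith
  have h1 := prod_le_prod (fun p _ ↦ by norm_num) h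
  rw [prod_const, prod_mul_distrib, prod_mul_distrib, ← psi_eq] at h1
  refine h1.trans (mul_le_mul_of_nonneg_right ?_ (by linarith [one_le_psi N]))
  rw [prod_ite_eq', prod_ite_eq']
  split_ifs <;> norm_num

theorem le_psi (N : ℕ) (hN : 1 ≤ N) : N° ≤ 8^(omega N) * psiMin N := by
  have h0 := Nat.prod_factorization_pow_eq_self (n := N) ⋆
  have h1 : N° = ∏ p ∈ N.primeFactors, p°^(N.factorization p) := by
    conv_lhs => rw [← h0]
    rw [Finsupp.prod, Nat.support_factorization]; push_cast; rfl
  rw [h1, psi_eq, omega, ← prod_const, ← prod_mul_distrib]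
  exact prod_le_prod (fun p _ ↦ by positivity) fun p hp ↦ pf_ge8 (Nat.prime_of_mem_primeFactors hp) (fac_pos hp)

theorem le_psi' (N : ℕ) (hN : 1 ≤ N) : N° ≤ 64 * psiMin N ^ 3 := by
  have h1 := le_psi N hN
  have h2 := four_pow_le N
  have h3 : 8°^(omega N) ≤ (4^(omega N))^2 := by
    rw [← pow_mul, mul_comm, pow_mul]; exact pow_le_pow_left₀ ♮ ♮ _
  have h0 := one_le_psi N
  calc N° ≤ 8^(omega N) * psiMin N := h1
    _ ≤ (8*psiMin N)^2 * psiMin N := by gcongr; exact h3.trans (pow_le_pow_left₀ ♯ h2 _)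
    _ = _ := by ring

theorem tw_prod {ι : Type*} (s : Finset ι) (f : ι → ℝ) (h : ∀ i ∈ s, f i = 0 ∨ f i = 1 ∨ f i = -1 ∨ f i = 2 ∨ f i = -2) :
    ∏ i ∈ s, f i = 0 ∨ ∃ a ≤ s.card, ∏ i ∈ s, f i = 2^a ∨ ∏ i ∈ s, f i = -2^a := by
  classical
  induction s using Finset.induction_on with
  | empty => right; exact ⟨0, le_rfl, by simp⟩
  | insert i s hi ih =>
    rw [prod_insert hi, card_insert_of_notMem hi]
    rcases ih (fun j hj ↦ h j (mem_insert_of_mem hj)) with h0 | ⟨a, ha, h1⟩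
    · left; rw [h0, mul_zero]
    · have e : 2°^(a+1) = 2*2^a := by ring
      rcases h i (mem_insert_self _ _) with hh | hh | hh | hh | hh
      · left; rw [hh, zero_mul]
      · right; refine ⟨a, by omega, ?_⟩; rw [hh]; rcases h1 with h1 | h1 <;> rw [h1] <;> simp
      · right; refine ⟨a, by omega, ?_⟩; rw [hh]; rcases h1 with h1 | h1 <;> rw [h1] <;> simp
      · right; refine ⟨a+1, by omega, ?_⟩; rw [hh, e]; rcases h1 with h1 | h1 <;> rw [h1] <;> simp
      · right; refine ⟨a+1, by omega, ?_⟩; rw [hh, e]; rcases h1 with h1 | h1 <;> rw [h1] <;> simp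

def TW (M : ℕ) : Finset ℝ := insert 0 ((range (M+1)).image (fun a ↦ 2°^a) ∪ (range (M+1)).image (fun a ↦ -2°^a))

theorem TW_card (M : ℕ) : (TW M).card ≤ 2*M+3 := by
  refine (card_insert_le _ _).trans ?_
  have := card_union_le ((range (M+1)).image (fun a ↦ 2°^a)) ((range (M+1)).image (fun a ↦ -2°^a))
  have h1 := card_image_le (s := range (M+1)) (f := fun a ↦ 2°^a)
  have h2 := card_image_le (s := range (M+1)) (f := fun a ↦ -2°^a)
  rw [card_range] at h1 h2; omega

theorem mem_TW {M : ℕ} {v : ℝ} (h : v = 0 ∨ ∃ a ≤ M, v = 2^a ∨ v = -2^a) : v ∈ TW M := by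
  unfold TW
  rcases h with rfl | ⟨a, ha, rfl | rfl⟩
  · exact mem_insert_self _ _
  · exact mem_insert_of_mem (mem_union_left _ (mem_image.2 ⟨a, mem_range.2 ⋆, rfl⟩))
  · exact mem_insert_of_mem (mem_union_right _ (mem_image.2 ⟨a, mem_range.2 ⋆, rfl⟩))

theorem TW_abs {M : ℕ} {v : ℝ} (h : v = 0 ∨ ∃ a ≤ M, v = 2^a ∨ v = -2^a) : |v| ≤ 2^M := by
  rcases h with rfl | ⟨a, ha, rfl | rfl⟩
  · simp
  · rw [abs_of_nonneg ♯]; exact pow_le_pow_right₀ ♮ ha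
  · rw [abs_neg, abs_of_nonneg ♯]; exact pow_le_pow_right₀ ♮ ha

theorem mu_cases (n : ℕ) : ((ArithmeticFunction.moebius n : ℤ):ℝ) = 0 ∨ ((ArithmeticFunction.moebius n : ℤ):ℝ) = 1 ∨ ((ArithmeticFunction.moebius n : ℤ):ℝ) = -1 := by
  have := ArithmeticFunction.abs_moebius_le_one (n := n)
  have h : ArithmeticFunction.moebius n = 0 ∨ ArithmeticFunction.moebius n = 1 ∨ ArithmeticFunction.moebius n = -1 := by
    have := abs_le.1 this; omega
  rcases h with h | h | h <;> rw [h] <;> simp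

theorem nu2_tw (N : ℕ) : nu2Min N = 0 ∨ ∃ a ≤ omega N, nu2Min N = 2^a ∨ nu2Min N = -2^a := by
  unfold nu2Min mval omega
  refine tw_prod _ _ fun p _ ↦ ?_
  dsimp only; split_ifs
  · rcases mu_cases (p^(N.factorization p - 1)) with h | h | h <;> rw [h] <;> norm_num
  all_goals norm_num

theorem nu3_tw (N : ℕ) : nu3Min N = 0 ∨ ∃ a ≤ omega N, nu3Min N = 2^a ∨ nu3Min N = -2^a := by
  unfold nu3Min mval omega
  refine tw_prod _ _ fun p _ ↦ ?_
  dsimp only; split_ifs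
  · rcases mu_cases (p^(N.factorization p - 1)) with h | h | h <;> rw [h] <;> norm_num
  all_goals norm_num

theorem nuInf_sq (N : ℕ) : 0 ≤ nuInfMin N ∧ nuInfMin N ^ 2 ≤ psiMin N := by
  constructor
  · unfold nuInfMin mval; exact prod_nonneg fun p _ ↦ by dsimp only; split_ifs <;> positivity
  · rw [psi_eq, nuInfMin, mval, ← prod_pow]
    refine prod_le_prod (fun p _ ↦ sq_nonneg _) fun p hp ↦ ?_
    split_ifs with h
    · obtain ⟨rfl, h1, h2⟩ := h
      have h8 := pf_ge8 (Nat.prime_of_mem_primeFactors hp) (fac_pos hp)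
      set e := N.factorization 2
      obtain ⟨m, hm⟩ := h1
      have : e/2-2 = m-2 := by omega
      rw [this, ← pow_mul]
      have h3 : 2°^e = 2^((m-2)*2) * 2^4 := by rw [← pow_add]; congr 1; omega
      push_cast at h8; rw [h3] at h8
      have : 0° < 2^((m-2)*2) := by positivity
      linarith
    · rw [zero_pow ♮]; linarith [(pf_mem hp).2]

theorem nuInf_ne {N : ℕ} (hN : 1 ≤ N) (h : nuInfMin N ≠ 0) : ∃ e, N = 2^e := by
  refine ⟨_, Nat.eq_prime_pow_of_unique_prime_dvd ⋆ (p := 2) fun {q} hq hd => ?_⟩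
  by_contra hc
  exact h (prod_eq_zero (Nat.mem_primeFactors.2 ⟨hq, hd, by omega⟩) (if_neg (fun hh ↦ hc hh.1)))

theorem psi_le_of_d {k N : ℕ} {x : ℝ} (hk : 2 ≤ k) (h : dMin k N ≤ (k°-1)/12*x) : psiMin N ≤ 2*x+1500 := by
  have hk' : 1° ≤ k-1 := by
    have : 2° ≤ k := by exact_mod_cast hk
    linarith
  have h1 := one_le_psi N
  set s := sqrt (psiMin N) with hs
  have hs2 : s^2 = psiMin N := sq_sqrt ♭
  have hs0 : 0 ≤ s := sqrt_nonneg _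
  obtain ⟨i0, i1⟩ := nuInf_sq N
  have hi : nuInfMin N ≤ s := le_sqrt_of_sq_le i1
  have ho : 2°^(omega N) ≤ 3*s := by
    apply le_of_sq_le_sq _ ♯
    rw [mul_pow, hs2, ← pow_mul, mul_comm, pow_mul]
    have := four_pow_le N
    norm_num; linarith
  have a2 := (TW_abs (nu2_tw N)).trans ho
  have a3 := (TW_abs (nu3_tw N)).trans ho
  have c2b : |c2 k| ≤ 1/4 := by unfold c2 chi4; split_ifs <;> norm_num
  have c3b : |c3 k| ≤ 1/3 := by unfold c3 chi3; split_ifs <;> norm_num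
  have b2 : |c2 k * nu2Min N| ≤ 1/4*(3*s) := by rw [abs_mul]; exact mul_le_mul c2b a2 (abs_nonneg _) ♮
  have b3 : |c3 k * nu3Min N| ≤ 1/3*(3*s) := by rw [abs_mul]; exact mul_le_mul c3b a3 (abs_nonneg _) ♮
  have bd : |delta2 k * ((ArithmeticFunction.moebius N : ℤ) : ℝ)| ≤ 1 := by
    rw [abs_mul]
    have d1 : |delta2 k| ≤ 1 := by unfold delta2; split_ifs <;> norm_num
    have d2 : |((ArithmeticFunction.moebius N : ℤ) : ℝ)| ≤ 1 := by rcases mu_cases N with h | h | h <;> rw [h] <;> norm_num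
    nlinarith [abs_nonneg (delta2 k)]
  unfold dMin at h
  have h5 : (k°-1)/12*(psiMin N - x) ≤ 9/4*s + 1 := by
    linarith [(abs_le.1 b2).1, (abs_le.1 b3).1, (abs_le.1 bd).1]
  by_contra hc; push Not at hc
  rcases le_or_gt x (psiMin N) with hx | hx
  · have h6 : 1/12*(psiMin N - x) ≤ (k°-1)/12*(psiMin N - x) := mul_le_mul_of_nonneg_right ♭ ♭
    nlinarith [sq_nonneg (s-27)]
  · linarith
end

open Finset Real
noncomputable section

theorem EPx (P : Finset ℕ) (c : ℕ → ℕ → ℝ) (S : ℕ → ℝ) (hc : ∀ p ∈ P, ∀ e, 0 ≤ c p e)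
    (hS : ∀ p ∈ P, ∀ n, ∑ e ∈ Icc 1 n, c p e ≤ S p) (A : Finset ℕ)
    (hA : ∀ N ∈ A, N ≠ 0 ∧ N.primeFactors ⊆ P) :
    ∑ N ∈ A, mval c N ≤ exp (∑ p ∈ P, S p) := by
  refine (EP P c S hc hS A hA).trans ?_
  rw [exp_sum]
  refine prod_le_prod (fun p hp ↦ ?_) fun p _ ↦ by linarith [add_one_le_exp (S p)]
  have := hS p hp 0
  rw [Icc_eq_empty ♮, sum_empty] at this; linarith

theorem sumE (c : ℕ → ℝ) (a D : ℝ) (ha : 0 ≤ a) (hD : 0 ≤ D) (h1 : c 1 ≤ a) (h : ∀ e, 2 ≤ e → c e ≤ D*(3/4)^(e-2)) (n : ℕ) :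
    ∑ e ∈ Icc 1 n, c e ≤ a + 6*D := by
  have key : ∀ n : ℕ, ∑ e ∈ Icc 1 (n+1), c e ≤ a + 4*D - 4*D*(3/4)^n := by
    intro n
    induction n with
    | zero => simp; exact h1
    | succ n ih =>
      rw [sum_Icc_succ_top ⋆]
      have := h (n+1+1) ⋆
      rw [show n+1+1-2 = n by omega] at this
      rw [pow_succ]; linarith
  rcases n with _ | n
  · simp; positivity
  · have : 0° ≤ 4*D*(3/4)^n := by positivity
    linarith [key n]

theorem pf_inv {p e : ℕ} (hp : p.Prime) (he : 1 ≤ e) : 0 < pf p e ∧ 1/pf p e ≤ 8/p°^e := by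
  have h0 : 0° < p°^e := by have := hp.pos; positivity
  have h := pf_ge8 hp he
  have h1 : 0 < pf p e := by linarith
  refine ⟨h1, ?_⟩
  rw [div_le_div_iff₀ h1 h0]; linarith

theorem pf_nonneg {p : ℕ} (hp : p.Prime) (e : ℕ) : 0 ≤ pf p e := by
  have h2 : 2° ≤ p := by exact_mod_cast hp.two_le
  unfold pf
  refine mul_nonneg (div_nonneg ♭ ♯) ?_
  have : 0° ≤ p°^2-1 := by nlinarith
  split_ifs
  · norm_num
  · linarith
  · positivity

theorem sum_PR_pred (t : ℕ) : ∑ p ∈ PR t, 1°/(p*(p°-1)) ≤ 1 := by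
  have := sum_inv_mul_pred (PR t) 1 le_rfl (fun p hp ↦ (mem_PR.1 hp).1.one_lt)
  simpa using this

theorem sq_le_pred {p : ℝ} (hp : 2 ≤ p) : 1/p^2 ≤ 1/(p*(p-1)) := by
  refine one_div_le_one_div_of_le (by nlinarith) (by nlinarith)

def bc (B : ℕ) (p e : ℕ) : ℝ := (3/2:ℝ)^e * (if 2 ≤ e ∧ B < p then B° else 1) / pf p e

theorem badsum : ∃ K : ℝ, 1 ≤ K ∧ ∀ (t B : ℕ) (A : Finset ℕ), 1 ≤ B → (∀ N ∈ A, N ≠ 0 ∧ N.primeFactors ⊆ PR t) →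
    ∑ N ∈ A, mval (bc B) N ≤ exp (3/2*t+K) := by
  obtain ⟨M, hM1, hM⟩ := levsum
  refine ⟨3/2*M+300, by linarith, fun t B A hB hA ↦ ?_⟩
  have hB0 : 0° < B := by exact_mod_cast hB
  have h := EPx (PR t) (bc B) (fun p ↦ 3/2*(1/(p°-1)) + 6*(18*(if B < p then B° else 1)/p°^2)) (fun p hp e ↦ ?_) (fun p hp n ↦ ?_) A hA
  · refine h.trans (exp_le_exp.2 ?_)
    have h1 : ∀ p ∈ PR t, 3/2*(1/(p°-1)) + 6*(18*(if B < p then B° else 1)/p°^2) ≤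
        3/2*(1/p°) + 110*(1/(p*(p°-1))) + 108*B*(if B < p then 1/(p*(p°-1)) else 0) := by
      intro p hp
      have h2 : 2° ≤ p := by exact_mod_cast (mem_PR.1 hp).1.two_le
      have e : 1/(p°-1) = 1/p + 1/(p*(p°-1)) := by
        have : p°-1 ≠ 0 := by linarith
        field_simp; ring
      have h3 := sq_le_pred h2
      have h4 : 0° ≤ 1/(p*(p°-1)) := by
        have : 0° ≤ p*(p°-1) := by nlinarith
        positivity
      rw [e]
      split_ifs
      · have := mul_le_mul_of_nonneg_left h3 hB0.le
        have e2 : 6*(18*B°/p°^2) = 108*(B*(1/p°^2)) := by ring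
        rw [e2]; linarith
      · have e2 : 6*(18*1°/p°^2) = 108*(1/p°^2) := by ring
        rw [e2]; linarith
    refine (sum_le_sum h1).trans ?_
    rw [sum_add_distrib, sum_add_distrib, ← mul_sum, ← mul_sum, ← mul_sum, ← sum_filter]
    have a1 := (abs_le.1 (hM t (fun _ ↦ 1) 1 (fun _ _ ↦ by norm_num))).2
    have a2 := sum_PR_pred t
    have a3 := sum_inv_mul_pred ((PR t).filter (fun p ↦ B < p)) B hB (fun p hp ↦ (mem_filter.1 hp).2)
    have a4 := mul_le_mul_of_nonneg_left a3 hB0.le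
    rw [mul_one_div_cancel hB0.ne'] at a4
    simp only [sum_const, card_range, nsmul_eq_mul, mul_one] at a1
    push_cast at a1
    linarith
  · have := pf_nonneg (mem_PR.1 hp).1 e
    unfold bc; split_ifs <;> positivity
  · have hp' := (mem_PR.1 hp).1
    have h2 : 2° ≤ p := by exact_mod_cast hp'.two_le
    refine sumE (bc B p) _ _ (by have : 0° < p°-1 := by linarith
                                 positivity) (by split_ifs <;> positivity) ?_ (fun e he ↦ ?_) n
    · simp [bc, pf_one]; rw [div_eq_mul_inv]
    · have e1 : (3/2:ℝ)^e*(8/p°^e) ≤ 18/p°^2*(3/4)^(e-2) := by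
        obtain ⟨k, rfl⟩ := Nat.exists_eq_add_of_le he
        rw [Nat.add_sub_cancel_left, mul_div_assoc', mul_comm _ 8°, mul_div_assoc, ← div_pow, pow_add]
        have : (3/2/p°)^k ≤ (3/4)^k := pow_le_pow_left₀ ♯ (by rw [div_le_iff₀ ♭]; linarith) _
        calc 8*((3/2/p°)^2*(3/2/p°)^k) ≤ 8*((3/2/p°)^2*(3/4)^k) := by gcongr
          _ = _ := by ring
      have e2 : bc B p e ≤ (3/2:ℝ)^e*(if B < p then B° else 1)*(8/p°^e) := by
        have : (if 2 ≤ e ∧ B < p then B° else 1) = (if B < p then B° else 1) := by simp [he]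
        unfold bc; rw [this, div_eq_mul_one_div]
        exact mul_le_mul_of_nonneg_left (pf_inv hp' ⋆).2 (by split_ifs <;> positivity)
      have hb : 0° ≤ (if B < p then B° else 1) := by split_ifs <;> positivity
      have := mul_le_mul_of_nonneg_left e1 hb
      calc bc B p e ≤ _ := e2
        _ = (if B < p then B° else 1)*((3/2:ℝ)^e*(8/p°^e)) := by ring
        _ ≤ _ := this
        _ = _ := by ring

theorem powsum (t : ℕ) (A : Finset ℕ) (hA : ∀ N ∈ A, N ≠ 0 ∧ N.primeFactors ⊆ PR t)
    (h2 : ∀ N ∈ A, ∀ p ∈ N.primeFactors, 2 ≤ N.factorization p) : ∑ N ∈ A, 1/psiMin N ≤ exp 48 := by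
  have h := EPx (PR t) (fun p e ↦ if e = 1 then 0 else 1/pf p e) (fun p ↦ 0 + 6*(8/p°^2)) (fun p hp e ↦ ?_) (fun p hp n ↦ ?_) A hA
  · have e : ∀ N ∈ A, 1/psiMin N = mval (fun p e ↦ if e = 1 then 0 else 1/pf p e) N := fun N hN ↦ by
      rw [psi_eq, mval, one_div, ← prod_inv_distrib]
      refine prod_congr rfl fun p hp ↦ ?_
      have := h2 N hN p hp
      rw [if_neg ⋆, one_div]
    rw [sum_congr rfl e]
    refine h.trans (exp_le_exp.2 ?_)
    have h1 : ∀ p ∈ PR t, 0° + 6*(8/p°^2) ≤ 48*(1/(p*(p°-1))) := fun p hp ↦ by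
      have h3 := sq_le_pred (p := p) (by exact_mod_cast (mem_PR.1 hp).1.two_le)
      have e : 0° + 6*(8/p°^2) = 48*(1/p°^2) := by ring
      rw [e]; linarith
    refine (sum_le_sum h1).trans ?_
    rw [← mul_sum]; linarith [sum_PR_pred t]
  · have := pf_nonneg (mem_PR.1 hp).1 e
    split_ifs <;> positivity
  · have hp' := (mem_PR.1 hp).1
    have h2 : 2° ≤ p := by exact_mod_cast hp'.two_le
    refine sumE _ 0 _ le_rfl ♯ (by simp) (fun e he ↦ ?_) n
    rw [if_neg ⋆]
    refine (pf_inv hp' ⋆).2.trans ?_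
    obtain ⟨k, rfl⟩ := Nat.exists_eq_add_of_le he
    rw [Nat.add_sub_cancel_left, pow_add, ← div_div, div_eq_mul_one_div _ (p°^k), ← one_div_pow]
    refine mul_le_mul_of_nonneg_left (pow_le_pow_left₀ ♯ ?_ _) ♯
    rw [div_le_iff₀ ♭]; linarith

theorem pi_bd {B : ℕ} (hB : 2 ≤ B) {u : ℝ} (hu : 0 < u) (T : Finset ℕ) (hT : ∀ q ∈ T, q.Prime ∧ B < q ∧ q°-1 ≤ u) :
    (T.card:ℝ) ≤ 12*u/log B := by
  have hB' : 2° ≤ B := by exact_mod_cast hB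
  have hl : 0 < log B := log_pos ♭
  rcases T.eq_empty_or_nonempty with rfl | ⟨q, hq⟩
  · simp; positivity
  obtain ⟨-, h2, h3⟩ := hT q hq
  have h2' : B°+1 ≤ q := by exact_mod_cast h2
  set v := u+1
  have hv : 3° ≤ v := by linarith
  have h4 : T.card ≤ Nat.primeCounting ⌊v⌋₊ := by
    rw [← Nat.primesLE_card_eq_primeCounting]
    exact card_le_card fun p hp ↦ by
      rw [Nat.mem_primesLE]
      exact ⟨Nat.le_floor (by linarith [(hT p hp).2.2]), (hT p hp).1⟩
  have h5 := Chebyshev.pi_le_log4_mul_div (x := v) ♭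
  have h6 : log (√v) = log v/2 := log_sqrt ♭
  have hs : 0 < √v := sqrt_pos.2 ♭
  have hvB : log B ≤ log v := log_le_log ♭ ♭
  have h7 : √v ≤ v/log √v := by
    rw [le_div_iff₀ (by rw [h6]; linarith)]
    nlinarith [log_le_self hs.le, mul_self_sqrt (show 0 ≤ v by linarith)]
  have h8 : log 4 ≤ 2 := by
    rw [show 4° = 2^2 by norm_num, log_pow]; push_cast; linarith [log_two_lt_d9]
  have h9 : v/log √v ≤ 4*u/log B := by
    rw [h6, div_le_div_iff₀ ♭ hl]
    nlinarith
  have h10 : log 4*v/log √v ≤ 2*(v/log √v) := by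
    rw [mul_div_assoc]; exact mul_le_mul_of_nonneg_right h8 (le_trans hs.le h7)
  have h11 : (T.card:ℝ) ≤ Nat.primeCounting ⌊v⌋₊ := by exact_mod_cast h4
  have : 12*u/log B = 3*(4*u/log B) := by ring
  linarith

/-- splitting off a simple prime and the powerful part -/
theorem psi_split {N t q : ℕ} (hN : 1 ≤ N) (hP : N.primeFactors ⊆ PR t) (hq : q ∈ N.primeFactors) (hq1 : N.factorization q = 1) :
    ∃ u ∈ Vs t, ∃ s : ℕ, 1 ≤ s ∧ s.primeFactors ⊆ PR t ∧ (∀ p ∈ s.primeFactors, 2 ≤ s.factorization p) ∧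
      1 ≤ u ∧ psiMin N = (q°-1)*(u*psiMin s) := by
  classical
  set f := N.factorization.filter (fun p ↦ 2 ≤ N.factorization p) with hf
  have hfs : f.support = N.primeFactors.filter (fun p ↦ 2 ≤ N.factorization p) := by
    rw [hf, Finsupp.support_filter, Nat.support_factorization]
  have hfp : ∀ p ∈ f.support, p.Prime := fun p hp ↦ by
    rw [hfs] at hp; exact Nat.prime_of_mem_primeFactors (mem_filter.1 hp).1
  set s := f.prod (· ^ ·) with hs
  have hs1 : s.factorization = f := Nat.prod_pow_factorization_eq_self hfp
  have hs2 : s.primeFactors = f.support := by rw [← Nat.support_factorization, hs1]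
  have hs0 : 1 ≤ s := Nat.pos_of_ne_zero (Finsupp.prod_ne_zero_iff.2 fun p hp ↦ pow_ne_zero _ (hfp p hp).ne_zero)
  have hv : ∀ p ∈ f.support, f p = N.factorization p := fun p hp ↦ by
    rw [hfs] at hp; exact Finsupp.filter_apply_pos _ _ (mem_filter.1 hp).2
  set S1 := (N.primeFactors.filter (fun p ↦ ¬ 2 ≤ N.factorization p)).erase q with hS1
  have hS : S1 ⊆ PR t := fun p hp ↦ hP (mem_filter.1 (mem_of_mem_erase hp)).1
  have hpo : ∀ p ∈ S1, 1 ≤ p-1 := fun p hp ↦ by have := (mem_PR.1 (hS hp)).1.two_le; omega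
  refine ⟨∏ p ∈ S1, (p-1), mem_image.2 ⟨S1, mem_powerset.2 hS, rfl⟩, s, hs0, ?_, ?_, ?_, ?_⟩
  · rw [hs2, hfs]; exact (filter_subset _ _).trans hP
  · intro p hp; rw [hs2] at hp; rw [hs1, hv p hp]; rw [hfs] at hp; exact (mem_filter.1 hp).2
  · exact Nat.one_le_iff_ne_zero.2 (prod_ne_zero_iff.2 fun p hp ↦ by have := hpo p hp; omega)
  · rw [psi_eq, ← prod_filter_mul_prod_filter_not _ (fun p ↦ 2 ≤ N.factorization p),
      ← mul_prod_erase (N.primeFactors.filter (fun p ↦ ¬ 2 ≤ N.factorization p)) _ (a := q) (mem_filter.2 ⟨hq, by omega⟩), hq1, pf_one, psi_eq, hs2, hs1, hfs, Nat.cast_prod]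
    have e1 : ∏ p ∈ S1, pf p (N.factorization p) = ∏ p ∈ S1, ((p-1:ℕ):ℝ) := prod_congr rfl fun p hp ↦ by
      have h1 := fac_pos (mem_filter.1 (mem_of_mem_erase hp)).1
      have h2 := (mem_filter.1 (mem_of_mem_erase hp)).2
      rw [show N.factorization p = 1 by omega, pf_one, Nat.cast_sub (by have := hpo p hp; omega)]; simp
    have e2 : ∏ p ∈ N.primeFactors with 2 ≤ N.factorization p, pf p (f p) = ∏ p ∈ N.primeFactors with 2 ≤ N.factorization p, pf p (N.factorization p) :=
      prod_congr rfl fun p hp ↦ by rw [hv p (by rw [hfs]; exact hp)]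
    rw [e1, e2]; ring
end

open Finset Real
noncomputable section

def Om (N : ℕ) : ℕ := ∑ p ∈ N.primeFactors, N.factorization p

theorem omega_le_Om (N : ℕ) : omega N ≤ Om N := by
  have := sum_le_sum (s := N.primeFactors) (f := fun _ ↦ 1) fun p hp ↦ fac_pos hp
  simpa [omega, Om] using this

theorem le_pow_Om {N B : ℕ} (hN : 1 ≤ N) (h : ∀ p ∈ N.primeFactors, p ≤ B) : N ≤ B^(Om N) := by
  have h0 := Nat.prod_factorization_pow_eq_self (n := N) ⋆
  conv_lhs => rw [← h0]
  rw [Finsupp.prod, Nat.support_factorization, Om, ← prod_pow_eq_pow_sum]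
  exact prod_le_prod (fun _ _ ↦ Nat.zero_le _) fun p hp ↦ Nat.pow_le_pow_left (h p hp) _

theorem bc_ge {N B M : ℕ} (hB : 1 ≤ B) (h : M < Om N ∨ ∃ p ∈ N.primeFactors, B < p ∧ 2 ≤ N.factorization p) :
    1 ≤ psiMin N * mval (bc B) N * ((2/3)^M + 1/B°) := by
  have hB' : 1° ≤ B := by exact_mod_cast hB
  set β : ℕ → ℝ := fun p ↦ if 2 ≤ N.factorization p ∧ B < p then B° else 1 with hβ
  have hβ1 : ∀ p, 1 ≤ β p := fun p ↦ by rw [hβ]; dsimp only; split_ifs <;> linarith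
  have e : psiMin N * mval (bc B) N = (3/2:ℝ)^(Om N) * ∏ p ∈ N.primeFactors, β p := by
    rw [psi_eq, mval, ← prod_mul_distrib, Om, ← prod_pow_eq_pow_sum, ← prod_mul_distrib]
    refine prod_congr rfl fun p hp ↦ ?_
    have := (pf_mem hp).2
    unfold bc; rw [mul_div_cancel₀ _ ♭]
  have h1 : 1° ≤ (3/2)^(Om N) := one_le_pow₀ ♮
  have h2 : 1 ≤ ∏ p ∈ N.primeFactors, β p := one_le_prod fun p _ ↦ hβ1 p
  rw [e]
  rcases h with h | ⟨p, hp, h3, h4⟩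
  · have h5 : (3/2:ℝ)^M ≤ (3/2)^(Om N) := pow_le_pow_right₀ ♮ h.le
    have e5 : (3/2:ℝ)^M * (2/3)^M = 1 := by rw [← mul_pow]; norm_num
    calc 1° = (3/2)^M * 1 * (2/3)^M := by rw [mul_one, e5]
      _ ≤ _ := by gcongr; linarith [show 0° ≤ 1/B° by positivity]
  · have h5 : B° ≤ ∏ p ∈ N.primeFactors, β p := by
      rw [← mul_prod_erase _ _ hp]
      have : β p = B := if_pos ⟨h4, h3⟩
      rw [this]
      exact le_mul_of_one_le_right ♭ (one_le_prod fun p _ ↦ hβ1 p)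
    calc 1° = 1 * B * (1/B) := by rw [one_mul, mul_one_div_cancel ♭]
      _ ≤ _ := by gcongr; linarith [show 0° ≤ (2/3:ℝ)^M by positivity]

theorem uc_arith {K X lB R V t a b c s e3 : ℝ} {M : ℕ} (hK : 1 ≤ K) (hX : 0 ≤ X) (hl : 0 < lB) (hR : 0 ≤ R)
    (h1 : b ≤ X*exp (3/2*t+K)*((2/3)^M+1/e3) + s) (h2 : V ≤ 12*exp 48*X/lB*R) (h3 : c ≤ 3*(2*M+3)^2*V) (h4 : a ≤ b+c) (he : 0 ≤ e3 := by positivity) :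
    a ≤ X*exp (3/2*t+(K+12*exp 48))*((2/3)^M+1/e3) + s + 3*(2*M+3)^2*((K+12*exp 48)*X/lB*R) := by
  have f1 : X*exp (3/2*t+K)*((2/3)^M+1/e3) ≤ X*exp (3/2*t+(K+12*exp 48))*((2/3)^M+1/e3) := by
    gcongr; linarith [exp_pos 48]
  have f2 : 3*(2*M°+3)^2*V ≤ 3*(2*M+3)^2*((K+12*exp 48)*X/lB*R) := by
    refine mul_le_mul_of_nonneg_left (h2.trans ?_) ♯
    gcongr; linarith
  linarith

theorem upper_core : ∃ K : ℝ, 1 ≤ K ∧ ∀ (k t M B : ℕ) (X : ℝ) (A : Finset ℕ), 2 ≤ B → 2 ≤ X → B°^M ≤ √X → X+1 ≤ EE (t+1) →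
    (∀ N, N ∈ A ↔ 1 ≤ N ∧ psiMin N ≤ X) →
    ((A.image (dMin k)).card:ℝ) ≤ X*exp (3/2*t+K)*((2/3)^M+1/B°) + √X + 3*(2*M+3)^2*(K*X/log B*Rs t) := by
  classical
  obtain ⟨K, hK1, hK⟩ := badsum
  refine ⟨K + 12*exp 48, by linarith [exp_pos 48], fun k t M B X A hB hX hBM hXt hA ↦ ?_⟩
  have hB2 : 2° ≤ B := by exact_mod_cast hB
  have hlB : 0 < log B := log_pos ♭
  have hPR : ∀ N ∈ A, N ≠ 0 ∧ N.primeFactors ⊆ PR t := fun N hN ↦ by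
    obtain ⟨h1, h2⟩ := (hA N).1 hN
    refine ⟨by omega, fun p hp ↦ mem_PR.2 ⟨Nat.prime_of_mem_primeFactors hp, ?_⟩⟩
    rw [lev_le_iff (Nat.prime_of_mem_primeFactors hp).two_le]
    linarith [prime_le_psi hp]
  set good : ℕ → Prop := fun N ↦ Om N ≤ M ∧ ∃ q ∈ N.primeFactors, B < q ∧ N.factorization q = 1 with hgood
  have hbad : ((A.filter (fun N ↦ ¬ good N)).card:ℝ) ≤ X*exp (3/2*t+K)*((2/3)^M+1/B°) + √X := by
    have h1 : ∀ N ∈ A.filter (fun N ↦ ¬ good N), 1° ≤ X*mval (bc B) N*((2/3)^M+1/B°) + (if N° ≤ √X then 1 else 0) := by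
      intro N hN
      obtain ⟨hN1, hN2⟩ := mem_filter.1 hN
      obtain ⟨h1, h2⟩ := (hA N).1 hN1
      have hm : 0 ≤ mval (bc B) N := prod_nonneg fun p hp ↦ by
        have := (pf_mem hp).2
        unfold bc; split_ifs <;> positivity
      by_cases hc : M < Om N ∨ ∃ p ∈ N.primeFactors, B < p ∧ 2 ≤ N.factorization p
      · have h3 := bc_ge (by omega : 1 ≤ B) hc
        have : psiMin N * mval (bc B) N * ((2/3)^M + 1/B°) ≤ X*mval (bc B) N*((2/3)^M+1/B°) := by gcongr
        split_ifs <;> linarith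
      · push Not at hc
        have h3 : N ≤ B^M := (le_pow_Om h1 fun p hp ↦ by
          by_contra hp2; push Not at hp2
          have h4 := hc.2 p hp hp2
          have h5 := fac_pos hp
          exact hN2 ⟨hc.1, p, hp, hp2, by omega⟩).trans (Nat.pow_le_pow_right ⋆ hc.1)
        have h4 : N° ≤ √X := le_trans (by exact_mod_cast h3) hBM
        rw [if_pos h4]
        have : 0 ≤ X*mval (bc B) N*((2/3)^M+1/B°) := by positivity
        linarith
    have h2 := sum_le_sum h1
    rw [sum_const, nsmul_eq_mul, mul_one, sum_add_distrib, ← sum_mul, ← mul_sum, ← sum_filter, sum_const, nsmul_eq_mul, mul_one] at h2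
    have h3 : ∑ N ∈ A.filter (fun N ↦ ¬ good N), mval (bc B) N ≤ exp (3/2*t+K) :=
      hK t B _ ⋆ fun N hN ↦ hPR N (mem_filter.1 hN).1
    have h4 : ((((A.filter (fun N ↦ ¬ good N)).filter (fun N : ℕ => N° ≤ √X)).card:ℕ):ℝ) ≤ √X := by
      have : (A.filter (fun N ↦ ¬ good N)).filter (fun N : ℕ => N° ≤ √X) ⊆ Icc 1 ⌊√X⌋₊ := fun N hN ↦ by
        obtain ⟨h5, h6⟩ := mem_filter.1 hN
        exact mem_Icc.2 ⟨((hA N).1 (mem_filter.1 h5).1).1, Nat.le_floor h6⟩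
      have := card_le_card this
      rw [Nat.card_Icc, Nat.add_sub_cancel] at this
      exact le_trans (by exact_mod_cast this) (Nat.floor_le (sqrt_nonneg _))
    refine h2.trans (add_le_add ?_ h4)
    gcongr
  set G := A.filter good with hG
  set V := G.image psiMin with hV
  have hVc : (V.card:ℝ) ≤ 12*exp 48*X/log B*Rs t := by
    set pw : ℕ → Prop := fun s ↦ ∀ p ∈ s.primeFactors, 2 ≤ s.factorization p with hpw
    set I := Vs t ×ˢ A.filter pw with hI
    set T : ℕ × ℕ → Finset ℕ := fun i ↦ (range (⌊X⌋₊+2)).filter (fun q ↦ q.Prime ∧ B < q ∧ q°-1 ≤ X/(i.1*psiMin i.2)) with hT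
    have hsub : V ⊆ I.biUnion fun i ↦ (T i).image (fun q : ℕ => (q°-1)*(i.1*psiMin i.2)) := by
      intro v hv
      obtain ⟨N, hN, rfl⟩ := mem_image.1 hv
      obtain ⟨hNA, -, q, hq, hBq, hq1⟩ := mem_filter.1 hN
      obtain ⟨h1, h2⟩ := (hA N).1 hNA
      obtain ⟨u, hu, s, hs1, hs2, hs3, hu1, e⟩ := psi_split h1 (hPR N hNA).2 hq hq1
      have hu' : 1° ≤ u := by exact_mod_cast hu1
      have hps := one_le_psi s
      have hqB : B° < q := by exact_mod_cast hBq
      have hup : 1*1 ≤ u*psiMin s := mul_le_mul hu' hps ♮ ♭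
      rw [e] at h2
      have hqX : q°-1 ≤ X := by nlinarith
      have hsX : psiMin s ≤ X := by
        have h5 : 1*psiMin s ≤ u*psiMin s := mul_le_mul_of_nonneg_right hu' ♭
        have h6 : 1*(u*psiMin s) ≤ (q°-1)*(u*psiMin s) := mul_le_mul_of_nonneg_right ♭ ♭
        linarith
      refine mem_biUnion.2 ⟨(u,s), mem_product.2 ⟨hu, mem_filter.2 ⟨(hA s).2 ⟨hs1, hsX⟩, hs3⟩⟩, mem_image.2 ⟨q, mem_filter.2 ⟨?_, Nat.prime_of_mem_primeFactors hq, hBq, ?_⟩, e.symm⟩⟩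
      · rw [mem_range]
        have : q-1 ≤ ⌊X⌋₊ := Nat.le_floor (by rw [Nat.cast_sub ⋆]; simpa using hqX)
        omega
      · rw [le_div_iff₀ ♭]; exact h2
    have hc : V.card ≤ ∑ i ∈ I, (T i).card :=
      (card_le_card hsub).trans (card_biUnion_le.trans (sum_le_sum fun i _ ↦ card_image_le))
    have h1 : ∀ i ∈ I, ((T i).card:ℝ) ≤ 12*X/log B*((1/(i.1:ℝ))*(1/psiMin i.2)) := fun i hi ↦ by
      have hi1 : 0° < i.1 := by exact_mod_cast Vs_pos (mem_product.1 hi).1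
      have hi2 := one_le_psi i.2
      have := pi_bd hB (u := X/(i.1*psiMin i.2)) ♯ (T i) (fun q hq ↦ (mem_filter.1 hq).2)
      refine this.trans (le_of_eq ?_)
      field_simp
    have h2 : (V.card:ℝ) ≤ ∑ i ∈ I, ((T i).card:ℝ) := by exact_mod_cast hc
    refine (h2.trans (sum_le_sum h1)).trans ?_
    rw [← mul_sum, hI, sum_product]; dsimp only; rw [← sum_mul_sum]
    have h3 := powsum t (A.filter pw) (fun N hN ↦ hPR N (mem_filter.1 hN).1) (fun N hN ↦ (mem_filter.1 hN).2)
    have h4 : (∑ w ∈ Vs t, 1/w°) = Rs t := rfl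
    rw [h4]
    have := one_le_Rs t
    calc 12*X/log B*(Rs t*_) ≤ 12*X/log B*(Rs t*exp 48) := by gcongr
      _ = _ := by ring
  have hgd : ((G.image (dMin k)).card:ℝ) ≤ 3*(2*M+3)^2*V.card := by
    have hsub : G.image (dMin k) ⊆ (V ×ˢ TW M ×ˢ TW M ×ˢ ({0,1,-1}:Finset ℝ)).image
        (fun z ↦ (k°-1)/12*z.1 - 1/2*0 + c2 k*z.2.1 + c3 k*z.2.2.1 + delta2 k*z.2.2.2) := by
      intro v hv
      obtain ⟨N, hN, rfl⟩ := mem_image.1 hv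
      obtain ⟨hNA, hM, q, hq, hBq, hq1⟩ := mem_filter.1 hN
      have hom := (omega_le_Om N).trans hM
      have hinf : nuInfMin N = 0 := by
        by_contra hc
        obtain ⟨e, he⟩ := nuInf_ne ((hA N).1 hNA).1 hc
        have h1 := Nat.prime_of_mem_primeFactors hq
        have h2 := h1.dvd_of_dvd_pow (he ▸ Nat.dvd_of_mem_primeFactors hq)
        have := Nat.le_of_dvd ♮ h2
        omega
      have tw : ∀ v : ℝ, (v = 0 ∨ ∃ a ≤ omega N, v = 2^a ∨ v = -2^a) → v ∈ TW M := fun v h ↦ 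
        mem_TW (h.imp_right fun ⟨a, ha, h⟩ ↦ ⟨a, ha.trans hom, h⟩)
      refine mem_image.2 ⟨(psiMin N, nu2Min N, nu3Min N, ((ArithmeticFunction.moebius N : ℤ):ℝ)), ?_, ?_⟩
      · refine mem_product.2 ⟨mem_image_of_mem _ hN, mem_product.2 ⟨tw _ (nu2_tw N), mem_product.2 ⟨tw _ (nu3_tw N), ?_⟩⟩⟩
        have := mu_cases N
        simpa using this
      · unfold dMin; rw [hinf]
    have h1 := (card_le_card hsub).trans card_image_le
    rw [card_product, card_product, card_product] at h1
    have h2 := TW_card M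
    have h3 : ({0,1,-1}:Finset ℝ).card ≤ 3 := card_le_three
    have h4 : V.card*((TW M).card*((TW M).card*({0,1,-1}:Finset ℝ).card)) ≤ V.card*((2*M+3)*((2*M+3)*3)) := by gcongr
    have h5 : (((G.image (dMin k)).card:ℕ):ℝ) ≤ (V.card*((2*M+3)*((2*M+3)*3)) : ℕ) := by exact_mod_cast h1.trans h4
    refine h5.trans (le_of_eq ?_)
    push_cast; ring
  have hsplit : (A.image (dMin k)).card ≤ (A.filter (fun N ↦ ¬ good N)).card + (G.image (dMin k)).card := by
    have : A.image (dMin k) = (A.filter (fun N ↦ ¬ good N)).image (dMin k) ∪ G.image (dMin k) := by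
      rw [← image_union, union_comm, hG, filter_union_filter_not_eq]
    rw [this]
    exact (card_union_le _ _).trans (Nat.add_le_add_right card_image_le _)
  have hs' : ((A.image (dMin k)).card:ℝ) ≤ (A.filter (fun N ↦ ¬ good N)).card + (G.image (dMin k)).card := by exact_mod_cast hsplit
  have hR := one_le_Rs t
  exact uc_arith hK1 ♭ hlB ♭ hbad hVc hgd hs'
end

open Finset Real
noncomputable section

def DS (k : ℕ) (x : ℝ) : Set ℝ := {y : ℝ | ∃ N : ℕ, 1 ≤ N ∧ dMin k N = y ∧ dMin k N ≤ (k°-1)/12 * x}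

theorem DS_cover {k : ℕ} {x X : ℝ} (hk : 2 ≤ k) (hx : 2*x+1500 ≤ X) (h0 : 0 ≤ X) : ∃ A : Finset ℕ, (∀ N, N ∈ A ↔ 1 ≤ N ∧ psiMin N ≤ X) ∧
    DS k x ⊆ A.image (dMin k) ∧ (A.card:ℝ) ≤ 64*X^3+1 := by
  classical
  have hb : ∀ N : ℕ, 1 ≤ N → psiMin N ≤ X → N ≤ ⌊64*X^3⌋₊ := fun N h1 h2 ↦ Nat.le_floor ((le_psi' N h1).trans (by
    have := one_le_psi N
    gcongr))
  refine ⟨(range (⌊64*X^3⌋₊+1)).filter (fun N ↦ 1 ≤ N ∧ psiMin N ≤ X), fun N ↦ ?_, ?_, ?_⟩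
  · rw [mem_filter, mem_range]
    exact ⟨fun h ↦ h.2, fun h ↦ ⟨by have := hb N h.1 h.2; omega, h⟩⟩
  · rintro _ ⟨N, h1, rfl, h2⟩
    have h3 := (psi_le_of_d hk h2).trans hx
    exact mem_coe.2 (mem_image_of_mem _ (mem_filter.2 ⟨mem_range.2 (by have := hb N h1 h3; omega), h1, h3⟩))
  · refine le_trans (Nat.cast_le.2 (card_filter_le _ _)) ?_
    rw [card_range]; push_cast
    linarith [Nat.floor_le (show 0 ≤ 64*X^3 by positivity)]

theorem DS_card {k : ℕ} {x : ℝ} {A : Finset ℕ} (h : DS k x ⊆ A.image (dMin k)) : (DS k x).ncard ≤ (A.image (dMin k)).card := by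
  have := Set.ncard_le_ncard h (finite_toSet _)
  rwa [Set.ncard_coe_finset] at this

theorem DS_bd {k : ℕ} {x : ℝ} (hk : 2 ≤ k) (hx : 0 ≤ x) : (DS k x).Finite ∧ ((DS k x).ncard:ℝ) ≤ 64*(2*x+1500)^3+1 := by
  obtain ⟨A, -, h2, h3⟩ := DS_cover hk (le_refl (2*x+1500)) ♭
  refine ⟨(finite_toSet _).subset h2, le_trans ?_ h3⟩
  exact_mod_cast (DS_card h2).trans card_image_le

theorem const_exp {c l : ℝ} (hc : 1 ≤ c) (hl : 1 ≤ l) : c ≤ exp (log c*l) := by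
  conv_lhs => rw [← exp_log (show 0 < c by linarith)]
  exact exp_le_exp.2 (le_mul_of_one_le_right (log_nonneg hc) hl)

theorem params {y E : ℝ} {x : ℝ} (hy : 100 ≤ y) (hE : E = exp y) (hx : x = exp E) :
    400*y^2 ≤ E ∧ 1500 ≤ x ∧ √(3*x) ≤ 6*x/E ∧ E ≤ log (3*x) := by
  have h4 : 400*y^2 ≤ E := by
    have h := pow_div_factorial_le_exp y ♭ 4
    norm_num [Nat.factorial] at h
    rw [hE]; nlinarith [sq_nonneg (y^2-10000)]
  have hE0 : 4000000 ≤ E := by nlinarith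
  have hx1 : 1500 ≤ x := by rw [hx]; linarith [add_one_le_exp E]
  have h5 : log (3*x) = log 3 + E := by rw [log_mul ♮ ♭, hx, log_exp]
  have h6 : E ≤ log (3*x) := by rw [h5]; linarith [log_nonneg (show 1° ≤ 3 by norm_num)]
  refine ⟨h4, hx1, ?_, h6⟩
  have hs : 0 < √(3*x) := sqrt_pos.2 ♭
  have h7 := log_le_self hs.le
  rw [log_sqrt ♭] at h7
  rw [le_div_iff₀ ♭]
  nlinarith [mul_self_sqrt (show 0 ≤ 3*x by linarith)]

theorem Bparams {y E L : ℝ} {M B : ℕ} (hy : 100 ≤ y) (h4 : 400*y^2 ≤ E) (hL : E ≤ L) (hM1 : 10*y ≤ M) (hM2 : M ≤ 11*y)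
    (hB : B = ⌊exp (L/(2*M))⌋₊) :
    2 ≤ B ∧ B°^M ≤ exp (L/2) ∧ 1/log B ≤ 44*y/E ∧ (2/3)^M+1/B° ≤ 3*exp (-(5/2*y)) := by
  set z := L/(2*M) with hz
  have hM0 : 0° < M := by linarith
  have hz1 : E/(22*y) ≤ z := by
    rw [hz, div_le_div_iff₀ ♭ ♭]; nlinarith
  have hz2 : 16*y ≤ z := le_trans (by rw [le_div_iff₀ ♭]; nlinarith) hz1
  have he := add_one_le_exp z
  have hB1 : B° ≤ exp z := hB ▸ Nat.floor_le (exp_pos _).le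
  have hB2 : exp z < B + 1 := hB ▸ Nat.lt_floor_add_one _
  have hB3 : exp z/2 ≤ B := by linarith
  have hB4 : 2° ≤ B := by linarith
  refine ⟨by exact_mod_cast hB4, ?_, ?_, ?_⟩
  · refine (pow_le_pow_left₀ ♯ hB1 M).trans (le_of_eq ?_)
    rw [← exp_nat_mul]; congr 1; rw [hz]; field_simp
  · have h1 : z/2 ≤ log B := by
      have := log_le_log ♯ hB3
      rw [log_div ♯ ♮, log_exp] at this
      linarith [log_two_lt_d9]
    have hE0 : 0 < E := by nlinarith
    have h2 : E/(44*y) ≤ log B := by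
      have : E/(44*y) = E/(22*y)/2 := by field_simp; norm_num
      linarith
    rw [div_le_div_iff₀ ♭ hE0]
    rw [div_le_iff₀ ♭] at h2; linarith
  · have h1 : (2/3:ℝ) ≤ exp (-(1/3)) := by
      rw [exp_neg, le_inv_comm₀ ♮ (exp_pos _)]
      refine le_of_pow_le_pow_left₀ (n := 3) ♮ ♮ ?_
      rw [← exp_nat_mul]; norm_num; linarith [exp_one_lt_d9]
    have h2 : (2/3:ℝ)^M ≤ exp (-(5/2*y)) := by
      refine (pow_le_pow_left₀ ♮ h1 M).trans ?_
      rw [← exp_nat_mul]; exact exp_le_exp.2 ♭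
    have h3 : 1/B° ≤ 2*exp (-(5/2*y)) := by
      have : 1/B° ≤ 2*exp (-z) := by
        rw [exp_neg, div_le_iff₀ ♭]
        calc 1° = 2*(exp z)⁻¹*(exp z/2) := by field_simp
          _ ≤ _ := by gcongr
      refine this.trans ?_
      gcongr; linarith
    linarith

theorem FordData.C_pos {ϱ : ℝ} (h : FordData ϱ) : 0 < 1/(2*log (1/ϱ)) := by
  have hl : 0 < log (1/ϱ) := log_pos (by rw [one_div]; exact (one_lt_inv₀ h.pos).2 h.lt)
  positivity

theorem grow {C A D y t : ℝ} (hC0 : 0 < C) (hA1 : 1 ≤ A) (hD1 : 1 ≤ D) (hy : 100 ≤ y) (ht1 : y ≤ t) (ht2 : t ≤ y+1) :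
    D*y^3*exp (C*(log (t/log t))^2+A*log t) ≤
      exp (C*(log (y/log y))^2 + (log D + 3 + 3*C + 2*A)*log y) := by
  have hl1 : 1 ≤ log y := by
    rw [← log_exp 1]; exact log_le_log (exp_pos _) (by linarith [exp_one_lt_d9])
  have hlt : log t ≤ 2*log y := by
    rw [two_mul, ← log_mul ♭ ♭]
    exact log_le_log ♭ (by nlinarith)
  have hlt' : log y ≤ log t := log_le_log ♭ ht1
  have hly : log y ≤ y := log_le_self ♭
  have g1 : 0 ≤ log (t/log t) := log_nonneg (by rw [le_div_iff₀ ♭, one_mul]; exact log_le_self ♭)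
  have g2 : log (t/log t) ≤ log (y/log y) + 1 := by
    have : t°/log t ≤ 2*(y/log y) := by
      rw [← mul_div_assoc]; exact div_le_div₀ ♭ ♭ ♭ hlt'
    have := log_le_log (div_pos ♭ ♭) this
    rw [log_mul ♮ (div_pos ♭ ♭).ne'] at this
    linarith [log_two_lt_d9]
  have g3 : log (y/log y) ≤ log y := by
    rw [log_div ♭ ♭]; linarith [log_nonneg hl1]
  have g4 : (log (t/log t))^2 ≤ (log (y/log y))^2 + 3*log y := by
    nlinarith [pow_le_pow_left₀ g1 g2 2]
  have f1 := const_exp hD1 hl1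
  have f2 : y^3 = exp (3*log y) := by
    rw [mul_comm, exp_mul, exp_log ♭]; norm_cast
  calc D*y^3*exp (C*(log (t/log t))^2+A*log t) ≤ exp (log D*log y)*exp (3*log y)*exp (C*(log (t/log t))^2+A*log t) := by
        rw [f2]; gcongr
    _ ≤ _ := by
        rw [← exp_add, ← exp_add]
        refine exp_le_exp.2 ?_
        have := mul_le_mul_of_nonneg_left g4 hC0.le
        have := mul_le_mul_of_nonneg_left hlt (show 0 ≤ A by linarith)
        linarith

theorem tot_arith {a b c d D e K y R z w : ℝ} (h1 : a ≤ b+c+d) (hb : b ≤ 9*e*z) (hc : c ≤ 6*z) (hd : d ≤ 300000*K*y^3*R*z)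
    (hD : D = 9*e+6+300000*K) (hz : 0 < z) (he : 0 < e) (hy : 100 ≤ y) (hR : 1 ≤ R) (hRw : R ≤ w) (hK : 1 ≤ K) : a ≤ z*(D*y^3*w) := by
  have hy3 : 1 ≤ y^3 := one_le_pow₀ ♭
  have hyR : 1*1 ≤ y^3*R := mul_le_mul hy3 hR ♮ ♭
  have h2 : (9*e+6)*z*(1*1) ≤ (9*e+6)*z*(y^3*R) := by gcongr
  have h3 : z*(D*y^3*R) ≤ z*(D*y^3*w) := by rw [hD]; gcongr
  rw [hD] at h3 ⊢; linarith

theorem t3_arith {y x K R E lB : ℝ} {M : ℕ} (hy : 100 ≤ y) (hx : 0 ≤ x) (hK : 1 ≤ K) (hR : 1 ≤ R) (hE : 0 < E) (hM2 : M° ≤ 11*y)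
    (hlB : 1/lB ≤ 44*y/E) : 3*(2*M°+3)^2*(K*(3*x)/lB*R) ≤ 300000*K*y^3*R*(x/E) := by
  have e1 : (2*M°+3)^2 ≤ (23*y)^2 := pow_le_pow_left₀ ♯ ♭ 2
  have h0 : 0 ≤ K*y^3*R*(x/E) := by positivity
  calc 3*(2*M°+3)^2*(K*(3*x)/lB*R) = 9*(2*M°+3)^2*(K*x*R)*(1/lB) := by ring
    _ ≤ 9*(2*M°+3)^2*(K*x*R)*(44*y/E) := mul_le_mul_of_nonneg_left hlB ♯
    _ ≤ 9*(23*y)^2*(K*x*R)*(44*y/E) := by gcongr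
    _ = 209484*(K*y^3*R*(x/E)) := by ring
    _ ≤ 300000*(K*y^3*R*(x/E)) := by linarith
    _ = _ := by ring

theorem FordData.upper {ϱ : ℝ} (h : FordData ϱ) : ∃ A : ℝ, 1 ≤ A ∧ ∀ (k : ℕ) (x y E : ℝ), 2 ≤ k → 100 ≤ y → E = exp y → x = exp E →
    ((DS k x).ncard:ℝ) ≤ x/E*exp (1/(2*log (1/ϱ))*(log (y/log y))^2 + A*log y) := by
  obtain ⟨A, hA1, hA⟩ := h.Rs_bound
  obtain ⟨K, hK1, hK⟩ := upper_core
  have hC0 := h.C_pos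
  set C := 1/(2*log (1/ϱ)) with hC
  set D := 9*exp (3/2+K) + 6 + 300000*K with hD
  have hD1 : 1 ≤ D := by have := exp_pos (3/2+K); linarith
  have hlD := log_nonneg hD1
  refine ⟨log D + 3 + 3*C + 2*A, by linarith, fun k x y E hk hy hE hx ↦ ?_⟩
  obtain ⟨h4, hx1, hsq, hL⟩ := params hy hE hx
  set L := log (3*x) with hLd
  set M := ⌈10*y⌉₊ with hM
  have hM1 : 10*y ≤ M := Nat.le_ceil _
  have hM2 : M° ≤ 11*y := by linarith [Nat.ceil_lt_add_one (show 0 ≤ 10*y by linarith)]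
  obtain ⟨hB2, hBM, hlB, hw⟩ := Bparams hy h4 hL hM1 hM2 (B := ⌊exp (L/(2*M))⌋₊) rfl
  set B := ⌊exp (L/(2*M))⌋₊ with hB
  set t := ⌈y⌉₊ with ht
  have ht1 : y ≤ t := Nat.le_ceil _
  have ht2 : t° ≤ y+1 := (Nat.ceil_lt_add_one ♭).le
  have hE0 : 0 < E := hE ▸ exp_pos y
  obtain ⟨F, hF1, hF2, -⟩ := DS_cover (k := k) (x := x) (X := 3*x) hk ♭ ♭
  have hsqe : exp (L/2) = √(3*x) := by
    rw [← exp_log (sqrt_pos.2 (show 0 < 3*x by linarith)), log_sqrt ♭]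
  have hEE : 3*x+1 ≤ EE (t+1) := by
    refine le_trans ?_ (EE_mono (show y+1 ≤ t°+1 by linarith))
    have h2 : 2*E ≤ exp (y+1) := by
      rw [exp_add, ← hE, mul_comm]; exact mul_le_mul_of_nonneg_left (by linarith [add_one_le_exp 1°]) hE0.le
    have h3 : exp (2*E) ≤ EE (y+1) := exp_le_exp.2 h2
    rw [two_mul, exp_add, ← hx] at h3
    clear * - h3 hx1; nlinarith
  have hm := hK k t M B (3*x) F hB2 ♭ (hsqe ▸ hBM) hEE hF1
  have hc : ((DS k x).ncard:ℝ) ≤ (F.image (dMin k)).card := by exact_mod_cast DS_card hF2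
  have ht3 : 3 ≤ t := by have : 3° ≤ t := by linarith
                         exact_mod_cast this
  have hR := hA t ht3
  have hR1 := one_le_Rs t
  set R := Rs t with hRd
  have t1 : 3*x*exp (3/2*t+K)*((2/3)^M+1/B°) ≤ 9*exp (3/2+K)*(x/E) := by
    have e1 : exp (3/2*t+K) ≤ exp (3/2+K)*exp (3/2*y) := by
      rw [← exp_add (3/2+K)]; exact exp_le_exp.2 ♭
    calc 3*x*exp (3/2*t+K)*((2/3)^M+1/B°) ≤ 3*x*(exp (3/2+K)*exp (3/2*y))*(3*exp (-(5/2*y))) := by gcongr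
      _ = 9*exp (3/2+K)*(x*(exp (3/2*y)*exp (-(5/2*y)))) := by ring
      _ = _ := by rw [← exp_add (3/2*y), div_eq_mul_inv x, hE, ← exp_neg]; ring_nf
  have t3 := t3_arith (K := K) hy (show 0 ≤ x by linarith) hK1 hR1 hE0 hM2 hlB
  have t2 : √(3*x) ≤ 6*(x/E) := by rw [← mul_div_assoc]; exact hsq
  refine (tot_arith (hc.trans hm) t1 t2 t3 hD ♯ (exp_pos _) hy hR1 hR hK1).trans ?_
  exact mul_le_mul_of_nonneg_left (grow hC0 hA1 hD1 hy ht1 ht2) ♯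
end

open Finset Real
noncomputable section

theorem dvd_split {ι : Type*} [DecidableEq ι] (s : Finset ι) (f : ι → ℕ) : ∀ n : ℕ, n ∣ ∏ i ∈ s, f i →
    ∃ g : ι → ℕ, ∏ i ∈ s, g i = n ∧ ∀ i ∈ s, g i ∣ f i := by
  induction s using Finset.induction_on with
  | empty => intro n h; exact ⟨fun _ ↦ 1, by simpa [eq_comm] using h, by simp⟩
  | insert a s ha ih =>
    intro n h
    rw [prod_insert ha] at h
    obtain ⟨x, y, hx, hy, rfl⟩ := exists_dvd_and_dvd_of_dvd_mul h
    obtain ⟨g, hg, hg'⟩ := ih y hy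
    refine ⟨Function.update g a x, ?_, ?_⟩
    · rw [prod_insert ha, Function.update_self, ← hg]
      congr 1
      exact prod_congr rfl fun i hi ↦ Function.update_of_ne (by rintro rfl; exact ha hi) _ _
    · intro i hi
      rcases eq_or_ne i a with rfl | hne
      · simpa using hx
      · rw [Function.update_of_ne hne]; exact hg' i ((mem_insert.1 hi).resolve_left hne)

theorem refine_mat {ι : Type*} [DecidableEq ι] (s T : Finset ι) (f : ι → ℕ) (hf : ∀ i ∈ s, 0 < f i) : ∀ f' : ι → ℕ,
    (∏ i ∈ s, f i = ∏ j ∈ T, f' j) →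
    ∃ d : ι → ι → ℕ, (∀ i ∈ s, ∏ j ∈ T, d i j = f i) ∧ ∀ j ∈ T, ∏ i ∈ s, d i j = f' j := by
  induction s using Finset.induction_on with
  | empty =>
    intro f' h
    refine ⟨fun _ _ ↦ 1, by simp, fun j hj ↦ ?_⟩
    have := Finset.dvd_prod_of_mem f' hj
    rw [← h] at this; simpa [eq_comm] using this
  | insert a s ha ih =>
    intro f' h
    rw [prod_insert ha] at h
    obtain ⟨g, hg, hg'⟩ := dvd_split T f' (f a) (h ▸ Dvd.intro _ rfl)
    have hfa := hf a (mem_insert_self _ _)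
    obtain ⟨d, h1, h2⟩ := ih (fun i hi ↦ hf i (mem_insert_of_mem hi)) (fun j ↦ f' j / g j) (by
      refine Nat.eq_of_mul_eq_mul_left hfa ?_
      rw [h, ← hg, ← prod_mul_distrib]
      exact prod_congr rfl fun j hj ↦ (Nat.mul_div_cancel' (hg' j hj)).symm)
    have hu : ∀ i ∈ s, Function.update d a g i = d i := fun i hi ↦ Function.update_of_ne (by rintro rfl; exact ha hi) _ _
    refine ⟨Function.update d a g, fun i hi ↦ ?_, fun j hj ↦ ?_⟩
    · rcases eq_or_ne i a with rfl | hne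
      · simpa using hg
      · have hi' := (mem_insert.1 hi).resolve_left hne
        rw [hu i hi']; exact h1 i hi'
    · rw [prod_insert ha, Function.update_self, prod_congr rfl (fun i hi ↦ by rw [hu i hi]), h2 j hj]
      exact Nat.mul_div_cancel' (hg' j hj)

def fsum {κ : Type*} (S : Finset κ) (P : κ → Prop) (W : κ → ℝ) : ℝ := ∑ d ∈ S, @ite ℝ (P d) (Classical.propDecidable _) (W d) 0

theorem ext1 {κ : Type*} [Fintype κ] [DecidableEq κ] (S : Finset (κ → ℕ)) (f : κ → ℕ → ℝ) (hf : ∀ e m, 0 ≤ f e m) (e : κ)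
    (T : (κ → ℕ) → Finset ℕ) (ε : ℝ) (P Ψ : (κ → ℕ) → Prop)
    (hX : ∀ d ∈ S, ∀ X ∈ T d, f e (X * d e) ≤ f e (d e) * (1/X))
    (hP : ∀ d ∈ S, P d → ∃ X, ∃ d' ∈ S, Ψ d' ∧ X ∈ T d' ∧ Function.update d' e (X * d' e) = d)
    (hT : ∀ d ∈ S, ∑ X ∈ T d, 1°/X ≤ ε) :
    fsum S P (fun d ↦ ∏ i, f i (d i)) ≤ ε * fsum S Ψ (fun d ↦ ∏ i, f i (d i)) := by
  classical
  unfold fsum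
  rw [← sum_filter, ← sum_filter]
  refine (sum_cover (S.filter P) ((S.filter Ψ).sigma T) (fun z ↦ Function.update z.1 e (z.2 * z.1 e)) _
    (fun d ↦ prod_nonneg fun i _ ↦ hf _ _) (fun d hd ↦ ?_)).trans ?_
  · obtain ⟨hd, hPd⟩ := mem_filter.1 hd
    obtain ⟨X, d', hd', h1, h2, h3⟩ := hP d hd hPd
    exact ⟨⟨d', X⟩, mem_sigma.2 ⟨mem_filter.2 ⟨hd', h1⟩, h2⟩, h3⟩
  · rw [sum_sigma, mul_sum]
    refine sum_le_sum fun d hd ↦ ?_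
    have hd := (mem_filter.1 hd).1
    have h0 : 0 ≤ ∏ i, f i (d i) := prod_nonneg fun i _ ↦ hf _ _
    refine le_trans ?_ (mul_le_mul_of_nonneg_right (hT d hd) h0)
    rw [sum_mul]
    refine sum_le_sum fun X hX' ↦ ?_
    have hr : ∀ i ∈ univ.erase e, f i (Function.update d e (X * d e) i) = f i (d i) := fun i hi ↦ by
      rw [Function.update_of_ne (ne_of_mem_erase hi)]
    rw [← mul_prod_erase univ _ (mem_univ e), ← mul_prod_erase univ (fun i ↦ f i (d i)) (mem_univ e), prod_congr rfl hr,
      Function.update_self, ← mul_assoc, mul_comm (1°/X)]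
    exact mul_le_mul_of_nonneg_right (hX d hd X hX') (prod_nonneg fun i _ ↦ hf _ _)

end

open Finset Real
noncomputable section

def nU {L : ℕ} (b : Fin L → ℕ) (U : Finset (Fin L)) (l : ℕ) : ℕ := (U.filter (fun i ↦ l ≤ b i)).card
def gU {L : ℕ} (b : Fin L → ℕ) (U : Finset (Fin L)) (l : ℕ) : ℝ := log (max 1 (nU b U l : ℝ))

structure LBox (L : ℕ) where
  a : Fin L → ℕ
  b : Fin L → ℕ
  Q : Fin L → Finset ℕ
  err : Fin L → ℝ
  ha : ∀ i, 10 ≤ a i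
  hab : ∀ i, a i ≤ b i + 1
  hq : ∀ i, ∀ q ∈ Q i, q.Prime ∧ lev q ≤ b i ∧ ∃ X, X.Prime ∧ X ∣ q-1 ∧ Zof (a i) < X°
  gap : ∀ i j, i < j → EE (b j + 1) ≤ Zof (a i)
  had : ∀ U i, i ∈ U → ∀ q ∈ Q i, ad (fun p ↦ gU b U (lev p)) (q-1) ≤ ∑ l ∈ range (b i+1), gU b U l + err i

theorem LBox.logA {L : ℕ} (B : LBox L) (i : Fin L) {A X : ℕ} (hX : X ≠ 0) (h : A * X + 1 ∈ B.Q i) :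
    A ≠ 0 ∧ log A ≤ exp ((B.b i:ℝ)+1) := by
  obtain ⟨h1, h2, -⟩ := B.hq i _ h
  have hA : A ≠ 0 := by rintro rfl; simp at h1; exact Nat.not_prime_one h1
  refine ⟨hA, ?_⟩
  rw [← log_EE]
  refine log_le_log (by exact_mod_cast Nat.pos_of_ne_zero hA) (le_trans ?_ ((lev_le_iff h1.two_le).1 h2))
  have : A * 1 ≤ A * X := Nat.mul_le_mul_left _ (Nat.pos_of_ne_zero hX)
  exact_mod_cast (by omega : A ≤ A*X+1)

theorem e_arith (c a : ℝ) (k : ℕ) (C t : ℝ) (hC : 1 ≤ C) (ha : 10 ≤ a) (hac : a ≤ c) (ht : 0 ≤ t) (ht' : t ≤ 2*c+2) :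
    C * exp c * (t^2 / (exp a / a^2))^k ≤ C * (2*c+2)^(4*k) * exp (c - k*a) := by
  have h1 : t^2 / (exp a / a^2) = (t^2*a^2) * exp (-a) := by
    rw [exp_neg]; field_simp
  have h2 : t^2*a^2 ≤ (2*c+2)^4 := by
    calc t^2*a^2 ≤ (2*c+2)^2*(2*c+2)^2 := by gcongr; linarith
      _ = _ := by ring
  rw [h1, mul_pow, ← exp_nat_mul, pow_mul, sub_eq_add_neg, exp_add c, show k° * -a = -(k*a) by ring]
  calc _ = C * (t^2*a^2)^k * (exp c * exp (-(k*a))) := by ring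
    _ ≤ _ := by gcongr

theorem LBox.prm {L : ℕ} (B : LBox L) (i : Fin L) : 16 ≤ Zof (B.a i) ∧ Zof (B.a i) ≤ EE ((B.b i:ℝ)+1) ∧
    loglog (EE ((B.b i:ℝ)+1)) = (B.b i:ℝ)+1 ∧ 10° ≤ B.a i ∧ (B.a i:ℝ) ≤ (B.b i:ℝ)+1 := by
  have h2 : (B.a i:ℝ) ≤ (B.b i:ℝ)+1 := by exact_mod_cast B.hab i
  refine ⟨Zof_ge (B.ha i), (Zof_le (B.ha i)).trans (EE_mono h2), by rw [loglog, log_EE, log_exp],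
    by exact_mod_cast B.ha i, h2⟩

theorem ext_e2 : ∃ C : ℝ, 1 ≤ C ∧ ∀ (L : ℕ) (B : LBox L) (i : Fin L) (A : ℕ) (T : Finset ℕ),
    (∀ X ∈ T, X ∈ PR (B.b i) ∧ Zof (B.a i) < X° ∧ A*X+1 ∈ B.Q i) →
    ∑ X ∈ T, 1°/X ≤ C * (2*((B.b i:ℝ)+1)+2)^8 * exp (((B.b i:ℝ)+1) - 2*B.a i) := by
  obtain ⟨C, hC, h⟩ := S2
  refine ⟨C, hC, fun L B i A T hT ↦ ?_⟩
  rcases T.eq_empty_or_nonempty with rfl | ⟨X, hX⟩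
  · rw [sum_empty]; positivity
  have hX0 := (mem_PR.1 (hT X hX).1).1.ne_zero
  obtain ⟨hA, hlA⟩ := B.logA i hX0 (hT X hX).2.2
  obtain ⟨p1, p2, p3, p4, p5⟩ := B.prm i
  refine (h ((B.b i:ℝ)+1) (Zof (B.a i)) (EE ((B.b i:ℝ)+1)) A T ♭ p1 p2 hA hlA (fun n hn ↦ ?_)).trans ?_
  · obtain ⟨q1, q2, q3⟩ := hT n hn
    obtain ⟨r1, r2⟩ := mem_PR.1 q1
    exact ⟨r1, (B.hq i _ q3).1, q2, (lev_le_iff r1.two_le).1 r2⟩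
  · rw [p3, log_EE, log_Zof]
    have := e_arith ((B.b i:ℝ)+1) (B.a i) 2 C ((B.b i:ℝ)+1+((B.b i:ℝ)+1)) hC p4 p5 ♭ ♭
    simpa using this

theorem ext_e3 : ∃ C : ℝ, 1 ≤ C ∧ ∀ (L : ℕ) (B : LBox L) (i : Fin L) (A A' : ℕ) (T : Finset ℕ), A ≠ A' →
    (∀ X ∈ T, X ∈ PR (B.b i) ∧ Zof (B.a i) < X° ∧ A*X+1 ∈ B.Q i ∧ A'*X+1 ∈ B.Q i) →
    ∑ X ∈ T, 1°/X ≤ C * (2*((B.b i:ℝ)+1)+2)^12 * exp (((B.b i:ℝ)+1) - 3*B.a i) := by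
  obtain ⟨C, hC, h⟩ := S3
  refine ⟨C, hC, fun L B i A A' T hne hT ↦ ?_⟩
  rcases T.eq_empty_or_nonempty with rfl | ⟨X, hX⟩
  · rw [sum_empty]; positivity
  have hX0 := (mem_PR.1 (hT X hX).1).1.ne_zero
  obtain ⟨hA, hlA⟩ := B.logA i hX0 (hT X hX).2.2.1
  obtain ⟨hA', hlA'⟩ := B.logA i hX0 (hT X hX).2.2.2
  obtain ⟨p1, p2, p3, p4, p5⟩ := B.prm i
  refine (h ((B.b i:ℝ)+1) (Zof (B.a i)) (EE ((B.b i:ℝ)+1)) A A' T ♭ p1 p2 hA hA' hne hlA hlA' (fun n hn ↦ ?_)).trans ?_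
  · obtain ⟨q1, q2, q3, q4⟩ := hT n hn
    obtain ⟨r1, r2⟩ := mem_PR.1 q1
    exact ⟨r1, (B.hq i _ q3).1, (B.hq i _ q4).1, q2, (lev_le_iff r1.two_le).1 r2⟩
  · rw [p3, log_EE, log_Zof]
    have := e_arith ((B.b i:ℝ)+1) (B.a i) 3 C ((B.b i:ℝ)+1+2+((B.b i:ℝ)+1)) hC p4 p5 ♭ ♭
    simpa using this

end

open Finset Real
noncomputable section

variable {L : ℕ}

def Dm (B : LBox L) (Big : ℕ) (U : Finset (Fin L)) (e : Fin L × Fin L) : Finset ℕ :=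
  if e.1 ∈ U ∧ e.2 ∈ U then (range (Big+1)).filter (fun m ↦ m ≠ 0 ∧ m.primeFactors ⊆ PR (min (B.b e.1) (B.b e.2)))
  else if e.1 = e.2 then (B.Q e.1).image (fun q ↦ q-1) else {1}
def fm (v : ℕ → ℝ) (U : Finset (Fin L)) (e : Fin L × Fin L) (m : ℕ) : ℝ :=
  if e.1 ∈ U ∧ e.2 ∈ U then cm (fun p ↦ v (lev p)) m / m else 1/m
def row (d : Fin L × Fin L → ℕ) (i : Fin L) : ℕ := ∏ j, d (i,j)
def col (d : Fin L × Fin L → ℕ) (j : Fin L) : ℕ := ∏ i, d (i,j)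
def cnd (B : LBox L) (d : Fin L × Fin L → ℕ) (i : Fin L) : Prop :=
  row d i + 1 ∈ B.Q i ∧ col d i + 1 ∈ B.Q i ∧ row d i ≠ col d i

theorem row_ext {d : Fin L × Fin L → ℕ} {i b : Fin L} {X m : ℕ} (h : d (i,b) = X*m) :
    row d i = row (Function.update d (i,b) m) i * X := by
  unfold row
  rw [← mul_prod_erase univ (fun j ↦ d (i,j)) (mem_univ b), ← mul_prod_erase univ (fun j ↦ Function.update d (i,b) m (i,j)) (mem_univ b),
    Function.update_self, h, prod_congr rfl (fun j hj ↦ Function.update_of_ne (f := d) (a := (i,j)) (a' := (i,b)) (by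
      simpa using ne_of_mem_erase hj) m)]
  ring

theorem col_ext {d : Fin L × Fin L → ℕ} {i b : Fin L} {X m : ℕ} (h : d (b,i) = X*m) :
    col d i = col (Function.update d (b,i) m) i * X := by
  unfold col
  rw [← mul_prod_erase univ (fun j ↦ d (j,i)) (mem_univ b), ← mul_prod_erase univ (fun j ↦ Function.update d (b,i) m (j,i)) (mem_univ b),
    Function.update_self, h, prod_congr rfl (fun j hj ↦ Function.update_of_ne (f := d) (a := (j,i)) (a' := (b,i)) (by
      simpa using ne_of_mem_erase hj) m)]
  ring

theorem row_ne {d : Fin L × Fin L → ℕ} {i : Fin L} {e : Fin L × Fin L} (m : ℕ) (h : e.1 ≠ i) :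
    row (Function.update d e m) i = row d i :=
  prod_congr rfl fun j _ ↦ Function.update_of_ne (by rintro rfl; exact h rfl) _ _

theorem col_ne {d : Fin L × Fin L → ℕ} {i : Fin L} {e : Fin L × Fin L} (m : ℕ) (h : e.2 ≠ i) :
    col (Function.update d e m) i = col d i :=
  prod_congr rfl fun j _ ↦ Function.update_of_ne (by rintro rfl; exact h rfl) _ _

theorem fm_nonneg {v : ℕ → ℝ} (hv : ∀ l, 0 ≤ v l ∧ v l ≤ 1) (U : Finset (Fin L)) (e) (m : ℕ) : 0 ≤ fm v U e m := by
  unfold fm; split_ifs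
  · exact div_nonneg (cm_nonneg fun p _ ↦ (hv _).1) ♯
  · positivity

theorem extE (B : LBox L) (Big : ℕ) (U : Finset (Fin L)) {v : ℕ → ℝ} (hv : ∀ l, 0 ≤ v l ∧ v l ≤ 1) {e : Fin L × Fin L}
    (he : e.1 ∈ U ∧ e.2 ∈ U) (T : (Fin L × Fin L → ℕ) → Finset ℕ) (ε : ℝ) (P Ψ : (Fin L × Fin L → ℕ) → Prop)
    (hp : ∀ d, ∀ X ∈ T d, X.Prime)
    (hP : ∀ d ∈ Fintype.piFinset (Dm B Big U), P d → ∃ X, X.Prime ∧ X ∣ d e ∧ ∀ m, d e = X * m →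
      Ψ (Function.update d e m) ∧ X ∈ T (Function.update d e m)) (hT : ∀ d, ∑ X ∈ T d, 1°/X ≤ ε) :
    fsum (Fintype.piFinset (Dm B Big U)) P (fun d ↦ ∏ i, fm v U i (d i)) ≤
      ε * fsum (Fintype.piFinset (Dm B Big U)) Ψ (fun d ↦ ∏ i, fm v U i (d i)) := by
  refine ext1 _ _ (fm_nonneg hv U) e T ε P Ψ (fun d hd X hX ↦ ?_) (fun d hd hPd ↦ ?_) (fun d _ ↦ hT d)
  · have h1 := Fintype.mem_piFinset.1 hd e
    simp only [Dm, if_pos he, mem_filter] at h1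
    have hX := hp d X hX
    simp only [fm, if_pos he]
    rw [cm_mul _ hX.ne_zero h1.2.1, cm_prime _ hX]
    have h2 : 0 ≤ cm (fun p ↦ v (lev p)) (d e) := cm_nonneg fun p _ ↦ (hv _).1
    have h3 : 0° < X := by exact_mod_cast hX.pos
    have h4 : 0° < d e := by exact_mod_cast Nat.pos_of_ne_zero h1.2.1
    rw [Nat.cast_mul, div_mul_div_comm, mul_one, mul_comm X°]
    exact div_le_div_of_nonneg_right (mul_le_of_le_one_left h2 (hv _).2) ♯
  · obtain ⟨X, hX, ⟨m, hm⟩, h⟩ := hP d hd hPd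
    refine ⟨X, Function.update d e m, ?_, (h m hm).1, (h m hm).2, by
      rw [Function.update_self, Function.update_idem, ← hm]; exact Function.update_eq_self _ _⟩
    rw [Fintype.mem_piFinset] at hd ⊢
    intro e'
    rcases eq_or_ne e' e with rfl | hne
    · have h1 := hd e'
      rw [Function.update_self]
      simp only [Dm, if_pos he, mem_filter, mem_range] at h1 ⊢
      have hm0 : m ≠ 0 := by rintro rfl; exact h1.2.1 (by simpa using hm)
      have : m ∣ d e' := ⟨X, by rw [hm, mul_comm]⟩
      exact ⟨lt_of_le_of_lt (Nat.le_of_dvd (Nat.pos_of_ne_zero h1.2.1) this) h1.1, hm0,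
        (Nat.primeFactors_mono this h1.2.1).trans h1.2.2⟩
    · rw [Function.update_of_ne hne]; exact hd e'

theorem LBox.inU (B : LBox L) {Big : ℕ} {U : Finset (Fin L)} {d} (hd : d ∈ Fintype.piFinset (Dm B Big U)) {i b : Fin L} (hi : i ∈ U)
    {X : ℕ} (hX : X.Prime) (hZ : Zof (B.a i) < X°) :
    (X ∣ d (i,b) → b ∈ U ∧ b ≤ i) ∧ (X ∣ d (b,i) → b ∈ U ∧ b ≤ i) := by
  have key : ∀ m, b ∈ U → m ≠ 0 → X ∣ m → m.primeFactors ⊆ PR (B.b b) → b ≤ i := fun m hb hm hXm hs ↦ by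
    by_contra hlt
    have h2 := (mem_PR.1 (hs (Nat.mem_primeFactors.2 ⟨hX, hXm, hm⟩))).2
    have := ((lev_le_iff hX.two_le).1 h2).trans (B.gap i b (not_le.1 hlt))
    linarith
  have pm : ∀ x y, PR (min x y) ⊆ PR y ∧ PR (min x y) ⊆ PR x := fun x y ↦ 
    ⟨fun p hp ↦ mem_PR.2 ⟨(mem_PR.1 hp).1, (mem_PR.1 hp).2.trans (min_le_right _ _)⟩,
     fun p hp ↦ mem_PR.2 ⟨(mem_PR.1 hp).1, (mem_PR.1 hp).2.trans (min_le_left _ _)⟩⟩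
  constructor
  · intro hdv
    have h1 := Fintype.mem_piFinset.1 hd (i,b)
    by_cases hb : b ∈ U
    · simp only [Dm, if_pos (And.intro hi hb), mem_filter] at h1
      exact ⟨hb, key _ hb h1.2.1 hdv (h1.2.2.trans (pm _ _).1)⟩
    · have hne : i ≠ b := by rintro rfl; exact hb hi
      simp [Dm, hb, hne] at h1
      rw [h1] at hdv; exact absurd (Nat.dvd_one.1 hdv) hX.ne_one
  · intro hdv
    have h1 := Fintype.mem_piFinset.1 hd (b,i)
    by_cases hb : b ∈ U
    · simp only [Dm, if_pos (And.intro hb hi), mem_filter] at h1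
      exact ⟨hb, key _ hb h1.2.1 hdv (h1.2.2.trans (pm _ _).2)⟩
    · have hne : b ≠ i := by rintro rfl; exact hb hi
      simp [Dm, hb, hne] at h1
      rw [h1] at hdv; exact absurd (Nat.dvd_one.1 hdv) hX.ne_one

def bigP (B : LBox L) (i : Fin L) (n : ℕ) : Prop := ∃ X : ℕ, X.Prime ∧ Zof (B.a i) < X° ∧ X ∣ n

theorem LBox.step0 (B : LBox L) (Big : ℕ) (U : Finset (Fin L)) {v : ℕ → ℝ} (hv : ∀ l, 0 ≤ v l ∧ v l ≤ 1) {i : Fin L} (hi : i ∈ U)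
    (e2 e3 : ℝ) (he2 : 0 ≤ e2) (he3 : 0 ≤ e3)
    (h2 : ∀ (A : ℕ) (T : Finset ℕ),
    (∀ X ∈ T, X ∈ PR (B.b i) ∧ Zof (B.a i) < X° ∧ A*X+1 ∈ B.Q i) → ∑ X ∈ T, 1°/X ≤ e2)
    (h3 : ∀ (A A' : ℕ) (T : Finset ℕ), A ≠ A' →
    (∀ X ∈ T, X ∈ PR (B.b i) ∧ Zof (B.a i) < X° ∧ A*X+1 ∈ B.Q i ∧ A'*X+1 ∈ B.Q i) → ∑ X ∈ T, 1°/X ≤ e3)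
    (Ψ : (Fin L × Fin L → ℕ) → Prop)
    (hΨ : ∀ d e m, e.1 ≤ i → e.2 ≤ i → Ψ d → Ψ (Function.update d e m)) :
    fsum (Fintype.piFinset (Dm B Big U)) (fun d ↦ cnd B d i ∧ Ψ d) (fun d ↦ ∏ i, fm v U i (d i)) ≤
      (e3 + L^2*e2^2) * fsum (Fintype.piFinset (Dm B Big U)) Ψ (fun d ↦ ∏ i, fm v U i (d i)) := by
  classical
  set S := Fintype.piFinset (Dm B Big U) with hS
  set W : (Fin L × Fin L → ℕ) → ℝ := fun d ↦ ∏ i, fm v U i (d i) with hW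
  have hW0 : ∀ d, 0 ≤ W d := fun d ↦ prod_nonneg fun i _ ↦ fm_nonneg hv U _ _
  have hPR : ∀ {n X : ℕ}, n + 1 ∈ B.Q i → X.Prime → X ∣ n → X ∈ PR (B.b i) := fun {n X} hn hX hd => by
    obtain ⟨q1, q2, -⟩ := B.hq i _ hn
    exact mem_PR_of_dvd q1.two_le q2 hX (by simpa using hd)
  set P1 : Fin L → Fin L → (Fin L × Fin L → ℕ) → Prop := fun a b d ↦ Ψ d ∧ row d i + 1 ∈ B.Q i ∧ col d i + 1 ∈ B.Q i ∧
    bigP B i (d (i,b)) ∧ bigP B i (d (a,i)) ∧ (a ∈ U ∧ b ∈ U ∧ a < i ∧ b < i) with hP1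
  set P0 : (Fin L × Fin L → ℕ) → Prop := fun d ↦ cnd B d i ∧ Ψ d ∧ bigP B i (d (i,i)) with hP0
  set X0 := fsum S Ψ W with hX0
  have hX00 : 0 ≤ X0 := sum_nonneg fun d _ ↦ by split_ifs; exacts [hW0 d, le_rfl]
  have c0 : fsum S P0 W ≤ e3 * X0 := by
    refine extE B Big U hv (e := (i,i)) ⟨hi, hi⟩ (fun d ↦ (PR (B.b i)).filter (fun X : ℕ => row d i ≠ col d i ∧ Zof (B.a i) < X° ∧
      row d i * X + 1 ∈ B.Q i ∧ col d i * X + 1 ∈ B.Q i)) e3 P0 Ψ (fun d X hX ↦ (mem_PR.1 (mem_filter.1 hX).1).1) ?_ ?_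
    · rintro d hd ⟨⟨q1, q2, q3⟩, hψ, X, hX, hZ, hdv⟩
      refine ⟨X, hX, hdv, fun m hm ↦ ⟨hΨ _ _ _ le_rfl le_rfl hψ, ?_⟩⟩
      have r1 := row_ext hm
      have r2 := col_ext hm
      refine mem_filter.2 ⟨hPR q1 hX ⟨_, r1.trans (mul_comm _ _)⟩, ?_, hZ, r1 ▸ q1, r2 ▸ q2⟩
      intro h; exact q3 (by rw [r1, r2, h])
    · intro d
      by_cases h : row d i = col d i
      · simp [h, he3]
      · exact h3 _ _ _ h fun X hX ↦ ⟨(mem_filter.1 hX).1, (mem_filter.1 hX).2.2⟩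
  have c1 : ∀ a ∈ U, ∀ b ∈ U, fsum S (P1 a b) W ≤ e2^2 * X0 := by
    intro a ha b hb
    by_cases hab : a < i ∧ b < i
    swap
    · unfold fsum
      rw [sum_eq_zero]
      · positivity
      · intro d hd; exact if_neg fun h ↦ hab h.2.2.2.2.2.2.2
    set Ψ1 : (Fin L × Fin L → ℕ) → Prop := fun d ↦ Ψ d ∧ col d i + 1 ∈ B.Q i ∧ bigP B i (d (a,i)) with hΨ1
    have s1 : fsum S (P1 a b) W ≤ e2 * fsum S Ψ1 W := by
      refine extE B Big U hv (e := (i,b)) ⟨hi, hb⟩ (fun d ↦ (PR (B.b i)).filter (fun X : ℕ => Zof (B.a i) < X° ∧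
        row d i * X + 1 ∈ B.Q i)) e2 _ Ψ1 (fun d X hX ↦ (mem_PR.1 (mem_filter.1 hX).1).1) ?_
        (fun d ↦ h2 _ _ fun X hX ↦ ⟨(mem_filter.1 hX).1, (mem_filter.1 hX).2⟩)
      rintro d hd ⟨hψ, q1, q2, ⟨X, hX, hZ, hdv⟩, q3, -⟩
      refine ⟨X, hX, hdv, fun m hm ↦ ⟨⟨hΨ _ _ _ le_rfl hab.2.le hψ, ?_, ?_⟩, ?_⟩⟩
      · rw [col_ne m (by exact hab.2.ne)]; exact q2
      · rw [Function.update_of_ne (by intro h; exact hab.1.ne (congrArg Prod.fst h))]; exact q3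
      · have r1 := row_ext hm
        exact mem_filter.2 ⟨hPR q1 hX ⟨_, r1.trans (mul_comm _ _)⟩, hZ, r1 ▸ q1⟩
    have s2 : fsum S Ψ1 W ≤ e2 * X0 := by
      refine extE B Big U hv (e := (a,i)) ⟨ha, hi⟩ (fun d ↦ (PR (B.b i)).filter (fun X : ℕ => Zof (B.a i) < X° ∧
        col d i * X + 1 ∈ B.Q i)) e2 _ Ψ (fun d X hX ↦ (mem_PR.1 (mem_filter.1 hX).1).1) ?_
        (fun d ↦ h2 _ _ fun X hX ↦ ⟨(mem_filter.1 hX).1, (mem_filter.1 hX).2⟩)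
      rintro d hd ⟨hψ, q2, ⟨X, hX, hZ, hdv⟩⟩
      refine ⟨X, hX, hdv, fun m hm ↦ ⟨hΨ _ _ _ hab.1.le le_rfl hψ, ?_⟩⟩
      have r1 := col_ext hm
      exact mem_filter.2 ⟨hPR q2 hX ⟨_, r1.trans (mul_comm _ _)⟩, hZ, r1 ▸ q2⟩
    calc _ ≤ _ := s1
      _ ≤ e2 * (e2 * X0) := mul_le_mul_of_nonneg_left s2 he2
      _ = _ := by ring
  have c2 : fsum S (fun d ↦ cnd B d i ∧ Ψ d) W ≤ fsum S P0 W + ∑ a ∈ U, ∑ b ∈ U, fsum S (P1 a b) W := by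
    have : ∑ a ∈ U, ∑ b ∈ U, fsum S (P1 a b) W = ∑ d ∈ S, ∑ a ∈ U, ∑ b ∈ U, if P1 a b d then W d else 0 := by
      refine (sum_congr rfl fun a _ ↦ sum_comm).trans (sum_comm.trans ?_)
      exact sum_congr rfl fun d _ ↦ sum_congr rfl fun a _ ↦ sum_congr rfl fun b _ ↦ by congr
    rw [this, fsum, fsum, ← sum_add_distrib]
    refine sum_le_sum fun d hd ↦ ?_
    have hin : ∀ a b, 0 ≤ (if P1 a b d then W d else 0) := fun a b ↦ by split_ifs; exacts [hW0 d, le_rfl]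
    have hs0 : 0 ≤ ∑ a ∈ U, ∑ b ∈ U, if P1 a b d then W d else 0 := sum_nonneg fun a _ ↦ sum_nonneg fun b _ ↦ hin a b
    split_ifs with q1 q2 q2
    · linarith
    · rw [zero_add]
      obtain ⟨⟨r1, r2, r3⟩, hψ⟩ := q1
      have nd : ¬ bigP B i (d (i,i)) := fun h ↦ q2 ⟨⟨r1, r2, r3⟩, hψ, h⟩
      obtain ⟨-, -, X, hX, hdv, hZ⟩ := B.hq i _ r1
      obtain ⟨-, -, X', hX', hdv', hZ'⟩ := B.hq i _ r2
      rw [Nat.add_sub_cancel] at hdv hdv'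
      obtain ⟨b, -, hb⟩ := (Prime.dvd_finsetProd_iff hX.prime _).1 hdv
      obtain ⟨a, -, ha⟩ := (Prime.dvd_finsetProd_iff hX'.prime _).1 hdv'
      obtain ⟨hbU, hbi⟩ := (B.inU hd hi hX hZ).1 hb
      obtain ⟨haU, hai⟩ := (B.inU hd hi hX' hZ').2 ha
      have hb' : b ≠ i := by rintro rfl; exact nd ⟨X, hX, hZ, hb⟩
      have ha' : a ≠ i := by rintro rfl; exact nd ⟨X', hX', hZ', ha⟩
      have hP : P1 a b d := ⟨hψ, r1, r2, ⟨X, hX, hZ, hb⟩, ⟨X', hX', hZ', ha⟩, haU, hbU, lt_of_le_of_ne hai ha', lt_of_le_of_ne hbi hb'⟩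
      refine le_trans ?_ (single_le_sum (f := fun a ↦ ∑ b ∈ U, if P1 a b d then W d else 0) (fun a _ ↦ sum_nonneg fun b _ ↦ hin a b) haU)
      refine le_trans ?_ (single_le_sum (f := fun b ↦ if P1 a b d then W d else 0) (fun b _ ↦ hin a b) hbU)
      rw [if_pos hP]
    · linarith [hW0 d]
    · linarith
  have c3 : ∑ a ∈ U, ∑ b ∈ U, fsum S (P1 a b) W ≤ L^2*(e2^2*X0) := by
    have hU : (U.card:ℝ) ≤ L := by exact_mod_cast (card_le_univ U).trans (by simp)
    refine (sum_le_sum fun a ha ↦ sum_le_sum fun b hb ↦ c1 a ha b hb).trans ?_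
    rw [sum_const, sum_const, nsmul_eq_mul, nsmul_eq_mul, ← mul_assoc, ← sq]
    gcongr
  calc _ ≤ _ := c2
    _ ≤ e3 * X0 + L^2*(e2^2*X0) := add_le_add c0 c3
    _ = _ := by ring

end

open Finset Real
noncomputable section

variable {L : ℕ}

theorem fsum_eq {κ : Type*} (S : Finset κ) (P : κ → Prop) [DecidablePred P] (W : κ → ℝ) : fsum S P W = ∑ d ∈ S.filter P, W d := by
  rw [sum_filter]; exact sum_congr rfl fun d _ ↦ by congr

def epsB (C : ℝ) (B : LBox L) (i : Fin L) : ℝ :=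
  C^2 * (1+L°^2) * (2*((B.b i:ℝ)+1)+2)^16 * exp (2*((B.b i:ℝ)+1) - 4*B.a i)

theorem eps_arith (C c a y l : ℝ) (hC : 1 ≤ C) (hac : a ≤ c) (hy : 1 ≤ y) :
    C * y^12 * exp (c-3*a) + l^2*(C * y^8 * exp (c-2*a))^2 ≤ C^2*(1+l^2)*y^16*exp (2*c-4*a) := by
  have h1 : (C * y^8 * exp (c-2*a))^2 = C^2*y^16*exp (2*c-4*a) := by
    rw [mul_pow, mul_pow, ← exp_nat_mul]; push_cast; ring_nf
  have h2 : C * y^12 * exp (c-3*a) ≤ C^2*y^16*exp (2*c-4*a) := by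
    have : C ≤ C^2 := by nlinarith
    have := pow_le_pow_right₀ hy (show 12 ≤ 16 by norm_num)
    have : exp (c-3*a) ≤ exp (2*c-4*a) := exp_le_exp.2 ♭
    gcongr
  rw [h1]; linarith

theorem LBox.step : ∃ C : ℝ, 1 ≤ C ∧ ∀ (L : ℕ) (B : LBox L) (Big : ℕ) (U : Finset (Fin L)) (v : ℕ → ℝ), (∀ l, 0 ≤ v l ∧ v l ≤ 1) →
    ∀ V : Finset (Fin L), V ⊆ U → fsum (Fintype.piFinset (Dm B Big U)) (fun d ↦ ∀ i ∈ V, cnd B d i) (fun d ↦ ∏ i, fm v U i (d i)) ≤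
      (∏ i ∈ V, epsB C B i) * ∑ d ∈ Fintype.piFinset (Dm B Big U), ∏ i, fm v U i (d i) := by
  obtain ⟨C2, hC2, h2⟩ := ext_e2
  obtain ⟨C3, hC3, h3⟩ := ext_e3
  refine ⟨max C2 C3, le_max_of_le_left hC2, fun L B Big U v hv V ↦ ?_⟩
  induction V using Finset.induction_on_min with
  | empty => intro _; simp [fsum]
  | insert i V hiV ih =>
    intro hV
    rw [prod_insert (fun h ↦ lt_irrefl _ (hiV i h)), mul_assoc]
    have e1 : ∀ d, (∀ j ∈ insert i V, cnd B d j) ↔ (cnd B d i ∧ ∀ j ∈ V, cnd B d j) := fun d ↦ forall_mem_insert _ _ _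
    simp only [e1]
    obtain ⟨p1, p2, p3, p4, p5⟩ := B.prm i
    refine (B.step0 Big U hv (hV (mem_insert_self _ _)) (max C2 C3 * (2*((B.b i:ℝ)+1)+2)^8 * exp (((B.b i:ℝ)+1) - 2*B.a i))
      (max C2 C3 * (2*((B.b i:ℝ)+1)+2)^12 * exp (((B.b i:ℝ)+1) - 3*B.a i)) ♯ ♯
      (fun A T hT ↦ (h2 L B i A T hT).trans (by gcongr; exact le_max_left _ _))
      (fun A A' T hne hT ↦ (h3 L B i A A' T hne hT).trans (by gcongr; exact le_max_right _ _)) _ ?_).trans ?_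
    · intro d e m he1 he2 hd j hj
      have := hiV j hj
      unfold cnd
      rw [row_ne m (lt_of_le_of_lt he1 this).ne, col_ne m (lt_of_le_of_lt he2 this).ne]
      exact hd j hj
    · refine mul_le_mul (eps_arith _ _ _ _ _ (le_max_of_le_left hC2) p5 ♭) (ih ((subset_insert _ _).trans hV)) ?_
        (by unfold epsB; positivity)
      exact sum_nonneg fun d _ ↦ by split_ifs; exacts [prod_nonneg fun i _ ↦ fm_nonneg hv U _ _, le_rfl]

def Nq (B : LBox L) (i : Fin L) : ℝ := ∑ q ∈ B.Q i, 1°/((q-1:ℕ):ℝ)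
def vU (b : Fin L → ℕ) (U : Finset (Fin L)) (l : ℕ) : ℝ := exp (-gU b U l)

theorem gU_nonneg (b : Fin L → ℕ) (U : Finset (Fin L)) (l : ℕ) : 0 ≤ gU b U l := log_nonneg (le_max_left _ _)
theorem vU_bd (b : Fin L → ℕ) (U : Finset (Fin L)) (l : ℕ) : 0 ≤ vU b U l ∧ vU b U l ≤ 1 :=
  ⟨(exp_pos _).le, exp_le_one_iff.2 (neg_nonpos.2 (gU_nonneg b U l))⟩

theorem vU_mul (b : Fin L → ℕ) (U : Finset (Fin L)) (l : ℕ) : nU b U l * vU b U l ≤ 1 := by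
  have h : 0° < max 1 (nU b U l : ℝ) := lt_of_lt_of_le one_pos (le_max_left _ _)
  rw [vU, gU, exp_neg, exp_log h, ← div_eq_mul_inv]
  exact (div_le_one h).2 (le_max_right _ _)

theorem vU_row (b : Fin L → ℕ) (U : Finset (Fin L)) (i : Fin L) :
    ∑ j ∈ U, ∑ l ∈ range (min (b i) (b j) + 1), vU b U l ≤ (b i:ℝ) + 1 := by
  have h1 : ∀ j ∈ U, ∑ l ∈ range (min (b i) (b j) + 1), vU b U l = ∑ l ∈ range (b i+1), if l ≤ b j then vU b U l else 0 := fun j _ ↦ by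
    rw [← sum_filter]
    refine sum_congr ?_ fun _ _ ↦ rfl
    ext l; simp only [mem_range, mem_filter]; omega
  rw [sum_congr rfl h1, sum_comm]
  refine (sum_le_sum (g := fun _ ↦ 1°) fun l _ ↦ ?_).trans (by simp)
  rw [← sum_filter, sum_const, nsmul_eq_mul]
  exact vU_mul b U l

theorem LBox.totW : ∃ M : ℝ, 1 ≤ M ∧ ∀ (L : ℕ) (B : LBox L) (Big : ℕ) (U : Finset (Fin L)),
    ∑ d ∈ Fintype.piFinset (Dm B Big U), ∏ i, fm (vU B.b U) U i (d i) ≤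
      ∏ i, if i ∈ U then exp ((B.b i:ℝ)+1+M*L) else Nq B i := by
  obtain ⟨M, hM, h⟩ := cm_lev_sum
  refine ⟨M, hM, fun L B Big U ↦ ?_⟩
  rw [← prod_univ_sum, Fintype.prod_prod_type]
  have hN : ∀ i, 0 ≤ Nq B i := fun i ↦ sum_nonneg fun q _ ↦ by positivity
  refine prod_le_prod (fun i _ ↦ prod_nonneg fun j _ ↦ sum_nonneg fun m _ ↦ fm_nonneg (vU_bd _ _) _ _ _) fun i _ ↦ ?_
  by_cases hi : i ∈ U
  · rw [if_pos hi]
    have h1 : ∀ j ∈ (univ:Finset (Fin L)), ∑ m ∈ Dm B Big U (i,j), fm (vU B.b U) U (i,j) m ≤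
        exp (if j ∈ U then (∑ l ∈ range (min (B.b i) (B.b j)+1), vU B.b U l + M) else 0) := by
      intro j _
      by_cases hj : j ∈ U
      · simp only [if_pos hj, fm, if_pos (And.intro hi hj)]
        have := h (min (B.b i) (B.b j)) (vU B.b U) 1 le_rfl (fun l _ ↦ vU_bd _ _ _) (fun p hp ↦ ?_) (Dm B Big U (i,j)) (fun N hN ↦ ?_)
        · simpa using this
        · have hp2 : 2° ≤ p := by exact_mod_cast (mem_PR.1 hp).1.two_le
          rw [div_le_iff₀ ♭]; linarith [(vU_bd B.b U (lev p)).2]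
        · simp only [Dm, if_pos (And.intro hi hj), mem_filter] at hN
          exact hN.2
      · have hne : i ≠ j := by rintro rfl; exact hj hi
        simp [Dm, fm, hj, hne]
    refine (prod_le_prod (fun j _ ↦ sum_nonneg fun m _ ↦ fm_nonneg (vU_bd _ _) _ _ _) h1).trans ?_
    rw [← exp_sum, exp_le_exp, ← sum_filter, sum_add_distrib, filter_mem_eq_inter, univ_inter, sum_const, nsmul_eq_mul]
    have hU : (U.card:ℝ) ≤ L := by exact_mod_cast (card_le_univ U).trans (by simp)
    have := vU_row B.b U i
    nlinarith
  · rw [if_neg hi, ← mul_prod_erase univ _ (mem_univ i), prod_eq_one, mul_one]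
    · simp only [Dm, fm, hi, false_and, if_false, if_true]
      refine (sum_image_le_of_nonneg (fun q _ ↦ by positivity)).trans le_rfl
    · intro j hj
      have hne : i ≠ j := (ne_of_mem_erase hj).symm
      simp [Dm, fm, hi, hne]

theorem cm_prod {ι : Type*} [DecidableEq ι] (u : ℕ → ℝ) (s : Finset ι) (d : ι → ℕ) (h : ∀ j ∈ s, d j ≠ 0) : cm u (∏ j ∈ s, d j) = ∏ j ∈ s, cm u (d j) := by
  induction s using Finset.induction_on with
  | empty => simp [cm_one]
  | insert a s ha ih =>
    rw [prod_insert ha, prod_insert ha, cm_mul u (h a (mem_insert_self _ _)) (prod_ne_zero_iff.2 fun j hj ↦ h j (mem_insert_of_mem hj)),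
      ih fun j hj ↦ h j (mem_insert_of_mem hj)]

def prs (B : LBox L) (U : Finset (Fin L)) : Finset ((Fin L → ℕ) × (Fin L → ℕ)) :=
  (Fintype.piFinset B.Q ×ˢ Fintype.piFinset B.Q).filter
    (fun z ↦ ∏ i, (z.1 i - 1) = ∏ i, (z.2 i - 1) ∧ univ.filter (fun i ↦ z.1 i ≠ z.2 i) = U)

def GB (B : LBox L) (U : Finset (Fin L)) (i : Fin L) : ℝ := ∑ l ∈ range (B.b i+1), gU B.b U l + B.err i

theorem LBox.fm_lower (B : LBox L) {Big : ℕ} {U : Finset (Fin L)} {d} (hd : d ∈ Fintype.piFinset (Dm B Big U)) (hc : ∀ i ∈ U, cnd B d i) :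
    ∏ i, 1°/((row d i + 1 - 1 : ℕ):ℝ) ≤ exp (∑ i ∈ U, GB B U i) * ∏ e, fm (vU B.b U) U e (d e) := by
  have h0 : ∀ i ∈ U, ∀ j, d (i,j) ≠ 0 ∧ (j ∉ U → d (i,j) = 1) := fun i hi j ↦ by
    have h1 := Fintype.mem_piFinset.1 hd (i,j)
    by_cases hj : j ∈ U
    · simp only [Dm, if_pos (And.intro hi hj), mem_filter] at h1
      exact ⟨h1.2.1, fun h ↦ absurd hj h⟩
    · have hne : i ≠ j := by rintro rfl; exact hj hi
      simp [Dm, hj, hne] at h1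
      simp [h1]
  have hE : ∏ i ∈ U, exp (GB B U i) = ∏ i, if i ∈ U then exp (GB B U i) else 1 := by rw [prod_ite_mem, univ_inter]
  rw [Fintype.prod_prod_type, exp_sum, hE, ← prod_mul_distrib]
  refine prod_le_prod (fun i _ ↦ by positivity) fun i _ ↦ ?_
  rw [Nat.add_sub_cancel]
  by_cases hi : i ∈ U
  · have e1 : ∏ j, fm (vU B.b U) U (i,j) (d (i,j)) = exp (ad (fun p ↦ - gU B.b U (lev p)) (row d i)) * (1/(row d i:ℝ)) := by
      rw [← cm_exp, row, cm_prod _ _ _ (fun j _ ↦ (h0 i hi j).1), Nat.cast_prod, one_div, ← prod_inv_distrib, ← prod_mul_distrib]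
      refine prod_congr rfl fun j _ ↦ ?_
      by_cases hj : j ∈ U
      · simp [fm, hi, hj, vU, div_eq_mul_inv]
      · simp [fm, hj, (h0 i hi j).2 hj, cm_one]
    rw [if_pos hi, e1, ← mul_assoc, ← exp_add]
    refine le_mul_of_one_le_left ♯ (one_le_exp ?_)
    have h2 := B.had U i hi _ (hc i hi).1
    rw [Nat.add_sub_cancel] at h2
    have h3 := ad_smul (-1) (fun p ↦ gU B.b U (lev p)) (row d i)
    simp only [neg_one_mul] at h3
    rw [h3]; unfold GB; linarith
  · rw [if_neg hi, one_mul, row, Nat.cast_prod, one_div, ← prod_inv_distrib]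
    refine le_of_eq (prod_congr rfl fun j _ ↦ ?_)
    simp [fm, hi]

theorem LBox.pairs (B : LBox L) {Big : ℕ} (hBig : ∀ i, ∀ q ∈ B.Q i, q ≤ Big) (U : Finset (Fin L)) :
    ∑ z ∈ prs B U, ∏ i, 1°/((z.1 i - 1 : ℕ):ℝ) ≤ exp (∑ i ∈ U, GB B U i) *
      fsum (Fintype.piFinset (Dm B Big U)) (fun d ↦ ∀ i ∈ U, cnd B d i) (fun d ↦ ∏ e, fm (vU B.b U) U e (d e)) := by
  classical
  rw [fsum_eq, mul_sum]
  refine (sum_cover (prs B U) ((Fintype.piFinset (Dm B Big U)).filter (fun d ↦ ∀ i ∈ U, cnd B d i))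
    (fun d ↦ (fun i ↦ row d i + 1, fun i ↦ col d i + 1)) (fun z ↦ ∏ i, 1°/((z.1 i - 1 : ℕ):ℝ))
    (fun z ↦ prod_nonneg fun i _ ↦ by positivity) (fun z hz ↦ ?_)).trans
    (sum_le_sum fun d hd ↦ B.fm_lower (mem_filter.1 hd).1 (mem_filter.1 hd).2)
  obtain ⟨hz1, hz2, hz3⟩ := mem_filter.1 hz
  obtain ⟨hq, hq'⟩ := mem_product.1 hz1
  rw [Fintype.mem_piFinset] at hq hq'
  have hne : ∀ i, z.1 i ≠ z.2 i ↔ i ∈ U := fun i ↦ by rw [← hz3]; simp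
  have pos : ∀ {i q}, q ∈ B.Q i → 0 < q - 1 := fun {i q} h => by have := (B.hq i q h).1.two_le; omega
  have hU : ∏ i ∈ U, (z.1 i - 1) = ∏ i ∈ U, (z.2 i - 1) := by
    rw [← prod_mul_prod_compl U, ← prod_mul_prod_compl U (fun i ↦ z.2 i - 1),
      prod_congr rfl (fun i (hi : i ∈ Uᶜ) => by rw [not_not.1 (mt (hne i).1 (mem_compl.1 hi))])] at hz2
    exact Nat.eq_of_mul_eq_mul_right (prod_pos fun i _ ↦ pos (hq' i)) hz2
  obtain ⟨d, h1, h2⟩ := refine_mat U U (fun i ↦ z.1 i - 1) (fun i _ ↦ pos (hq i)) (fun i ↦ z.2 i - 1) hU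
  set D : Fin L × Fin L → ℕ := fun e ↦ if e.1 ∈ U ∧ e.2 ∈ U then d e.1 e.2 else if e.1 = e.2 then z.1 e.1 - 1 else 1 with hD
  have hrow : ∀ i, row D i = z.1 i - 1 := fun i ↦ by
    by_cases hi : i ∈ U
    · rw [← h1 i hi, row, ← prod_subset (subset_univ U)]
      · exact prod_congr rfl fun j hj ↦ by simp [hD, hi, hj]
      · intro j _ hj
        have : i ≠ j := by rintro rfl; exact hj hi
        simp [hD, hj, this]
    · simp [row, hD, hi]
  have hcol : ∀ i, col D i = z.2 i - 1 := fun i ↦ by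
    by_cases hi : i ∈ U
    · rw [← h2 i hi, col, ← prod_subset (subset_univ U)]
      · exact prod_congr rfl fun j hj ↦ by simp [hD, hi, hj]
      · intro j _ hj
        have : j ≠ i := by rintro rfl; exact hj hi
        simp [hD, hj, this]
    · have : z.1 i = z.2 i := not_not.1 (mt (hne i).1 hi)
      simp [col, hD, hi, this]
  have e1 : ∀ i, row D i + 1 = z.1 i := fun i ↦ by rw [hrow]; have := pos (hq i); omega
  have e2 : ∀ i, col D i + 1 = z.2 i := fun i ↦ by rw [hcol]; have := pos (hq' i); omega
  refine ⟨D, mem_filter.2 ⟨Fintype.mem_piFinset.2 fun e ↦ ?_, fun i hi ↦ ⟨by rw [e1]; exact hq i, by rw [e2]; exact hq' i, ?_⟩⟩, ?_⟩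
  · by_cases he : e.1 ∈ U ∧ e.2 ∈ U
    · have d1 : d e.1 e.2 ∣ z.1 e.1 - 1 := by rw [← h1 _ he.1]; exact dvd_prod_of_mem _ he.2
      have d2 : d e.1 e.2 ∣ z.2 e.2 - 1 := by rw [← h2 _ he.2]; exact dvd_prod_of_mem (fun i ↦ d i e.2) he.1
      have := Nat.le_of_dvd (pos (hq _)) d1
      have := hBig _ _ (hq e.1)
      simp only [Dm, if_pos he, mem_filter, mem_range, hD]
      refine ⟨by omega, (Nat.pos_of_dvd_of_pos d1 (pos (hq _))).ne', fun p hp ↦ ?_⟩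
      have hp1 := Nat.dvd_of_mem_primeFactors hp
      have hp2 := Nat.prime_of_mem_primeFactors hp
      obtain ⟨r1, r2, -⟩ := B.hq _ _ (hq e.1)
      obtain ⟨s1, s2, -⟩ := B.hq _ _ (hq' e.2)
      exact mem_PR.2 ⟨hp2, le_min (mem_PR.1 (mem_PR_of_dvd r1.two_le r2 hp2 (hp1.trans d1))).2
        (mem_PR.1 (mem_PR_of_dvd s1.two_le s2 hp2 (hp1.trans d2))).2⟩
    · simp only [Dm, if_neg he, hD]
      split_ifs with h
      · exact mem_image.2 ⟨_, hq e.1, rfl⟩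
      · simp
  · intro h; exact (hne i).2 hi (by rw [← e1, ← e2, h])
  · exact Prod.ext (funext e1) (funext e2)

end

open Finset Real
noncomputable section

variable {L : ℕ}

theorem LBox.prs_bd : ∃ C M : ℝ, 1 ≤ C ∧ 1 ≤ M ∧ ∀ (L : ℕ) (B : LBox L) (U : Finset (Fin L)), (∀ i, 1 ≤ Nq B i) →
    ∑ z ∈ prs B U, ∏ i, 1°/((z.1 i - 1 : ℕ):ℝ) ≤
      (∏ i ∈ U, (exp (GB B U i) * epsB C B i * exp ((B.b i:ℝ)+1+M*L))) * ∏ i, Nq B i := by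
  obtain ⟨C, hC, h1⟩ := LBox.step
  obtain ⟨M, hM, h2⟩ := LBox.totW
  refine ⟨C, M, hC, hM, fun L B U hN ↦ ?_⟩
  have hBig : ∀ i, ∀ q ∈ B.Q i, q ≤ ∑ i, ∑ q ∈ B.Q i, q := fun i q hq ↦ 
    (single_le_sum (f := fun q ↦ q) (fun _ _ ↦ Nat.zero_le _) hq).trans
      (single_le_sum (f := fun i ↦ ∑ q ∈ B.Q i, q) (fun _ _ ↦ Nat.zero_le _) (mem_univ i))
  have e0 : ∀ i, 0 ≤ epsB C B i := fun i ↦ by unfold epsB; positivity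
  refine (B.pairs hBig U).trans ?_
  refine (mul_le_mul_of_nonneg_left ((h1 L B _ U _ (vU_bd _ _) U subset_rfl).trans
    (mul_le_mul_of_nonneg_left (h2 L B _ U) (prod_nonneg fun i _ ↦ e0 i))) (exp_pos _).le).trans ?_
  rw [prod_mul_distrib, prod_mul_distrib, ← exp_sum, mul_assoc, mul_assoc]
  refine mul_le_mul_of_nonneg_left (mul_le_mul_of_nonneg_left ?_ (prod_nonneg fun i _ ↦ e0 i)) (exp_pos _).le
  rw [← univ_inter U, ← prod_ite_mem, ← prod_mul_distrib, univ_inter]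
  refine prod_le_prod (fun i _ ↦ ?_) fun i _ ↦ ?_
  · split_ifs; exacts [(exp_pos _).le, zero_le_one.trans (hN i)]
  · split_ifs
    · exact le_mul_of_one_le_right (exp_pos _).le (hN i)
    · rw [one_mul]

theorem LBox.second : ∃ C M : ℝ, 1 ≤ C ∧ 1 ≤ M ∧ ∀ (L : ℕ) (B : LBox L), (∀ i, 1 ≤ Nq B i) →
    (∀ U : Finset (Fin L), U.Nonempty → ∏ i ∈ U, (exp (GB B U i) * epsB C B i * exp ((B.b i:ℝ)+1+M*L)) ≤ exp (-L)) →
    (∏ i, Nq B i)/2 ≤ ∑ w ∈ (Fintype.piFinset B.Q).image (fun q : Fin L → ℕ => ∏ i, (q i - 1)), 1°/(w:ℕ) := by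
  obtain ⟨C, M, hC, hM, h⟩ := LBox.prs_bd
  refine ⟨C, M, hC, hM, fun L B hN hU ↦ ?_⟩
  set P := Fintype.piFinset B.Q with hP
  set φ : (Fin L → ℕ) → ℕ := fun q ↦ ∏ i, (q i - 1) with hφ
  set F : (Fin L → ℕ) → ℝ := fun q ↦ ∏ i, 1°/((q i - 1 : ℕ):ℝ) with hF
  have hFφ : ∀ q, F q = 1/(φ q:ℝ) := fun q ↦ by simp [hF, hφ]
  set N := ∏ i, Nq B i with hNdef
  have hN1 : 1 ≤ N := by
    rw [hNdef, ← prod_const_one (s := (univ : Finset (Fin L)))]; exact prod_le_prod (fun _ _ ↦ zero_le_one) fun i _ ↦ hN i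
  have hNs : N = ∑ q ∈ P, F q := prod_univ_sum _ _
  set E := ∑ z ∈ P ×ˢ P with φ z.1 = φ z.2, F z.1 with hE
  have hE2 : E ≤ 2 * N := by
    have e1 : E = ∑ U : Finset (Fin L), ∑ z ∈ prs B U, F z.1 := by
      rw [hE, ← sum_fiberwise_of_maps_to (t := univ) (g := fun z : (Fin L → ℕ) × (Fin L → ℕ) => univ.filter (fun i ↦ z.1 i ≠ z.2 i)) (fun _ _ ↦ mem_univ _)]
      exact sum_congr rfl fun U _ ↦ sum_congr (by rw [filter_filter]; rfl) fun _ _ ↦ rfl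
    have e2 : ∀ U ∈ (univ : Finset (Finset (Fin L))), ∑ z ∈ prs B U, F z.1 ≤ (if U = ∅ then 1 else 0) * N + exp (-L) * N := fun U _ ↦ by
      refine (h L B U hN).trans ?_
      have := exp_pos (-L°)
      rcases U.eq_empty_or_nonempty with rfl | hne
      · rw [prod_empty, if_pos rfl]; nlinarith
      · rw [if_neg hne.ne_empty, zero_mul, zero_add]
        exact mul_le_mul_of_nonneg_right (hU U hne) ♭
    have e3 : 2°^L * exp (-L) ≤ 1 := by
      rw [exp_neg, ← div_eq_mul_inv, div_le_one (exp_pos _)]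
      calc 2°^L ≤ (exp 1)^L := by gcongr; linarith [add_one_le_exp 1]
        _ = _ := by rw [← exp_nat_mul, mul_one]
    rw [e1]
    refine (sum_le_sum e2).trans ?_
    rw [sum_add_distrib, ← sum_mul, sum_ite_eq' univ ∅, if_pos (mem_univ _), sum_const, nsmul_eq_mul, card_univ, Fintype.card_finset, Fintype.card_fin]
    push_cast
    nlinarith
  set r : ℕ → ℝ := fun w ↦ ((P.filter (fun q ↦ φ q = w)).card : ℝ) with hr
  have f1 : N = ∑ w ∈ P.image φ, r w * (1/w°) := by
    rw [hNs, ← sum_fiberwise_of_maps_to (t := P.image φ) (g := φ) (fun q hq ↦ mem_image_of_mem _ hq)]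
    refine sum_congr rfl fun w _ ↦ ?_
    rw [sum_congr rfl (g := fun _ ↦ 1/w°) (fun q hq ↦ by rw [hFφ, (mem_filter.1 hq).2]), sum_const, nsmul_eq_mul]
  have f2 : E = ∑ w ∈ P.image φ, r w ^ 2 * (1/w°) := by
    rw [hE, ← sum_fiberwise_of_maps_to (t := P.image φ) (g := fun z : (Fin L → ℕ) × (Fin L → ℕ) => φ z.1)
      (fun z hz ↦ mem_image_of_mem _ (mem_product.1 (mem_filter.1 hz).1).1)]
    refine sum_congr rfl fun w _ ↦ ?_
    rw [sum_congr rfl (g := fun _ ↦ 1/w°) (fun z hz ↦ by rw [hFφ, (mem_filter.1 hz).2]), sum_const, nsmul_eq_mul]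
    congr 1
    rw [hr, sq, ← Nat.cast_mul, ← card_product]
    congr 2
    ext z; simp only [mem_filter, mem_product]
    constructor
    · rintro ⟨⟨⟨h1, h2⟩, h3⟩, h4⟩; exact ⟨⟨h1, h4⟩, h2, h3 ▸ h4⟩
    · rintro ⟨⟨h1, h4⟩, h2, h5⟩; exact ⟨⟨⟨h1, h2⟩, h4.trans h5.symm⟩, h4⟩
  have cs := sum_sq_le_sum_mul_sum_of_sq_le_mul (P.image φ) (r := fun w ↦ r w * (1/w°)) (f := fun w ↦ 1/w°) (g := fun w ↦ r w ^ 2 * (1/w°))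
    (fun w _ ↦ by positivity) (fun w _ ↦ by positivity) (fun w _ ↦ le_of_eq (by ring))
  rw [← f1, ← f2] at cs
  have hT : 0 ≤ ∑ w ∈ P.image φ, 1/w° := sum_nonneg fun w _ ↦ by positivity
  nlinarith

theorem expoU (b : Fin L → ℕ) (c : ℕ → ℕ) (hc : Antitone c) (hb : ∀ i, b i + 1 = c i) (U : Finset (Fin L)) (i0 : Fin L) (hi0 : i0 ∈ U)
    (hmin : ∀ i ∈ U, i0 ≤ i) : ∑ i ∈ U, ∑ l ∈ range (b i+1), (gU b U l - 1) ≤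
      -(c i0 : ℝ) + ∑ k ∈ range L, fordA (k+1) * c (i0+k+1) := by
  have h1 : ∀ i ∈ U, ∑ l ∈ range (b i+1), (gU b U l - 1) = ∑ l ∈ range (c i0), if l ≤ b i then gU b U l - 1 else 0 := fun i hi ↦ by
    have := hc (show (i0:ℕ) ≤ i from hmin i hi)
    have := hb i
    rw [← sum_filter]
    refine sum_congr ?_ fun _ _ ↦ rfl
    ext l; simp only [mem_range, mem_filter]; omega
  rw [sum_congr rfl h1, sum_comm]
  have h2 : ∀ l ∈ range (c i0), (∑ i ∈ U, if l ≤ b i then gU b U l - 1 else 0) ≤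
      -1 + ∑ k ∈ range L, fordA (k+1) * (if l < c (i0+k+1) then 1 else 0) := fun l hl ↦ by
    rw [← sum_filter, sum_const, nsmul_eq_mul]
    change (nU b U l : ℝ) * _ ≤ _
    have hn : 1 ≤ nU b U l := card_pos.2 ⟨i0, mem_filter.2 ⟨hi0, by have := hb i0; have := mem_range.1 hl; omega⟩⟩
    obtain ⟨n, hn'⟩ : ∃ n, nU b U l = n+1 := ⟨nU b U l - 1, by omega⟩
    have hg : gU b U l = log ((n+1:ℕ):ℝ) := by
      unfold gU; rw [hn', max_eq_right]; exact_mod_cast (by omega : 1 ≤ n+1)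
    have hft := ford_tele n
    rw [hg, hn']
    have hnL : n ≤ L := by
      have : nU b U l ≤ L := (card_le_univ _).trans (by simp)
      omega
    have h3 : ∑ k ∈ range n, fordA (k+1) ≤ ∑ k ∈ range L, fordA (k+1) * (if l < c (i0+k+1) then 1 else 0) := by
      refine le_trans (le_of_eq (sum_congr rfl fun k hk ↦ ?_)) (sum_le_sum_of_subset_of_nonneg (range_subset_range.2 hnL) fun k _ _ ↦ ?_)
      · rw [if_pos, mul_one]
        by_contra hlt
        have hsub : (U.filter (fun i ↦ l ≤ b i)).image (fun i : Fin L => (i:ℕ)) ⊆ Ico (i0:ℕ) (i0+k+1) := by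
          intro x hx
          obtain ⟨i, hi, rfl⟩ := mem_image.1 hx
          obtain ⟨hiU, hil⟩ := mem_filter.1 hi
          refine mem_Ico.2 ⟨hmin i hiU, ?_⟩
          by_contra hge
          have := hc (not_lt.1 hge)
          have := hb i
          omega
        have := card_le_card hsub
        rw [card_image_of_injective _ Fin.val_injective, Nat.card_Ico] at this
        have h5 : nU b U l ≤ k + 1 := by unfold nU; omega
        have := mem_range.1 hk
        omega
      · exact mul_nonneg (fordA_succ_pos k).le (by split_ifs <;> norm_num)
    linarith
  refine (sum_le_sum h2).trans ?_
  rw [sum_add_distrib, sum_const, card_range, nsmul_eq_mul, mul_neg_one, sum_comm]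
  gcongr with k hk
  rw [← mul_sum]
  refine mul_le_mul_of_nonneg_left ?_ (fordA_succ_pos k).le
  rw [← sum_filter, sum_const, nsmul_eq_mul, mul_one]
  exact_mod_cast (card_le_card (t := range (c (i0+k+1))) (fun l hl ↦ mem_range.2 (mem_filter.1 hl).2)).trans (by simp)

end

open Finset Real
noncomputable section

theorem f_arith (C : ℝ) (hC : 1 ≤ C) : ∃ r0 : ℝ, 20 ≤ r0 ∧ ∀ s, r0 ≤ s → C * (s^16 * exp (-(s/2))) ≤ 1/16 ∧ C * exp (-s) ≤ 1/16 := by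
  have h := (tendsto_pow_mul_exp_neg_atTop_nhds_zero 16).comp (Filter.tendsto_id.atTop_div_const (show 0° < 2 by norm_num))
  obtain ⟨r, hr⟩ := Filter.eventually_atTop.1 (h.eventually (ge_mem_nhds (show 0° < 1/(16*2^16*C) by positivity)))
  refine ⟨max r 20, le_max_right _ _, fun s hs ↦ ?_⟩
  have h1 := hr s ((le_max_left _ _).trans hs)
  have hs' : 20 ≤ s := (le_max_right _ _).trans hs
  simp only [Function.comp_apply, id, div_pow] at h1
  have h2 : C * (s^16 * exp (-(s/2))) ≤ 1/16 := by
    calc _ = C * 2^16 * (s^16/2^16 * exp (-(s/2))) := by ring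
      _ ≤ C*2^16 * (1/(16*2^16*C)) := by gcongr
      _ = _ := by field_simp
  refine ⟨h2, le_trans (mul_le_mul_of_nonneg_left ?_ ♭) h2⟩
  calc exp (-s) ≤ 1 * exp (-(s/2)) := by rw [one_mul]; exact exp_le_exp.2 ♭
    _ ≤ _ := by gcongr; exact one_le_pow₀ ♭

open Classical in
def QB {L : ℕ} (a b : Fin L → ℕ) (err : Fin L → ℝ) (i : Fin L) : Finset ℕ :=
  (PR (b i)).filter (fun q ↦ a i ≤ lev q ∧ (∃ X, X.Prime ∧ X ∣ q-1 ∧ Zof (a i) < X°) ∧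
    ∀ U, i ∈ U → ad (fun p ↦ gU b U (lev p)) (q-1) ≤ ∑ l ∈ range (b i+1), gU b U l + err i)

theorem mem_QB {L : ℕ} {a b : Fin L → ℕ} {err : Fin L → ℝ} {i : Fin L} {q : ℕ} : q ∈ QB a b err i ↔ (q.Prime ∧ lev q ≤ b i) ∧
    a i ≤ lev q ∧ (∃ X, X.Prime ∧ X ∣ q-1 ∧ Zof (a i) < X°) ∧
    ∀ U, i ∈ U → ad (fun p ↦ gU b U (lev p)) (q-1) ≤ ∑ l ∈ range (b i+1), gU b U l + err i := by
  simp only [QB, mem_filter, mem_PR]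

theorem qb1 (C r c l : ℝ) (L : ℕ) (h : ∀ s, r ≤ s → C * (s^16 * exp (-(s/2))) ≤ 1/16 ∧ C * exp (-s) ≤ 1/16)
    (hr : 20 ≤ r) (hL : L° ≤ r) (hc : r^20 ≤ c) (hl : l+1 ≤ c) (hcl : c ≤ 2*l) (hC : 1 ≤ C) :
    2^L * (C * ((l+1)^8 * exp (-((2*c/r^3)/r^6) + (l+1)/r^10) + exp (-l^2+5*l+5))) ≤ 1/8 := by
  have e2 : 2°^L ≤ exp r := by
    calc 2°^L ≤ (exp 1)^L := by gcongr; have := add_one_le_exp 1°; linarith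
      _ ≤ _ := by rw [← exp_nat_mul, mul_one]; exact exp_le_exp.2 hL
  have h0 : 0 < r := by linarith
  have r11 : r^2 ≤ r^11 := pow_le_pow_right₀ ♭ ♮
  have r20 : r^2 ≤ r^20 := pow_le_pow_right₀ ♭ ♮
  have hs : r^11 ≤ c/r^9 := by rw [le_div_iff₀ ♯]; calc r^11*r^9 = r^20 := by ring
      _ ≤ c := hc
  have hl0 : 0 ≤ l := by nlinarith
  have hlr : r ≤ l := by nlinarith
  set s := c/r^9
  have hcs : c ≤ s^2 := by
    have h1 : c = s*r^9 := by simp only [s]; field_simp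
    have h2 : r^9 ≤ s := le_trans (pow_le_pow_right₀ ♭ ♮) hs
    have : 0 < s := lt_of_lt_of_le ♯ h2
    nlinarith
  have hrs : 2*r ≤ s := by nlinarith
  obtain ⟨b1, -⟩ := h s ♭
  obtain ⟨-, b2⟩ := h l hlr
  have k1 : (l+1)^8 * exp (-((2*c/r^3)/r^6) + (l+1)/r^10) * exp r ≤ s^16 * exp (-(s/2)) := by
    rw [mul_assoc, ← exp_add]
    have he : (2*c/r^3)/r^6 = 2*s := by simp only [s]; field_simp
    have : (l+1)^8 ≤ s^16 := by
      calc (l+1)^8 ≤ (s^2)^8 := by gcongr; linarith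
        _ = _ := by ring
    gcongr
    rw [he]
    have : (l+1)/r^10 ≤ s/20 := by
      rw [div_le_iff₀ ♯]
      calc l+1 ≤ c := hl
        _ = s/20 * (20*r^9) := by simp only [s]; field_simp
        _ ≤ s/20*r^10 := by
          have : 0 ≤ s := by linarith
          gcongr; rw [show r^10 = r*r^9 by ring]; gcongr
    linarith
  have k2 : exp (-l^2+5*l+5) * exp r ≤ exp (-l) := by
    rw [← exp_add]; exact exp_le_exp.2 (by nlinarith)
  calc _ ≤ exp r * (C * ((l+1)^8 * exp (-((2*c/r^3)/r^6) + (l+1)/r^10) + exp (-l^2+5*l+5))) := by gcongr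
    _ = C * ((l+1)^8 * exp (-((2*c/r^3)/r^6) + (l+1)/r^10) * exp r) + C * (exp (-l^2+5*l+5) * exp r) := by ring
    _ ≤ C * (s^16 * exp (-(s/2))) + C * exp (-l) := by gcongr
    _ ≤ _ := by linarith

theorem QB_ge : ∃ r0 : ℕ, 20 ≤ r0 ∧ ∀ (L : ℕ) (a b : Fin L → ℕ) (err : Fin L → ℝ) (i : Fin L) (r w : ℕ), r0 ≤ r → L ≤ r →
    r^20 ≤ b i + 1 → b i + 1 ≤ 2 * a i → a i + w = b i + 1 → 1 ≤ w → err i = 2*(b i+1:ℝ)/r^3 →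
    w°/2 ≤ ∑ q ∈ QB a b err i, 1°/((q-1:ℕ):ℝ) := by
  classical
  obtain ⟨C1, hC1, hT⟩ := T1
  obtain ⟨C2, hC2, hLD⟩ := LD
  obtain ⟨M, hM, hlev⟩ := level_sum
  obtain ⟨r0, hr0, hf⟩ := f_arith (C1+C2+M) ♭
  refine ⟨⌈r0⌉₊, by exact_mod_cast hr0.trans (Nat.le_ceil r0), fun L a b err i r w hr hL hc hca haw hw herr ↦ ?_⟩
  have hrR : r0 ≤ r := Nat.ceil_le.1 hr
  have hr20 : 20° ≤ r := hr0.trans hrR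
  have hr20' : 20 ≤ r := by exact_mod_cast hr20
  have hra : r ≤ a i := by
    have : r^2 ≤ r^20 := Nat.pow_le_pow_right ⋆ ♮
    nlinarith
  have hraR : r° ≤ a i := by exact_mod_cast hra
  have hcR : r°^20 ≤ (b i:ℝ)+1 := by exact_mod_cast hc
  have hcaR : (b i:ℝ)+1 ≤ 2*a i := by exact_mod_cast hca
  set f : ℕ → ℝ := fun q ↦ 1°/((q-1:ℕ):ℝ) with hfdef
  have f0 : ∀ q, 0 ≤ f q := fun q ↦ by positivity
  have f1 : ∀ q, q.Prime → f q = 1/(q°-1) := fun q hq ↦ by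
    simp only [hfdef]; rw [Nat.cast_sub hq.one_lt.le, Nat.cast_one]
  set Sm := ((PR (b i)).filter (fun q ↦ a i ≤ lev q)).filter (fun q ↦ ∀ p : ℕ, p.Prime → p ∣ q-1 → p° ≤ Zof (a i))
  set Bd : Finset (Fin L) → ℕ → Finset ℕ := fun U l ↦ (LP l).filter (fun q ↦ ∑ l ∈ range l, gU b U l + err i ≤ ad (fun p ↦ gU b U (lev p)) (q-1))
  have hSm : ∑ q ∈ Sm, f q ≤ 1/4 := by
    have := hT (a i) (b i) (fun _ ↦ 1) Sm ⋆ (fun _ ↦ by norm_num) (fun q hq ↦ by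
      obtain ⟨h1, h2⟩ := mem_filter.1 hq
      obtain ⟨h3, h4⟩ := mem_filter.1 h1
      exact ⟨(mem_PR.1 h3).1, h4, (mem_PR.1 h3).2, h2⟩)
    calc ∑ q ∈ Sm, f q = ∑ q ∈ Sm, cm (fun p ↦ 1) (q-1) / (q°-1) := sum_congr rfl fun q hq ↦ by
          rw [f1 q (mem_PR.1 (mem_filter.1 (mem_filter.1 hq).1).1).1, cm_eq]; simp [Finsupp.prod]
      _ ≤ _ := this
      _ ≤ (C1+C2+M) * exp (-(a i:ℝ)) := by
          gcongr
          · linarith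
          · nlinarith
      _ ≤ 1/16 := (hf _ (hrR.trans hraR)).2
      _ ≤ _ := by norm_num
  have hBd : ∀ l ∈ Ico (a i) (b i+1), ∑ U : Finset (Fin L), ∑ q ∈ Bd U l, f q ≤ 1/8 := fun l hl ↦ by
    obtain ⟨hl1, hl2⟩ := mem_Ico.1 hl
    have hl1R : (a i:ℝ) ≤ l := by exact_mod_cast hl1
    have hl2R : l°+1 ≤ b i+1 := by exact_mod_cast hl2
    refine le_trans (sum_le_card_nsmul univ _ ((C1+C2+M) * ((l+1:ℝ)^8 * exp (-((2*(b i+1:ℝ)/r^3)/r^6) + (l+1)/r^10) + exp (-l°^2+5*l+5))) fun U _ ↦ ?_) ?_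
    · refine le_trans (le_of_eq_of_le (sum_congr rfl fun q hq ↦ f1 q (mem_LP.1 (mem_filter.1 hq).1).1)
        (hLD r l (fun l ↦ gU b U l) (err i) (Bd U l) hr20' ⋆ (fun l ↦ ?_) (by rw [herr]; positivity) fun q hq ↦ ?_)) ?_
      · rw [abs_of_nonneg (gU_nonneg _ _ _)]
        have h1 : (nU b U l:ℝ) ≤ L := by exact_mod_cast (card_le_univ _).trans (by simp)
        have h2 : L° ≤ r := by exact_mod_cast hL
        exact (log_le_self ♯).trans (max_le ♭ (h1.trans h2))
      · obtain ⟨h1, h2⟩ := mem_filter.1 hq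
        exact ⟨(mem_LP.1 h1).1, (mem_LP.1 h1).2, h2⟩
      · rw [herr]
        gcongr
        linarith
    · rw [card_univ, Fintype.card_finset, Fintype.card_fin, nsmul_eq_mul]
      push_cast
      exact qb1 _ r _ l L (fun s hs ↦ hf s (hrR.trans hs)) hr20 (by exact_mod_cast hL) hcR hl2R ♭ ♭
  have hlow : ∀ l ∈ Ico (a i) (b i+1), 15/16 ≤ ∑ q ∈ LP l, f q := fun l hl ↦ by
    have hl1R : (a i:ℝ) ≤ l := by exact_mod_cast (mem_Ico.1 hl).1
    have h1 := (abs_le.1 (hlev l)).1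
    have h2 := (hf l ♭).2
    have h3 : M * exp (-l°) ≤ (C1+C2+M) * exp (-l°) := by gcongr; linarith
    have h4 : ∑ q ∈ LP l, 1°/q ≤ ∑ q ∈ LP l, f q := sum_le_sum fun q hq ↦ by
      have hq := (mem_LP.1 hq).1
      have : 2° ≤ q := by exact_mod_cast hq.two_le
      rw [f1 q hq]
      exact one_div_le_one_div_of_le ♭ ♭
    linarith
  have hcov : ∀ l ∈ Ico (a i) (b i+1), ∀ q ∈ LP l, f q ≤ (if q ∈ QB a b err i then f q else 0) + (if q ∈ Sm then f q else 0) +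
      ∑ U : Finset (Fin L), if q ∈ Bd U l then f q else 0 := fun l hl q hq ↦ by
    have n1 : 0 ≤ ∑ U : Finset (Fin L), if q ∈ Bd U l then f q else 0 := sum_nonneg fun U _ ↦ by split_ifs; exacts [f0 q, le_rfl]
    by_cases h1 : q ∈ QB a b err i
    · rw [if_pos h1]; have : 0 ≤ if q ∈ Sm then f q else 0 := by split_ifs; exacts [f0 q, le_rfl]
      linarith
    by_cases h2 : q ∈ Sm
    · rw [if_neg h1, if_pos h2]; linarith
    rw [if_neg h1, if_neg h2, zero_add, zero_add]
    obtain ⟨hl1, hl2⟩ := mem_Ico.1 hl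
    obtain ⟨q1, q2⟩ := mem_LP.1 hq
    have q3 : q ∈ PR (b i) := mem_PR.2 ⟨q1, by omega⟩
    have h3 : ∃ X, X.Prime ∧ X ∣ q-1 ∧ Zof (a i) < X° := by
      by_contra! hh
      exact h2 (mem_filter.2 ⟨mem_filter.2 ⟨q3, by omega⟩, hh⟩)
    obtain ⟨U, hU⟩ : ∃ U, q ∈ Bd U l := by
      by_contra! hh
      refine h1 (mem_QB.2 ⟨mem_PR.1 q3, by omega, h3, fun U _ ↦ ?_⟩)
      have := fun h ↦ hh U (mem_filter.2 ⟨hq, h⟩)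
      refine (not_le.1 this).le.trans ?_
      gcongr
      exact fun _ _ _ ↦ gU_nonneg _ _ _
    refine le_trans ?_ (single_le_sum (f := fun U ↦ if q ∈ Bd U l then f q else 0) (fun U _ ↦ by split_ifs; exacts [f0 q, le_rfl]) (mem_univ U))
    simp only [hU, if_true, le_refl]
  have hdis : ∀ S : Finset ℕ, ∑ l ∈ Ico (a i) (b i+1), ∑ q ∈ LP l, (if q ∈ S then f q else 0) ≤ ∑ q ∈ S, f q := fun S ↦ by
    simp_rw [← sum_filter]
    rw [← sum_biUnion]
    · exact sum_le_sum_of_subset_of_nonneg (fun q hq ↦ by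
        obtain ⟨l, _, h⟩ := mem_biUnion.1 hq; exact (mem_filter.1 h).2) fun q _ _ ↦ f0 q
    · intro l _ m _ hlm
      refine disjoint_left.2 fun q h1 h2 ↦ hlm ?_
      rw [← (mem_LP.1 (mem_filter.1 h1).1).2, ← (mem_LP.1 (mem_filter.1 h2).1).2]
  have hs := sum_le_sum fun l hl ↦ sum_le_sum (hcov l hl)
  simp only [sum_add_distrib] at hs
  have t1 := card_nsmul_le_sum _ _ _ hlow
  have t2 := hdis (QB a b err i)
  have t3 := hdis Sm
  have t4 : ∑ l ∈ Ico (a i) (b i+1), ∑ q ∈ LP l, ∑ U : Finset (Fin L), (if q ∈ Bd U l then f q else 0) ≤ w * (1/8) := by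
    refine (sum_le_card_nsmul _ _ _ fun l hl ↦ le_trans (le_of_eq ?_) (hBd l hl)).trans (le_of_eq ?_)
    · rw [sum_comm]
      refine sum_congr rfl fun U _ ↦ ?_
      rw [← sum_filter]
      exact sum_congr (by ext q; simp only [mem_filter, Bd]; tauto) fun _ _ ↦ rfl
    · rw [Nat.card_Ico, ← haw, Nat.add_sub_cancel_left, nsmul_eq_mul]
  rw [Nat.card_Ico, ← haw, Nat.add_sub_cancel_left, nsmul_eq_mul] at t1
  rw [haw] at t1
  have : 1° ≤ w := by exact_mod_cast hw
  linarith

end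

open Finset Real
noncomputable section

theorem z_exp (z : ℝ) (hz : 0 ≤ z) (n : ℕ) : z^n ≤ exp (2*n*√z) := by
  have h1 : z ≤ exp (2*√z) := by
    have := add_one_le_exp (√z)
    calc z = √z^2 := (sq_sqrt hz).symm
      _ ≤ (exp (√z))^2 := by gcongr; linarith
      _ = _ := by rw [← exp_nat_mul]; norm_num
  calc z^n ≤ (exp (2*√z))^n := by gcongr
    _ = _ := by rw [← exp_nat_mul]; ring_nf

theorem z_sqrt (z r : ℝ) (hr : 20 ≤ r) (hz : r^21 ≤ z) : r^10 ≤ √z ∧ √z * r^10 ≤ z := by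
  have h1 : r^10 ≤ √z := le_sqrt_of_sq_le (le_trans (by rw [← pow_mul]; exact pow_le_pow_right₀ ♭ ♮) hz)
  have h0 : 0 ≤ z := le_trans ♯ hz
  refine ⟨h1, ?_⟩
  calc √z*r^10 ≤ √z*√z := by gcongr
    _ = z := mul_self_sqrt h0

def cc (ϱ κ : ℝ) (L j : ℕ) : ℕ := ⌊κ*ϱ^j*(L°-j)⌋₊


theorem cc_real {ϱ κ : ℝ} {L : ℕ} (h : FordData ϱ) (hκ : 0 < κ) {i j : ℕ} (hij : i ≤ j) (hj : j ≤ L) : κ*ϱ^j*(L°-j) ≤ κ*ϱ^i*(L°-i) := by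
  have h0 := h.pos
  have h1 := h.lt
  have e1 : j° ≤ L := by exact_mod_cast hj
  have e2 : i° ≤ j := by exact_mod_cast hij
  have := pow_le_pow_of_le_one h.pos.le h.lt.le hij
  gcongr ?_*?_*?_
  linarith

theorem cc_anti {ϱ κ : ℝ} {L : ℕ} (h : FordData ϱ) (hκ : 0 < κ) : Antitone (cc ϱ κ L) := fun i j hij ↦ by
  have h0 := h.pos
  rcases le_or_gt j L with hj | hj
  · exact Nat.floor_le_floor (cc_real h hκ hij hj)
  · have : L° < j := by exact_mod_cast hj
    have e : cc ϱ κ L j = 0 := Nat.floor_eq_zero.2 (lt_of_le_of_lt (mul_nonpos_of_nonneg_of_nonpos ♯ ♭) one_pos)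
    rw [e]; exact Nat.zero_le _

theorem cc_facts {ϱ κ : ℝ} {L : ℕ} (h : FordData ϱ) (hκ : 0 < κ) {ε r : ℝ} (hε : ε = (1-ϱ)/16) (hr : 20 ≤ r) (hrε : 2/ε ≤ r) (hz : r^21 ≤ κ*ϱ^L) {i : ℕ} (hi : i < L) :
    ∃ z, z = κ*ϱ^i ∧ r^21 ≤ z ∧ z*(L°-i) - 1 ≤ cc ϱ κ L i ∧ (cc ϱ κ L i:ℝ) ≤ z*(L°-i) ∧
      ε*z/2 ≤ (⌊ε*z⌋₊:ℝ) ∧ (⌊ε*z⌋₊:ℝ) ≤ ε*z ∧ ε*z ≤ z/16 ∧ 1 ≤ ⌊ε*z⌋₊ ∧ z - 1 ≤ cc ϱ κ L i ∧ 20*r^20 ≤ z ∧ r^2 ≤ z := by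
  have h0 := h.pos
  have h1 := h.lt
  have hi' : i°+1 ≤ L := by exact_mod_cast hi
  have z0 : 0 < κ*ϱ^i := by positivity
  have hzi : r^21 ≤ κ*ϱ^i := hz.trans (by have := pow_le_pow_of_le_one h.pos.le h.lt.le hi.le; gcongr)
  have e0 : 0 < ε := by rw [hε]; linarith
  have hr2 : r^2 ≤ κ*ϱ^i := (pow_le_pow_right₀ ♭ ♮).trans hzi
  have hez : 2 ≤ ε*(κ*ϱ^i) := by
    rw [div_le_iff₀ e0] at hrε
    nlinarith
  have f1 := Nat.lt_floor_add_one (ε*(κ*ϱ^i))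
  have f2 := Nat.lt_floor_add_one (κ*ϱ^i*(L°-i))
  have f3 : κ*ϱ^i*1 ≤ κ*ϱ^i*(L°-i) := by gcongr; linarith
  refine ⟨_, rfl, hzi, ?_, Nat.floor_le (mul_nonneg z0.le ♭), by linarith, Nat.floor_le ♯, by rw [hε]; nlinarith, Nat.le_floor (by push_cast; linarith), ?_, ?_, hr2⟩
  · unfold cc; linarith
  · unfold cc; linarith
  · calc 20*r^20 ≤ r*r^20 := by gcongr
      _ = r^21 := by ring
      _ ≤ _ := hzi

theorem cc_slack {ϱ κ : ℝ} {L : ℕ} (h : FordData ϱ) (hκ : 0 < κ) {i : ℕ} (hi : i < L) : ∑ k ∈ range L, fordA (k+1) * cc ϱ κ L (i+k+1) ≤ κ*ϱ^i*(L°-i-1) := by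
  have h0 := h.pos
  have h1 := h.lt
  have hi' : i°+1 ≤ L := by exact_mod_cast hi
  have : ∀ k ∈ range L, fordA (k+1) * cc ϱ κ L (i+k+1) ≤ κ*ϱ^i*(L°-i-1) * (fordA (k+1) * ϱ^(k+1)) := fun k _ ↦ by
    have hc : (cc ϱ κ L (i+k+1):ℝ) ≤ κ*ϱ^i*(L°-i-1) * ϱ^(k+1) := by
      rcases le_total 0 (κ*ϱ^(i+k+1)*(L°-(i+k+1:ℕ))) with hp | hp
      · refine (Nat.floor_le hp).trans ?_
        rw [show κ*ϱ^(i+k+1)*(L°-(i+k+1:ℕ)) = κ*ϱ^i*(L°-(i+k+1:ℕ))*ϱ^(k+1) by ring]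
        gcongr ?_*?_*?_
        push_cast; linarith [Nat.cast_nonneg (α := ℝ) k]
      · unfold cc; rw [Nat.floor_of_nonpos hp, Nat.cast_zero]; 
        have : 0 ≤ L°-i-1 := by linarith
        positivity
    calc _ ≤ fordA (k+1) * (κ*ϱ^i*(L°-i-1) * ϱ^(k+1)) := mul_le_mul_of_nonneg_left hc (fordA_succ_pos k).le
      _ = _ := by ring
  refine (sum_le_sum this).trans ?_
  rw [← mul_sum]
  exact mul_le_of_le_one_right (mul_nonneg ♯ ♭) (h.psum_le L)

theorem gap_ar (z r : ℝ) (a : ℝ) (hr : 20 ≤ r) (hz : r^21 ≤ z) (ha : 0 ≤ a) (haz : a ≤ z^2) : a^2 ≤ exp (z/2) := by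
  obtain ⟨s1, s2⟩ := z_sqrt z r hr hz
  have z0 : 0 ≤ z := le_trans ♯ hz
  calc a^2 ≤ (z^2)^2 := by gcongr
    _ = z^4 := by ring
    _ ≤ _ := z_exp z z0 4
    _ ≤ _ := by
      refine exp_le_exp.2 ?_
      have : 16 ≤ r^10 := by calc 16° ≤ r^1 := by linarith
                              _ ≤ _ := pow_le_pow_right₀ ♭ ♮
      push_cast
      nlinarith [sqrt_nonneg z]

theorem cc_gap {ϱ κ : ℝ} {L : ℕ} (h : FordData ϱ) (hκ : 0 < κ) {ε r : ℝ} (hε : ε = (1-ϱ)/16) (hr : 20 ≤ r) (hLr : L° ≤ r) (hrε : 2/ε ≤ r) (hz : r^21 ≤ κ*ϱ^L) {i j : ℕ} (hij : i < j) (hj : j < L) :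
    cc ϱ κ L j ≤ cc ϱ κ L i - ⌊ε*(κ*ϱ^i)⌋₊ ∧ EE (cc ϱ κ L j) ≤ Zof (cc ϱ κ L i - ⌊ε*(κ*ϱ^i)⌋₊) := by
  have h0 := h.pos
  have h1 := h.lt
  obtain ⟨z, rfl, f1, f2, f3, f4, f5, f6, f7, f8, f9, f10⟩ := cc_facts h hκ hε hr hrε hz (hij.trans hj)
  set z := κ*ϱ^i with hzd
  have r2 : 400 ≤ r^2 := by nlinarith
  have z0 : 0 < z := by linarith
  have hw : ⌊ε*z⌋₊ ≤ cc ϱ κ L i := by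
    have : (⌊ε*z⌋₊:ℝ) ≤ cc ϱ κ L i := by linarith
    exact_mod_cast this
  have hj' : i°+1+1 ≤ L := by exact_mod_cast (by omega : i+1+1 ≤ L)
  have g1 : (cc ϱ κ L j:ℝ) ≤ ϱ*z*(L°-i-1) := by
    have : (cc ϱ κ L j:ℝ) ≤ cc ϱ κ L (i+1) := by exact_mod_cast cc_anti h hκ hij
    refine this.trans ((Nat.floor_le (mul_nonneg ♯ (by push_cast; linarith))).trans (le_of_eq ?_))
    push_cast; rw [hzd]; ring
  have hai : ((cc ϱ κ L i - ⌊ε*z⌋₊:ℕ):ℝ) = cc ϱ κ L i - ⌊ε*z⌋₊ := Nat.cast_sub hw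
  have g2 : (cc ϱ κ L j:ℝ) + z/2 ≤ ((cc ϱ κ L i - ⌊ε*z⌋₊:ℕ):ℝ) := by
    rw [hai]
    have : ϱ*(z*(L°-i-1)) ≤ 1*(z*(L°-i-1)) := by
      have : 0 ≤ L°-i-1 := by linarith
      gcongr
    linarith
  have g3 : ((cc ϱ κ L i - ⌊ε*z⌋₊:ℕ):ℝ) ≤ z^2 := by
    rw [hai]
    have : z*(L°-i) ≤ z*z := by
      gcongr
      have : 0 ≤ i° := Nat.cast_nonneg _
      nlinarith
    linarith [Nat.cast_nonneg (α := ℝ) ⌊ε*z⌋₊]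
  refine ⟨by rw [← Nat.cast_le (α := ℝ)]; linarith, ?_⟩
  set a := cc ϱ κ L i - ⌊ε*z⌋₊
  unfold EE Zof
  have ha : 0° < a := by
    have : 0° ≤ cc ϱ κ L j := Nat.cast_nonneg _
    linarith
  refine exp_le_exp.2 ?_
  rw [le_div_iff₀ ♯]
  have g4 := gap_ar z r a hr f1 ha.le g3
  calc _ ≤ exp (cc ϱ κ L j) * exp (z/2) := by gcongr
    _ ≤ _ := by rw [← exp_add]; exact exp_le_exp.2 g2

end

open Finset Real
noncomputable section

theorem low_ar1 (C L z r c : ℝ) (hr : 20 ≤ r) (hz : r^21 ≤ z) (hC : 1 ≤ C) (hCr : C ≤ r) (hL0 : 0 ≤ L) (hL : L ≤ r) (hc0 : 0 ≤ c) (hc : c ≤ z*r) :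
    C^2*(1+L^2)*(2*c+2)^16 ≤ exp (66*√z) := by
  have hr1 : 1° ≤ r := by linarith
  have h6 : r^6 ≤ z := (pow_le_pow_right₀ hr1 ♮).trans hz
  have h2 : r^2 ≤ z := (pow_le_pow_right₀ hr1 ♮).trans hz
  have z0 : 0 ≤ z := le_trans ♯ hz
  have k1 : C^2*(1+L^2) ≤ z := by
    calc C^2*(1+L^2) ≤ r^2*(r^2+r^2) := by gcongr; exact one_le_pow₀ hr1
      _ = r^4*2 := by ring
      _ ≤ r^4*r^2 := by gcongr; nlinarith
      _ = r^6 := by ring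
      _ ≤ z := h6
  have k2 : 2*c+2 ≤ z^2 := by nlinarith
  calc _ ≤ z*(z^2)^16 := by gcongr
    _ = z^33 := by ring
    _ ≤ _ := z_exp z z0 33
    _ = _ := by norm_num

theorem low_ar2 (M L z r W : ℝ) (hr : 20 ≤ r) (hz : r^21 ≤ z) (hM0 : 0 ≤ M) (hMr : M ≤ r) (hL0 : 0 ≤ L) (hL : L ≤ r) (hW : W ≤ z/16) :
    -z + 1 + (4*W + L*(2*(z*r)/r^3 + M*L + 66*√z)) ≤ -L := by
  obtain ⟨s1, s2⟩ := z_sqrt z r hr hz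
  have hr1 : 1° ≤ r := by linarith
  have h4 : r^5 ≤ z := (pow_le_pow_right₀ hr1 ♮).trans hz
  have z0 : 0 ≤ z := le_trans ♯ hz
  have r4 : 160000 ≤ r^4 := by calc 160000° = 20^4 := by norm_num
                                  _ ≤ _ := by gcongr
  have k1 : L*(2*(z*r)/r^3) ≤ z/10 := by
    calc L*(2*(z*r)/r^3) ≤ r*(2*(z*r)/r^3) := by gcongr
      _ = 2*z/r := by field_simp
      _ ≤ _ := by rw [div_le_iff₀ ♭]; nlinarith
  have k2 : L*(M*L) ≤ z/20 := by
    have a1 : L*(M*L) ≤ r*(r*r) := by gcongr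
    have a2 : 400*r^3 ≤ r^5 := by rw [show r^5 = r^2*r^3 by ring]; gcongr; nlinarith
    nlinarith
  have k3 : L*(66*√z) ≤ z/20 := by
    have a1 : L*(66*√z) ≤ r*(66*√z) := by gcongr
    have a2 : 1320*r ≤ r^10 := by
      calc 1320*r ≤ r^4*r := by gcongr; linarith
        _ = r^5 := by ring
        _ ≤ _ := pow_le_pow_right₀ hr1 ♮
    have a3 : √z*(1320*r) ≤ √z*r^10 := by gcongr
    linarith
  have k4 : 160000*r ≤ z := by
    calc 160000*r ≤ r^4*r := by gcongr
      _ = r^5 := by ring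
      _ ≤ z := h4
  have k5 : 20 ≤ z := by linarith
  nlinarith

set_option maxHeartbeats 600000 in
theorem FordData.lowerL {ϱ : ℝ} (h : FordData ϱ) : ∃ r0 : ℕ, 20 ≤ r0 ∧ ∀ (L : ℕ) (κ : ℝ), r0 ≤ L → (L°+20)^21 ≤ κ*ϱ^L →
    ∃ W : Finset ℕ, (∀ w ∈ W, ∃ S : Finset ℕ, (∀ p ∈ S, p.Prime ∧ 7 < p ∧ p° ≤ EE (κ*L)) ∧ S.card ≤ L ∧ w = ∏ p ∈ S, (p-1)) ∧
      (∏ i : Fin L, (1-ϱ)/64*(κ*ϱ^(i:ℕ)))/2 ≤ ∑ w ∈ W, 1°/w := by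
  classical
  obtain ⟨C, M, hC, hM, hsec⟩ := LBox.second
  obtain ⟨r1, hr1, hQB⟩ := QB_ge
  have h0 := h.pos
  have h1 := h.lt
  set ε := (1-ϱ)/16 with hε
  have ε0 : 0 < ε := by rw [hε]; linarith
  refine ⟨r1 + ⌈C⌉₊ + ⌈M⌉₊ + ⌈2/ε⌉₊, by omega, fun L κ hL hκ ↦ ?_⟩
  set r : ℝ := L°+20 with hrd
  have hrc : ((L+20:ℕ):ℝ) = r := by push_cast; rfl
  have hLr : L° ≤ r := by linarith
  have big : r1°+C+M+2/ε ≤ r := by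
    have : r1°+⌈C⌉₊+⌈M⌉₊+⌈2/ε⌉₊ ≤ L := by exact_mod_cast hL
    linarith [Nat.le_ceil C, Nat.le_ceil M, Nat.le_ceil (2/ε)]
  have e2 : 0 < 2/ε := by positivity
  have r10 : 0° ≤ r1 := Nat.cast_nonneg _
  have hr : 20 ≤ r := by linarith [Nat.cast_nonneg (α := ℝ) L]
  have κ0 : 0 < κ := by
    by_contra hn
    have : κ*ϱ^L ≤ 0 := mul_nonpos_of_nonpos_of_nonneg (not_lt.1 hn) ♯
    have : 0 < r^21 := by positivity
    linarith
  have F : ∀ i : Fin L, _ := fun i ↦ cc_facts h κ0 hε hr (by linarith : 2/ε ≤ r) hκ i.2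
  set a : Fin L → ℕ := fun i ↦ cc ϱ κ L i - ⌊ε*(κ*ϱ^(i:ℕ))⌋₊ with ha
  set b : Fin L → ℕ := fun i ↦ cc ϱ κ L i - 1 with hb
  set err : Fin L → ℝ := fun i ↦ 2*(b i+1:ℝ)/r^3 with herr
  have r20 : 20 ≤ r^20 := le_trans (by simpa using hr) (pow_le_pow_right₀ ♭ (show 1 ≤ 20 by norm_num))
  have hb1 : ∀ i, b i + 1 = cc ϱ κ L i := fun i ↦ by
    obtain ⟨z, hz, f1, f2, f3, f4, f5, f6, f7, f8, f9, f10⟩ := F i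
    have : 1° ≤ cc ϱ κ L i := by linarith
    exact Nat.sub_add_cancel (by exact_mod_cast this)
  have hb1R : ∀ i, (b i:ℝ) + 1 = cc ϱ κ L i := fun i ↦ by exact_mod_cast hb1 i
  have haw : ∀ i, a i + ⌊ε*(κ*ϱ^(i:ℕ))⌋₊ = b i + 1 ∧ b i + 1 ≤ 2*a i ∧ (L+20)^20 ≤ b i + 1 := fun i ↦ by
    obtain ⟨z, rfl, f1, f2, f3, f4, f5, f6, f7, f8, f9, f10⟩ := F i
    have k : 2*⌊ε*(κ*ϱ^(i:ℕ))⌋₊ ≤ cc ϱ κ L i := by rw [← Nat.cast_le (α := ℝ)]; push_cast; linarith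
    rw [hb1]
    refine ⟨Nat.sub_add_cancel ⋆, by simp only [ha]; omega, ?_⟩
    rw [← Nat.cast_le (α := ℝ), Nat.cast_pow, hrc]; linarith
  have hawR : ∀ i, (a i:ℝ) + ⌊ε*(κ*ϱ^(i:ℕ))⌋₊ = b i + 1 := fun i ↦ by exact_mod_cast (haw i).1
  have hgap : ∀ i j : Fin L, i < j → b j < a i ∧ EE (b j + 1) ≤ Zof (a i) := fun i j hij ↦ by
    obtain ⟨g1, g2⟩ := cc_gap h κ0 hε hr hLr (by linarith : 2/ε ≤ r) hκ hij j.2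
    exact ⟨by have := hb1 j; simp only [ha]; omega, by rw [hb1R]; exact g2⟩
  have ha10 : ∀ i, 10 ≤ a i := fun i ↦ by
    have k := haw i
    have : L+20 ≤ (L+20)^20 := Nat.le_self_pow ♮ _
    omega
  let B : LBox L := ⟨a, b, QB a b err, err, ha10, fun i ↦ by have := haw i; omega, fun i q hq ↦ by
    obtain ⟨⟨q1, q2⟩, -, q3, -⟩ := mem_QB.1 hq; exact ⟨q1, q2, q3⟩, fun i j hij ↦ (hgap i j hij).2,
    fun U i hi q hq ↦ (mem_QB.1 hq).2.2.2 U hi⟩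
  have hN : ∀ i : Fin L, (1-ϱ)/64*(κ*ϱ^(i:ℕ)) ≤ Nq B i ∧ 1 ≤ Nq B i := fun (i : Fin L) => by
    obtain ⟨z, rfl, f1, f2, f3, f4, f5, f6, f7, f8, f9, f10⟩ := F i
    have := hQB L a b err i (L+20) _ (by rw [← Nat.cast_le (α := ℝ), hrc]; linarith) ⋆ (haw i).2.2 (haw i).2.1 (haw i).1 f7 (by rw [hrc])
    refine ⟨le_trans ?_ this, le_trans ?_ this⟩
    · rw [show (1-ϱ)/64 = ε/4 by rw [hε]; ring]; linarith
    · rw [le_div_iff₀ ♮]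
      have k : 2 ≤ r*ε := by have := (div_le_iff₀ ε0).1 (by linarith : 2/ε ≤ r); linarith
      have k2 : 20*r ≤ κ*ϱ^(i:ℕ) := by clear * - f10 hr; nlinarith
      have : 20*(r*ε) ≤ ε*(κ*ϱ^(i:ℕ)) := by linarith [mul_le_mul_of_nonneg_left k2 ε0.le]
      linarith
  refine ⟨(Fintype.piFinset B.Q).image (fun q : Fin L → ℕ => ∏ i, (q i-1)), fun w hw ↦ ?_, le_trans ?_ (hsec L B (fun i ↦ (hN i).2) fun U hU ↦ ?_)⟩
  · obtain ⟨q, hq, rfl⟩ := mem_image.1 hw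
    have hq' : ∀ i, _ := fun i ↦ mem_QB.1 (Fintype.mem_piFinset.1 hq i)
    refine ⟨univ.image q, fun p hp ↦ ?_, card_image_le.trans (by simp), ?_⟩
    · obtain ⟨i, -, rfl⟩ := mem_image.1 hp
      obtain ⟨⟨q1, q2⟩, q3, -, -⟩ := hq' i
      refine ⟨q1, ?_, ((lev_le_iff q1.two_le).1 q2).trans (EE_mono ?_)⟩
      · have k := lev_lt_of ♮ ((ha10 i).trans q3)
        have k2 := add_one_le_exp (exp ((10:ℕ):ℝ))
        have k3 := add_one_le_exp ((10:ℕ):ℝ)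
        have : 7° < q i := by unfold EE at k; push_cast at k k2 k3; linarith
        exact_mod_cast this
      · rw [hb1R]
        refine (Nat.cast_le.2 (cc_anti h κ0 (Nat.zero_le i))).trans ((Nat.floor_le (by simp; positivity)).trans (by simp))
    · rw [prod_image]
      intro i _ j _ hij
      by_contra hne
      rcases lt_or_gt_of_ne hne with hlt | hlt
      · have := (hgap _ _ hlt).1; have := (hq' i).2.1; have := (hq' j).1.2; rw [hij] at *; omega
      · have := (hgap _ _ hlt).1; have := (hq' j).2.1; have := (hq' i).1.2; rw [hij] at *; omega
  · gcongr with i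
    exact (hN i).1
  · set i0 := U.min' hU
    have hi0 : i0 ∈ U := min'_mem U hU
    have hmin : ∀ i ∈ U, i0 ≤ i := fun i hi ↦ min'_le U i hi
    obtain ⟨z, hz, f1, f2, f3, f4, f5, f6, f7, f8, f9, f10⟩ := F i0
    have hx := expoU b (cc ϱ κ L) (cc_anti h κ0) hb1 U i0 hi0 hmin
    have hsl := cc_slack h κ0 i0.2
    rw [← hz] at hsl
    have z0 : 0 ≤ z := le_trans ♯ f10
    have hcz : ∀ i ∈ U, (b i:ℝ)+1 ≤ z*r := fun i hi ↦ by
      rw [hb1R]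
      refine (Nat.cast_le.2 (cc_anti h κ0 (hmin i hi))).trans (f3.trans ?_)
      gcongr
      linarith [Nat.cast_nonneg (α := ℝ) (i0:ℕ)]
    have hfac : ∀ i ∈ U, exp (GB B U i) * epsB C B i * exp ((B.b i:ℝ)+1+M*L) ≤
        exp (∑ l ∈ range (b i+1), (gU b U l - 1) + (4*⌊ε*(κ*ϱ^(i:ℕ))⌋₊ + (2*(z*r)/r^3 + M*L + 66*√z))) := fun i hi ↦ by
      have k := low_ar1 C L z r (b i+1) hr f1 hC ♭ (Nat.cast_nonneg _) hLr ♯ (hcz i hi)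
      have ke : err i ≤ 2*(z*r)/r^3 := by simp only [herr]; gcongr; exact hcz i hi
      unfold epsB
      change exp (GB B U i) * (C^2*(1+L°^2)*(2*((b i:ℝ)+1)+2)^16 * exp (2*((b i:ℝ)+1)-4*a i)) * exp ((b i:ℝ)+1+M*L) ≤ _
      calc _ ≤ exp (GB B U i) * (exp (66*√z) * exp (2*((b i:ℝ)+1)-4*a i)) * exp ((b i:ℝ)+1+M*L) := by gcongr
        _ ≤ _ := by
          rw [← exp_add, ← exp_add, ← exp_add]
          refine exp_le_exp.2 ?_
          change (∑ l ∈ range (b i+1), gU b U l + err i) + _ + _ ≤ _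
          rw [sum_sub_distrib, sum_const, card_range, nsmul_eq_mul, mul_one]
          push_cast
          linarith [hawR i]
    refine (prod_le_prod (fun i _ ↦ by unfold epsB; positivity) hfac).trans ?_
    rw [← exp_sum]
    refine exp_le_exp.2 ?_
    have hW : ∑ i ∈ U, (⌊ε*(κ*ϱ^(i:ℕ))⌋₊:ℝ) ≤ z/16 := by
      calc _ ≤ ∑ i ∈ U, ε*(κ*ϱ^(i:ℕ)) := sum_le_sum fun i _ ↦ Nat.floor_le ♯
        _ = ∑ j ∈ U.image (fun i : Fin L => (i:ℕ)), ε*κ*ϱ^j := by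
          rw [sum_image fun i _ j _ hij ↦ Fin.ext hij]; exact sum_congr rfl fun i _ ↦ by ring
        _ ≤ ∑ j ∈ Ico (i0:ℕ) L, ε*κ*ϱ^j := sum_le_sum_of_subset_of_nonneg (fun j hj ↦ by
          obtain ⟨i, hi, rfl⟩ := mem_image.1 hj; exact mem_Ico.2 ⟨hmin i hi, i.2⟩) fun _ _ _ ↦ by positivity
        _ ≤ ε*κ*(ϱ^(i0:ℕ)/(1-ϱ)) := by
          rw [← mul_sum]; gcongr; exact geom_sum_Ico_le_of_lt_one h0.le h1
        _ = _ := by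
          have : 1-ϱ ≠ 0 := by linarith
          rw [hz, hε]; field_simp
    have hx2 := low_ar2 M L z r _ hr f1 ♭ ♭ (Nat.cast_nonneg _) hLr hW
    rw [sum_add_distrib, sum_add_distrib, ← mul_sum, sum_const, nsmul_eq_mul]
    have hcard : (U.card:ℝ) * (2*(z*r)/r^3 + M*L + 66*√z) ≤ L * (2*(z*r)/r^3 + M*L + 66*√z) := by
      have M0 : 0 ≤ M := by linarith
      have r0 : 0 ≤ r := by linarith
      exact mul_le_mul_of_nonneg_right (by exact_mod_cast (card_le_univ _).trans (by simp)) ♯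
    linarith

end

open Finset Real
noncomputable section

theorem low_ar3 (lam K K1 u l L : ℝ) (hl : 0 < lam) (hK1 : 0 ≤ K1) (hu : 1 ≤ u) (hl0 : 0 ≤ l) (hlu : l ≤ 2*√u)
    (hL1 : lam*L ≤ u - 30*l) (hL2 : u - 30*l - lam ≤ lam*L) (hLK : L ≤ K*u) :
    1/(2*lam)*(u-l)^2 - ((116^2+2*lam^2)/(2*lam) + K1*K + 1)*u ≤ L*(u-l-K1) - lam*L^2/2 - 1 := by
  set G := u - l
  set δ := G - lam*L with hδ
  have d0 : 0 ≤ δ := by simp only [hδ, G]; linarith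
  have d1 : δ ≤ 29*l+lam := by simp only [hδ, G]; linarith
  have hsq := mul_self_sqrt (by linarith : 0 ≤ u)
  have d2 : δ^2 ≤ (116^2+2*lam^2)*u := by
    have a1 : δ^2 ≤ (29*l+lam)^2 := by gcongr
    have a2 : l^2 ≤ 4*u := by nlinarith [sqrt_nonneg u]
    nlinarith [sq_nonneg (29*l-lam), sq_nonneg lam]
  have e : L*(G-K1) - lam*L^2/2 - 1 = 1/(2*lam)*G^2 - δ^2/(2*lam) - K1*L - 1 := by
    rw [show L = (G-δ)/lam by rw [hδ]; field_simp; ring]; field_simp; ring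
  rw [e]
  have d3 : δ^2/(2*lam) ≤ (116^2+2*lam^2)/(2*lam)*u := by
    rw [div_mul_eq_mul_div]; gcongr
  nlinarith [mul_le_mul_of_nonneg_left hLK hK1]

theorem prod_log (ϱ e κ : ℝ) (h0 : 0 < ϱ) (he : 0 < e) (hκ : 0 < κ) (L : ℕ) :
    L * log (e*κ) - log (1/ϱ) * L°^2/2 ≤ log (∏ i : Fin L, e*(κ*ϱ^(i:ℕ))) ∨ 1 < ϱ := by
  by_cases h1 : 1 < ϱ
  · exact Or.inr h1
  left
  have hl : log ϱ ≤ 0 := log_nonpos h0.le (not_lt.1 h1)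
  rw [log_prod fun i _ ↦ by positivity, Fin.sum_univ_eq_sum_range (fun i ↦ log (e*(κ*ϱ^i))) L, one_div, log_inv]
  induction L with
  | zero => simp
  | succ n ih =>
    rw [sum_range_succ, ← mul_assoc, log_mul (x := e*κ) ♯ ♯, log_pow]
    push_cast
    nlinarith

set_option maxHeartbeats 600000 in
theorem FordData.lower {ϱ : ℝ} (h : FordData ϱ) : ∃ A T0 : ℝ, 1 ≤ A ∧ 100 ≤ T0 ∧ ∀ t : ℝ, T0 ≤ t → ∃ W : Finset ℕ,
    (∀ w ∈ W, ∃ S : Finset ℕ, (∀ p ∈ S, p.Prime ∧ 7 < p ∧ p° ≤ EE t) ∧ (S.card:ℝ) ≤ t ∧ w = ∏ p ∈ S, (p-1)) ∧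
      exp (1/(2*log (1/ϱ)) * (log (t/log t))^2 - A * log t) ≤ ∑ w ∈ W, 1°/w := by
  obtain ⟨r0, hr0, hL⟩ := h.lowerL
  have h0 := h.pos
  have h1 := h.lt
  set lam := log (1/ϱ) with hlam
  have l0 : 0 < lam := log_pos (by rw [lt_div_iff₀ h0]; linarith)
  have hϱ : ϱ = exp (-lam) := by rw [hlam, one_div, log_inv, neg_neg, exp_log h0]
  set K := 1/lam + 20 with hK
  have K1 : 1 ≤ K := by have : 0 < 1/lam := by positivity
                        linarith
  set e := (1-ϱ)/64 with he
  have e0 : 0 < e := by rw [he]; linarith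
  have e1 : e ≤ 1 := by rw [he]; linarith
  have KK : 0 ≤ log K - log e := by linarith [log_nonneg K1, log_nonpos e0.le e1]
  set u0 := K^3 + (60 + (r0+1)*lam)^2*4 + 100
  refine ⟨(116^2+2*lam^2)/(2*lam) + (log K - log e)*K + 1, exp u0, ?_, ?_, fun t ht ↦ ?_⟩
  · have : 0 ≤ (116^2+2*lam^2)/(2*lam) + (log K - log e)*K := by positivity
    linarith
  · have := add_one_le_exp u0
    have : 0 ≤ K^3 + (60 + (r0+1)*lam)^2*4 := by positivity
    linarith
  have hK3 : K^3 ≤ u0 ∧ (60 + (r0+1)*lam)^2*4 ≤ u0 ∧ 100 ≤ u0 := by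
    have : 0 ≤ K^3 := by positivity
    have : 0 ≤ (60 + (r0+1)*lam)^2 := by positivity
    simp only [u0]; exact ⟨by linarith, by linarith, by linarith⟩
  have t0 : 0 < t := (exp_pos _).trans_le ht
  set u := log t with hu
  have hut : t = exp u := (exp_log t0).symm
  have hu0 : u0 ≤ u := by rwa [hu, le_log_iff_exp_le t0]
  obtain ⟨k1, k2, k3⟩ := hK3
  have u1 : 100 ≤ u := by linarith
  set l := log u with hl
  have l1 : 0 ≤ l := log_nonneg ♭
  have hul : u = exp l := (exp_log ♭).symm
  have hlu : l ≤ 2*√u := by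
    rw [hl, log_le_iff_le_exp ♭]; simpa using z_exp u ♭ 1
  have hsu : 2*(60 + (r0+1)*lam) ≤ √u := le_sqrt_of_sq_le ♭
  have hbig : (r0+1)*lam ≤ u - 30*l := by
    have := mul_self_sqrt (by linarith : 0 ≤ u)
    have : 0 ≤ (r0+1)*lam := by positivity
    nlinarith [sqrt_nonneg u]
  set L := ⌊(u-30*l)/lam⌋₊ with hLd
  have hx0 : 0 ≤ (u-30*l)/lam := div_nonneg (le_trans ♯ hbig) l0.le
  have L1 : lam*L ≤ u-30*l := by have := Nat.floor_le hx0; rw [le_div_iff₀ l0] at this; linarith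
  have L2 : u-30*l-lam ≤ lam*L := by
    have := (Nat.lt_floor_add_one ((u-30*l)/lam)).le; rw [div_le_iff₀ l0] at this; linarith
  have L0 : 0° ≤ L := Nat.cast_nonneg _
  have Lr : r0 ≤ L := Nat.le_floor (by rw [le_div_iff₀ l0]; linarith)
  have LK : L° + 20 ≤ K*u := by
    have : L° ≤ u/lam := by rw [le_div_iff₀ l0]; linarith
    rw [hK, add_mul, one_div_mul_eq_div]; nlinarith
  set κ := t/(L°+1) with hκ
  have κ0 : 0 < κ := by positivity
  have hmain : (L°+20)^21 ≤ κ*ϱ^L := by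
    rw [hκ, div_mul_eq_mul_div, le_div_iff₀ ♯]
    calc (L°+20)^21*(L+1) ≤ (K*u)^21*(K*u) := by gcongr; linarith
      _ = K*(K^3)^7*u^22 := by ring
      _ ≤ u*u^7*u^22 := by
        have : K ≤ K^3 := le_self_pow₀ K1 ♮
        gcongr <;> linarith
      _ = exp (30*l) := by rw [show 30°*l = (30:ℕ)*l by norm_num, exp_nat_mul, ← hul]; ring
      _ ≤ exp (u - lam*L) := exp_le_exp.2 ♭
      _ = t*ϱ^L := by rw [hϱ, ← exp_nat_mul, hut, ← exp_add]; ring_nf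
  obtain ⟨W, hW1, hW2⟩ := hL L κ Lr hmain
  have hκt : κ*L ≤ t := by rw [hκ, div_mul_eq_mul_div, div_le_iff₀ ♯]; nlinarith
  refine ⟨W, fun w hw ↦ ?_, le_trans ?_ hW2⟩
  · obtain ⟨S, s1, s2, s3⟩ := hW1 w hw
    refine ⟨S, fun p hp ↦ ⟨(s1 p hp).1, (s1 p hp).2.1, (s1 p hp).2.2.trans (EE_mono hκt)⟩, ?_, s3⟩
    have a1 : L°+20 ≤ κ*ϱ^L := (le_self_pow₀ ♭ ♮).trans hmain
    have a2 : κ*ϱ^L ≤ κ := mul_le_of_le_one_right κ0.le (pow_le_one₀ h0.le h1.le)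
    have a3 : κ ≤ t := div_le_self t0.le ♭
    have : (S.card:ℝ) ≤ L := by exact_mod_cast s2
    linarith
  · have hP : 0 < ∏ i : Fin L, e*(κ*ϱ^(i:ℕ)) := prod_pos fun i _ ↦ by positivity
    rw [← le_log_iff_exp_le ♯, log_div hP.ne' ♮, log_div t0.ne' ♭]
    have hp := (prod_log ϱ e κ h0 e0 κ0 L).resolve_right ♭
    have hlk : u - l - (log K - log e) ≤ log (e*κ) := by
      rw [log_mul e0.ne' κ0.ne', hκ, log_div t0.ne' ♯]
      have : log (L°+1) ≤ log (K*u) := log_le_log ♯ ♭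
      rw [log_mul ♭ ♭] at this
      linarith
    have ha := low_ar3 lam K (log K - log e) u l L l0 KK ♭
      l1 hlu L1 L2 ♭
    have h2 : log 2 ≤ 1 := by linarith [log_two_lt_d9]
    have := mul_le_mul_of_nonneg_left hlk L0
    linarith

end

open Finset Real
noncomputable section

theorem dval {k q : ℕ} {S : Finset ℕ} (hq : q.Prime) (hq7 : 7 < q) (hqS : q ∉ S) (hS : ∀ p ∈ S, p.Prime ∧ 7 < p) :
    dMin k (1225*∏ p ∈ insert q S, p) = (k°-1)/12*(144*(((q-1)*∏ p ∈ S, (p-1) : ℕ):ℝ)) := by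
  have hT : ∀ p ∈ insert q S, p.Prime ∧ 7 < p := by
    intro p hp; rcases mem_insert.1 hp with rfl | h
    exacts [⟨hq, hq7⟩, hS p h]
  set m := ∏ p ∈ insert q S, p with hm
  have hpm : m.primeFactors = insert q S := Nat.primeFactors_prod fun p hp ↦ (hT p hp).1
  have hm0 : m ≠ 0 := prod_ne_zero_iff.2 fun p hp ↦ (hT p hp).1.ne_zero
  have hsm : ∀ p, p < 8 → m.factorization p = 0 := fun p hp ↦ by
    rw [← Finsupp.notMem_support_iff, Nat.support_factorization, hpm]
    exact fun h ↦ absurd (hT p h).2 ⋆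
  have hf1 : ∀ p ∈ insert q S, m.factorization p = 1 := fun p hp ↦ by
    rw [hm, Nat.factorization_prod_apply fun i hi ↦ (hT i hi).1.ne_zero, sum_eq_single_of_mem p hp]
    · exact (hT p hp).1.factorization_self
    · intro b hb hbp; rw [(hT b hb).1.factorization, Finsupp.single_apply, if_neg hbp]
  have hff : ∀ p, (1225*m).factorization p = 2*(5:ℕ).factorization p + 2*(7:ℕ).factorization p + m.factorization p := fun p ↦ by
    rw [show 1225*m = 5^2*7^2*m by norm_num, Nat.factorization_mul ♮ hm0, Nat.factorization_mul ♮ ♮,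
      Nat.factorization_pow, Nat.factorization_pow]; simp
  have p5 : Nat.Prime 5 := by norm_num
  have p7 : Nat.Prime 7 := by norm_num
  have h5 : (1225*m).factorization 5 = 2 := by rw [hff, hsm 5 ♮, p5.factorization, p7.factorization]; simp
  have h7 : (1225*m).factorization 7 = 2 := by rw [hff, hsm 7 ♮, p5.factorization, p7.factorization]; simp
  have hN0 : 1225*m ≠ 0 := by simp [hm0]
  have hpf : (1225*m).primeFactors = insert 5 (insert 7 (insert q S)) := by
    rw [Nat.primeFactors_mul ♮ hm0, hpm, show (1225:ℕ) = 5^2*7^2 by norm_num, Nat.primeFactors_mul ♮ ♮,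
      Nat.primeFactors_prime_pow ♮ p5, Nat.primeFactors_prime_pow ♮ p7]
    ext; simp; tauto
  have n7 : 7 ∉ insert q S := fun h ↦ absurd (hT 7 h).2 ⋆
  have n5 : 5 ∉ insert 7 (insert q S) := by
    rw [mem_insert, not_or]; exact ⟨by norm_num, fun h ↦ absurd (hT 5 h).2 ⋆⟩
  have e1 : psiMin (1225*m) = 144*(((q-1)*∏ p ∈ S, (p-1) : ℕ):ℝ) := by
    rw [psi_eq, hpf, prod_insert n5, prod_insert n7, h5, h7]
    have : ∏ p ∈ insert q S, pf p ((1225*m).factorization p) = ((∏ p ∈ insert q S, (p-1) : ℕ):ℝ) := by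
      rw [Nat.cast_prod]
      refine prod_congr rfl fun p hp ↦ ?_
      have := hT p hp
      rw [hff, hf1 p hp, p5.factorization, p7.factorization, Finsupp.single_apply, Finsupp.single_apply, if_neg ⋆, if_neg ⋆,
        Nat.cast_sub this.1.one_le]; simp [pf_one]
    rw [this, prod_insert hqS]; norm_num [pf]; ring
  have e2 : nuInfMin (1225*m) = 0 := by
    by_contra h
    obtain ⟨e, he⟩ := nuInf_ne (Nat.pos_of_ne_zero hN0) h
    have := (Nat.prime_dvd_prime_iff_eq p5 Nat.prime_two).1 (p5.dvd_of_dvd_pow (he ▸ (Dvd.intro _ (by ring : 5*(245*m) = 1225*m))))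
    omega
  have e3 : nu2Min (1225*m) = 0 := by
    refine prod_eq_zero (show 5 ∈ (1225*m).primeFactors by rw [hpf]; simp) ?_
    rw [h5]; norm_num
  have e4 : nu3Min (1225*m) = 0 := by
    refine prod_eq_zero (show 7 ∈ (1225*m).primeFactors by rw [hpf]; simp) ?_
    rw [h7]; norm_num
  have e5 : ArithmeticFunction.moebius (1225*m) = 0 := by
    refine ArithmeticFunction.moebius_eq_zero_of_not_squarefree fun h ↦ ?_
    have := h 5 ⟨49*m, by ring⟩
    norm_num at this
  simp only [dMin, e1, e2, e3, e4, e5]; simp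

theorem coll (P : Finset (ℕ × ℕ)) (f : ℕ × ℕ → ℕ) :
    P.card ≤ (P.image f).card + ((P ×ˢ P).filter fun z ↦ f z.1 = f z.2 ∧ z.1 ≠ z.2).card := by
  classical
  set g := Function.invFunOn f (P : Set (ℕ × ℕ))
  have hg : ∀ a ∈ P, g (f a) ∈ P ∧ f (g (f a)) = f a := fun a ha ↦ 
    ⟨Function.invFunOn_mem ⟨a, ha, rfl⟩, Function.invFunOn_eq ⟨a, ha, rfl⟩⟩
  rw [← card_filter_add_card_filter_not (s := P) fun a ↦ g (f a) = a]
  refine add_le_add (card_le_card_of_injOn f (fun a ha ↦ mem_image_of_mem _ (mem_filter.1 ha).1) fun a ha b hb h ↦ ?_)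
    (card_le_card_of_injOn (fun a ↦ (a, g (f a))) (fun a ha ↦ ?_) fun a _ b _ h ↦ (Prod.ext_iff.1 h).1)
  · rw [← (mem_filter.1 ha).2, h, (mem_filter.1 hb).2]
  · obtain ⟨h1, h2⟩ := mem_filter.1 ha
    exact mem_filter.2 ⟨mem_product.2 ⟨h1, (hg a h1).1⟩, (hg a h1).2.symm, fun h ↦ h2 h.symm⟩

theorem gcd_sum (W U : Finset ℕ) (hW : ∀ w ∈ W, w ≠ 0 ∧ ∀ d, d ∣ w → d ∈ U) :
    ∑ z ∈ W ×ˢ W, (Nat.gcd z.1 z.2:ℝ)/(z.1*z.2) ≤ (∑ u ∈ U, 1°/u)^3 := by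
  rw [show (∑ u ∈ U, 1°/u)^3 = ∑ c ∈ U ×ˢ (U ×ˢ U), 1°/(c.1*(c.2.1*c.2.2)) by
    simp_rw [sum_product, pow_succ, pow_zero, one_mul, mul_assoc, sum_mul_sum, one_div, mul_inv, mul_sum]]
  have hp : ∀ z ∈ W ×ˢ W, ∃ a b, 0 < Nat.gcd z.1 z.2 ∧ z.1 = Nat.gcd z.1 z.2*a ∧ z.2 = Nat.gcd z.1 z.2*b := fun z hz ↦ by
    obtain ⟨a, ha⟩ := Nat.gcd_dvd_left z.1 z.2
    obtain ⟨b, hb⟩ := Nat.gcd_dvd_right z.1 z.2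
    exact ⟨a, b, Nat.gcd_pos_of_pos_left _ (Nat.pos_of_ne_zero (hW _ (mem_product.1 hz).1).1), ha, hb⟩
  rw [show ∑ z ∈ W ×ˢ W, (Nat.gcd z.1 z.2:ℝ)/(z.1*z.2) = ∑ z ∈ W ×ˢ W,
      (fun c : ℕ × ℕ × ℕ => 1°/(c.1*(c.2.1*c.2.2))) (Nat.gcd z.1 z.2, z.1/Nat.gcd z.1 z.2, z.2/Nat.gcd z.1 z.2) from sum_congr rfl fun z hz ↦ ?_,
    ← sum_image (f := fun c : ℕ × ℕ × ℕ => 1°/(c.1*(c.2.1*c.2.2))) (g := fun z : ℕ × ℕ => (Nat.gcd z.1 z.2, z.1/Nat.gcd z.1 z.2, z.2/Nat.gcd z.1 z.2)) fun z hz z' hz' h ↦ ?_]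
  · refine sum_le_sum_of_subset_of_nonneg (image_subset_iff.2 fun z hz ↦ ?_) fun _ _ _ ↦ by positivity
    obtain ⟨h1, h2⟩ := mem_product.1 hz
    exact mem_product.2 ⟨(hW _ h1).2 _ (Nat.gcd_dvd_left _ _), mem_product.2 ⟨(hW _ h1).2 _ (Nat.div_dvd_of_dvd (Nat.gcd_dvd_left _ _)),
      (hW _ h2).2 _ (Nat.div_dvd_of_dvd (Nat.gcd_dvd_right _ _))⟩⟩
  · simp only [Prod.mk.injEq] at h
    refine Prod.ext ?_ ?_
    · rw [← Nat.mul_div_cancel' (Nat.gcd_dvd_left z.1 z.2), h.2.1, h.1, Nat.mul_div_cancel' (Nat.gcd_dvd_left z'.1 z'.2)]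
    · rw [← Nat.mul_div_cancel' (Nat.gcd_dvd_right z.1 z.2), h.2.2, h.1, Nat.mul_div_cancel' (Nat.gcd_dvd_right z'.1 z'.2)]
  · obtain ⟨a, b, h0, ha, hb⟩ := hp z hz
    have a0 : a ≠ 0 := by rintro rfl; exact (hW _ (mem_product.1 hz).1).1 (by simpa using ha)
    have b0 : b ≠ 0 := by rintro rfl; exact (hW _ (mem_product.1 hz).2).1 (by simpa using hb)
    have e1 : z.1/Nat.gcd z.1 z.2 = a := Nat.div_eq_of_eq_mul_right h0 ha
    have e2 : z.2/Nat.gcd z.1 z.2 = b := Nat.div_eq_of_eq_mul_right h0 hb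
    have g1 : (z.1:ℝ) = Nat.gcd z.1 z.2*a := by exact_mod_cast ha
    have g2 : (z.2:ℝ) = Nat.gcd z.1 z.2*b := by exact_mod_cast hb
    dsimp only
    rw [e1, e2, g1, g2]
    have : 0° < Nat.gcd z.1 z.2 := by exact_mod_cast h0
    field_simp

end

open Finset Real
noncomputable section

theorem big_E {y E : ℝ} (hy : 100 ≤ y) (hE : E = exp y) : 5000 ≤ E := by
  have := quadratic_le_exp_of_nonneg (by linarith : 0 ≤ y)
  rw [hE]; nlinarith

theorem exp_sp {E a b : ℝ} (hE : 5000 ≤ E) (h : a + E/8 ≤ b) : 30*E*exp a ≤ exp b := by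
  have h1 := quadratic_le_exp_of_nonneg (by linarith : 0 ≤ E/8)
  calc _ ≤ exp (E/8)*exp a := by gcongr; nlinarith
    _ = exp (E/8+a) := (exp_add _ _).symm
    _ ≤ _ := exp_le_exp.2 ♭

theorem le_exp_log {w : ℕ} {c : ℝ} (h0 : w ≠ 0) (h : log w ≤ c) : w° ≤ exp c := by
  have : 0° < w := by positivity
  rw [← exp_log this]; exact exp_le_exp.2 h

theorem coll_pair : ∃ C : ℝ, 1 ≤ C ∧ ∀ (X y E : ℝ) (w w' : ℕ), 100 ≤ y → E = exp y → X = exp E/144 → w ≠ 0 → w' ≠ 0 → w ≠ w' →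
    log w ≤ E/8 → log w' ≤ E/8 → ∀ T : Finset (ℕ × ℕ),
    (∀ z ∈ T, z.1.Prime ∧ z.2.Prime ∧ (z.1:ℝ) ≤ X/w ∧ (z.1-1)*w = (z.2-1)*w') →
    (T.card:ℝ) ≤ C*X*(y^4/E^2)*((Nat.gcd w w':ℝ)/(w*w')) := by
  obtain ⟨C, hC, H⟩ := S2'
  refine ⟨324*C, by linarith, fun X y E w w' hy hE hX h0 h0' hne hl hl' T hT ↦ ?_⟩
  have hE5 := big_E hy hE
  set g := Nat.gcd w w' with hg
  have g0 : 0 < g := Nat.gcd_pos_of_pos_left _ (Nat.pos_of_ne_zero h0)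
  obtain ⟨A, B, hco, hA, hB⟩ : ∃ A B, Nat.Coprime A B ∧ w' = A*g ∧ w = B*g := by
    obtain ⟨B, A, h1, h2, h3⟩ := Nat.exists_coprime w w'
    exact ⟨A, B, h1.symm, h3, h2⟩
  have A0 : A ≠ 0 := by rintro rfl; simp at hA; omega
  have B0 : B ≠ 0 := by rintro rfl; simp at hB; omega
  have hX0 : 0 < X := by rw [hX]; positivity
  have hw : 1° ≤ w := by exact_mod_cast Nat.pos_of_ne_zero h0
  have hw' : 1° ≤ w' := by exact_mod_cast Nat.pos_of_ne_zero h0'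
  have hg1 : 1° ≤ g := by exact_mod_cast g0
  have hA1 : 1° ≤ A := by exact_mod_cast Nat.pos_of_ne_zero A0
  have hB1 : 1° ≤ B := by exact_mod_cast Nat.pos_of_ne_zero B0
  have hAr : w'° = A*g := by exact_mod_cast hA
  have hBr : w° = B*g := by exact_mod_cast hB
  set z := X*(g°/(w*w')) with hz
  have hzA : z = X/w/A := by rw [hz, hAr]; field_simp
  have hz2 : z ≤ exp E := by
    rw [hzA, div_div]
    refine (div_le_self hX0.le (by nlinarith)).trans ?_
    rw [hX]; linarith [exp_pos E]
  have hz1 : exp (E/2) + 1 ≤ z := by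
    have e1 : X/(w*w') ≤ z := by
      rw [hzA, div_div]; refine div_le_div_of_nonneg_left hX0.le ♯ ?_
      rw [hAr]; nlinarith [mul_le_mul_of_nonneg_left hg1 (show 0° ≤ w*A by positivity)]
    have e2 : w°*w' ≤ exp (E/4) := by
      calc w°*w' ≤ exp (E/8)*exp (E/8) := by gcongr; exacts [le_exp_log h0 hl, le_exp_log h0' hl']
        _ = _ := by rw [← exp_add]; ring_nf
    have e3 : X/exp (E/4) ≤ X/(w*w') := by gcongr
    have e4 : X/exp (E/4) = exp (3*E/4)/144 := by
      rw [hX, div_right_comm, ← exp_sub]; ring_nf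
    have e5 := exp_sp hE5 (show E/2 + E/8 ≤ 3*E/4 by linarith)
    have e6 := one_le_exp (show 0 ≤ E/2 by linarith)
    nlinarith
  have hN1 : exp (E/2) ≤ (⌊z⌋₊:ℝ) := by linarith [Nat.lt_floor_add_one z]
  have hN2 : (⌊z⌋₊:ℝ) ≤ z := Nat.floor_le (by linarith [exp_pos (E/2)])
  have hN0 : 0° < ⌊z⌋₊ := (exp_pos _).trans_le hN1
  have hL1 : E/2 ≤ log ⌊z⌋₊ := (le_log_iff_exp_le hN0).2 hN1
  have hL2 : log ⌊z⌋₊ ≤ E := (log_le_iff_le_exp hN0).2 (hN2.trans hz2)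
  have hLL1 : 0 ≤ loglog ⌊z⌋₊ := log_nonneg ♭
  have hLL2 : loglog ⌊z⌋₊ ≤ y := by
    unfold loglog; rw [log_le_iff_le_exp ♭, ← hE]; exact hL2
  have hN3 : 3 ≤ ⌊z⌋₊ := by
    have := add_one_le_exp (E/2)
    exact_mod_cast (show 3° ≤ ⌊z⌋₊ by linarith)
  have key : ∀ q ∈ T, ∃ n, q.1 = A*n+1 ∧ q.2 = B*n+1 := fun q hq ↦ by
    obtain ⟨h1, h2, -, h4⟩ := hT q hq
    rw [hA, hB, ← mul_assoc, ← mul_assoc] at h4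
    have h5 := Nat.eq_of_mul_eq_mul_right g0 h4
    obtain ⟨n, hn⟩ : A ∣ q.1 - 1 := hco.dvd_of_dvd_mul_right ⟨q.2-1, by rw [h5]; ring⟩
    refine ⟨n, by have := h1.one_le; omega, ?_⟩
    rw [hn] at h5
    have := Nat.eq_of_mul_eq_mul_right (Nat.pos_of_ne_zero A0) (show B*n*A = (q.2-1)*A by rw [← h5]; ring)
    have := h2.one_le; omega
  have hdiv : ∀ n, (A*n+1-1)/A = n := fun n ↦ by
    rw [Nat.add_sub_cancel, Nat.mul_div_cancel_left _ (Nat.pos_of_ne_zero A0)]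
  have hA2 : log A ≤ exp y := by
    rw [← hE]; refine le_trans (log_le_log ♭ (by rw [hAr]; nlinarith)) (hl'.trans ♭)
  have hB2 : log B ≤ exp y := by
    rw [← hE]; refine le_trans (log_le_log ♭ (by rw [hBr]; nlinarith)) (hl.trans ♭)
  have := H y ⌊z⌋₊ A B (T.image fun q ↦ (q.1-1)/A) ♭ hN3 A0 B0 (by rintro rfl; omega) hA2 hB2 (by
    intro n hn
    obtain ⟨q, hq, rfl⟩ := mem_image.1 hn
    obtain ⟨n, h1, h2⟩ := key q hq
    obtain ⟨h3, h4, h5, -⟩ := hT q hq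
    rw [h1, hdiv, ← h1, ← h2]
    refine ⟨h3, h4, Nat.le_floor ?_⟩
    rw [hzA, le_div_iff₀ ♭]
    refine le_trans ?_ h5
    rw [h1]; push_cast; linarith)
  rw [card_image_of_injOn fun q hq q' hq' h ↦ by
    obtain ⟨n, h1, h2⟩ := key q hq
    obtain ⟨n', h1', h2'⟩ := key q' hq'
    rw [h1, h1', hdiv, hdiv] at h
    exact Prod.ext (by rw [h1, h1', h]) (by rw [h2, h2', h])] at this
  refine this.trans ?_
  have b1 : (y+2+loglog ⌊z⌋₊)^2/log ⌊z⌋₊ ≤ (3*y)^2/(E/2) := by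
    gcongr; linarith
  calc _ ≤ C*z*((3*y)^2/(E/2))^2 := by gcongr
    _ = _ := by rw [hz]; field_simp; ring

theorem prim_ct {E z : ℝ} (hE : 5000 ≤ E) (h1 : exp (3*E/4) ≤ z) (h2 : z ≤ exp E) :
    z/(4*E) ≤ (((range (⌊z⌋₊+1)).filter fun q : ℕ => q.Prime ∧ exp (E/2) < q).card:ℝ) := by
  classical
  have a1 := exp_sp hE (show 0 + E/8 ≤ 3*E/4 by linarith)
  have a2 := exp_sp hE (show E/2 + E/8 ≤ 3*E/4 by linarith)
  have a3 := one_le_exp (show 0 ≤ E/2 by linarith)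
  rw [exp_zero] at a1
  have hz : 100000 ≤ z := by linarith
  have h3 := Chebyshev.pi_ge' (show 1 < z by linarith)
  have h4 : log (z+2) ≤ E+1 := by
    rw [log_le_iff_le_exp ♭, exp_add]
    have := add_one_le_exp 1°
    nlinarith
  have h5 : 0 < log z := log_pos ♭
  have h6 : log z ≤ E := (log_le_iff_le_exp ♭).2 h2
  have h7 : z/(2*E) ≤ ((z-1)*log 2 - log (z+2))/log z := by
    rw [← div_div]
    refine div_le_div₀ ?_ ?_ h5 h6
    · nlinarith [log_two_gt_d9]
    · nlinarith [log_two_gt_d9]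
  have h8 : Nat.primeCounting ⌊z⌋₊ ≤ ((range (⌊z⌋₊+1)).filter fun q : ℕ => q.Prime ∧ exp (E/2) < q).card + (⌊exp (E/2)⌋₊+1) := by
    rw [Nat.primeCounting, Nat.primeCounting', Nat.count_eq_card_filter_range, ← card_range (⌊exp (E/2)⌋₊+1)]
    refine (card_le_card fun q hq ↦ ?_).trans (card_union_le _ _)
    obtain ⟨hq1, hq2⟩ := mem_filter.1 hq
    by_cases h : exp (E/2) < q
    · exact mem_union_left _ (mem_filter.2 ⟨hq1, hq2, h⟩)
    · exact mem_union_right _ (mem_range.2 (Nat.lt_succ_of_le (Nat.le_floor (not_lt.1 h))))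
  have h9 : (Nat.primeCounting ⌊z⌋₊:ℝ) ≤ (((range (⌊z⌋₊+1)).filter fun q : ℕ => q.Prime ∧ exp (E/2) < q).card:ℝ) + (exp (E/2)+1) := by
    have := Nat.floor_le (exp_pos (E/2)).le
    have h8' : (Nat.primeCounting ⌊z⌋₊:ℝ) ≤ _ := Nat.cast_le.2 h8
    push_cast at h8'; linarith
  have h10 : exp (E/2)+1 ≤ z/(4*E) := by rw [le_div_iff₀ ♭]; nlinarith
  have h11 : z/(2*E) = z/(4*E) + z/(4*E) := by field_simp; ring
  linarith

theorem wprop {t y E : ℝ} {w : ℕ} {S : Finset ℕ} (hy : 100 ≤ y) (hE : E = exp y) (hty : t ≤ y/4)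
    (hS : ∀ p ∈ S, p.Prime ∧ 7 < p ∧ p° ≤ EE t) (hc : (S.card:ℝ) ≤ t) (hw : w = ∏ p ∈ S, (p-1)) :
    w ≠ 0 ∧ log w ≤ E/8 ∧ w.primeFactors ⊆ PR ⌊t⌋₊ := by
  have h0 : ∀ p ∈ S, p - 1 ≠ 0 := fun p hp ↦ by have := (hS p hp).2.1; omega
  refine ⟨hw ▸ prod_ne_zero_iff.2 h0, ?_, fun p hp ↦ ?_⟩
  · rw [hw, Nat.cast_prod, log_prod fun p hp ↦ Nat.cast_ne_zero.2 (h0 p hp)]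
    calc _ ≤ ∑ p ∈ S, exp t := sum_le_sum fun p hp ↦ by
            rw [← log_EE t]
            refine log_le_log (by have := h0 p hp; positivity) (le_trans ?_ (hS p hp).2.2)
            exact_mod_cast Nat.sub_le _ _
      _ = S.card*exp t := by rw [sum_const, nsmul_eq_mul]
      _ ≤ (y/4)*exp (y/4) := by gcongr; linarith
      _ ≤ E/8 := by
        have h1 := add_one_le_exp (y/4)
        have h2 : E = exp (y/4)*exp (y/4)*(exp (y/4)*exp (y/4)) := by
          rw [hE, ← exp_add, ← exp_add]; ring_nf
        have h3 : 8 ≤ exp (y/4) := by linarith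
        rw [h2]
        have h4 : 8*(y/4) ≤ exp (y/4)*(exp (y/4)*exp (y/4)) := by nlinarith
        nlinarith [exp_pos (y/4)]
  · obtain ⟨hp1, hp2, -⟩ := Nat.mem_primeFactors.1 hp
    rw [hw] at hp2
    obtain ⟨q, hq, hpq⟩ := (hp1.prime.dvd_finsetProd_iff _).1 hp2
    obtain ⟨h1, -, h3⟩ := hS q hq
    exact mem_PR_of_dvd h1.two_le ((lev_le_iff h1.two_le).2 (h3.trans (EE_mono (by exact_mod_cast (Nat.lt_floor_add_one t).le)))) hp1 hpq

end

open Finset Real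
noncomputable section

theorem low_core : ∃ K : ℝ, 1 ≤ K ∧ ∀ (k : ℕ) (x y E t : ℝ) (W : Finset ℕ), 2 ≤ k → 100 ≤ y → E = exp y → x = exp E → 1 ≤ t → t ≤ y/4 →
    (∀ w ∈ W, ∃ S : Finset ℕ, (∀ p ∈ S, p.Prime ∧ 7 < p ∧ p° ≤ EE t) ∧ (S.card:ℝ) ≤ t ∧ w = ∏ p ∈ S, (p-1)) →
    x/(576*E)*∑ w ∈ W, 1°/w ≤ (DS k x).ncard + K*x*(y^4/E^2)*exp (3*t) := by
  classical
  obtain ⟨C, hC, H⟩ := coll_pair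
  obtain ⟨M, hM, HM⟩ := cm_lev_sum
  refine ⟨C*exp (3*(1+M)), by nlinarith [one_le_exp (show 0 ≤ 3*(1+M) by linarith)], fun k x y E t W hk hy hE hx ht hty hW ↦ ?_⟩
  have hE5 := big_E hy hE
  have hwp : ∀ w ∈ W, w ≠ 0 ∧ log w ≤ E/8 ∧ w.primeFactors ⊆ PR ⌊t⌋₊ := fun w hw ↦ by
    obtain ⟨S, h1, h2, h3⟩ := hW w hw
    exact wprop hy hE hty h1 h2 h3
  obtain ⟨X, hX⟩ : ∃ X, X = exp E/144 := ⟨_, rfl⟩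
  have hX0 : 0 < X := by rw [hX]; positivity
  have hxX : x = 144*X := by rw [hx, hX]; ring
  obtain ⟨Q, hQ⟩ : ∃ Q : ℕ → Finset ℕ, ∀ w, Q w = (range (⌊X/w⌋₊+1)).filter fun q : ℕ => q.Prime ∧ exp (E/2) < q := ⟨_, fun _ ↦ rfl⟩
  have hQm : ∀ w q, q ∈ Q w → q.Prime ∧ exp (E/2) < q ∧ q° ≤ X/w := fun w q h ↦ by
    rw [hQ] at h
    obtain ⟨h1, h2, h3⟩ := mem_filter.1 h
    exact ⟨h2, h3, (Nat.le_floor_iff ♯).1 (Nat.lt_succ_iff.1 (mem_range.1 h1))⟩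
  have hQc : ∀ w ∈ W, X/w/(4*E) ≤ (Q w).card := fun w hw ↦ by
    obtain ⟨h0, hl, -⟩ := hwp w hw
    have hw1 : 1° ≤ w := by exact_mod_cast Nat.pos_of_ne_zero h0
    rw [hQ]
    refine prim_ct hE5 ?_ ?_
    · rw [le_div_iff₀ ♭, hX, le_div_iff₀ ♮]
      have e1 := exp_sp hE5 (show 7*E/8 + E/8 ≤ E by linarith)
      have e2 : exp (3*E/4)*w ≤ exp (7*E/8) := by
        calc _ ≤ exp (3*E/4)*exp (E/8) := by gcongr; exact le_exp_log h0 hl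
          _ = _ := by rw [← exp_add]; ring_nf
      nlinarith [exp_pos (7*E/8)]
    · refine (div_le_self hX0.le hw1).trans ?_
      rw [hX]; linarith [exp_pos E]
  obtain ⟨P, hP⟩ : ∃ P, P = W.biUnion fun w ↦ (Q w).image (Prod.mk w) := ⟨_, rfl⟩
  have hPm : ∀ z ∈ P, z.1 ∈ W ∧ z.2 ∈ Q z.1 := fun z hz ↦ by
    rw [hP] at hz
    obtain ⟨w, hw, h⟩ := mem_biUnion.1 hz
    obtain ⟨q, hq, rfl⟩ := mem_image.1 h
    exact ⟨hw, hq⟩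
  have hPc : X/(4*E)*∑ w ∈ W, 1°/w ≤ P.card := by
    rw [hP, card_biUnion fun w _ w' _ hne ↦ disjoint_left.2 fun z hz hz' ↦ by
      obtain ⟨q, -, rfl⟩ := mem_image.1 hz
      obtain ⟨q', -, h⟩ := mem_image.1 hz'
      exact hne (Prod.ext_iff.1 h).1.symm]
    rw [mul_sum]; push_cast
    refine sum_le_sum fun w hw ↦ ?_
    rw [card_image_of_injective _ (Prod.mk_right_injective w)]
    refine le_trans (le_of_eq ?_) (hQc w hw)
    field_simp
  obtain ⟨f, hf⟩ : ∃ f : ℕ × ℕ → ℕ, ∀ z, f z = (z.2-1)*z.1 := ⟨_, fun _ ↦ rfl⟩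
  have hV : (P.image f).card ≤ (DS k x).ncard := by
    rw [← Set.ncard_coe_finset]
    have hk1 : 0° < (k°-1)/12 := by
      have : 2° ≤ k := by exact_mod_cast hk
      linarith
    refine Set.ncard_le_ncard_of_injOn (fun v : ℕ => (k°-1)/12*(144*v°)) (fun v hv ↦ ?_) (fun a _ b _ h ↦ ?_)
      (DS_bd hk (by rw [hxX]; linarith)).1
    · obtain ⟨z, hz, rfl⟩ := mem_image.1 (mem_coe.1 hv)
      obtain ⟨h1, h2⟩ := hPm z hz
      obtain ⟨S, g1, g2, g3⟩ := hW _ h1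
      obtain ⟨q1, q2, q3⟩ := hQm _ _ h2
      have hEt : EE t ≤ exp (E/2) := by
        refine exp_le_exp.2 ?_
        have e1 := add_one_le_exp (y-t)
        have e2 : E = exp t*exp (y-t) := by rw [hE, ← exp_add]; ring_nf
        rw [e2]; nlinarith [exp_pos t]
      have h7 : 7 < z.2 := by
        have := add_one_le_exp (E/2)
        exact_mod_cast (show 7° < z.2 by linarith)
      have hd := dval (k := k) q1 h7 (fun h ↦ absurd (g1 _ h).2.2 (not_le.2 (hEt.trans_lt q2))) fun p hp ↦ ⟨(g1 p hp).1, (g1 p hp).2.1⟩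
      rw [← g3, ← hf] at hd
      refine ⟨_, Nat.pos_of_ne_zero (mul_ne_zero ♮ (prod_ne_zero_iff.2 fun p hp ↦ ?_)), hd, ?_⟩
      · rcases mem_insert.1 hp with rfl | h
        exacts [q1.ne_zero, (g1 p h).1.ne_zero]
      · rw [hd, hxX, hf]
        have hw : 0° < z.1 := by exact_mod_cast Nat.pos_of_ne_zero (hwp _ h1).1
        rw [le_div_iff₀ hw] at q3
        have : (((z.2-1:ℕ)):ℝ) ≤ z.2 := by exact_mod_cast Nat.sub_le _ _
        push_cast
        gcongr
        nlinarith
    · have : (a°) = b := by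
        have := mul_left_cancel₀ hk1.ne' h
        linarith
      exact_mod_cast this
  have hcol := coll P f
  set Z := (P ×ˢ P).filter fun z ↦ f z.1 = f z.2 ∧ z.1 ≠ z.2 with hZ
  have hZm : ∀ z ∈ Z, z.1 ∈ P ∧ z.2 ∈ P ∧ f z.1 = f z.2 ∧ z.1 ≠ z.2 := fun z hz ↦ by
    obtain ⟨h1, h2⟩ := mem_filter.1 hz
    exact ⟨(mem_product.1 h1).1, (mem_product.1 h1).2, h2⟩
  have hZc : (Z.card:ℝ) ≤ C*X*(y^4/E^2)*∑ z ∈ W ×ˢ W, (Nat.gcd z.1 z.2:ℝ)/(z.1*z.2) := by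
    rw [card_eq_sum_card_fiberwise (f := fun z : (ℕ × ℕ) × ℕ × ℕ => (z.1.1, z.2.1)) (t := W ×ˢ W) fun z hz ↦ 
      mem_product.2 ⟨(hPm _ (hZm z hz).1).1, (hPm _ (hZm z hz).2.1).1⟩, mul_sum]
    push_cast
    refine sum_le_sum fun u hu ↦ ?_
    obtain ⟨hu1, hu2⟩ := mem_product.1 hu
    by_cases hne : u.1 = u.2
    · rw [filter_eq_empty_iff.2 fun z hz h ↦ ?_]
      · simp; positivity
      · obtain ⟨h1, h2, h3, h4⟩ := hZm z hz
        have a1 : z.1.1 = z.2.1 := by rw [← h] at hne; exact hne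
        rw [hf, hf, a1] at h3
        have h5 := Nat.eq_of_mul_eq_mul_right (Nat.pos_of_ne_zero (hwp _ (hPm _ h2).1).1) h3
        have := (hQm _ _ (hPm _ h1).2).1.one_le
        have := (hQm _ _ (hPm _ h2).2).1.one_le
        exact h4 (Prod.ext a1 ⋆)
    · have key : ∀ z ∈ Z.filter fun z : (ℕ × ℕ) × ℕ × ℕ => (z.1.1, z.2.1) = u, z ∈ Z ∧ z.1.1 = u.1 ∧ z.2.1 = u.2 := fun z hz ↦ by
        obtain ⟨h1, h2⟩ := mem_filter.1 hz
        exact ⟨h1, by rw [← h2], by rw [← h2]⟩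
      rw [← card_image_of_injOn (f := fun z : (ℕ × ℕ) × ℕ × ℕ => (z.1.2, z.2.2)) fun a ha b hb h ↦ by
        obtain ⟨-, a1, a2⟩ := key a ha
        obtain ⟨-, b1, b2⟩ := key b hb
        obtain ⟨h1, h2⟩ := Prod.ext_iff.1 h
        exact Prod.ext (Prod.ext (by rw [a1, b1]) h1) (Prod.ext (by rw [a2, b2]) h2)]
      refine H X y E u.1 u.2 hy hE hX (hwp _ hu1).1 (hwp _ hu2).1 hne (hwp _ hu1).2.1 (hwp _ hu2).2.1 _ fun r hr ↦ ?_
      obtain ⟨z, hz, rfl⟩ := mem_image.1 hr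
      obtain ⟨h, a1, a2⟩ := key z hz
      obtain ⟨h1, h2, h3, -⟩ := hZm z h
      have b1 := hQm _ _ (hPm _ h1).2
      rw [hf, hf, a1, a2] at h3
      rw [a1] at b1
      exact ⟨b1.1, (hQm _ _ (hPm _ h2).2).1, b1.2.2, h3⟩
  have hU := gcd_sum W (W.biUnion Nat.divisors) fun w hw ↦ ⟨(hwp w hw).1, fun d hd ↦ mem_biUnion.2 ⟨w, hw, Nat.mem_divisors.2 ⟨hd, (hwp w hw).1⟩⟩⟩
  have hU2 : ∑ u ∈ W.biUnion Nat.divisors, 1°/u ≤ exp (t+1+M) := by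
    have := HM ⌊t⌋₊ (fun _ ↦ 1) 1 le_rfl (fun _ _ ↦ ⟨zero_le_one, le_rfl⟩) (fun p hp ↦ by
      have : 2° ≤ p := by exact_mod_cast (mem_PR.1 hp).1.two_le
      rw [div_le_iff₀ ♭]; linarith) (W.biUnion Nat.divisors) fun u hu ↦ by
        obtain ⟨w, hw, h⟩ := mem_biUnion.1 hu
        obtain ⟨h1, h2⟩ := Nat.mem_divisors.1 h
        exact ⟨ne_zero_of_dvd_ne_zero h2 h1, (Nat.primeFactors_mono h1 h2).trans (hwp w hw).2.2⟩
    refine le_trans (sum_le_sum fun u _ ↦ le_of_eq ?_) (this.trans (exp_le_exp.2 ?_))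
    · rw [cm_eq]; simp [Finsupp.prod]
    · have := Nat.floor_le (show 0 ≤ t by linarith)
      simp; linarith
  have hU3 : (∑ u ∈ W.biUnion Nat.divisors, 1°/u)^3 ≤ exp (3*(1+M))*exp (3*t) := by
    refine (pow_le_pow_left₀ (sum_nonneg fun _ _ ↦ by positivity) hU2 3).trans (le_of_eq ?_)
    rw [← exp_nat_mul, ← exp_add]; push_cast; ring_nf
  have hcol' : (P.card:ℝ) ≤ (P.image f).card + Z.card := by exact_mod_cast hcol
  have hV' : ((P.image f).card:ℝ) ≤ (DS k x).ncard := by exact_mod_cast hV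
  have hfin : C*X*(y^4/E^2)*∑ z ∈ W ×ˢ W, (Nat.gcd z.1 z.2:ℝ)/(z.1*z.2) ≤ C*exp (3*(1+M))*x*(y^4/E^2)*exp (3*t) := by
    calc _ ≤ C*x*(y^4/E^2)*(exp (3*(1+M))*exp (3*t)) := by
          have hx0 : 0 ≤ x := by linarith
          gcongr
          · linarith
          · exact hU.trans hU3
      _ = _ := by ring
  have e : x/(576*E) = X/(4*E) := by rw [hxX]; field_simp; norm_num
  rw [e]; linarith

end

open Finset Real
noncomputable section

theorem log_two_sqrt {y : ℝ} (hy : 0 < y) : log y ≤ 2*√y := by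
  have h := log_le_sub_one_of_pos (sqrt_pos.2 hy)
  rw [log_sqrt hy.le] at h
  linarith

theorem by_ar {B l y : ℝ} (hB0 : 0 ≤ B) (hl : l = log y) (hy1 : 100 ≤ y) (hy : 64*B^2 ≤ y) : B*l ≤ y/4 := by
  have h1 : l ≤ 2*√y := hl ▸ log_two_sqrt ♭
  have h2 : 8*B ≤ √y := le_sqrt_of_sq_le ♭
  have h3 := mul_self_sqrt (show 0 ≤ y by linarith)
  have h4 := mul_le_mul_of_nonneg_left h1 hB0
  nlinarith [sqrt_nonneg y]

theorem FordData.low_top {ϱ : ℝ} (h : FordData ϱ) : ∃ A Y0 : ℝ, 1 ≤ A ∧ 100 ≤ Y0 ∧ ∀ (k : ℕ) (x y E : ℝ), 2 ≤ k → Y0 ≤ y → E = exp y → x = exp E →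
    x/E*exp (1/(2*log (1/ϱ))*(log (y/log y))^2 - A*log y) ≤ ((DS k x).ncard:ℝ) := by
  have hC := h.C_pos
  obtain ⟨A, T0, hA, hT0, H⟩ := h.lower
  obtain ⟨K, hK, HK⟩ := low_core
  set C := 1/(2*log (1/ϱ))
  set A2 := 4*C+A with hA2
  set B := log (1152*K)+4+A2 with hB
  have l0 : 0 ≤ log 1152 := log_nonneg ♮
  have l1 : 0 ≤ log (1152*K) := log_nonneg ♭
  have hB0 : 0 ≤ B := by linarith
  refine ⟨A2+log 1152, 100+4*T0+64*B^2, by linarith, by linarith [sq_nonneg B], fun k x y E hk hy hE hx ↦ ?_⟩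
  have hB2 := sq_nonneg B
  have hy1 : 100 ≤ y := by linarith
  have hyT : T0 ≤ y/4 := by linarith
  obtain ⟨W, hW, hS⟩ := H (y/4) hyT
  have hcore := HK k x y E (y/4) W hk hy1 hE hx ♭ le_rfl hW
  obtain ⟨l, hl⟩ : ∃ l, l = log y := ⟨_, rfl⟩
  rw [← hl]
  have hl4 : log (y/4) = l - log 4 := by rw [hl, log_div ♭ ♮]
  have h40 : 0 ≤ log 4 := log_nonneg ♮
  have h41 : log 4 ≤ 2 := by
    rw [show 4° = 2^2 by norm_num, log_pow]; have := log_two_lt_d9; push_cast; linarith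
  have hl1 : 3 ≤ l := by
    rw [hl, le_log_iff_exp_le ♭, show 3° = (3:ℕ)*1 by norm_num, exp_nat_mul]
    have := exp_one_lt_d9
    calc exp 1^3 ≤ (2.72:ℝ)^3 := by gcongr; linarith
      _ ≤ y := by linarith
  have hyl : y = exp l := by rw [hl, exp_log ♭]
  have hll : 0 ≤ log l := log_nonneg ♭
  obtain ⟨G, hG⟩ : ∃ G, G = log (y/l) := ⟨_, rfl⟩
  have hG1 : G = l - log l := by rw [hG, hl, log_div ♭ (by rw [← hl]; linarith)]
  have hG0 : 0 ≤ G := by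
    have := log_le_sub_one_of_pos (show 0 < l by linarith)
    linarith
  have hGt : G - 2 ≤ log (y/4/log (y/4)) := by
    rw [log_div ♭ (by rw [hl4]; linarith), hl4, hG1]
    have := log_le_log (show 0 < l - log 4 by linarith) (show l - log 4 ≤ l by linarith)
    linarith
  have hsq : G^2 - 4*G ≤ (log (y/4/log (y/4)))^2 := by
    by_cases h2 : 2 ≤ G
    · have := pow_le_pow_left₀ ♭ hGt 2
      linarith
    · nlinarith [sq_nonneg (log (y/4/log (y/4)))]
  rw [← hG]
  have hSS : exp (C*G^2 - A2*l) ≤ ∑ w ∈ W, 1°/w := by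
    refine le_trans (exp_le_exp.2 ?_) hS
    have := mul_le_mul_of_nonneg_left hsq hC.le
    have : C*G ≤ C*l := by gcongr; linarith
    have : A*log (y/4) ≤ A*l := by gcongr; linarith
    rw [hA2]; linarith
  obtain ⟨s, hs⟩ : ∃ s, s = ∑ w ∈ W, 1°/w := ⟨_, rfl⟩
  rw [← hs] at hcore hSS
  have hs0 := (exp_pos _).trans_le hSS
  have hE0 : 0 < E := hE ▸ exp_pos _
  have hx0 : 0 < x := hx ▸ exp_pos _
  have hsm : 1152*K*y^4 ≤ exp (y/4)*s := by
    have hBy := by_ar hB0 hl hy1 ♭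
    have hcg := mul_nonneg hC.le (sq_nonneg G)
    calc 1152*K*y^4 ≤ exp (log (1152*K)*l)*exp ((4:ℕ)*l) := by
          rw [exp_nat_mul, ← hyl]; gcongr; exact const_exp ♭ ♭
      _ = exp (B*l + -(A2*l)) := by rw [← exp_add, hB]; push_cast; ring_nf
      _ ≤ exp (y/4 + (C*G^2 - A2*l)) := exp_le_exp.2 ♭
      _ ≤ _ := by rw [exp_add]; gcongr
  have h2 : K*x*(y^4/E^2)*exp (3*(y/4)) ≤ x/(1152*E)*s := by
    have e1 : E = exp (3*(y/4))*exp (y/4) := by rw [hE, ← exp_add]; ring_nf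
    have p1 := exp_pos (3*(y/4))
    have p2 := exp_pos (y/4)
    rw [show K*x*(y^4/E^2)*exp (3*(y/4)) = x/(1152*E)*(1152*K*y^4/exp (y/4)) by
      rw [show E^2 = E*(exp (3*(y/4))*exp (y/4)) by rw [← e1, sq]]; field_simp]
    gcongr
    rw [div_le_iff₀ p2]; linarith
  have h3 : x/(576*E)*s = x/(1152*E)*s + x/(1152*E)*s := by field_simp; ring
  calc _ = x/(1152*E)*exp (C*G^2 - A2*l)*(1152*exp (-(log 1152*l))) := by
        rw [show C*G^2 - (A2+log 1152)*l = (C*G^2 - A2*l) + -(log 1152*l) by ring, exp_add]; field_simp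
    _ ≤ x/(1152*E)*s*1 := by
        gcongr
        rw [exp_neg, ← div_eq_mul_inv, div_le_one (exp_pos _)]
        exact const_exp ♮ ♭
    _ ≤ _ := by linarith

theorem chi_bd (k : ℕ) : |c2 k| ≤ 1/4 ∧ |c3 k| ≤ 1/3 ∧ delta2 k ≤ 1 := by
  refine ⟨?_, ?_, ?_⟩
  · unfold c2 chi4; split_ifs <;> norm_num
  · unfold c3 chi3; split_ifs <;> norm_num
  · unfold delta2; split_ifs <;> norm_num

theorem DS_one {k : ℕ} {x : ℝ} (hk : 2 ≤ k) (hx : 16 ≤ x) : 1° ≤ (DS k x).ncard := by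
  have hk' : 2° ≤ k := by exact_mod_cast hk
  have h : dMin k 1 ∈ DS k x := by
    refine ⟨1, le_rfl, rfl, ?_⟩
    obtain ⟨h2, h3, h4⟩ := chi_bd k
    simp only [dMin, psiMin, nuInfMin, nu2Min, nu3Min, mval]
    simp
    nlinarith [le_abs_self (c2 k), le_abs_self (c3 k)]
  have := Set.ncard_pos (DS_bd hk ♭).1 |>.2 ⟨_, h⟩
  exact_mod_cast this

theorem FordData.final {ϱ : ℝ} (h : FordData ϱ) : ∃ A : ℝ, 0 < A ∧ ∀ (k : ℕ) (x y E l : ℝ), 2 ≤ k → 16 ≤ x → E = log x → y = log E → l = log y →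
    x/E*exp (1/(2*log (1/ϱ))*(log (y/l))^2 - A*l) ≤ ((DS k x).ncard:ℝ) ∧
    ((DS k x).ncard:ℝ) ≤ x/E*exp (1/(2*log (1/ϱ))*(log (y/l))^2 + A*l) := by
  have hC := h.C_pos
  obtain ⟨A1, hA1, H1⟩ := h.upper
  obtain ⟨A2, Y0, hA2, hY0, H2⟩ := h.low_top
  set C := 1/(2*log (1/ϱ))
  obtain ⟨c, hc⟩ : ∃ c, c = log (log (log 16)) := ⟨_, rfl⟩
  have hE16 : exp 1 < log 16 := by
    rw [show 16° = 2^4 by norm_num, log_pow]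
    have := log_two_gt_d9; have := exp_one_lt_d9; push_cast; linarith
  have hp1 := exp_pos 1
  have hy16 : 1 < log (log 16) := (lt_log_iff_exp_lt ♭).2 hE16
  have hc0 : 0 < c := hc ▸ log_pos hy16
  obtain ⟨X0, hX0⟩ : ∃ X0, X0 = EE Y0 := ⟨_, rfl⟩
  have hX1 : 1 < X0 := hX0 ▸ one_lt_EE _
  set R := 64*(2*X0+1500)^3+1 with hR
  have hR1 : 1 ≤ R := by rw [hR]; linarith [show 0 ≤ 64*(2*X0+1500)^3 by positivity]
  set D := (log X0 + C*(log (Y0/c))^2 + log R)/c with hD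
  have lX := log_nonneg hX1.le
  have lR := log_nonneg hR1
  have hG0 : 0 ≤ C*(log (Y0/c))^2 := by positivity
  have hD0 : 0 ≤ D := by positivity
  refine ⟨A1+A2+D, by linarith, fun k x y E l hk hx hE hy hl ↦ ?_⟩
  have hEl : log 16 ≤ E := hE ▸ log_le_log ♮ hx
  have hyl : log (log 16) ≤ y := hy ▸ log_le_log ♭ hEl
  have hlc : c ≤ l := hl ▸ hc ▸ log_le_log ♭ hyl
  have hE' : E = exp y := by rw [hy, exp_log ♭]
  have hx' : x = exp E := by rw [hE, exp_log ♭]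
  have hxE : 0 < x/E := div_pos ♭ ♭
  have hl0 : 0 < l := by linarith
  have n1 : 0 ≤ A1*l := by positivity
  have n2 : 0 ≤ A2*l := by positivity
  have n3 : 0 ≤ D*l := by positivity
  rw [add_mul, add_mul]
  by_cases hyY : Y0 ≤ y
  · have u := H1 k x y E hk (hY0.trans hyY) hE' hx'
    have v := H2 k x y E hk hyY hE' hx'
    rw [← hl] at u v
    refine ⟨le_trans ?_ v, u.trans ?_⟩ <;> refine mul_le_mul_of_nonneg_left (exp_le_exp.2 ?_) hxE.le <;> linarith
  · have hyY' : y ≤ Y0 := (not_le.1 hyY).le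
    have hxX : x ≤ X0 := by rw [hx', hX0, hE']; exact exp_le_exp.2 (exp_le_exp.2 hyY')
    have hDl : log X0 + C*(log (Y0/c))^2 + log R ≤ D*l := by
      rw [← div_mul_cancel₀ (log X0 + C*(log (Y0/c))^2 + log R) hc0.ne', ← hD]; gcongr
    have hly : l ≤ y := by have := log_le_sub_one_of_pos (show 0 < y by linarith); linarith
    have hGG : C*(log (y/l))^2 ≤ C*(log (Y0/c))^2 := by
      have : 0 ≤ log (y/l) := log_nonneg ((one_le_div hl0).2 hly)
      have : y/l ≤ Y0/c := by gcongr
      have := div_pos (show 0 < y by linarith) hl0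
      gcongr
    have hGp : 0 ≤ C*(log (y/l))^2 := by positivity
    constructor
    · refine le_trans ?_ (DS_one hk hx)
      calc _ ≤ X0*exp (-log X0) := by
            refine mul_le_mul ((div_le_self ♭ ?_).trans hxX) (exp_le_exp.2 ♭) (exp_pos _).le ♭
            have := add_one_le_exp 1°; linarith
        _ = 1 := by rw [exp_neg, exp_log ♭, mul_inv_cancel₀ ♭]
    · have h1 : 1 ≤ x/E := by
        rw [one_le_div ♭, hx']; linarith [add_one_le_exp E]
      calc _ ≤ 64*(2*x+1500)^3+1 := (DS_bd hk ♭).2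
        _ ≤ R := by rw [hR]; gcongr
        _ = 1*exp (log R) := by rw [exp_log ♭, one_mul]
        _ ≤ _ := mul_le_mul h1 (exp_le_exp.2 ♭) (exp_pos _).le hxE.le

end

end

/-- STATEMENT: value distribution of dim S_k^min(Γ₀(N)). -/
theorem dimension_count_min
    (ϱ : ℝ) (hϱ₀ : 0 < ϱ) (hϱ₁ : ϱ < 1)
    (hϱ : ∑' n : ℕ, fordA (n+1) * ϱ^(n+1) = 1) :
    ∃ A : ℝ, 0 < A ∧ ∀ k : ℕ, Even k → 2 ≤ k → ∀ x : ℝ, 16 ≤ x →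
      x / Real.log x *
          Real.exp ((1/(2*Real.log (1/ϱ))) * (Real.log (loglog x / logloglog x))^2
            - A * logloglog x)
        ≤ (Set.ncard {y : ℝ | ∃ N : ℕ, 1 ≤ N ∧ dMin k N = y ∧
            dMin k N ≤ ((k:ℝ)-1)/12 * x} : ℝ) ∧
      (Set.ncard {y : ℝ | ∃ N : ℕ, 1 ≤ N ∧ dMin k N = y ∧
            dMin k N ≤ ((k:ℝ)-1)/12 * x} : ℝ)
        ≤ x / Real.log x *
          Real.exp ((1/(2*Real.log (1/ϱ))) * (Real.log (loglog x / logloglog x))^2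
            + A * logloglog x) := by
  obtain ⟨A, hA, H⟩ := (FordData.mk hϱ₀ hϱ₁ hϱ).final
  exact ⟨A, hA, fun k _ hk x hx => H k x _ _ _ hk hx rfl rfl rfl⟩
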